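/- Let F(y₀,y₁,…,y_d) ∈ C^∞(ℂ^{d+1};ℝ) in the real sense (C^∞ in Re y_i, Im y_i) have a zero of order at least 3 at the origin and satisfy the global ellipticity hypothesis. Then for any s > 2d+11 and any u₀ ∈ H^s(𝕋^d;ℂ) there exist a time 0 < T = T(‖u₀‖_{H^s}) and a unique solution u ∈ C^0([0,T);H^s(𝕋^d;ℂ)) ∩ C^1([0,T);H^{s−2}(𝕋^d;ℂ)) of the Cauchy problem i u_t − Δu + P(u) = 0, u(0,·) = u₀. Moreover, for each t ∈ [0,T) the solution map u₀ ↦ u(t,·) is continuous with respect to the H^s topology. -/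

import Mathlib

open MeasureTheory Complex Real Filter
noncomputable section
namespace QLNLS
abbrev Vec (d : ℕ) := Fin d → ℝ
abbrev Zd (d : ℕ) := Fin d → ℤ
abbrev Fn (d : ℕ) := Vec d → ℂ
abbrev Seq (d : ℕ) := Zd d → ℂ
abbrev Sym (d : ℕ) := Vec d → Vec d → ℂ
variable {d : ℕ}
def rnorm (ξ : Vec d) : ℝ := Real.sqrt (∑ i, (ξ i) ^ 2)
def znorm (n : Zd d) : ℝ := Real.sqrt (∑ i, ((n i : ℝ)) ^ 2)
def jb (n : Zd d) : ℝ := Real.sqrt (1 + ∑ i, ((n i : ℝ)) ^ 2)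
def jbR (ξ : Vec d) : ℝ := Real.sqrt (1 + ∑ i, (ξ i) ^ 2)
def Periodic2pi (u : Fn d) : Prop :=
  ∀ (x : Vec d) (n : Zd d), u (fun i => x i + 2 * π * (n i : ℝ)) = u x
def box (d : ℕ) : Set (Vec d) := Set.univ.pi fun _ : Fin d => Set.Ioc (0 : ℝ) (2 * π)
def fCoeff (u : Fn d) (n : Zd d) : ℂ :=
  (((2 * π : ℝ) ^ (-(d : ℝ) / 2) : ℝ) : ℂ) *
    ∫ x in box d, u x * Complex.exp (-Complex.I * ((∑ i, (n i : ℝ) * x i : ℝ) : ℂ))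
def hsNormSq (s : ℝ) (c : Seq d) : ℝ := ∑' n : Zd d, jb n ^ (2 * s) * ‖c n‖ ^ 2
def hsNorm (s : ℝ) (c : Seq d) : ℝ := Real.sqrt (hsNormSq s c)
def InHsSeq (s : ℝ) (c : Seq d) : Prop :=
  Summable fun n : Zd d => jb n ^ (2 * s) * ‖c n‖ ^ 2
def sobNorm (s : ℝ) (u : Fn d) : ℝ := hsNorm s (fCoeff u)
def InHs (s : ℝ) (u : Fn d) : Prop :=
  Periodic2pi u ∧ InHsSeq s (fCoeff u) ∧
    ∀ x : Vec d, HasSum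
      (fun n : Zd d => (((2 * π : ℝ) ^ (-(d : ℝ) / 2) : ℝ) : ℂ) * fCoeff u n *
        Complex.exp (Complex.I * ((∑ i, (n i : ℝ) * x i : ℝ) : ℂ))) (u x)
def pdF (i : Fin d) (u : Fn d) : Fn d := fun x => fderiv ℝ u x (Pi.single i 1)
def pdx (i : Fin d) (a : Sym d) : Sym d := fun x ξ => fderiv ℝ (fun y => a y ξ) x (Pi.single i 1)
def pdxi (i : Fin d) (a : Sym d) : Sym d := fun x ξ => fderiv ℝ (fun η => a x η) ξ (Pi.single i 1)
def mderiv (L : List (Fin d ⊕ Fin d)) (a : Sym d) : Sym d :=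
  L.foldr (fun i b => match i with | Sum.inl j => pdx j b | Sum.inr j => pdxi j b) a
def nXi (L : List (Fin d ⊕ Fin d)) : ℕ := (L.filter fun i => i.isRight).length
def symVals (m : ℝ) (s : ℕ) (a : Sym d) : Set ℝ :=
  { r | ∃ (L : List (Fin d ⊕ Fin d)) (x ξ : Vec d), L.length ≤ s ∧
        r = jbR ξ ^ (-m + (nXi L : ℝ)) * ‖mderiv L a x ξ‖ }
def symNorm (m : ℝ) (s : ℕ) (a : Sym d) : ℝ := sSup (symVals m s a)
def InSymClass (m : ℝ) (s : ℕ) (a : Sym d) : Prop :=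
  ContDiff ℝ (s : ℕ∞) (Function.uncurry a) ∧ (∀ ξ, Periodic2pi fun x => a x ξ) ∧
    BddAbove (symVals m s a)
def poisson (a b : Sym d) : Sym d := fun x ξ =>
  ∑ j, (pdxi j a x ξ * pdx j b x ξ - pdx j a x ξ * pdxi j b x ξ)
def sigmaB (a b : Sym d) : Sym d := fun x ξ =>
  ∑ j, ∑ k,
    (pdxi j (pdxi k a) x ξ * pdx j (pdx k b) x ξ
      - 2 * pdx j (pdxi k a) x ξ * pdxi j (pdx k b) x ξ
      + pdx j (pdx k a) x ξ * pdxi j (pdxi k b) x ξ)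
structure IsCutoff (χ : ℝ → ℝ) : Prop where
  smooth : ContDiff ℝ (⊤ : ℕ∞) χ
  mem : ∀ t : ℝ, χ t ∈ Set.Icc (0 : ℝ) 1
  eq_one : ∀ t : ℝ, |t| ≤ 5 / 4 → χ t = 1
  eq_zero : ∀ t : ℝ, 8 / 5 ≤ |t| → χ t = 0
def symCoeff (a : Sym d) (η : Zd d) (ξ : Vec d) : ℂ := fCoeff (fun x => a x ξ) η
def mid (j k : Zd d) : Vec d := fun i => ((j i + k i : ℤ) : ℝ) / 2
def cutFactor (χ : ℝ → ℝ) (ε : ℝ) (j k : Zd d) : ℝ :=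
  χ (znorm (j - k) / (ε * jb (j + k)))
def paraC (χ : ℝ → ℝ) (ε : ℝ) (a : Sym d) (c : Seq d) : Seq d := fun j =>
  (((2 * π : ℝ) ^ (-(d : ℝ) / 2) : ℝ) : ℂ) *
    ∑' k : Zd d, ((cutFactor χ ε j k : ℝ) : ℂ) * symCoeff a (j - k) (mid j k) * c k
def remC (χ : ℝ → ℝ) (ε₁ ε₂ : ℝ) (a : Sym d) (c : Seq d) : Seq d := fun j =>
  (((2 * π : ℝ) ^ (-(d : ℝ) / 2) : ℝ) : ℂ) *
    ∑' k : Zd d, ((cutFactor χ ε₁ j k - cutFactor χ ε₂ j k : ℝ) : ℂ) *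
      symCoeff a (j - k) (mid j k) * c k
def wdP {n : ℕ} (j : Fin n) (G : (Fin n → ℂ) → ℂ) : (Fin n → ℂ) → ℂ := fun y =>
  (fderiv ℝ G y (Pi.single j 1) - Complex.I * fderiv ℝ G y (Pi.single j Complex.I)) / 2
def wdM {n : ℕ} (j : Fin n) (G : (Fin n → ℂ) → ℂ) : (Fin n → ℂ) → ℂ := fun y =>
  (fderiv ℝ G y (Pi.single j 1) + Complex.I * fderiv ℝ G y (Pi.single j Complex.I)) / 2
def jet (u : Fn d) (x : Vec d) : Fin (d + 1) → ℂ :=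
  Fin.cons (u x) fun j => pdF j u x
def Pop (F : (Fin (d + 1) → ℂ) → ℂ) (u : Fn d) : Fn d := fun x =>
  wdM 0 F (jet u x) - ∑ j, pdF j (fun y => wdM (Fin.succ j) F (jet u y)) x
def GoodF (d : ℕ) (F : (Fin (d + 1) → ℂ) → ℂ) : Prop :=
  ContDiff ℝ (⊤ : ℕ∞) F ∧ (∀ y, (F y).im = 0) ∧ ∀ k : ℕ, k ≤ 2 → iteratedFDeriv ℝ k F 0 = 0
def Elliptic (d : ℕ) (F : (Fin (d + 1) → ℂ) → ℂ) : Prop :=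
  ∃ c₁ > (0 : ℝ), ∃ c₂ > (0 : ℝ), ∀ (ξ : Vec d) (y : Fin (d + 1) → ℂ),
    (c₁ * ∑ i, (ξ i) ^ 2 ≤
      (∑ j, ∑ k, ((ξ j * ξ k : ℝ) : ℂ) *
        ((if j = k then 1 else 0) + wdP (Fin.succ j) (wdM (Fin.succ k) F) y)).re) ∧
    (ξ ≠ 0 → c₂ ≤
      (1 + (∑ j, ∑ k, ((ξ j * ξ k : ℝ) : ℂ) * wdP (Fin.succ j) (wdM (Fin.succ k) F) y).re
            / ∑ i, (ξ i) ^ 2) ^ 2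
        - ‖∑ j, ∑ k, ((ξ j * ξ k : ℝ) : ℂ) * wdM (Fin.succ j) (wdM (Fin.succ k) F) y‖ ^ 2
            / (∑ i, (ξ i) ^ 2) ^ 2)
def a2sym (F : (Fin (d + 1) → ℂ) → ℂ) (u : Fn d) : Sym d := fun x ξ =>
  ∑ j, ∑ k, ((ξ j * ξ k : ℝ) : ℂ) * wdP (Fin.succ j) (wdM (Fin.succ k) F) (jet u x)
def b2sym (F : (Fin (d + 1) → ℂ) → ℂ) (u : Fn d) : Sym d := fun x ξ =>
  ∑ j, ∑ k, ((ξ j * ξ k : ℝ) : ℂ) * wdM (Fin.succ j) (wdM (Fin.succ k) F) (jet u x)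
def a1sym (F : (Fin (d + 1) → ℂ) → ℂ) (u : Fn d) : Sym d := fun x ξ =>
  Complex.I / 2 * ∑ j, ((ξ j : ℝ) : ℂ) *
    (wdM 0 (wdP (Fin.succ j) F) (jet u x) - wdP 0 (wdM (Fin.succ j) F) (jet u x))
def starSeq (c : Seq d) : Seq d := fun n => (starRingEnd ℂ) (c (-n))
def starF (u : Fn d) : Fn d := fun x => (starRingEnd ℂ) (u x)
def starSym (a : Sym d) : Sym d := fun x ξ => (starRingEnd ℂ) (a x ξ)
def flipSym (a : Sym d) : Sym d := fun x ξ => (starRingEnd ℂ) (a x (-ξ))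
def Em : Fin 2 → ℂ := ![1, -1]
def opBWmat (χ : ℝ → ℝ) (ε : ℝ) (A : Fin 2 → Fin 2 → Sym d) (C : Fin 2 → Seq d) :
    Fin 2 → Seq d := fun σ j => ∑ τ, paraC χ ε (A σ τ) (C τ) j
def sq2sym (d : ℕ) : Sym d := fun _ ξ => (((rnorm ξ) ^ 2 : ℝ) : ℂ)
def A2mat (F : (Fin (d + 1) → ℂ) → ℂ) (u : Fn d) : Fin 2 → Fin 2 → Sym d :=
  ![![a2sym F u, b2sym F u], ![flipSym (b2sym F u), a2sym F u]]
def A1mat (F : (Fin (d + 1) → ℂ) → ℂ) (u : Fn d) : Fin 2 → Fin 2 → Sym d :=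
  ![![a1sym F u, 0], ![0, flipSym (a1sym F u)]]
def sysSym (F : (Fin (d + 1) → ℂ) → ℂ) (u : Fn d) : Fin 2 → Fin 2 → Sym d := fun σ τ =>
  fun x ξ => (if σ = τ then sq2sym d x ξ else 0) + A2mat F u σ τ x ξ + A1mat F u σ τ x ξ
def hsNormVec (s : ℝ) (C : Fin 2 → Seq d) : ℝ := hsNorm s (C 0) + hsNorm s (C 1)
def InHsVec (s : ℝ) (C : Fin 2 → Seq d) : Prop := InHsSeq s (C 0) ∧ InHsSeq s (C 1)
def pairL2 (C E : Fin 2 → Seq d) : ℂ :=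
  ∑' n : Zd d, (C 0 n * (starRingEnd ℂ) (E 0 n) + C 1 n * (starRingEnd ℂ) (E 1 n))
def pairS (c e : Seq d) : ℂ := ∑' n : Zd d, c n * (starRingEnd ℂ) (e n)
def PreservesReality (M : (Fin 2 → Seq d) → (Fin 2 → Seq d)) : Prop :=
  ∀ c : Seq d, M ![c, starSeq c] 1 = starSeq (M ![c, starSeq c] 0)
def Vvec (v : ℝ → Fn d) (t : ℝ) : Fin 2 → Seq d :=
  ![fCoeff (v t), starSeq (fCoeff (v t))]
def SolvesLin (χ : ℝ → ℝ) (ε : ℝ) (F : (Fin (d + 1) → ℂ) → ℂ) (T : ℝ)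
    (u v : ℝ → Fn d) : Prop :=
  ∀ᵐ t ∂(volume.restrict (Set.Ico (0 : ℝ) T)), ∀ (σ : Fin 2) (n : Zd d),
    HasDerivAt (fun τ => Vvec v τ σ n)
      (Complex.I * Em σ * opBWmat χ ε (sysSym F (u t)) (Vvec v t) σ n) t
def RegHyp (s₀ : ℕ) (s T r : ℝ) (u : ℝ → Fn d) : Prop :=
  (∀ t ∈ Set.Ico (0 : ℝ) T, InHs s (u t)) ∧
  (∃ M : ℝ, ∀ t ∈ Set.Ico (0 : ℝ) T, sobNorm s (u t) ≤ M) ∧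
  (∃ L : ℝ, ∀ t₁ ∈ Set.Ico (0 : ℝ) T, ∀ t₂ ∈ Set.Ico (0 : ℝ) T,
    sobNorm (s - 2) (u t₁ - u t₂) ≤ L * |t₁ - t₂|) ∧
  (∀ t ∈ Set.Ico (0 : ℝ) T, sobNorm (2 * (s₀ : ℝ) + 7) (u t) ≤ r) ∧
  (∀ t₁ ∈ Set.Ico (0 : ℝ) T, ∀ t₂ ∈ Set.Ico (0 : ℝ) T,
    sobNorm (2 * (s₀ : ℝ) + 5) (u t₁ - u t₂) ≤ r * |t₁ - t₂|)
def RegSol (s T : ℝ) (v : ℝ → Fn d) : Prop :=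
  (∀ t ∈ Set.Ico (0 : ℝ) T, InHs s (v t)) ∧
  (∃ M : ℝ, ∀ t ∈ Set.Ico (0 : ℝ) T, sobNorm s (v t) ≤ M) ∧
  (∃ L : ℝ, ∀ t₁ ∈ Set.Ico (0 : ℝ) T, ∀ t₂ ∈ Set.Ico (0 : ℝ) T,
    sobNorm (s - 2) (v t₁ - v t₂) ≤ L * |t₁ - t₂|)
def cutXR (χ : ℝ → ℝ) (R : ℝ) (ξ : Vec d) : ℝ := 1 - χ (rnorm ξ / R)
def a2til (F : (Fin (d + 1) → ℂ) → ℂ) (u : Fn d) (χ : ℝ → ℝ) (R : ℝ) : Sym d := fun x ξ =>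
  ((((rnorm ξ) ^ 2)⁻¹ * cutXR χ R ξ : ℝ) : ℂ) * a2sym F u x ξ
def b2til (F : (Fin (d + 1) → ℂ) → ℂ) (u : Fn d) (χ : ℝ → ℝ) (R : ℝ) : Sym d := fun x ξ =>
  ((((rnorm ξ) ^ 2)⁻¹ * cutXR χ R ξ : ℝ) : ℂ) * b2sym F u x ξ
def lam2 (F : (Fin (d + 1) → ℂ) → ℂ) (u : Fn d) (χ : ℝ → ℝ) (R : ℝ) :
    Vec d → Vec d → ℝ := fun x ξ =>
  Real.sqrt ((1 + (a2til F u χ R x ξ).re) ^ 2 - ‖b2til F u χ R x ξ‖ ^ 2)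
def sden (F : (Fin (d + 1) → ℂ) → ℂ) (u : Fn d) (χ : ℝ → ℝ) (R : ℝ) :
    Vec d → Vec d → ℝ := fun x ξ =>
  Real.sqrt (2 * lam2 F u χ R x ξ * (1 + (a2til F u χ R x ξ).re + lam2 F u χ R x ξ))
def s1sym (F : (Fin (d + 1) → ℂ) → ℂ) (u : Fn d) (χ : ℝ → ℝ) (R : ℝ) : Sym d := fun x ξ =>
  (((1 + (a2til F u χ R x ξ).re + lam2 F u χ R x ξ) / sden F u χ R x ξ : ℝ) : ℂ)
def s2sym (F : (Fin (d + 1) → ℂ) → ℂ) (u : Fn d) (χ : ℝ → ℝ) (R : ℝ) : Sym d := fun x ξ =>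
  -b2til F u χ R x ξ / ((sden F u χ R x ξ : ℝ) : ℂ)
def a2plus (F : (Fin (d + 1) → ℂ) → ℂ) (u : Fn d) (χ : ℝ → ℝ) (R : ℝ) : Sym d := fun x ξ =>
  ((lam2 F u χ R x ξ - 1 : ℝ) : ℂ)
def a2one (F : (Fin (d + 1) → ℂ) → ℂ) (u : Fn d) (χ : ℝ → ℝ) (R : ℝ) : Sym d := fun x ξ =>
  (((rnorm ξ) ^ 2 * (lam2 F u χ R x ξ - 1) : ℝ) : ℂ)
def Lscal (F : (Fin (d + 1) → ℂ) → ℂ) (u : Fn d) (χ : ℝ → ℝ) (R : ℝ) :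
    Vec d → Vec d → ℝ := fun x ξ =>
  (rnorm ξ) ^ 2 + (rnorm ξ) ^ 2 * (lam2 F u χ R x ξ - 1)
def Smat (F : (Fin (d + 1) → ℂ) → ℂ) (u : Fn d) (χ : ℝ → ℝ) (R : ℝ) (x ξ : Vec d) :
    Matrix (Fin 2) (Fin 2) ℂ :=
  !![s1sym F u χ R x ξ, s2sym F u χ R x ξ;
     (starRingEnd ℂ) (s2sym F u χ R x ξ), s1sym F u χ R x ξ]
def SmatInv (F : (Fin (d + 1) → ℂ) → ℂ) (u : Fn d) (χ : ℝ → ℝ) (R : ℝ) (x ξ : Vec d) :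
    Matrix (Fin 2) (Fin 2) ℂ :=
  !![s1sym F u χ R x ξ, -s2sym F u χ R x ξ;
     -(starRingEnd ℂ) (s2sym F u χ R x ξ), s1sym F u χ R x ξ]
def A2tilMat (F : (Fin (d + 1) → ℂ) → ℂ) (u : Fn d) (χ : ℝ → ℝ) (R : ℝ) (x ξ : Vec d) :
    Matrix (Fin 2) (Fin 2) ℂ :=
  !![a2til F u χ R x ξ, b2til F u χ R x ξ;
     (starRingEnd ℂ) (b2til F u χ R x (-ξ)), a2til F u χ R x ξ]
def EmatM : Matrix (Fin 2) (Fin 2) ℂ := !![1, 0; 0, -1]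
def SinvMatSym (F : (Fin (d + 1) → ℂ) → ℂ) (u : Fn d) (χ : ℝ → ℝ) (R : ℝ) :
    Fin 2 → Fin 2 → Sym d :=
  ![![s1sym F u χ R, fun x ξ => -s2sym F u χ R x ξ],
    ![fun x ξ => -(starRingEnd ℂ) (s2sym F u χ R x ξ), s1sym F u χ R]]
def s1_1 (F : (Fin (d + 1) → ℂ) → ℂ) (u : Fn d) (χ : ℝ → ℝ) (R : ℝ) : Sym d := fun x ξ =>
  1 / (2 * Complex.I) *
    (poisson (s2sym F u χ R) (starSym (s2sym F u χ R)) x ξ * s1sym F u χ R x ξ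
      + 2 * poisson (s1sym F u χ R) (s2sym F u χ R) x ξ *
          (starRingEnd ℂ) (s2sym F u χ R x ξ))
def s2_1 (F : (Fin (d + 1) → ℂ) → ℂ) (u : Fn d) (χ : ℝ → ℝ) (R : ℝ) : Sym d := fun x ξ =>
  1 / (2 * Complex.I) *
    (poisson (s2sym F u χ R) (starSym (s2sym F u χ R)) x ξ * s2sym F u χ R x ξ
      + 2 * poisson (s1sym F u χ R) (s2sym F u χ R) x ξ * s1sym F u χ R x ξ)
def S1mat (F : (Fin (d + 1) → ℂ) → ℂ) (u : Fn d) (χ : ℝ → ℝ) (R : ℝ) (x ξ : Vec d) :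
    Matrix (Fin 2) (Fin 2) ℂ :=
  (1 / (2 * Complex.I)) •
    (!![poisson (s2sym F u χ R) (starSym (s2sym F u χ R)) x ξ,
          2 * poisson (s1sym F u χ R) (s2sym F u χ R) x ξ;
        -2 * poisson (s1sym F u χ R) (starSym (s2sym F u χ R)) x (-ξ),
          poisson (s2sym F u χ R) (starSym (s2sym F u χ R)) x (-ξ)] *
      Smat F u χ R x ξ)
def g1sym (F : (Fin (d + 1) → ℂ) → ℂ) (u : Fn d) (χ : ℝ → ℝ) (R : ℝ) : Sym d := fun x ξ =>
  1 / (2 * Complex.I) * poisson (s1_1 F u χ R) (s1sym F u χ R) x ξ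
    - 1 / (2 * Complex.I) * poisson (s2_1 F u χ R) (starSym (s2sym F u χ R)) x ξ
    + 1 / 8 * sigmaB (s2sym F u χ R) (starSym (s2sym F u χ R)) x ξ
def g2sym (F : (Fin (d + 1) → ℂ) → ℂ) (u : Fn d) (χ : ℝ → ℝ) (R : ℝ) : Sym d := fun x ξ =>
  -(1 / (2 * Complex.I)) * poisson (s1_1 F u χ R) (s2sym F u χ R) x ξ
    + 1 / (2 * Complex.I) * poisson (s2_1 F u χ R) (s1sym F u χ R) x ξ
def dOp (i : Fin d) (c : Seq d) : Seq d := fun n => Complex.I * ((n i : ℝ) : ℂ) * c n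
def GoodConst (C : ℝ → ℝ) : Prop := Monotone C ∧ ∀ x : ℝ, 0 < C x
def IsSol (F : (Fin (d + 1) → ℂ) → ℂ) (s T : ℝ) (u₀ : Fn d) (u : ℝ → Fn d) : Prop :=
  (∀ t ∈ Set.Ico (0 : ℝ) T, InHs s (u t)) ∧
  (∀ x, u 0 x = u₀ x) ∧
  (∀ t₀ ∈ Set.Ico (0 : ℝ) T, ∀ δ > (0 : ℝ), ∃ η > (0 : ℝ), ∀ t ∈ Set.Ico (0 : ℝ) T,
    |t - t₀| < η → sobNorm s (u t - u t₀) < δ) ∧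
  ∃ w : ℝ → Fn d,
    (∀ t ∈ Set.Ico (0 : ℝ) T, InHs (s - 2) (w t)) ∧
    (∀ t₀ ∈ Set.Ico (0 : ℝ) T, ∀ δ > (0 : ℝ), ∃ η > (0 : ℝ), ∀ t ∈ Set.Ico (0 : ℝ) T,
      t ≠ t₀ → |t - t₀| < η →
        sobNorm (s - 2)
          (fun x => (u t x - u t₀ x) / (((t - t₀ : ℝ)) : ℂ) - w t₀ x) < δ) ∧
    (∀ t₀ ∈ Set.Ico (0 : ℝ) T, ∀ δ > (0 : ℝ), ∃ η > (0 : ℝ), ∀ t ∈ Set.Ico (0 : ℝ) T,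
      |t - t₀| < η → sobNorm (s - 2) (w t - w t₀) < δ) ∧
    (∀ t ∈ Set.Ico (0 : ℝ) T, ∀ x : Vec d,
      Complex.I * w t x - (∑ j, pdF j (pdF j (u t)) x) + Pop F (u t) x = 0)
section
open Set (Icc Ico Ioo)
open Finset (univ sum_congr sum_nonneg sum_le_sum sum_add_distrib mul_sum sum_mul sum_mul_sq_le_sq_mul_sq sum_sub_distrib single_le_sum mem_univ sum_comm sum_neg_distrib sum_eq_zero sum_le_sum_of_subset_of_nonneg sum_sq_le_sq_sum_of_nonneg)
local notation "LA" => (by linarith)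
local notation "PO" => (by positivity)
local notation "cJ" => starRingEnd ℂ
local notation "FZ" d:max => Finset (Zd d)
local notation "VC" d:max => Vec d → ℂ
local notation "SM" c:max => Summable fun n => ‖c n‖
local notation "HKK" d:max k:max => 2 * (d:ℝ) + 2 ≤ 2 * k - 1
lemma mL {a b c : ℝ} (h : b ≤ c) (k : 0 ≤ a) : a * b ≤ a * c := mul_le_mul_of_nonneg_left h k
lemma mR {a b c : ℝ} (h : b ≤ c) (k : 0 ≤ a) : b * a ≤ c * a := mul_le_mul_of_nonneg_right h k
lemma dn (d : ℕ) : (0:ℝ) ≤ d := Nat.cast_nonneg d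
abbrev Y (d : ℕ) := Fin (d + 1) → ℂ
abbrev GY (d : ℕ) := Fin (d + 1) → Y d → ℂ
variable {c : Seq d} {B : FZ d} {g : GY d} {m L δ s : ℝ} {u z a : Seq d} {f : VC d} {G : Y d → ℂ}
def kap (d : ℕ) : ℝ := (2 * π : ℝ) ^ (-(d : ℝ) / 2)
def ee (n : Zd d) (x : Vec d) : ℂ := Complex.exp (I * ((∑ i, (n i : ℝ) * x i : ℝ) : ℂ))
def S (c : Seq d) (x : Vec d) : ℂ := ∑' n : Zd d, (kap d : ℂ) * c n * ee n x
def Supp (B : FZ d) (c : Seq d) : Prop := ∀ n, n ∉ B → c n = 0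
def PB (B : FZ d) (c : Seq d) : Seq d := fun n => open Classical in if n ∈ B then c n else 0
lemma kap_pos : 0 < kap d := Real.rpow_pos_of_pos PO _
lemma kap_sq : kap d ^ 2 * (2 * π) ^ d = 1 := by
  have h : (0:ℝ) < 2 * π := by positivity
  rw [kap, ← rpow_natCast, ← rpow_mul h.le, ← rpow_natCast (2*π) d, ← rpow_add h]
  simp
lemma ee_zero (x : Vec d) : ee 0 x = 1 := by simp [ee]
lemma ee_add (n m : Zd d) (x : Vec d) : ee (n + m) x = ee n x * ee m x := by
  simp only [ee, ← Complex.exp_add]; congr 1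
  push_cast [Pi.add_apply]; rw [← mul_add, ← sum_add_distrib]; congr 2; ext i; ring
lemma ee_neg (n : Zd d) (x : Vec d) : ee (-n) x = cJ (ee n x) := by
  simp only [ee, ← Complex.exp_conj, map_mul, Complex.conj_I, conj_ofReal]; congr 1
  simp [sum_neg_distrib]
lemma norm_ee (n : Zd d) (x : Vec d) : ‖ee n x‖ = 1 := by
  rw [ee, mul_comm, Complex.norm_exp_ofReal_mul_I]
lemma ee_mul_conj (n : Zd d) (x : Vec d) : ee n x * cJ (ee n x) = 1 := by
  rw [← ee_neg, ← ee_add]; simp [ee_zero]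
lemma cont_ee (n : Zd d) : Continuous (ee n) := by unfold ee; fun_prop
lemma per_ee (n : Zd d) : Periodic2pi (ee n) := by
  intro x m
  simp only [ee]
  rw [Complex.exp_eq_exp_iff_exists_int]
  refine ⟨∑ i, n i * m i, ?_⟩
  push_cast
  simp only [mul_add, sum_add_distrib, sum_mul, mul_sum]
  congr 1; refine sum_congr rfl fun i _ => ?_; ring
lemma box_meas : MeasurableSet (box d) := MeasurableSet.univ_pi fun _ => measurableSet_Ioc
lemma vol_box : volume.real (box d) = (2 * π) ^ d := by
  simp only [Measure.real, box, Real.volume_pi_Ioc, sub_zero]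
  simp [ENNReal.toReal_ofReal Real.pi_pos.le]
lemma vol_box_lt : volume (box d) < ⊤ := by
  simp only [box, Real.volume_pi_Ioc, sub_zero]
  exact ENNReal.prod_lt_top fun _ _ => ENNReal.ofReal_lt_top
lemma box_sub : box d ⊆ Icc 0 (fun _ => 2 * π) := fun _ hx =>
  ⟨fun i => (hx i trivial).1.le, fun i => (hx i trivial).2⟩
lemma intB {E : Type*} [NormedAddCommGroup E] {f : Vec d → E} (hf : Continuous f) :
    Integrable f (volume.restrict (box d)) :=
  (hf.continuousOn.integrableOn_compact isCompact_Icc).mono_set box_sub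
lemma int_ee (n : Zd d) : ∫ x in box d, ee n x = if n = 0 then (((2 * π) ^ d : ℝ) : ℂ) else 0 := by
  split_ifs with h
  · subst h; simp [ee_zero, vol_box]
  · have h1 : ∀ x : Vec d, ee n x = ∏ i, Complex.exp (I * n i * x i) := by
      intro x; rw [← Complex.exp_sum, ee]; congr 1; push_cast; rw [mul_sum]
      exact sum_congr rfl fun i _ => by ring
    simp only [h1]
    rw [box, volume_pi, Measure.restrict_pi_pi,
      integral_fintype_prod_eq_prod (fun i (t : ℝ) => Complex.exp (I * n i * t))]
    obtain ⟨i, hi⟩ : ∃ i, n i ≠ 0 := by by_contra hc; push Not at hc; exact h (funext hc)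
    refine Finset.prod_eq_zero (mem_univ i) ?_
    have hc : (I * n i : ℂ) ≠ 0 := mul_ne_zero Complex.I_ne_zero (by exact_mod_cast hi)
    rw [← intervalIntegral.integral_of_le PO, integral_exp_mul_complex hc]
    have : Complex.exp (I * n i * ((2 * π : ℝ) : ℂ)) = 1 := by
      rw [Complex.exp_eq_one_iff]; exact ⟨n i, by push_cast; ring⟩
    rw [this]; simp
lemma fCoeff_eq (u : VC d) (n : Zd d) :
    fCoeff u n = (kap d : ℂ) * ∫ x in box d, u x * ee (-n) x := by
  unfold fCoeff kap ee; congr 2; ext x; congr 2; simp [sum_neg_distrib]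
lemma fCoeff_eq' (u : VC d) (n : Zd d) :
    fCoeff u n = (kap d : ℂ) * ∫ x in box d, u x * cJ (ee n x) := by
  rw [fCoeff_eq]; simp only [ee_neg]
lemma fCoeff_add {f g : VC d} (hf : Continuous f) (hg : Continuous g) :
    fCoeff (fun x => f x + g x) = fCoeff f + fCoeff g := by
  ext n; simp only [Pi.add_apply, fCoeff_eq, ← mul_add, add_mul]
  rw [integral_add] <;> exact intB (by have := cont_ee (-n); fun_prop)
lemma fCoeff_sub {f g : VC d} (hf : Continuous f) (hg : Continuous g) :
    fCoeff (fun x => f x - g x) = fCoeff f - fCoeff g := by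
  ext n; simp only [Pi.sub_apply, fCoeff_eq, ← mul_sub, sub_mul]
  rw [integral_sub] <;> exact intB (by have := cont_ee (-n); fun_prop)
lemma fCoeff_smul (a : ℂ) (f : VC d) : fCoeff (fun x => a * f x) = fun n => a * fCoeff f n := by
  ext n; simp only [fCoeff_eq, mul_assoc]; rw [integral_const_mul]; ring
lemma fCoeff_sum {ι : Type*} (s : Finset ι) (f : ι → VC d) (hf : ∀ i ∈ s, Continuous (f i)) :
    fCoeff (fun x => ∑ i ∈ s, f i x) = fun n => ∑ i ∈ s, fCoeff (f i) n := by
  ext n; simp only [fCoeff_eq, sum_mul]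
  rw [integral_finsetSum, mul_sum]
  exact fun i hi => intB (by have := cont_ee (-n); have := hf i hi; fun_prop)
lemma fCoeff_conj (f : VC d) : fCoeff (fun x => cJ (f x)) = starSeq (fCoeff f) := by
  ext n; simp only [fCoeff_eq, starSeq, map_mul, conj_ofReal, ← integral_conj, ← ee_neg, neg_neg]
lemma S_fin (h : Supp B c) (x : Vec d) :
    S c x = ∑ n ∈ B, (kap d : ℂ) * c n * ee n x := by
  rw [S, tsum_eq_sum]; intro n hn; simp [h n hn]
lemma Supp.summ (h : Supp B c) (w : Zd d → ℝ) :
    Summable fun n => w n * ‖c n‖ :=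
  summable_of_ne_finset_zero (s := B) fun n hn => by simp [h n hn]
lemma Supp.summ1 (h : Supp B c) : SM c := by
  simpa using h.summ 1
lemma S_summ (hc : SM c) (x : Vec d) :
    Summable fun n => (kap d : ℂ) * c n * ee n x := by
  refine Summable.of_norm ?_
  simp only [norm_mul, norm_ee, mul_one]; exact hc.mul_left _
lemma S_norm (hc : SM c) (x : Vec d) :
    ‖S c x‖ ≤ kap d * ∑' n, ‖c n‖ := by
  have h := norm_tsum_le_tsum_norm (S_summ hc x).norm
  simp only [norm_mul, norm_ee, mul_one, tsum_mul_left, norm_real, Real.norm_eq_abs, abs_of_pos (kap_pos (d:=d))] at h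
  exact h
lemma cont_S (hc : SM c) : Continuous (S c) := by
  refine continuous_tsum (u := fun n => kap d * ‖c n‖) (fun n => by have := cont_ee n; fun_prop) (hc.mul_left _) ?_
  intro n x; simp [norm_ee, abs_of_pos (kap_pos (d:=d))]
lemma per_S (c : Seq d) : Periodic2pi (S c) := by
  intro x n; unfold S; congr 1; ext m; rw [per_ee m x n]
lemma S_add {a b : Seq d} (ha : SM a) (hb : SM b) (x : Vec d) :
    S (a + b) x = S a x + S b x := by
  simp only [S]; rw [← (S_summ ha x).tsum_add (S_summ hb x)]; congr 1; ext n; simp; ring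
lemma S_sub {a b : Seq d} (ha : SM a) (hb : SM b) (x : Vec d) :
    S (a - b) x = S a x - S b x := by
  simp only [S]; rw [← (S_summ ha x).tsum_sub (S_summ hb x)]; congr 1; ext n; simp; ring
lemma S_smul (a : ℂ) (c : Seq d) (x : Vec d) : S (fun n => a * c n) x = a * S c x := by
  simp only [S]; rw [← tsum_mul_left]; congr 1; ext n; ring
lemma S_star (c : Seq d) (x : Vec d) : S (starSeq c) x = cJ (S c x) := by
  simp only [S]; rw [Complex.conj_tsum, ← (Equiv.neg (Zd d)).tsum_eq]; congr 1; ext n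
  simp only [starSeq, Equiv.neg_apply, neg_neg, ee_neg, map_mul, conj_ofReal]
lemma int_ee2 (n m : Zd d) : ∫ x in box d, ee m x * ee (-n) x =
    if m = n then (((2 * π) ^ d : ℝ) : ℂ) else 0 := by
  simp only [← ee_add]; rw [int_ee]; simp only [← sub_eq_add_neg, sub_eq_zero]
lemma fCoeff_S (hc : SM c) : fCoeff (S c) = c := by
  ext n
  rw [fCoeff_eq]
  have h1 : ∀ x, S c x * ee (-n) x = ∑' m, (kap d : ℂ) * c m * (ee m x * ee (-n) x) := by
    intro x; rw [S, ← tsum_mul_right]; congr 1; ext m; ring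
  simp only [h1]
  have hk := kap_pos (d := d)
  rw [← integral_tsum_of_summable_integral_norm]
  · simp only [integral_const_mul, int_ee2]
    rw [tsum_eq_single n (fun m hm => by simp [hm])]
    have := kap_sq (d := d)
    simp only [if_true]
    have h2 : (kap d : ℂ) ^ 2 * (((2 * π) ^ d : ℝ) : ℂ) = 1 := by exact_mod_cast this
    linear_combination c n * h2
  · intro m; exact intB (by have := cont_ee (-n); have := cont_ee m; fun_prop)
  · simp only [norm_mul, norm_ee, mul_one, integral_const]
    exact (hc.mul_left _).mul_left _
lemma fCoeff_ee_mul (f : VC d) (k n : Zd d) : fCoeff (fun x => f x * ee k x) n = fCoeff f (n - k) := by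
  simp only [fCoeff_eq, mul_assoc, ← ee_add]; rw [show k + -n = -(n - k) by abel]
lemma fCoeff_mul_S (ha : Supp B a) (hf : Continuous f) (n : Zd d) :
    fCoeff (fun x => f x * S a x) n = kap d * ∑ k ∈ B, fCoeff f (n - k) * a k := by
  simp only [S_fin ha, mul_sum]
  rw [fCoeff_sum _ _ (fun k _ => by have := cont_ee k; fun_prop)]
  refine sum_congr rfl fun k _ => ?_
  have : (fun x => f x * ((kap d : ℂ) * a k * ee k x)) = fun x => ((kap d : ℂ) * a k) * (f x * ee k x) := by
    ext x; ring
  simp only [this, fCoeff_smul, fCoeff_ee_mul]; ring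
lemma pairing {φ : Seq d} (h : Supp B φ) (hf : Continuous f) :
    ∑ n ∈ B, fCoeff f n * cJ (φ n) = ∫ x in box d, f x * cJ (S φ x) := by
  simp only [S_fin h, map_sum, mul_sum]
  rw [integral_finsetSum _ (fun n _ => intB (by have := cont_ee n; fun_prop))]
  refine sum_congr rfl fun n _ => ?_
  rw [fCoeff_eq']
  simp only [map_mul, conj_ofReal]
  rw [mul_right_comm, ← integral_const_mul]; congr 1; ext x; ring
lemma Supp_PB (B : FZ d) (c : Seq d) : Supp B (PB B c) := fun n hn => by simp [PB, hn]
lemma PB_mem {n : Zd d} (h : n ∈ B) (c : Seq d) : PB B c n = c n := by simp [PB, h]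
lemma PB_eq (h : Supp B c) : PB B c = c := by
  ext n; by_cases hn : n ∈ B
  · simp [PB, hn]
  · simp [PB, hn, h n hn]
lemma parseval (h : Supp B c) :
    ∫ x in box d, ‖S c x‖ ^ 2 = ∑ n ∈ B, ‖c n‖ ^ 2 := by
  have := pairing h (cont_S h.summ1)
  rw [fCoeff_S h.summ1] at this
  simp only [mul_conj, normSq_eq_norm_sq] at this
  have h2 := this.trans (integral_complex_ofReal (f := fun x => ‖S c x‖ ^ 2))
  exact_mod_cast h2.symm
lemma bessel (B : FZ d) (hf : Continuous f) :
    ∑ n ∈ B, ‖fCoeff f n‖ ^ 2 ≤ ∫ x in box d, ‖f x‖ ^ 2 := by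
  set φ := PB B (fCoeff f)
  have hφ : Supp B φ := Supp_PB _ _
  have h1 := pairing hφ hf
  have h2 := parseval hφ
  have h3 : ∑ n ∈ B, ‖φ n‖ ^ 2 = ∑ n ∈ B, ‖fCoeff f n‖ ^ 2 :=
    sum_congr rfl fun n hn => by rw [show φ n = _ from PB_mem hn _]
  have h4 : (∑ n ∈ B, fCoeff f n * cJ (φ n)).re = ∑ n ∈ B, ‖fCoeff f n‖ ^ 2 := by
    rw [Complex.re_sum]; refine sum_congr rfl fun n hn => ?_
    rw [show φ n = _ from PB_mem hn _, mul_conj, normSq_eq_norm_sq, ofReal_re]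
  have hS := cont_S hφ.summ1
  have h5 : ∫ x in box d, ‖f x - S φ x‖ ^ 2 = (∫ x in box d, ‖f x‖ ^ 2) -
      2 * (∫ x in box d, f x * cJ (S φ x)).re + ∫ x in box d, ‖S φ x‖ ^ 2 := by
    have e : (∫ x in box d, f x * cJ (S φ x)).re = ∫ x in box d, (f x * cJ (S φ x)).re :=
      (integral_re (𝕜 := ℂ) (f := fun x => f x * cJ (S φ x)) (intB (by fun_prop))).symm
    rw [e, ← integral_const_mul, ← integral_sub, ← integral_add]
    · congr 1; ext x
      rw [← normSq_eq_norm_sq, ← normSq_eq_norm_sq, ← normSq_eq_norm_sq, Complex.normSq_sub]; ring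
    all_goals exact intB (by fun_prop)
  have h6 : 0 ≤ ∫ x in box d, ‖f x - S φ x‖ ^ 2 := integral_nonneg fun _ => by positivity
  rw [← h1, h4, h2, h3] at h5
  linarith
lemma int_pdF (hf : ContDiff ℝ 1 f) (hp : Periodic2pi f) (j : Fin d) :
    ∫ x in box d, pdF j f x = 0 := by
  obtain _ | n := d
  · exact j.elim0
  have hfd : Continuous fun x => fderiv ℝ f x := hf.continuous_fderiv one_ne_zero
  have key := integral_divergence_of_hasFDerivAt_off_countable' (E := ℂ) (n := n) (fun _ => (0:ℝ)) (fun _ => 2 * π)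
    (fun _ => by positivity) (fun i => if i = j then f else 0) (fun i => if i = j then fderiv ℝ f else 0)
    ∅ Set.countable_empty (fun i => by split_ifs; exacts [hf.continuous.continuousOn, continuousOn_const])
    (fun x _ i => by
      split_ifs
      · exact (hf.differentiable one_ne_zero x).hasFDerivAt
      · exact hasFDerivAt_const _ _)
    (by
      refine Continuous.integrableOn_Icc ?_
      refine continuous_finsetSum _ fun i _ => ?_
      split_ifs
      · exact hfd.clm_apply continuous_const
      · exact continuous_const)
  have e1 : ∀ x : Vec (n+1), ∑ i, (if i = j then fderiv ℝ f else 0 : Vec (n+1) → Vec (n+1) →L[ℝ] ℂ) x (Pi.single i 1) = pdF j f x := by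
    intro x; rw [Finset.sum_eq_single j]
    · simp [pdF]
    · intro i _ hi; simp [hi]
    · simp
  simp only [e1] at key
  have e2 : ∫ x in box (n+1), pdF j f x = ∫ x in Icc (fun _ => (0:ℝ)) (fun _ => 2 * π), pdF j f x := by
    rw [volume_pi, ← setIntegral_congr_set Measure.univ_pi_Ioc_ae_eq_Icc]; rfl
  rw [e2, key]
  refine sum_eq_zero fun i _ => ?_
  rw [sub_eq_zero]
  congr 1; ext x
  split_ifs with h
  · have := hp (Fin.insertNth i 0 x) (Pi.single i 1)
    rw [← this]; congr 1; ext k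
    refine Fin.succAboveCases i ?_ (fun k => ?_) k <;> simp
  · rfl
lemma HasFDerivAt_ee (n : Zd d) (x : Vec d) : HasFDerivAt (ee n)
    (ee n x • (I • ∑ i, ((n i : ℝ) • (Complex.ofRealCLM.comp (ContinuousLinearMap.proj (R := ℝ) (φ := fun _ : Fin d => ℝ) i))))) x := by
  have h1 : HasFDerivAt (fun x : Vec d => I * ((∑ i, (n i : ℝ) * x i : ℝ) : ℂ))
    (I • ∑ i, ((n i : ℝ) • (Complex.ofRealCLM.comp (ContinuousLinearMap.proj (R := ℝ) (φ := fun _ : Fin d => ℝ) i)))) x := by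
    have : (fun x : Vec d => I * ((∑ i, (n i : ℝ) * x i : ℝ) : ℂ)) = (I • ∑ i, ((n i : ℝ) • (Complex.ofRealCLM.comp (ContinuousLinearMap.proj (R := ℝ) (φ := fun _ : Fin d => ℝ) i)))) := by
      ext y; simp
    rw [this]; exact (I • ∑ i, ((n i : ℝ) • (Complex.ofRealCLM.comp (ContinuousLinearMap.proj (R := ℝ) (φ := fun _ : Fin d => ℝ) i)))).hasFDerivAt
  exact h1.cexp
lemma contDiff_ee (n : Zd d) {k} : ContDiff ℝ k (ee n) := by
  have : ContDiff ℝ k fun x : Vec d => ((∑ i, (n i : ℝ) * x i : ℝ) : ℂ) := by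
    have h0 : ContDiff ℝ k fun x : Vec d => ∑ i, (n i : ℝ) * x i := ContDiff.sum fun i _ => by fun_prop
    exact Complex.ofRealCLM.contDiff.comp h0
  unfold ee; fun_prop
lemma pdF_ee (j : Fin d) (n : Zd d) (x : Vec d) : pdF j (ee n) x = I * n j * ee n x := by
  rw [pdF, (HasFDerivAt_ee n x).fderiv]
  simp only [_root_.smul_apply, _root_.sum_apply, ContinuousLinearMap.comp_apply, ContinuousLinearMap.proj_apply, Complex.ofRealCLM_apply, smul_eq_mul]
  rw [Finset.sum_eq_single j]
  · simp; ring
  · intro i _ hi; simp [hi]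
  · simp
lemma pdF_mul {f g : VC d} {x : Vec d} (hf : DifferentiableAt ℝ f x) (hg : DifferentiableAt ℝ g x) (j : Fin d) :
    pdF j (fun x => f x * g x) x = pdF j f x * g x + f x * pdF j g x := by
  simp only [pdF]; rw [fderiv_fun_mul hf hg]; simp; ring
lemma fCoeff_pdF (hf : ContDiff ℝ 1 f) (hp : Periodic2pi f) (j : Fin d) (n : Zd d) :
    fCoeff (pdF j f) n = I * n j * fCoeff f n := by
  have h := int_pdF (f := fun x => f x * ee (-n) x) (hf.mul (contDiff_ee _))
    (fun x m => by simp only [hp x m, per_ee _ x m]) j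
  have hd : ∀ x, pdF j (fun x => f x * ee (-n) x) x = pdF j f x * ee (-n) x - (I * n j) * (f x * ee (-n) x) := by
    intro x
    rw [pdF_mul (hf.differentiable one_ne_zero x) ((contDiff_ee (k := 1) _).differentiable one_ne_zero x), pdF_ee]
    push_cast [Pi.neg_apply]; ring
  have hc : Continuous (pdF j f) := (hf.continuous_fderiv one_ne_zero).clm_apply continuous_const
  simp only [hd] at h
  have hf' := hf.continuous
  have he := cont_ee (-n)
  rw [integral_sub (intB (f := fun x => pdF j f x * ee (-n) x) (hc.mul he)) (intB (f := fun x => I * (n j : ℂ) * (f x * ee (-n) x)) (continuous_const.mul (hf'.mul he))), integral_const_mul] at h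
  rw [fCoeff_eq, fCoeff_eq]
  linear_combination (kap d : ℂ) * h
lemma periodic_rep (x : Vec d) :
    ∃ y ∈ box d, ∃ n : Zd d, x = fun i => y i + 2 * π * n i := by
  have hpi : (0:ℝ) < 2 * π := by positivity
  refine ⟨fun i => toIocMod hpi 0 (x i), fun i _ => ?_, fun i => toIocDiv hpi 0 (x i), ?_⟩
  · simpa using toIocMod_mem_Ioc hpi 0 (x i)
  · ext i; have := toIocMod_add_toIocDiv_zsmul hpi 0 (x i); simp only [zsmul_eq_mul] at this; linarith
lemma bdd_of_per (hf : Continuous f) (hp : Periodic2pi f) : ∃ M, ∀ x, ‖f x‖ ≤ M := by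
  obtain ⟨M, hM⟩ := (isCompact_Icc (a := (0 : Vec d)) (b := fun _ => 2 * π)).exists_bound_of_continuousOn hf.continuousOn
  refine ⟨M, fun x => ?_⟩
  obtain ⟨y, hy, n, rfl⟩ := periodic_rep x
  rw [hp]; exact hM y (box_sub hy)
lemma box_dense (x : Vec d) (hx : x ∈ box d) : ∃ z : ℕ → Vec d, (∀ k i, z k i ∈ Ioo 0 (2*π)) ∧ Tendsto z atTop (nhds x) := by
  have hpi : (0:ℝ) < π := Real.pi_pos
  have h : ∀ i, x i ∈ closure (Ioo 0 (2*π)) := fun i => by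
    rw [closure_Ioo PO]; exact ⟨(hx i trivial).1.le, (hx i trivial).2⟩
  choose z hz1 hz2 using fun i => mem_closure_iff_seq_limit.1 (h i)
  exact ⟨fun k i => z i k, fun k i => hz1 i k, tendsto_pi_nhds.2 hz2⟩
lemma eq_zero_of_int (hf : Continuous f) (hp : Periodic2pi f)
    (h : ∫ x in box d, ‖f x‖ ^ 2 = 0) (x : Vec d) : f x = 0 := by
  have h1 := (setIntegral_eq_zero_iff_of_nonneg_ae (Eventually.of_forall fun x => by positivity)
    (intB (f := fun x => ‖f x‖ ^ 2) (by fun_prop))).1 h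
  set O : Set (Vec d) := Set.univ.pi fun _ => Ioo 0 (2*π)
  have hO : IsOpen O := isOpen_set_pi Set.finite_univ fun _ _ => isOpen_Ioo
  have hOb : O ⊆ box d := Set.pi_mono fun _ _ => Set.Ioo_subset_Ioc_self
  have h2 : (fun x => ‖f x‖ ^ 2) =ᵐ[volume.restrict O] fun _ => 0 := ae_restrict_of_ae_restrict_of_subset hOb h1
  have h3 := Measure.eqOn_open_of_ae_eq h2 hO (by fun_prop) (by fun_prop)
  obtain ⟨y, hy, n, rfl⟩ := periodic_rep x
  rw [hp]
  obtain ⟨z, hz, hzl⟩ := box_dense y hy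
  have h4 : Tendsto (fun k => f (z k)) atTop (nhds (f y)) := (hf.tendsto y).comp hzl
  have h5 : ∀ k, f (z k) = 0 := fun k => by
    have := h3 (show z k ∈ O from fun i _ => hz k i); simpa using this
  simp only [h5] at h4
  exact (tendsto_nhds_unique h4 tendsto_const_nhds)
def qT (x : Vec d) : UnitAddTorus (Fin d) := fun i => ((x i : ℝ) : AddCircle (1:ℝ))
lemma mF_eq (n : Zd d) (x : Vec d) : UnitAddTorus.mFourier n (qT x) = ee n (fun i => 2 * π * x i) := by
  simp only [UnitAddTorus.mFourier, ContinuousMap.coe_mk, qT, fourier_coe_apply, ee]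
  rw [← Complex.exp_sum, sum_congr rfl]
  rotate_left 1
  · exact fun i _ => rfl
  · congr 1; push_cast; rw [mul_sum]; exact sum_congr rfl fun i _ => by simp; ring
lemma approx_trig (hf : Continuous f) (hp : Periodic2pi f) {ε : ℝ} (hε : 0 < ε) :
    ∃ (B : FZ d) (c : Seq d), Supp B c ∧ ∀ x, ‖f x - S c x‖ < ε := by
  have hq : IsOpenQuotientMap (qT (d := d)) :=
    IsOpenQuotientMap.piMap (f := fun _ (t : ℝ) => (t : AddCircle (1:ℝ))) fun _ => QuotientAddGroup.isOpenQuotientMap_mk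
  choose r hr using hq.surjective
  set g : UnitAddTorus (Fin d) → ℂ := fun z => f (fun i => 2 * π * r z i)
  have hg : ∀ x, g (qT x) = f (fun i => 2 * π * x i) := by
    intro x
    have h1 := hr (qT x)
    have : ∀ i, ∃ m : ℤ, r (qT x) i = x i + m := fun i => by
      have h2 := congrFun h1 i
      simp only [qT] at h2
      rw [← sub_eq_zero, ← AddCircle.coe_sub, AddCircle.coe_eq_zero_iff] at h2
      obtain ⟨m, hm⟩ := h2
      exact ⟨m, by simp at hm; linarith⟩
    choose m hm using this
    simp only [g, hm, mul_add]; exact hp _ m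
  have hgc : Continuous g := by
    rw [hq.isQuotientMap.continuous_iff]
    have : g ∘ qT = fun x => f (fun i => 2 * π * x i) := funext hg
    rw [this]; fun_prop
  have hmem : (⟨g, hgc⟩ : C(UnitAddTorus (Fin d), ℂ)) ∈ (Submodule.span ℂ (Set.range UnitAddTorus.mFourier)).topologicalClosure := by
    rw [UnitAddTorus.span_mFourier_closure_eq_top]; trivial
  obtain ⟨p, hps, hpd⟩ := Metric.mem_closure_iff.1 hmem ε hε
  obtain ⟨a, rfl⟩ := Finsupp.mem_span_range_iff_exists_finsupp.1 hps
  have hs : Supp a.support (fun n => a n * ((kap d : ℂ)⁻¹)) := fun n hn => by simp [Finsupp.notMem_support_iff.1 hn]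
  refine ⟨a.support, _, hs, fun x => ?_⟩
  have hx : x = fun i => 2 * π * (x i / (2 * π)) := by ext i; field_simp
  have hk : (kap d : ℂ) ≠ 0 := by exact_mod_cast (kap_pos (d := d)).ne'
  have h1 := ContinuousMap.dist_apply_le_dist (f := ⟨g, hgc⟩) (g := a.sum fun i c => c • UnitAddTorus.mFourier i) (qT fun i => x i / (2*π))
  rw [dist_eq_norm] at h1
  refine lt_of_le_of_lt (le_of_eq ?_) (h1.trans_lt hpd)
  congr 1
  rw [ContinuousMap.coe_mk, hg, ← hx, S_fin hs]
  congr 1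
  simp only [Finsupp.sum, ContinuousMap.coe_sum, Finset.sum_apply, ContinuousMap.coe_smul, Pi.smul_apply, mF_eq, ← hx, smul_eq_mul]
  refine sum_congr rfl fun n _ => ?_
  field_simp
lemma eq_zero_of_fCoeff (hf : Continuous f) (hp : Periodic2pi f) (h : ∀ n, fCoeff f n = 0) (x : Vec d) :
    f x = 0 := by
  refine eq_zero_of_int hf hp ?_ x
  obtain ⟨M, hM⟩ := bdd_of_per hf hp
  have hM0 : 0 ≤ M := (norm_nonneg _).trans (hM 0)
  refine le_antisymm (le_of_forall_pos_le_add fun ε hε => ?_) (integral_nonneg fun _ => by positivity)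
  have hV : (0:ℝ) < (2*π)^d := by positivity
  obtain ⟨B, c, hc, hB⟩ := approx_trig hf hp (ε := ε / ((M + 1) * (2*π)^d)) PO
  have h1 := pairing hc hf
  simp only [h, zero_mul, Finset.sum_const_zero] at h1
  have hS := cont_S hc.summ1
  have h2 : ((∫ x in box d, ‖f x‖ ^ 2 : ℝ) : ℂ) = ∫ x in box d, f x * cJ (f x - S c x) := by
    rw [← integral_complex_ofReal]
    simp only [map_sub, mul_sub]
    rw [integral_sub (intB (by fun_prop)) (intB (by fun_prop)), ← h1, sub_zero]
    congr 1; ext x; rw [mul_conj, normSq_eq_norm_sq]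
  have h3 : ‖((∫ x in box d, ‖f x‖ ^ 2 : ℝ) : ℂ)‖ ≤ M * (ε / ((M + 1) * (2*π)^d)) * volume.real (box d) := by
    rw [h2]
    refine norm_setIntegral_le_of_norm_le_const vol_box_lt fun x _ => ?_
    rw [norm_mul, RCLike.norm_conj]
    exact mul_le_mul (hM x) (hB x).le (norm_nonneg _) hM0
  rw [norm_real, Real.norm_eq_abs, vol_box] at h3
  refine (le_abs_self _).trans (h3.trans ?_)
  rw [zero_add]
  have : M * (ε / ((M + 1) * (2*π)^d)) * (2*π)^d = ε * (M / (M+1)) := by field_simp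
  rw [this]
  exact mul_le_of_le_one_right hε.le (by rw [div_le_one PO]; linarith)
lemma eq_S_of_summ (hf : Continuous f) (hp : Periodic2pi f)
    (h : Summable fun n => ‖fCoeff f n‖) (x : Vec d) : f x = S (fCoeff f) x := by
  have := eq_zero_of_fCoeff (f := fun x => f x - S (fCoeff f) x) (hf.sub (cont_S h))
    (fun x n => by simp only [hp x n, per_S _ x n]) (fun n => by rw [fCoeff_sub hf (cont_S h), fCoeff_S h]; simp) x
  exact sub_eq_zero.1 this
def mu (a : Fin (d + 1)) (n : Zd d) : ℂ := Fin.cases 1 (fun j => I * (n j : ℂ)) a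
def JJ (a : Fin (d + 1)) (c : Seq d) : Seq d := fun n => mu a n * c n
lemma mu_zero (n : Zd d) : mu 0 n = 1 := rfl
lemma mu_succ (j : Fin d) (n : Zd d) : mu j.succ n = I * (n j : ℂ) := rfl
lemma JJ_zero (c : Seq d) : JJ 0 c = c := by ext n; simp [JJ, mu_zero]
lemma one_le_jb (n : Zd d) : 1 ≤ jb n := by
  rw [jb, Real.one_le_sqrt]; linarith [sum_nonneg fun i (_ : i ∈ univ) => sq_nonneg ((n i : ℝ))]
lemma jb_pos (n : Zd d) : 0 < jb n := zero_lt_one.trans_le (one_le_jb n)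
lemma abs_le_jb (n : Zd d) (j : Fin d) : |(n j : ℝ)| ≤ jb n := by
  rw [jb, ← Real.sqrt_sq_eq_abs]; refine Real.sqrt_le_sqrt ?_
  have := single_le_sum (f := fun i => ((n i : ℝ)) ^ 2) (fun i _ => sq_nonneg _) (mem_univ j)
  linarith
lemma norm_mu_le (a : Fin (d + 1)) (n : Zd d) : ‖mu a n‖ ≤ jb n := by
  refine Fin.cases ?_ (fun j => ?_) a
  · simpa [mu_zero] using one_le_jb n
  · simpa [mu_succ] using abs_le_jb n j
lemma summ_of_jb {k : ℕ} (h : Summable fun n => jb n ^ k * ‖c n‖) : SM c :=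
  h.of_nonneg_of_le (fun _ => norm_nonneg _) fun n => le_mul_of_one_le_left (norm_nonneg _) (one_le_pow₀ (one_le_jb n))
lemma summ_JJ {k : ℕ} (h : Summable fun n => jb n ^ (k+1) * ‖c n‖) (a : Fin (d+1)) :
    Summable fun n => jb n ^ k * ‖JJ a c n‖ := by
  refine h.of_nonneg_of_le (fun n => by have := jb_pos n; positivity) fun n => ?_
  rw [JJ, norm_mul, pow_succ, mul_assoc]
  have := norm_mu_le a n; have := jb_pos n; gcongr
lemma hasFDeriv_S (h : Summable fun n => jb n ^ 1 * ‖c n‖) (x : Vec d) :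
    HasFDerivAt (S c) (∑ j, S (JJ j.succ c) x • (Complex.ofRealCLM.comp (ContinuousLinearMap.proj (R := ℝ) (φ := fun _ : Fin d => ℝ) j))) x := by
  have hu : Summable fun n : Zd d => ∑ j : Fin d, kap d * ‖JJ j.succ c n‖ :=
    summable_sum fun j _ => by simpa using (summ_JJ (k := 0) (by simpa using h) j.succ).mul_left (kap d)
  set P : Fin d → Vec d →L[ℝ] ℂ := fun j => Complex.ofRealCLM.comp (ContinuousLinearMap.proj (R := ℝ) (φ := fun _ : Fin d => ℝ) j)
  have hP : ∀ j, ‖P j‖ ≤ 1 := fun j => ContinuousLinearMap.opNorm_le_bound _ zero_le_one fun y => by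
    simpa [P] using norm_le_pi_norm y j
  have key := hasFDerivAt_tsum (𝕜 := ℝ) (f := fun n x => (kap d : ℂ) * c n * ee n x)
    (f' := fun n x => ∑ j, ((kap d : ℂ) * JJ j.succ c n * ee n x) • P j) hu
    (fun n x => by
      have := (HasFDerivAt_ee n x).const_mul ((kap d : ℂ) * c n)
      refine this.congr_fderiv ?_
      rw [Finset.smul_sum, Finset.smul_sum, Finset.smul_sum]; refine sum_congr rfl fun j _ => ?_
      ext y; simp [P, JJ, mu_succ]; ring)
    (fun n x => by
      refine (norm_sum_le _ _).trans (sum_le_sum fun j _ => ?_)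
      rw [norm_smul, norm_mul, norm_mul, norm_ee, mul_one]
      refine (mul_le_of_le_one_right PO (hP j)).trans (le_of_eq ?_)
      simp [abs_of_pos (kap_pos (d:=d))])
    (S_summ (summ_of_jb h) 0) x
  have hj : ∀ j : Fin d, Summable fun n => (kap d : ℂ) * JJ j.succ c n * ee n x := fun j =>
    S_summ (by simpa using summ_JJ (k := 0) (by simpa using h) j.succ) x
  refine HasFDerivAt.congr_fderiv key ?_
  rw [Summable.tsum_finsetSum (fun j _ => (hj j).smul_const _)]
  refine sum_congr rfl fun j _ => ?_
  rw [(hj j).tsum_smul_const]; rfl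
lemma pdF_S (h : Summable fun n => jb n ^ 1 * ‖c n‖) (j : Fin d) : pdF j (S c) = S (JJ j.succ c) := by
  ext x
  rw [pdF, (hasFDeriv_S h x).fderiv]
  simp only [_root_.sum_apply, _root_.smul_apply, ContinuousLinearMap.comp_apply, ContinuousLinearMap.proj_apply, Complex.ofRealCLM_apply, smul_eq_mul]
  rw [Finset.sum_eq_single j]
  · simp
  · intro i _ hi; simp [hi]
  · simp
lemma contDiff_S (k : ℕ) : ∀ {c : Seq d}, (Summable fun n => jb n ^ k * ‖c n‖) → ContDiff ℝ k (S c) := by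
  induction k with
  | zero => intro c h; exact contDiff_zero.2 (cont_S (by simpa using h))
  | succ k ih =>
    intro c h
    have h1 : Summable fun n => jb n ^ 1 * ‖c n‖ := h.of_nonneg_of_le (fun n => by have := jb_pos n; positivity)
      fun n => mR (pow_le_pow_right₀ (one_le_jb n) (by omega)) (norm_nonneg _)
    push_cast
    rw [contDiff_succ_iff_fderiv]
    refine ⟨fun x => (hasFDeriv_S h1 x).differentiableAt, by simp, ?_⟩
    rw [show fderiv ℝ (S c) = _ from funext fun x => (hasFDeriv_S h1 x).fderiv]
    exact ContDiff.sum fun j _ => (ih (summ_JJ h j.succ)).smul contDiff_const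
lemma jet_S (h : Summable fun n => jb n ^ 1 * ‖c n‖) (x : Vec d) (a : Fin (d+1)) :
    jet (S c) x a = S (JJ a c) x := by
  refine Fin.cases ?_ (fun j => ?_) a
  · simp [jet, JJ_zero]
  · simp [jet, pdF_S h]
lemma Supp.jb (h : Supp B c) (k : ℕ) : Summable fun n => jb n ^ k * ‖c n‖ := h.summ _
lemma Supp.JJ (h : Supp B c) (a : Fin (d+1)) : Supp B (JJ a c) :=
  fun n hn => by simp [QLNLS.JJ, h n hn]
lemma Supp.smooth (h : Supp B c) : ContDiff ℝ (⊤ : ℕ∞) (S c) :=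
  contDiff_infty.2 fun k => contDiff_S k (h.jb k)
def HB (m b : ℝ) (c : Seq d) : Prop := 0 ≤ b ∧ ∀ T : FZ d, ∑ n ∈ T, (jb n ^ m * ‖c n‖) ^ 2 ≤ b ^ 2
lemma le_of_sq' {a b : ℝ} (h : a ^ 2 ≤ b ^ 2) (hb : 0 ≤ b) : a ≤ b := (le_abs_self a).trans (abs_le_of_sq_le_sq h hb)
lemma jw (m : ℝ) (n : Zd d) : 0 < jb n ^ m := Real.rpow_pos_of_pos (jb_pos n) m
lemma hs_term (m : ℝ) (c : Seq d) (n : Zd d) : jb n ^ (2 * m) * ‖c n‖ ^ 2 = (jb n ^ m * ‖c n‖) ^ 2 := by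
  rw [mul_pow, ← rpow_natCast (jb n ^ m), ← rpow_mul (jb_pos n).le]; congr 2; push_cast; ring
lemma HB.inHs {m b : ℝ} (h : HB m b c) : InHsSeq m c := by
  unfold InHsSeq; simp only [hs_term]
  exact summable_of_sum_le (fun _ => by positivity) h.2
lemma HB.norm {m b : ℝ} (h : HB m b c) : hsNorm m c ≤ b := by
  rw [hsNorm, hsNormSq, Real.sqrt_le_left h.1]; simp only [hs_term]
  exact Real.tsum_le_of_sum_le (fun _ => by positivity) h.2
lemma hsNorm_nonneg (m : ℝ) (c : Seq d) : 0 ≤ hsNorm m c := sqrt_nonneg _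
lemma hsNormSq_nonneg (m : ℝ) (c : Seq d) : 0 ≤ hsNormSq m c :=
  tsum_nonneg fun n => by have := jw (2*m) n; positivity
lemma hsNorm_sq (m : ℝ) (c : Seq d) : hsNorm m c ^ 2 = hsNormSq m c := sq_sqrt (hsNormSq_nonneg m c)
lemma InHsSeq.HB {m : ℝ} (h : InHsSeq m c) : HB m (hsNorm m c) c := by
  refine ⟨hsNorm_nonneg _ _, fun T => ?_⟩
  rw [hsNorm_sq, hsNormSq]; simp only [← hs_term]
  exact h.sum_le_tsum T fun n _ => by have := jw (2*m) n; positivity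
lemma Supp.inHs (h : Supp B c) (m : ℝ) : InHsSeq m c :=
  summable_of_ne_finset_zero (s := B) fun n hn => by simp [h n hn]
lemma Supp.HB (h : Supp B c) (m : ℝ) : QLNLS.HB m (hsNorm m c) c := (h.inHs m).HB
lemma Supp.normSq (h : Supp B c) (m : ℝ) :
    hsNorm m c ^ 2 = ∑ n ∈ B, (QLNLS.jb n ^ m * ‖c n‖) ^ 2 := by
  rw [hsNorm_sq, hsNormSq, tsum_eq_sum (s := B) (fun n hn => by simp [h n hn])]; simp only [hs_term]
lemma HB.mono {m b b' : ℝ} (h : HB m b c) (hb : b ≤ b') : HB m b' c :=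
  ⟨h.1.trans hb, fun T => (h.2 T).trans (pow_le_pow_left₀ h.1 hb 2)⟩
lemma HB.of_le {m m' b K : ℝ} {c e : Seq d} (h : HB m b e) (hK : 0 ≤ K)
    (hle : ∀ n, jb n ^ m' * ‖c n‖ ≤ K * (jb n ^ m * ‖e n‖)) : HB m' (K * b) c := by
  refine ⟨mul_nonneg hK h.1, fun T => ?_⟩
  calc _ ≤ ∑ n ∈ T, (K * (jb n ^ m * ‖e n‖)) ^ 2 := sum_le_sum fun n _ =>
        pow_le_pow_left₀ (by have := jw m' n; positivity) (hle n) 2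
    _ = K ^ 2 * ∑ n ∈ T, (jb n ^ m * ‖e n‖) ^ 2 := by rw [mul_sum]; simp only [mul_pow]
    _ ≤ _ := by rw [mul_pow]; exact mL (h.2 T) (sq_nonneg K)
lemma HB.of_le1 {m m' b : ℝ} {c e : Seq d} (h : HB m b e)
    (hle : ∀ n, jb n ^ m' * ‖c n‖ ≤ jb n ^ m * ‖e n‖) : HB m' b c := by
  simpa using h.of_le zero_le_one (by simpa using hle)
lemma HB.down {m m' b : ℝ} (h : HB m b c) (hm : m' ≤ m) : HB m' b c :=
  h.of_le1 fun n => mR (Real.rpow_le_rpow_of_exponent_le (one_le_jb n) hm) (norm_nonneg _)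
lemma HB.smul {m b : ℝ} (h : HB m b c) (a : ℂ) : HB m (‖a‖ * b) (fun n => a * c n) :=
  h.of_le (norm_nonneg a) fun n => by rw [norm_mul]; exact le_of_eq (by ring)
lemma l2_add {ι : Type*} (T : Finset ι) (f g : ι → ℝ) {a b : ℝ} (ha : 0 ≤ a) (hb : 0 ≤ b)
    (hf : ∑ i ∈ T, f i ^ 2 ≤ a ^ 2) (hg : ∑ i ∈ T, g i ^ 2 ≤ b ^ 2) : ∑ i ∈ T, (f i + g i) ^ 2 ≤ (a + b) ^ 2 := by
  have h1 := sum_mul_sq_le_sq_mul_sq T f g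
  have h2 : ∑ i ∈ T, f i * g i ≤ a * b := by
    refine le_of_sq' ?_ PO 
    rw [mul_pow]; exact h1.trans (mul_le_mul hf hg (sum_nonneg fun _ _ => sq_nonneg _) (sq_nonneg a))
  have h3 : ∑ i ∈ T, (f i + g i) ^ 2 = ∑ i ∈ T, f i ^ 2 + 2 * ∑ i ∈ T, f i * g i + ∑ i ∈ T, g i ^ 2 := by
    rw [mul_sum, ← sum_add_distrib, ← sum_add_distrib]; exact sum_congr rfl fun i _ => by ring
  rw [h3]; nlinarith
lemma HB.add {m a b : ℝ} {c e : Seq d} (h : HB m a c) (h' : HB m b e) : HB m (a + b) (c + e) := by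
  refine ⟨add_nonneg h.1 h'.1, fun T => ?_⟩
  refine (sum_le_sum fun n _ => pow_le_pow_left₀ (by have := jw m n; positivity) ?_ 2).trans
    (l2_add T _ _ h.1 h'.1 (h.2 T) (h'.2 T))
  rw [← mul_add]; exact mL (norm_add_le _ _) (jw m n).le
lemma HB.neg {m b : ℝ} (h : HB m b c) : HB m b (-c) := h.of_le1 fun n => by simp
lemma HB.sub {m a b : ℝ} {c e : Seq d} (h : HB m a c) (h' : HB m b e) : HB m (a + b) (c - e) := by
  rw [sub_eq_add_neg]; exact h.add h'.neg
lemma HB.zero (m : ℝ) {b : ℝ} (hb : 0 ≤ b) : HB m b (0 : Seq d) := ⟨hb, fun T => by simp; positivity⟩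
lemma HB.sum {ι : Type*} (s : Finset ι) {m : ℝ} {b : ι → ℝ} {c : ι → Seq d} (h : ∀ i ∈ s, HB m (b i) (c i)) :
    HB m (∑ i ∈ s, b i) (fun n => ∑ i ∈ s, c i n) := by
  classical
  induction s using Finset.induction_on with
  | empty => simp only [Finset.sum_empty]; exact HB.zero m le_rfl
  | insert i s hi ih =>
    simp only [Finset.sum_insert hi]
    exact (h i (by simp)).add (ih fun j hj => h j (by simp [hj]))
lemma HB.star {m b : ℝ} (h : HB m b c) : HB m b (starSeq c) := by
  refine ⟨h.1, fun T => ?_⟩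
  have := h.2 (T.map (Equiv.neg (Zd d)).toEmbedding)
  rw [Finset.sum_map] at this
  convert this using 3 with n
  simp [starSeq, jb]
lemma HB.PB {m b : ℝ} (h : HB m b c) (B : FZ d) : HB m b (PB B c) :=
  h.of_le1 fun n => by
    by_cases hn : n ∈ B
    · simp [QLNLS.PB, hn]
    · simp [QLNLS.PB, hn]; have := jw m n; positivity
lemma HB.JJ {m b : ℝ} (h : HB (m+1) b c) (a : Fin (d+1)) : HB m b (JJ a c) :=
  h.of_le1 fun n => by
    rw [QLNLS.JJ, norm_mul, rpow_add (jb_pos n), Real.rpow_one, mul_assoc]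
    exact mL (mR (norm_mu_le a n) (norm_nonneg _)) (jw m n).le
lemma HB.jw {m p b : ℝ} (h : HB (m+p) b c) : HB m b (fun n => ((jb n ^ p : ℝ) : ℂ) * c n) :=
  h.of_le1 fun n => by
    rw [norm_mul, norm_real, Real.norm_eq_abs, abs_of_pos (QLNLS.jw p n), ← mul_assoc, ← rpow_add (jb_pos n)]
lemma hsNorm_mono {m m' : ℝ} (h : InHsSeq m c) (hm : m' ≤ m) : hsNorm m' c ≤ hsNorm m c := (h.HB.down hm).norm
lemma jb_sq (n : Zd d) : jb n ^ 2 = 1 + ∑ i, ((n i : ℝ)) ^ 2 :=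
  sq_sqrt (by linarith [sum_nonneg fun i (_ : i ∈ univ) => sq_nonneg ((n i : ℝ))])
lemma jb_neg (n : Zd d) : jb (-n) = jb n := by simp [jb]
lemma jb_add_le (n k : Zd d) : jb (n + k) ≤ jb n + jb k := by
  have h1 := jb_sq n; have h2 := jb_sq k; have h3 := jb_sq (n + k)
  have hn := one_le_jb n; have hk := one_le_jb k
  refine le_of_sq' ?_ PO 
  have hcs := sum_mul_sq_le_sq_mul_sq univ (fun i => (n i : ℝ)) (fun i => (k i : ℝ))
  have h4 : ∑ i, (n i : ℝ) * k i ≤ jb n * jb k := by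
    refine le_of_sq' ?_ PO
    rw [mul_pow, h1, h2]
    have p1 : 0 ≤ ∑ i, ((n i : ℝ)) ^ 2 := sum_nonneg fun _ _ => sq_nonneg _
    have p2 : 0 ≤ ∑ i, ((k i : ℝ)) ^ 2 := sum_nonneg fun _ _ => sq_nonneg _
    nlinarith
  have h5 : ∑ i, (((n + k) i : ℤ) : ℝ) ^ 2 = ∑ i, ((n i : ℝ)) ^ 2 + 2 * ∑ i, (n i : ℝ) * k i + ∑ i, ((k i : ℝ)) ^ 2 := by
    rw [mul_sum, ← sum_add_distrib, ← sum_add_distrib]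
    exact sum_congr rfl fun i _ => by push_cast [Pi.add_apply]; ring
  nlinarith
lemma jb_tri (n k : Zd d) : jb n ≤ jb (n - k) + jb k := by simpa using jb_add_le (n - k) k
lemma jb_tri' (n k : Zd d) : jb k ≤ jb (n - k) + jb n := by
  have := jb_add_le (k - n) n; rw [← jb_neg (k - n)] at this; simpa using this
lemma jb_peetre (n k : Zd d) : jb n ≤ 2 * (jb (n - k) * jb k) := by
  nlinarith [jb_tri n k, one_le_jb (n-k), one_le_jb k, mul_nonneg (sub_nonneg.2 (one_le_jb (n-k))) (sub_nonneg.2 (one_le_jb k))]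
lemma jb_peetre' (n k : Zd d) : jb k ≤ 2 * (jb (n - k) * jb n) := by
  nlinarith [jb_tri' n k, one_le_jb (n-k), one_le_jb n, mul_nonneg (sub_nonneg.2 (one_le_jb (n-k))) (sub_nonneg.2 (one_le_jb n))]
lemma peetre (m : ℝ) (n k : Zd d) : jb n ^ m ≤ 2 ^ |m| * (jb (n - k) ^ |m| * jb k ^ m) := by
  have h1 := jb_pos n; have h2 := jb_pos k; have h3 := jb_pos (n-k)
  rcases le_total 0 m with hm | hm
  · rw [abs_of_nonneg hm, ← mul_rpow h3.le h2.le, ← mul_rpow (by norm_num) PO]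
    exact rpow_le_rpow h1.le (jb_peetre n k) hm
  · rw [abs_of_nonpos hm]
    have : jb k ^ (-m) ≤ 2 ^ (-m) * (jb (n-k) ^ (-m) * jb n ^ (-m)) := by
      rw [← mul_rpow h3.le h1.le, ← mul_rpow (by norm_num) PO]
      exact rpow_le_rpow h2.le (jb_peetre' n k) LA
    rw [rpow_neg h2.le, rpow_neg h1.le m] at this
    have e1 := jw m n; have e2 := jw m k
    calc jb n ^ m = jb n ^ m * ((jb k ^ m)⁻¹ * jb k ^ m) := by field_simp
      _ ≤ jb n ^ m * ((2 ^ (-m) * (jb (n-k) ^ (-m) * (jb n ^ m)⁻¹)) * jb k ^ m) := by gcongr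
      _ = _ := by field_simp
lemma peetre2 (m : ℝ) (n k : Zd d) : jb n ^ m ≤ 2 ^ |m| * (jb (n - k) ^ m * jb k ^ |m|) := by
  have := peetre m n (n - k); rw [sub_sub_cancel] at this; linarith
lemma tame_w {m : ℝ} (hm : 0 ≤ m) (n k : Zd d) : jb n ^ m ≤ 2 ^ m * (jb (n - k) ^ m + jb k ^ m) := by
  have h1 := jb_pos n; have h2 := jb_pos k; have h3 := jb_pos (n-k)
  have : jb n ≤ 2 * max (jb (n-k)) (jb k) := by linarith [jb_tri n k, le_max_left (jb (n-k)) (jb k), le_max_right (jb (n-k)) (jb k)]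
  refine (rpow_le_rpow h1.le this hm).trans ?_
  rw [mul_rpow (by norm_num) PO]
  refine mL ?_ PO
  have e1 := jw m (n-k); have e2 := jw m k
  rcases max_cases (jb (n-k)) (jb k) with h | h <;> rw [h.1] <;> linarith
lemma exists_sumw (d : ℕ) : ∃ Z : ℝ, 0 < Z ∧ ∀ T : FZ d, ∑ n ∈ T, (jb n ^ (-(d:ℝ))) ^ 2 ≤ Z ^ 2 := by
  have hs : Summable fun k : ℤ => (1 + (k:ℝ)^2)⁻¹ := by
    have h1 : Summable fun k : ℤ => 1 / |(k:ℝ)| ^ (2:ℝ) := (Real.summable_one_div_int_pow (p := 2)).2 (by norm_num) |>.congr fun k => by norm_num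
    refine Summable.of_norm_bounded_eventually h1 ?_
    rw [Filter.eventually_cofinite]
    refine (Set.finite_singleton (0:ℤ)).subset fun k hk => ?_
    by_contra h0
    apply hk
    have h0' : (0:ℝ) < (k:ℝ)^2 := by have : (k:ℝ) ≠ 0 := by exact_mod_cast h0
                                     positivity
    rw [Real.norm_of_nonneg PO, one_div]
    norm_num
    exact inv_anti₀ h0' LA
  set Z := ∑' k : ℤ, (1 + (k:ℝ)^2)⁻¹
  have hZ0 : 0 ≤ Z := tsum_nonneg fun k => by positivity
  refine ⟨Real.sqrt (Z ^ d) + 1, by positivity, fun T => ?_⟩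
  have key : ∑ n ∈ T, (jb n ^ (-(d:ℝ))) ^ 2 ≤ Z ^ d := by
    have h1 : ∀ n : Zd d, (jb n ^ (-(d:ℝ))) ^ 2 ≤ ∏ i, (1 + ((n i : ℝ))^2)⁻¹ := by
      intro n
      rw [rpow_neg (jb_pos n).le, rpow_natCast, inv_pow, ← pow_mul, mul_comm, pow_mul, jb_sq, Finset.prod_inv_distrib]
      refine inv_anti₀ (Finset.prod_pos fun i _ => by positivity) ?_
      calc ∏ i, (1 + ((n i : ℝ))^2) ≤ ∏ i : Fin d, (1 + ∑ j, ((n j : ℝ))^2) := by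
            refine Finset.prod_le_prod (fun i _ => by positivity) fun i _ => ?_
            have := single_le_sum (f := fun j => ((n j : ℝ))^2) (fun j _ => sq_nonneg _) (mem_univ i)
            linarith
        _ = _ := by simp
    classical
    refine (sum_le_sum fun n _ => h1 n).trans ?_
    calc _ ≤ ∑ n ∈ Fintype.piFinset (fun i : Fin d => T.image fun n : Zd d => (n i : ℤ)), ∏ i, (1 + ((n i : ℝ))^2)⁻¹ := by
          refine sum_le_sum_of_subset_of_nonneg (fun n hn => ?_) fun n _ _ => Finset.prod_nonneg fun i _ => by positivity
          rw [Fintype.mem_piFinset]; exact fun i => Finset.mem_image_of_mem _ hn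
      _ = ∏ i, ∑ k ∈ T.image (fun n : Zd d => (n i : ℤ)), (1 + ((k : ℝ))^2)⁻¹ :=
          (Finset.prod_univ_sum (fun i : Fin d => T.image fun n : Zd d => (n i : ℤ)) (fun _ k => (1 + ((k : ℝ))^2)⁻¹)).symm
      _ ≤ ∏ i : Fin d, Z := Finset.prod_le_prod (fun i _ => sum_nonneg fun k _ => by positivity)
          fun i _ => hs.sum_le_tsum _ fun k _ => by positivity
      _ = Z ^ d := by simp
  refine key.trans ?_
  nlinarith [sq_sqrt (pow_nonneg hZ0 d), sqrt_nonneg (Z ^ d)]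
def Zc (d : ℕ) : ℝ := (exists_sumw d).choose
lemma Zc_pos : 0 < Zc d := (exists_sumw d).choose_spec.1
lemma Zc_sum (T : FZ d) : ∑ n ∈ T, (jb n ^ (-(d:ℝ))) ^ 2 ≤ Zc d ^ 2 := (exists_sumw d).choose_spec.2 T
lemma HB.l1 {p b : ℝ} (h : HB (p + d) b c) (T : FZ d) : ∑ n ∈ T, jb n ^ p * ‖c n‖ ≤ Zc d * b := by
  refine le_of_sq' ?_ (mul_nonneg Zc_pos.le h.1)
  have := sum_mul_sq_le_sq_mul_sq T (fun n => jb n ^ (-(d:ℝ))) (fun n => jb n ^ (p + d) * ‖c n‖)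
  calc _ = (∑ n ∈ T, jb n ^ (-(d:ℝ)) * (jb n ^ (p + d) * ‖c n‖)) ^ 2 := by
        congr 1; refine sum_congr rfl fun n _ => ?_
        rw [← mul_assoc, ← rpow_add (jb_pos n)]; congr 2; ring
    _ ≤ _ := this.trans (by rw [mul_pow]; exact mul_le_mul (Zc_sum T) (h.2 T) (sum_nonneg fun _ _ => sq_nonneg _) (sq_nonneg _))
lemma HB.summ {p b : ℝ} (h : HB (p + d) b c) : Summable fun n => jb n ^ p * ‖c n‖ :=
  summable_of_sum_le (fun n => by have := QLNLS.jw p n; positivity) h.l1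
lemma HB.summ0 {b : ℝ} (h : HB d b c) : SM c := by
  have : HB (0 + d) b c := by simpa using h
  simpa using this.summ
lemma HB.tsum0 {b : ℝ} (h : HB d b c) : ∑' n, ‖c n‖ ≤ Zc d * b := by
  have : HB (0 + d) b c := by simpa using h
  exact Real.tsum_le_of_sum_le (fun n => norm_nonneg _) fun T => by simpa using this.l1 T
lemma HB.sup {b : ℝ} (h : HB d b c) (x : Vec d) : ‖S c x‖ ≤ kap d * (Zc d * b) :=
  (S_norm h.summ0 x).trans (mL h.tsum0 kap_pos.le)
lemma HB.summN {b : ℝ} {k : ℕ} (h : HB (k + d) b c) : Summable fun n => jb n ^ k * ‖c n‖ := by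
  simpa [rpow_natCast] using h.summ
lemma l2c1 (B T : FZ d) {α β : Zd d → ℝ} (_hα : ∀ n, 0 ≤ α n) (hβ : ∀ n, 0 ≤ β n) {A b : ℝ}
    (h1 : ∀ T : FZ d, ∑ n ∈ T, α n ^ 2 ≤ A ^ 2) (hb : 0 ≤ b) (h2 : ∑ n ∈ B, β n ≤ b) :
    ∑ n ∈ T, (∑ k ∈ B, α (n - k) * β k) ^ 2 ≤ (A * b) ^ 2 := by
  have hβB : 0 ≤ ∑ k ∈ B, β k := sum_nonneg fun k _ => hβ k
  have e1 : ∀ n, (∑ k ∈ B, α (n - k) * β k) ^ 2 ≤ b * ∑ k ∈ B, β k * α (n - k) ^ 2 := fun n => by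
    have := sum_mul_sq_le_sq_mul_sq B (fun k => √(β k)) (fun k => √(β k) * α (n - k))
    calc _ = (∑ k ∈ B, √(β k) * (√(β k) * α (n-k))) ^ 2 := by
          congr 1; refine sum_congr rfl fun k _ => ?_
          rw [← mul_assoc, Real.mul_self_sqrt (hβ k), mul_comm]
      _ ≤ _ := this
      _ = (∑ k ∈ B, β k) * ∑ k ∈ B, β k * α (n-k) ^ 2 := by simp only [mul_pow, sq_sqrt (hβ _)]
      _ ≤ _ := mR h2 (sum_nonneg fun k _ => mul_nonneg (hβ k) (sq_nonneg _))
  have e2 : ∀ k, ∑ n ∈ T, α (n - k) ^ 2 ≤ A ^ 2 := fun k => by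
    have := h1 (T.map (Equiv.subRight k).toEmbedding)
    rwa [Finset.sum_map] at this
  calc _ ≤ ∑ n ∈ T, b * ∑ k ∈ B, β k * α (n - k) ^ 2 := sum_le_sum fun n _ => e1 n
    _ = b * ∑ k ∈ B, β k * ∑ n ∈ T, α (n - k) ^ 2 := by
        rw [← mul_sum, sum_comm]; simp only [mul_sum]
    _ ≤ b * ∑ k ∈ B, β k * A ^ 2 := by
        refine mL (sum_le_sum fun k _ => mL (e2 k) (hβ k)) hb
    _ ≤ b * (b * A ^ 2) := by
        rw [← sum_mul]; exact mL (mR h2 (sq_nonneg _)) hb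
    _ = _ := by ring
lemma l2c2 (B T : FZ d) {α β : Zd d → ℝ} (hα : ∀ n, 0 ≤ α n) (_hβ : ∀ n, 0 ≤ β n) {A b : ℝ}
    (hb : 0 ≤ A) (h2 : ∀ T : FZ d, ∑ n ∈ T, α n ≤ A) (h1 : ∑ n ∈ B, β n ^ 2 ≤ b ^ 2) :
    ∑ n ∈ T, (∑ k ∈ B, α (n - k) * β k) ^ 2 ≤ (A * b) ^ 2 := by
  have e0 : ∀ n, ∑ k ∈ B, α (n - k) ≤ A := fun n => by
    have := h2 (B.map (Equiv.subLeft n).toEmbedding)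
    rwa [Finset.sum_map] at this
  have e2 : ∀ k, ∑ n ∈ T, α (n - k) ≤ A := fun k => by
    have := h2 (T.map (Equiv.subRight k).toEmbedding)
    rwa [Finset.sum_map] at this
  have e1 : ∀ n, (∑ k ∈ B, α (n - k) * β k) ^ 2 ≤ A * ∑ k ∈ B, α (n - k) * β k ^ 2 := fun n => by
    have := sum_mul_sq_le_sq_mul_sq B (fun k => √(α (n-k))) (fun k => √(α (n-k)) * β k)
    calc _ = (∑ k ∈ B, √(α (n-k)) * (√(α (n-k)) * β k)) ^ 2 := by
          congr 1; refine sum_congr rfl fun k _ => ?_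
          rw [← mul_assoc, Real.mul_self_sqrt (hα _)]
      _ ≤ _ := this
      _ = (∑ k ∈ B, α (n-k)) * ∑ k ∈ B, α (n-k) * β k ^ 2 := by simp only [mul_pow, sq_sqrt (hα _)]
      _ ≤ _ := mR (e0 n) (sum_nonneg fun k _ => mul_nonneg (hα _) (sq_nonneg _))
  calc _ ≤ ∑ n ∈ T, A * ∑ k ∈ B, α (n - k) * β k ^ 2 := sum_le_sum fun n _ => e1 n
    _ = A * ∑ k ∈ B, (∑ n ∈ T, α (n - k)) * β k ^ 2 := by
        rw [← mul_sum, sum_comm]; simp only [sum_mul]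
    _ ≤ A * ∑ k ∈ B, A * β k ^ 2 := by
        refine mL (sum_le_sum fun k _ => mR (e2 k) (sq_nonneg _)) hb
    _ ≤ A * (A * b ^ 2) := by
        rw [← mul_sum]; gcongr
    _ = _ := by ring
lemma CV1 {p q bf ba : ℝ} {f a : Seq d} (B : FZ d) (hf : HB p bf f) (ha : HB (q + d) ba a) (T : FZ d) :
    ∑ n ∈ T, (∑ k ∈ B, (jb (n-k) ^ p * ‖f (n-k)‖) * (jb k ^ q * ‖a k‖)) ^ 2 ≤ (Zc d * (bf * ba)) ^ 2 := by
  have := l2c1 B T (α := fun n => jb n ^ p * ‖f n‖) (β := fun n => jb n ^ q * ‖a n‖)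
    (fun n => by have := jw p n; positivity) (fun n => by have := jw q n; positivity) hf.2
    (mul_nonneg Zc_pos.le ha.1) (ha.l1 B)
  exact this.trans (le_of_eq (by ring))
lemma CV2 {p q bf ba : ℝ} {f a : Seq d} (B : FZ d) (hf : HB (p + d) bf f) (ha : HB q ba a) (T : FZ d) :
    ∑ n ∈ T, (∑ k ∈ B, (jb (n-k) ^ p * ‖f (n-k)‖) * (jb k ^ q * ‖a k‖)) ^ 2 ≤ (Zc d * (bf * ba)) ^ 2 := by
  have := l2c2 B T (α := fun n => jb n ^ p * ‖f n‖) (β := fun n => jb n ^ q * ‖a n‖)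
    (fun n => by have := jw p n; positivity) (fun n => by have := jw q n; positivity)
    (mul_nonneg Zc_pos.le hf.1) hf.l1 (ha.2 B)
  exact this.trans (le_of_eq (by ring))
def KS (B : FZ d) (κ : Zd d → Zd d → ℝ) (f a : Seq d) : Seq d :=
  fun n => (kap d : ℂ) * ∑ k ∈ B, (κ n k : ℂ) * (f (n - k) * a k)
lemma KS_norm (B : FZ d) (κ : Zd d → Zd d → ℝ) (f a : Seq d) (n : Zd d) :
    ‖KS B κ f a n‖ ≤ kap d * ∑ k ∈ B, |κ n k| * (‖f (n-k)‖ * ‖a k‖) := by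
  rw [KS, norm_mul, norm_real, Real.norm_of_nonneg kap_pos.le]
  refine mL ((norm_sum_le _ _).trans (sum_le_sum fun k _ => ?_)) kap_pos.le
  simp
lemma KS_le {κ : Zd d → Zd d → ℝ} {f a : Seq d} {m K p q b : ℝ} (hK : 0 ≤ K) (hb : 0 ≤ b)
    (hκ : ∀ n k, jb n ^ m * |κ n k| ≤ K * (jb (n-k) ^ p * jb k ^ q))
    (h : ∀ T : FZ d, ∑ n ∈ T, (∑ k ∈ B, (jb (n-k) ^ p * ‖f (n-k)‖) * (jb k ^ q * ‖a k‖)) ^ 2 ≤ b ^ 2) :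
    HB m (kap d * K * b) (KS B κ f a) := by
  refine ⟨mul_nonneg (mul_nonneg kap_pos.le hK) hb, fun T => ?_⟩
  rw [mul_pow]
  refine le_trans ?_ (mL (h T) (sq_nonneg _))
  rw [mul_sum]
  refine sum_le_sum fun n _ => ?_
  rw [← mul_pow]
  refine pow_le_pow_left₀ (by have := jw m n; positivity) ?_ 2
  calc jb n ^ m * ‖KS B κ f a n‖ ≤ jb n ^ m * (kap d * ∑ k ∈ B, |κ n k| * (‖f (n-k)‖ * ‖a k‖)) :=
        mL (KS_norm B κ f a n) (jw m n).le
    _ = kap d * ∑ k ∈ B, (jb n ^ m * |κ n k|) * (‖f (n-k)‖ * ‖a k‖) := by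
        rw [mul_left_comm, mul_sum]; simp only [mul_assoc]
    _ ≤ kap d * ∑ k ∈ B, (K * (jb (n-k) ^ p * jb k ^ q)) * (‖f (n-k)‖ * ‖a k‖) := by
        refine mL (sum_le_sum fun k _ => mR (hκ n k) PO) kap_pos.le
    _ = _ := by
        rw [mul_assoc (kap d) K]; congr 1; rw [mul_sum]; exact sum_congr rfl fun k _ => by ring
lemma fCoeff_KS (ha : Supp B a) (hf : Continuous f) :
    fCoeff (fun x => f x * S a x) = KS B (fun _ _ => 1) (fCoeff f) a := by
  ext n; rw [fCoeff_mul_S ha hf, KS]; simp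
lemma KS_split (B : FZ d) (κ κ' : Zd d → Zd d → ℝ) (f a : Seq d) :
    KS B (fun n k => κ n k + κ' n k) f a = KS B κ f a + KS B κ' f a := by
  ext n; simp only [KS, Pi.add_apply, ← mul_add, ← sum_add_distrib]; congr 1
  refine sum_congr rfl fun k _ => ?_; push_cast; ring
lemma prod_tame (d : ℕ) {m : ℝ} (hm : 0 ≤ m) : ∃ C, 0 ≤ C ∧ ∀ (B : FZ d) (a : Seq d) (f : VC d) (x y x' y' : ℝ),
    Supp B a → Continuous f → HB d x (fCoeff f) → HB m y (fCoeff f) → HB d x' a → HB m y' a →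
    HB m (C * (x * y' + y * x')) (fCoeff fun z => f z * S a z) := by
  classical
  refine ⟨kap d * 2 ^ m * Zc d, by have := kap_pos (d := d); have := Zc_pos (d := d); positivity, fun B a f x y x' y' hs hf h1 h2 h3 h4 => ?_⟩
  rw [fCoeff_KS hs hf]
  have e : (fun _ _ => 1 : Zd d → Zd d → ℝ) = fun n k => (if jb k ≤ jb (n-k) then 1 else 0) + (if jb k ≤ jb (n-k) then 0 else 1) := by
    ext n k; split_ifs <;> simp
  have w : ∀ n k : Zd d, jb n ≤ 2 * max (jb (n-k)) (jb k) := fun n k => by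
    linarith [jb_tri n k, le_max_left (jb (n-k)) (jb k), le_max_right (jb (n-k)) (jb k)]
  have w' : ∀ n k : Zd d, jb n ^ m ≤ 2 ^ m * max (jb (n-k)) (jb k) ^ m := fun n k => by
    rw [← mul_rpow (by norm_num) (by have := jb_pos k; positivity)]
    exact rpow_le_rpow (jb_pos n).le (w n k) hm
  rw [e, KS_split]
  have A1 := KS_le (B := B) (f := fCoeff f) (a := a) (m := m) (K := 2 ^ m) (p := m) (q := 0) (κ := fun n k => (if jb k ≤ jb (n-k) then 1 else 0))
    PO (mul_nonneg Zc_pos.le (mul_nonneg h2.1 h3.1)) (fun n k => by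
      split_ifs with h
      · have := w' n k; rw [max_eq_left h] at this; simpa using this
      · have := jw m (n-k); simp; positivity) (CV1 B h2 (by simpa using h3))
  have A2 := KS_le (B := B) (f := fCoeff f) (a := a) (m := m) (K := 2 ^ m) (p := 0) (q := m) (κ := fun n k => (if jb k ≤ jb (n-k) then 0 else 1))
    PO (mul_nonneg Zc_pos.le (mul_nonneg h1.1 h4.1)) (fun n k => by
      split_ifs with h
      · have := jw m k; simp; positivity
      · have := w' n k; rw [max_eq_right (not_le.1 h).le] at this; simpa using this) (CV2 B (by simpa using h1) h4)
  exact (A1.add A2).mono (le_of_eq (by ring))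
lemma prod_fm (d : ℕ) {m L : ℝ} (hm : 0 ≤ m) (hL : m ≤ L) (hL' : 2 * d ≤ L) : ∃ C, 0 ≤ C ∧ ∀ (B : FZ d) (a : Seq d) (f : VC d) (x y : ℝ),
    Supp B a → Continuous f → HB m x (fCoeff f) → HB L y a → HB m (C * (x * y)) (fCoeff fun z => f z * S a z) := by
  have hd := dn d
  rcases le_total m d with h | h
  · refine ⟨kap d * 2 ^ m * Zc d, by have := kap_pos (d := d); have := Zc_pos (d := d); positivity, fun B a f x y hs hf h1 h2 => ?_⟩
    rw [fCoeff_KS hs hf]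
    exact (KS_le (K := 2 ^ m) (p := m) (q := m) PO (mul_nonneg Zc_pos.le (mul_nonneg h1.1 h2.1)) (fun n k => by
      simpa [abs_of_nonneg hm] using peetre2 m n k) (CV1 B h1 (h2.down LA))).mono (le_of_eq (by ring))
  · obtain ⟨C, hC, H⟩ := prod_tame d hm
    refine ⟨2 * C, by positivity, fun B a f x y hs hf h1 h2 => ?_⟩
    exact (H B a f x x y y hs hf (h1.down h) h1 (h2.down LA) (h2.down hL)).mono (le_of_eq (by ring))
lemma prod_am (d : ℕ) {m L : ℝ} (hm : 0 ≤ m) (hL : m ≤ L) (hL' : 2 * d ≤ L) : ∃ C, 0 ≤ C ∧ ∀ (B : FZ d) (a : Seq d) (f : VC d) (x y : ℝ),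
    Supp B a → Continuous f → HB L x (fCoeff f) → HB m y a → HB m (C * (x * y)) (fCoeff fun z => f z * S a z) := by
  have hd := dn d
  rcases le_total m d with h | h
  · refine ⟨kap d * 2 ^ m * Zc d, by have := kap_pos (d := d); have := Zc_pos (d := d); positivity, fun B a f x y hs hf h1 h2 => ?_⟩
    rw [fCoeff_KS hs hf]
    exact (KS_le (K := 2 ^ m) (p := m) (q := m) PO (mul_nonneg Zc_pos.le (mul_nonneg h1.1 h2.1)) (fun n k => by
      simpa [abs_of_nonneg hm] using peetre m n k) (CV2 B (h1.down LA) h2)).mono (le_of_eq (by ring))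
  · obtain ⟨C, hC, H⟩ := prod_tame d hm
    refine ⟨2 * C, by positivity, fun B a f x y hs hf h1 h2 => ?_⟩
    exact (H B a f x x y y hs hf (h1.down LA) (h1.down hL) (h2.down h) h2).mono (le_of_eq (by ring))
def Lam (p : ℝ) (c : Seq d) : Seq d := fun n => ((jb n ^ p : ℝ) : ℂ) * c n
lemma Supp.Lam (h : Supp B c) (p : ℝ) : Supp B (Lam p c) := fun n hn => by simp [QLNLS.Lam, h n hn]
lemma comm_est (d : ℕ) (p : ℕ) {L : ℝ} (hL : (p:ℝ) + 1 ≤ L) (hL' : 2 * d + 1 ≤ L) : ∃ C, 0 ≤ C ∧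
    ∀ (B : FZ d) (a : Seq d) (f : VC d) (x y : ℝ),
    Supp B a → Continuous f → HB L x (fCoeff f) → HB p y a →
    HB 0 (C * (x * y)) (Lam (p+1) (fCoeff fun z => f z * S a z) - fCoeff fun z => f z * S (Lam (p+1) a) z) := by
  classical
  have hd := dn d
  have hk := kap_pos (d := d)
  have hz := Zc_pos (d := d)
  refine ⟨kap d * (p+1) * Zc d * 2 ^ p * 2, by positivity, fun B a f x y hs hf h1 h2 => ?_⟩
  rw [fCoeff_KS hs hf, fCoeff_KS (hs.Lam _) hf]
  have e0 : (Lam (p+1) (KS B (fun _ _ => 1) (fCoeff f) a) - KS B (fun _ _ => 1) (fCoeff f) (Lam (p+1) a)) =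
      KS B (fun n k => jb n ^ (p+1) - jb k ^ (p+1)) (fCoeff f) a := by
    ext n
    have ep : ∀ n : Zd d, jb n ^ ((p:ℝ)+1) = jb n ^ (p+1) := fun n => by rw [← rpow_natCast]; push_cast; rfl
    simp only [Pi.sub_apply, Lam, KS, ep]
    rw [mul_left_comm, ← mul_sub, mul_sum, ← sum_sub_distrib]
    congr 1; refine sum_congr rfl fun k _ => ?_; push_cast; ring
  rw [e0]
  have e : (fun n k : Zd d => jb n ^ (p+1) - jb k ^ (p+1)) = fun n k => (if jb k ≤ jb (n-k) then jb n ^ (p+1) - jb k ^ (p+1) else 0) + (if jb k ≤ jb (n-k) then 0 else jb n ^ (p+1) - jb k ^ (p+1)) := by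
    ext n k; split_ifs <;> simp
  have w : ∀ n k : Zd d, |jb n ^ (p+1) - jb k ^ (p+1)| ≤ (p+1) * 2 ^ p * (jb (n-k) * max (jb (n-k)) (jb k) ^ p) := fun n k => by
    have a1 := abs_pow_sub_pow_le (jb n) (jb k) (p+1)
    have a2 : |jb n - jb k| ≤ jb (n-k) := by rw [abs_le]; constructor <;> linarith [jb_tri n k, jb_tri' n k]
    have a3 : max |jb n| |jb k| ≤ 2 * max (jb (n-k)) (jb k) := by
      rw [abs_of_pos (jb_pos n), abs_of_pos (jb_pos k)]
      have := jb_pos k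
      exact max_le (by linarith [jb_tri n k, le_max_left (jb (n-k)) (jb k), le_max_right (jb (n-k)) (jb k)])
        (by linarith [le_max_right (jb (n-k)) (jb k)])
    refine a1.trans ?_
    simp only [Nat.add_sub_cancel]
    calc _ ≤ jb (n-k) * ((p+1 : ℕ):ℝ) * (2 * max (jb (n-k)) (jb k)) ^ p := by
          have := jb_pos (n-k)
          gcongr
      _ = _ := by rw [mul_pow]; push_cast; ring
  rw [e, KS_split]
  have A2 := KS_le (B := B) (f := fCoeff f) (a := a) (m := 0) (K := (p+1) * 2 ^ p) (p := 1) (q := p) (b := Zc d * (x * y)) (κ := fun n k => (if jb k ≤ jb (n-k) then 0 else jb n ^ (p+1) - jb k ^ (p+1)))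
    PO (mul_nonneg hz.le (mul_nonneg h1.1 h2.1)) (fun n k => by
      have i1 := jb_pos k; have i2 := jb_pos (n-k)
      split_ifs with h
      · simp; positivity
      · have := w n k; rw [max_eq_right (not_le.1 h).le] at this; simpa using this)
    (CV2 B (h1.down LA) h2)
  have A1 : HB 0 (kap d * ((p+1) * 2 ^ p) * (Zc d * (x * y))) (KS B (fun n k => (if jb k ≤ jb (n-k) then jb n ^ (p+1) - jb k ^ (p+1) else 0)) (fCoeff f) a) := by
    have ww : ∀ n k : Zd d, |(if jb k ≤ jb (n-k) then jb n ^ (p+1) - jb k ^ (p+1) else 0)| ≤ (p+1) * 2 ^ p * jb (n-k) ^ (p+1) := fun n k => by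
      have i2 := jb_pos (n-k)
      split_ifs with h
      · have := w n k; rw [max_eq_left h, ← pow_succ'] at this; exact this
      · simp; positivity
    rcases le_total (p:ℝ) d with h | h
    · refine KS_le (p := (p:ℝ)+1) (q := p) PO (mul_nonneg hz.le (mul_nonneg h1.1 h2.1)) (fun n k => ?_) (CV2 B (h1.down LA) h2)
      rw [Real.rpow_zero, one_mul]; refine (ww n k).trans ?_
      refine mL ?_ PO
      have : jb (n-k) ^ ((p:ℝ)+1) = jb (n-k) ^ (p+1) := by rw [← rpow_natCast]; push_cast; rfl
      rw [this]
      exact le_mul_of_one_le_right (by have := jb_pos (n-k); positivity) (one_le_rpow (one_le_jb k) PO)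
    · refine KS_le (p := (p:ℝ)+1) (q := 0) PO (mul_nonneg hz.le (mul_nonneg h1.1 h2.1)) (fun n k => ?_) (CV1 B (h1.down LA) (h2.down LA))
      have : jb (n-k) ^ ((p:ℝ)+1) = jb (n-k) ^ (p+1) := by rw [← rpow_natCast]; push_cast; rfl
      rw [Real.rpow_zero, one_mul, Real.rpow_zero, mul_one, this]; exact ww n k
  exact (A1.add A2).mono (le_of_eq (by ring))
abbrev Sm (G : Y d → ℂ) : Prop := ContDiff ℝ (⊤ : ℕ∞) G
abbrev Ix (d : ℕ) := Fin (d + 1) × Bool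
def FS (c : Seq d) : Prop := ∃ B, Supp B c
def eb (α : Ix d) : Y d := Pi.single α.1 (if α.2 then I else 1)
def rc (α : Ix d) (η : Y d) : ℝ := if α.2 then (η α.1).im else (η α.1).re
def dv (α : Ix d) (G : Y d → ℂ) (y : Y d) : ℂ := fderiv ℝ G y (eb α)
def JC (α : Ix d) (z : Seq d) : Seq d := fun n =>
  (if α.2 then -I else 1) / 2 * JJ α.1 z n + (if α.2 then I else 1) / 2 * starSeq (JJ α.1 z) n
def jt (u : Seq d) (x : Vec d) : Y d := fun a => S (JJ a u) x
lemma rc_expand (η : Y d) : η = ∑ α, rc α η • eb α := by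
  ext a
  simp only [Finset.sum_apply, Fintype.sum_prod_type, Fintype.sum_bool, rc, eb]
  simp [Pi.single_apply, sum_add_distrib]
  rw [add_comm]; exact (Complex.re_add_im (η a)).symm
lemma fderiv_expand (G : Y d → ℂ) (y η : Y d) : fderiv ℝ G y η = ∑ α, dv α G y * (rc α η : ℂ) := by
  conv_lhs => rw [rc_expand η]
  simp [dv, mul_comm]
lemma Sm.dv (hG : Sm G) (α : Ix d) : Sm (dv α G) :=
  (hG.fderiv_right (m := (⊤:ℕ∞)) (by simp)).clm_apply contDiff_const
lemma FS.summ (h : FS c) : SM c := let ⟨_, h⟩ := h; h.summ1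
lemma FS.jb (h : FS c) (k : ℕ) : Summable fun n => jb n ^ k * ‖c n‖ := let ⟨_, h⟩ := h; h.jb k
lemma FS.JJ (h : FS c) (a : Fin (d+1)) : FS (JJ a c) := let ⟨B, h⟩ := h; ⟨B, h.JJ a⟩
lemma FS.add {c e : Seq d} (h : FS c) (h' : FS e) : FS (c + e) := by
  classical
  obtain ⟨B, h⟩ := h; obtain ⟨B', h'⟩ := h'
  exact ⟨B ∪ B', fun n hn => by simp [h n (fun h => hn (by simp [h])), h' n (fun h => hn (by simp [h]))]⟩
lemma FS.smul (h : FS c) (a : ℂ) : FS (fun n => a * c n) :=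
  let ⟨B, h⟩ := h; ⟨B, fun n hn => by simp [h n hn]⟩
lemma FS.star (h : FS c) : FS (starSeq c) := by
  classical
  obtain ⟨B, h⟩ := h
  refine ⟨B.image (fun n => -n), fun n hn => ?_⟩
  rw [starSeq, h (-n) (fun h => hn (Finset.mem_image.2 ⟨-n, h, by simp⟩)), map_zero]
lemma FS.JC (h : FS c) (α : Ix d) : FS (JC α c) := ((h.JJ α.1).smul _).add ((h.JJ α.1).star.smul _)
lemma FS.inHs (h : FS c) (m : ℝ) : InHsSeq m c := let ⟨_, h⟩ := h; h.inHs m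
lemma FS.HB (h : FS c) (m : ℝ) : QLNLS.HB m (hsNorm m c) c := (h.inHs m).HB
lemma FS.smooth (h : FS c) : ContDiff ℝ (⊤ : ℕ∞) (S c) := let ⟨_, h⟩ := h; h.smooth
lemma FS.cont (h : FS c) : Continuous (S c) := cont_S h.summ
lemma S_JC (h : FS z) (α : Ix d) (x : Vec d) : S (JC α z) x = (rc α (jt z x) : ℂ) := by
  have := S_add ((h.JJ α.1).smul ((if α.2 then -I else 1) / 2)).summ ((h.JJ α.1).star.smul ((if α.2 then I else 1) / 2)).summ x
  have e : S (JC α z) x = _ := this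
  rw [e, S_smul, S_smul, S_star, rc, jt]
  generalize S (QLNLS.JJ α.1 z) x = w
  apply Complex.ext <;> split_ifs <;> simp <;> ring
lemma HB.JC {m b : ℝ} (h : HB (m+1) b c) (α : Ix d) : HB m b (JC α c) := by
  have h1 := (h.JJ α.1).smul ((if α.2 then -I else 1) / 2)
  have h2 := (h.JJ α.1).star.smul ((if α.2 then I else 1) / 2)
  refine HB.mono (h1.add h2) (le_of_eq ?_)
  split_ifs <;> simp <;> ring
lemma cont_jt (h : FS u) : Continuous (jt u) := continuous_pi fun a => (h.JJ a).cont
lemma smooth_jt (h : FS u) : ContDiff ℝ (⊤ : ℕ∞) (jt u) := contDiff_pi.2 fun a => (h.JJ a).smooth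
lemma per_jt (u : Seq d) (x : Vec d) (m : Zd d) : jt u (fun i => x i + 2 * π * (m i : ℝ)) = jt u x :=
  funext fun a => per_S (JJ a u) x m
lemma jt_bound {b : ℝ} (h : HB (d+1) b u) (x : Vec d) : ‖jt u x‖ ≤ kap d * (Zc d * b) :=
  (pi_norm_le_iff_of_nonneg (mul_nonneg kap_pos.le (mul_nonneg Zc_pos.le h.1))).2 fun a => (h.JJ a).sup x
lemma JJ_comm (a b : Fin (d+1)) (u : Seq d) : JJ a (JJ b u) = JJ b (JJ a u) := by
  ext n; simp only [JJ]; ring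
lemma pdF_comp (hG : Sm G) (h : FS u) (j : Fin d) (x : Vec d) :
    pdF j (fun x => G (jt u x)) x = fderiv ℝ G (jt u x) (jt (JJ j.succ u) x) := by
  have hj : HasFDerivAt (jt u) (ContinuousLinearMap.pi fun a => fderiv ℝ (S (JJ a u)) x) x :=
    hasFDerivAt_pi.2 fun a => ((h.JJ a).smooth.differentiable (by simp) x).hasFDerivAt
  have hg : HasFDerivAt G (fderiv ℝ G (jt u x)) (jt u x) := (hG.differentiable (by simp) _).hasFDerivAt
  have := (hg.comp x hj).fderiv
  rw [pdF]; change fderiv ℝ (G ∘ jt u) x _ = _; rw [this]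
  simp only [ContinuousLinearMap.comp_apply]
  congr 1; ext a
  have := congrFun (pdF_S ((h.JJ a).jb 1) j) x
  rw [pdF] at this
  simp only [ContinuousLinearMap.pi_apply, jt, this]; rw [JJ_comm]
lemma cont_cp (hG : Sm G) (h : FS u) : Continuous (fun x => G (jt u x)) := hG.continuous.comp (cont_jt h)
lemma cont_S' (h : FS u) (α : Ix d) : Continuous (fun x => S (JC α u) x) := (h.JC α).cont
lemma HB_succ {m b0 : ℝ} {b : Fin d → ℝ} (h0 : HB m b0 c) (h : ∀ j, HB m (b j) (JJ j.succ c)) :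
    HB (m+1) (b0 + ∑ j, b j) c := by
  have hR : HB m (b0 + ∑ j, b j) (fun n => ((‖c n‖ + ∑ j : Fin d, ‖JJ j.succ c n‖ : ℝ) : ℂ)) := by
    have h1 : HB m b0 (fun n => ((‖c n‖ : ℝ) : ℂ)) := h0.of_le1 fun n => by simp
    have h2 := HB.sum (univ : Finset (Fin d)) (m := m) (b := b) (c := fun j n => ((‖JJ j.succ c n‖ : ℝ):ℂ)) fun j _ => (h j).of_le1 fun n => by simp
    have h3 := h1.add h2
    convert h3 using 1
    ext n; simp
  refine hR.of_le1 fun n => ?_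
  rw [rpow_add (jb_pos n), Real.rpow_one, mul_assoc]
  refine mL ?_ (jw m n).le
  rw [norm_real, Real.norm_of_nonneg PO]
  have : jb n ≤ 1 + ∑ j, |(n j : ℝ)| := by
    refine le_of_sq' ?_ PO
    rw [jb_sq]
    have : ∑ i, ((n i:ℝ)) ^ 2 ≤ (∑ j, |(n j : ℝ)|) ^ 2 := by
      simp only [← sq_abs (n _ : ℝ)]
      exact sum_sq_le_sq_sum_of_nonneg fun i _ => abs_nonneg _
    nlinarith [sum_nonneg fun j (_ : j ∈ univ) => abs_nonneg (n j : ℝ)]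
  calc _ ≤ (1 + ∑ j, |(n j : ℝ)|) * ‖c n‖ := mR this (norm_nonneg _)
    _ = _ := by
      rw [add_mul, one_mul, sum_mul]; congr 1
      refine sum_congr rfl fun j _ => ?_
      simp [JJ, mu_succ]
lemma HB_sup (hf : Continuous f) {M : ℝ} (hM : 0 ≤ M) (h : ∀ x, ‖f x‖ ≤ M) :
    HB 0 (M * √((2 * π) ^ d)) (fCoeff f) := by
  refine ⟨by positivity, fun T => ?_⟩
  simp only [Real.rpow_zero, one_mul]
  refine (bessel T hf).trans ?_
  rw [mul_pow, sq_sqrt PO, ← vol_box (d := d)]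
  calc _ ≤ ∫ x in box d, M ^ 2 := integral_mono (intB (by fun_prop)) (intB continuous_const) fun x => pow_le_pow_left₀ (norm_nonneg _) (h x) 2
    _ = _ := by simp [mul_comm]
lemma sm_bound (hG : Continuous G) (R : ℝ) : ∃ M, 0 ≤ M ∧ ∀ y, ‖y‖ ≤ R → ‖G y‖ ≤ M := by
  obtain ⟨M, hM⟩ := (isCompact_closedBall (0 : Y d) R).exists_bound_of_continuousOn hG.continuousOn
  exact ⟨max M 0, le_max_right _ _, fun y hy => (hM y (by simpa using hy)).trans (le_max_left _ _)⟩
lemma comp_est {L : ℝ} (h2 : 2 * d + 2 ≤ L) {m : ℝ} (hm : 0 ≤ m) (h1 : m + 1 ≤ L) (hG : Sm G) (R : ℝ) :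
    ∃ C, 0 ≤ C ∧ ∀ u, FS u → HB L R u → HB m C (fCoeff fun x => G (jt u x)) := by
  have hd := dn d
  suffices ∀ (k : ℕ) (m : ℝ), 0 ≤ m → m ≤ k → m + 1 ≤ L → ∀ {G : Y d → ℂ}, Sm G → ∀ R : ℝ,
    ∃ C, 0 ≤ C ∧ ∀ u, FS u → HB L R u → HB m C (fCoeff fun x => G (jt u x)) from
    this ⌈m⌉₊ m hm (Nat.le_ceil m) h1 hG R
  clear hG h1 hm m R
  intro k
  induction k with
  | zero =>
    intro m hm hm' h1 G hG R
    obtain rfl : m = 0 := le_antisymm (by simpa using hm') hm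
    obtain ⟨M, hM, hb⟩ := sm_bound hG.continuous (kap d * (Zc d * R))
    refine ⟨M * √((2 * π) ^ d), by positivity, fun u hu hR => ?_⟩
    simpa using HB_sup (cont_cp hG hu) hM fun x => hb _ (jt_bound (hR.down LA) x)
  | succ k ih =>
    intro m0 hm0 hk h10 G hG R
    push_cast at hk
    obtain ⟨m, hm, hmk, h1, hmm⟩ : ∃ m : ℝ, 0 ≤ m ∧ m ≤ k ∧ m + 1 + 1 ≤ L ∧ m0 ≤ m + 1 :=
      ⟨max (m0 - 1) 0, le_max_right _ _, max_le LA (Nat.cast_nonneg k), by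
        rcases max_cases (m0 - 1) 0 with h | h <;> rw [h.1] <;> linarith, by linarith [le_max_left (m0 - 1) 0]⟩
    obtain ⟨C0, hC0, H0⟩ := ih m hm hmk LA hG R
    choose C hC H using fun α : Ix d => ih m hm hmk LA (hG.dv α) R
    obtain ⟨K, hK, HK⟩ := prod_fm d (m := m) (L := L - 2) hm LA LA
    refine ⟨C0 + ∑ _j : Fin d, ∑ α, K * (C α * |R|), add_nonneg hC0 (sum_nonneg fun j _ => sum_nonneg fun α _ => mul_nonneg hK (mul_nonneg (hC α) (abs_nonneg R))), fun u hu hR => ?_⟩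
    refine HB.down (m := m + 1) (HB_succ (H0 u hu hR) fun j => ?_) hmm
    have e : JJ j.succ (fCoeff fun x => G (jt u x)) = fun n => ∑ α, fCoeff (fun x => dv α G (jt u x) * S (JC α (JJ j.succ u)) x) n := by
      have := fCoeff_sum univ (fun (α : Ix d) x => dv α G (jt u x) * S (JC α (JJ j.succ u)) x)
        fun α _ => (cont_cp (hG.dv α) hu).mul (cont_S' (hu.JJ _) α)
      rw [← this]
      ext n
      rw [JJ, mu_succ, ← fCoeff_pdF (f := fun x => G (jt u x)) ((hG.comp (smooth_jt hu)).of_le (by simp)) (fun x m => by simp only [per_jt])]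
      congr 1; ext x
      rw [pdF_comp hG hu, fderiv_expand]
      exact sum_congr rfl fun α _ => by rw [S_JC (hu.JJ _)]
    rw [e]
    refine HB.sum _ fun α _ => ?_
    obtain ⟨B, hB⟩ := (hu.JJ j.succ).JC α
    exact HK B _ _ _ _ hB (cont_cp (hG.dv α) hu) (H α u hu hR) (HB.JC (m := L - 2) (HB.JJ (m := L - 2 + 1) (by convert hR.mono (le_abs_self R) using 1; ring) _) α)
def d2 (G : Y d → ℂ) (y v z : Y d) : ℂ := fderiv ℝ (fun y' => fderiv ℝ G y' z) y v
lemma Sm.fd (hG : Sm G) (z : Y d) : Sm (fun y' => fderiv ℝ G y' z) :=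
  (hG.fderiv_right (m := (⊤:ℕ∞)) (by simp)).clm_apply contDiff_const
lemma Sm.diff (hG : Sm G) (y : Y d) : DifferentiableAt ℝ G y := hG.differentiable (by simp) y
lemma d2_expand (hG : Sm G) (y v z : Y d) :
    d2 G y v z = ∑ β, ∑ α, dv α (dv β G) y * (rc α v : ℂ) * (rc β z : ℂ) := by
  have e : (fun y' => fderiv ℝ G y' z) = fun y' => ∑ β, dv β G y' * (rc β z : ℂ) := by ext y'; exact fderiv_expand G y' z
  rw [d2, e, fderiv_fun_sum (fun β _ => ((hG.dv β).diff y).mul_const _), ContinuousLinearMap.sum_apply]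
  refine sum_congr rfl fun β _ => ?_
  rw [fderiv_mul_const ((hG.dv β).diff y)]
  simp only [ContinuousLinearMap.smul_apply, smul_eq_mul]
  rw [fderiv_expand, mul_sum]
  exact sum_congr rfl fun α _ => by ring
lemma cont_lin (hG : Sm G) {u z : Seq d} (hu : FS u) (hz : FS z) : Continuous (fun x => fderiv ℝ G (jt u x) (jt z x)) := by
  simp only [fderiv_expand, ← S_JC hz]
  exact continuous_finsetSum _ fun α _ => (cont_cp (hG.dv α) hu).mul (cont_S' hz α)
lemma cont_bil (hG : Sm G) {u v z : Seq d} (hu : FS u) (hv : FS v) (hz : FS z) :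
    Continuous (fun x => d2 G (jt u x) (jt v x) (jt z x)) := by
  simp only [d2_expand hG, ← S_JC hz, ← S_JC hv]
  exact continuous_finsetSum _ fun β _ => continuous_finsetSum _ fun α _ => ((cont_cp ((hG.dv β).dv α) hu).mul (cont_S' hv α)).mul (cont_S' hz β)
lemma fC_lin (hG : Sm G) {u z : Seq d} (hu : FS u) (hz : FS z) : fCoeff (fun x => fderiv ℝ G (jt u x) (jt z x)) =
    fun n => ∑ α, fCoeff (fun x => dv α G (jt u x) * S (JC α z) x) n := by
  simp only [fderiv_expand, ← S_JC hz]
  exact fCoeff_sum univ (fun (α : Ix d) x => dv α G (jt u x) * S (JC α z) x) fun α _ => (cont_cp (hG.dv α) hu).mul (cont_S' hz α)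
lemma fC_bil (hG : Sm G) {u v z : Seq d} (hu : FS u) (hv : FS v) (hz : FS z) : fCoeff (fun x => d2 G (jt u x) (jt v x) (jt z x)) =
    fun n => ∑ p : Ix d × Ix d, fCoeff (fun x => (dv p.2 (dv p.1 G) (jt u x) * S (JC p.2 v) x) * S (JC p.1 z) x) n := by
  simp only [d2_expand hG, ← S_JC hz, ← S_JC hv]
  have := fCoeff_sum univ (fun (p : Ix d × Ix d) x => (dv p.2 (dv p.1 G) (jt u x) * S (JC p.2 v) x) * S (JC p.1 z) x)
    fun p _ => ((cont_cp ((hG.dv p.1).dv p.2) hu).mul (cont_S' hv p.2)).mul (cont_S' hz p.1)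
  rw [← this]; simp only [Fintype.sum_prod_type (f := fun p : Ix d × Ix d => _)]
lemma lin_est {m L : ℝ} (hm : 0 ≤ m) (h1 : m + 1 ≤ L) (h2 : 2 * d + 2 ≤ L) (hG : Sm G) (R : ℝ) :
    ∃ C, 0 ≤ C ∧ ∀ u z y, FS u → FS z → HB L R u → HB (m+1) y z → HB m (C * y) (fCoeff fun x => fderiv ℝ G (jt u x) (jt z x)) := by
  have hM : max m (2*d:ℝ) + 1 ≤ L := by rcases max_cases m (2*d:ℝ) with h | h <;> rw [h.1] <;> linarith
  choose C hC H using fun α : Ix d => comp_est h2 (le_max_of_le_left hm) hM (hG.dv α) R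
  obtain ⟨K, hK, HK⟩ := prod_am d (m := m) (L := max m (2*d:ℝ)) hm (by exact le_max_left _ _) (by exact le_max_right _ _)
  refine ⟨∑ α, K * C α, sum_nonneg fun α _ => mul_nonneg hK (hC α), fun u z y hu hz hR hy => ?_⟩
  rw [fC_lin hG hu hz, sum_mul]
  refine HB.sum _ fun α _ => ?_
  obtain ⟨B, hB⟩ := hz.JC α
  exact (HK B _ _ _ _ hB (cont_cp (hG.dv α) hu) (H α u hu hR) (hy.JC α)).mono (le_of_eq (by ring))
lemma bil_est {m L : ℝ} (hm : 0 ≤ m) (h1 : m + 1 ≤ L) (h2 : 2 * d + 2 ≤ L) (hG : Sm G) (R : ℝ) :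
    ∃ C, 0 ≤ C ∧ ∀ u v z y, FS u → FS v → FS z → HB L R u → HB L R v → HB (m+1) y z →
      HB m (C * y) (fCoeff fun x => d2 G (jt u x) (jt v x) (jt z x)) := by
  have hM : max m (2*d:ℝ) + 1 ≤ L := by rcases max_cases m (2*d:ℝ) with h | h <;> rw [h.1] <;> linarith
  have a1 : (m:ℝ) ≤ max m (2*d:ℝ) := by exact le_max_left _ _
  have a2 : 2 * (d:ℝ) ≤ max m (2*d:ℝ) := by exact le_max_right _ _
  choose C hC H using fun p : Ix d × Ix d => comp_est h2 (le_max_of_le_left hm) hM ((hG.dv p.1).dv p.2) R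
  obtain ⟨K, hK, HK⟩ := prod_am d (m := m) (L := max m (2*d:ℝ)) hm a1 a2
  obtain ⟨K', hK', HK'⟩ := prod_am d (m := max m (2*d:ℝ)) (L := max m (2*d:ℝ)) (le_max_of_le_left hm) le_rfl a2
  refine ⟨∑ p, K * (K' * (C p * |R|)), sum_nonneg fun p _ => mul_nonneg hK (mul_nonneg hK' (mul_nonneg (hC p) (abs_nonneg R))), fun u v z y hu hv hz hR hR' hy => ?_⟩
  rw [fC_bil hG hu hv hz, sum_mul]
  refine HB.sum _ fun p _ => ?_
  obtain ⟨B, hB⟩ := hz.JC p.1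
  obtain ⟨B', hB'⟩ := hv.JC p.2
  have c1 := cont_cp ((hG.dv p.1).dv p.2) hu
  refine (HK B _ _ _ _ hB (c1.mul (cont_S' hv p.2)) (HK' B' _ _ _ _ hB' c1 (H p u hu hR) (((hR'.mono (le_abs_self R)).down hM).JC p.2)) (hy.JC p.1)).mono (le_of_eq (by ring))
lemma bil_tame {m L : ℝ} (hm : 0 ≤ m) (h1 : m + 1 ≤ L) (h2 : 2 * d + 2 ≤ L) (hG : Sm G) (R : ℝ) :
    ∃ C, 0 ≤ C ∧ ∀ u v z y y', FS u → FS v → FS z → HB L R u → HB (d+1) R v → HB (d+1) R z → HB (m+1) y v → HB (m+1) y' z →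
      HB m (C * (y + y')) (fCoeff fun x => d2 G (jt u x) (jt v x) (jt z x)) := by
  have hM : max m (2*d:ℝ) + 1 ≤ L := by rcases max_cases m (2*d:ℝ) with h | h <;> rw [h.1] <;> linarith
  have a1 : (m:ℝ) ≤ max m (2*d:ℝ) := by exact le_max_left _ _
  have a2 : 2 * (d:ℝ) ≤ max m (2*d:ℝ) := by exact le_max_right _ _
  have hd := dn d
  choose C hC H using fun p : Ix d × Ix d => comp_est h2 (le_max_of_le_left hm) hM ((hG.dv p.1).dv p.2) R
  obtain ⟨K, hK, HK⟩ := prod_tame d (m := m) hm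
  obtain ⟨K1, hK1, HK1⟩ := prod_am d (m := d) (L := max m (2*d:ℝ)) PO LA a2
  obtain ⟨K2, hK2, HK2⟩ := prod_am d (m := m) (L := max m (2*d:ℝ)) hm a1 a2
  refine ⟨∑ p, K * (K1 * (C p * |R|) + K2 * (C p * |R|)), sum_nonneg fun p _ => mul_nonneg hK
    (add_nonneg (mul_nonneg hK1 (mul_nonneg (hC p) (abs_nonneg R))) (mul_nonneg hK2 (mul_nonneg (hC p) (abs_nonneg R)))), fun u v z y y' hu hv hz hR hR1 hR2 hy hy' => ?_⟩
  rw [fC_bil hG hu hv hz, sum_mul]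
  refine HB.sum _ fun p _ => ?_
  obtain ⟨B, hB⟩ := hz.JC p.1
  obtain ⟨B', hB'⟩ := hv.JC p.2
  have c1 := cont_cp ((hG.dv p.1).dv p.2) hu
  have hf := H p u hu hR
  refine (HK B _ _ _ _ _ _ hB (c1.mul (cont_S' hv p.2)) (HK1 B' _ _ _ _ hB' c1 hf (hR1.JC p.2))
    (HK2 B' _ _ _ _ hB' c1 hf (hy.JC p.2)) (hR2.JC p.1) (hy'.JC p.1)).mono ?_
  have r0 := hR.1
  have hc := hC p
  have y0 := hy.1
  have y0' := hy'.1
  rw [abs_of_nonneg r0, mul_assoc K (K1 * (C p * R) + K2 * (C p * R)) (y + y')]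
  refine mL ?_ hK
  have t1 : 0 ≤ K1 * (C p * R) * y := by positivity
  have t2 : 0 ≤ K2 * (C p * R) * y' := by positivity
  nlinarith
def Dv (h : Fin (d+1) → VC d) : Seq d := fun n => ∑ b, cJ (mu b n) * fCoeff (h b) n
lemma HB.Dv {m : ℝ} {h : Fin (d+1) → VC d} {b : Fin (d+1) → ℝ} (hb : ∀ a, HB (m+1) (b a) (fCoeff (h a))) : HB m (∑ a, b a) (Dv h) := by
  refine HB.sum _ fun a _ => (hb a).of_le1 fun n => ?_
  rw [norm_mul, RCLike.norm_conj, rpow_add (jb_pos n), Real.rpow_one, mul_assoc]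
  exact mL (mR (norm_mu_le a n) (norm_nonneg _)) (QLNLS.jw m n).le
lemma Dv_sub {h k : Fin (d+1) → VC d} (hh : ∀ a, Continuous (h a)) (hk : ∀ a, Continuous (k a)) :
    Dv (fun a x => h a x - k a x) = Dv h - Dv k := by
  ext n; simp only [Dv, Pi.sub_apply, ← sum_sub_distrib, ← mul_sub]
  exact sum_congr rfl fun a _ => by rw [fCoeff_sub (hh a) (hk a)]; rfl
lemma Dv_add {h k : Fin (d+1) → VC d} (hh : ∀ a, Continuous (h a)) (hk : ∀ a, Continuous (k a)) :
    Dv (fun a x => h a x + k a x) = Dv h + Dv k := by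
  ext n; simp only [Dv, Pi.add_apply, ← sum_add_distrib, ← mul_add]
  exact sum_congr rfl fun a _ => by rw [fCoeff_add (hh a) (hk a)]; rfl
def ipr (y η : Y d) : ℝ := ∑ b, (y b * cJ (η b)).re
lemma Dv_pair {φ : Seq d} (hφ : Supp B φ) {h : Fin (d+1) → VC d} (hh : ∀ a, Continuous (h a)) :
    ∑ n ∈ B, (Dv h n * cJ (φ n)).re = ∫ x in box d, ipr (fun b => h b x) (jt φ x) := by
  have e : ∀ b, ∑ n ∈ B, fCoeff (h b) n * cJ (JJ b φ n) = ∫ x in box d, h b x * cJ (S (JJ b φ) x) :=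
    fun b => pairing (hφ.JJ b) (hh b)
  have ci : ∀ b, Continuous fun x => h b x * cJ (S (JJ b φ) x) := fun b => (hh b).mul (Complex.continuous_conj.comp (cont_S (hφ.JJ b).summ1))
  have e2 : ∑ n ∈ B, Dv h n * cJ (φ n) = ∫ x in box d, ∑ b, h b x * cJ (S (JJ b φ) x) := by
    rw [integral_finsetSum _ (fun b _ => intB (ci b))]
    simp only [← e, Dv, sum_mul]
    rw [sum_comm]
    refine sum_congr rfl fun b _ => sum_congr rfl fun n _ => ?_
    simp only [JJ, map_mul]; ring
  have e3 := congrArg Complex.re e2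
  rw [Complex.re_sum] at e3
  rw [e3]
  have hi : Integrable (fun x => ∑ b, h b x * cJ (S (JJ b φ) x)) (volume.restrict (box d)) :=
    intB (continuous_finsetSum _ fun b _ => ci b)
  have := integral_re hi
  simp only [RCLike.re_to_complex] at this
  rw [← this]
  simp only [ipr, Complex.re_sum, jt]
def kk (b : Seq d) (ξ : Vec d) : Seq d := fun n => b n * cJ (ee n ξ)
lemma Supp.kk {b : Seq d} (h : Supp B b) (ξ : Vec d) : Supp B (kk b ξ) := fun n hn => by simp [QLNLS.kk, h n hn]
lemma kk_parseval {b : Seq d} (h : Supp B b) (x : Vec d) : ∫ ξ in box d, ‖S (kk b ξ) x‖ ^ 2 = ∑ n ∈ B, ‖b n‖ ^ 2 := by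
  have hs : Supp B (fun n => cJ (b n) * cJ (ee n x)) := fun n hn => by simp [h n hn]
  have := parseval hs
  simp only [norm_mul, RCLike.norm_conj, norm_ee, mul_one] at this
  rw [← this]; congr 1; ext ξ
  rw [S_fin hs, S_fin (h.kk ξ), ← RCLike.norm_conj, map_sum]
  congr 2
  refine sum_congr rfl fun n _ => ?_
  simp [kk]; ring
lemma kk_cont {b : Seq d} (h : Supp B b) : Continuous fun p : Vec d × Vec d => S (kk b p.1) p.2 := by
  have : (fun p : Vec d × Vec d => S (kk b p.1) p.2) = fun p => ∑ n ∈ B, (kap d : ℂ) * (b n * cJ (ee n p.1)) * ee n p.2 := by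
    ext p; exact S_fin (h.kk p.1) p.2
  rw [this]
  have := fun n : Zd d => cont_ee (d := d) n
  refine continuous_finsetSum _ fun n _ => ?_
  exact (continuous_const.mul (continuous_const.mul (Complex.continuous_conj.comp ((this n).comp continuous_fst)))).mul ((this n).comp continuous_snd)
lemma intBB {f : Vec d × Vec d → ℝ} (hf : Continuous f) : Integrable f ((volume.restrict (box d)).prod (volume.restrict (box d))) := by
  rw [Measure.prod_restrict]
  exact (hf.continuousOn.integrableOn_compact (isCompact_Icc.prod isCompact_Icc)).mono_set (Set.prod_mono box_sub box_sub)
lemma kk_swap {b : Seq d} (h : Supp B b) {H : Vec d → ℝ} (hH : Continuous H) :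
    Integrable (fun ξ => ∫ x in box d, H x * ‖S (kk b ξ) x‖ ^ 2) (volume.restrict (box d)) ∧
    ∫ ξ in box d, ∫ x in box d, H x * ‖S (kk b ξ) x‖ ^ 2 = (∑ n ∈ B, ‖b n‖ ^ 2) * ∫ x in box d, H x := by
  have hc : Continuous fun p : Vec d × Vec d => H p.2 * ‖S (kk b p.1) p.2‖ ^ 2 :=
    (hH.comp continuous_snd).mul ((kk_cont h).norm.pow 2)
  have hi := intBB hc
  refine ⟨hi.integral_prod_left, ?_⟩
  rw [integral_integral_swap hi]
  simp only [integral_const_mul, kk_parseval h]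
  rw [integral_mul_const, mul_comm]
lemma FS_mul {a b : Seq d} (ha : FS a) (hb : FS b) : ∃ c, FS c ∧ ∀ x, S c x = S a x * S b x := by
  obtain ⟨A, hA⟩ := ha
  obtain ⟨B, hB⟩ := hb
  classical
  set f : VC d := fun x => S a x * S b x
  have hf : Continuous f := (cont_S hA.summ1).mul (cont_S hB.summ1)
  have hs : Supp ((A ×ˢ B).image fun p => p.1 + p.2) (fCoeff f) := by
    intro n hn
    rw [fCoeff_mul_S hB (cont_S hA.summ1), fCoeff_S hA.summ1]
    rw [sum_eq_zero, mul_zero]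
    intro k hk
    by_cases h : n - k ∈ A
    · exact absurd (Finset.mem_image.2 ⟨(n - k, k), Finset.mem_product.2 ⟨h, hk⟩, by simp⟩) hn
    · rw [hA _ h, zero_mul]
  refine ⟨fCoeff f, ⟨_, hs⟩, fun x => (eq_S_of_summ hf (fun x m => ?_) hs.summ1 x).symm⟩
  simp only [f, per_S _ x m]
def jt0 (a : Seq d) (x : Vec d) : Y d := Fin.cons 0 (fun j => S (JJ j.succ a) x)
lemma jt_mul {a b c : Seq d} (ha : FS a) (hb : FS b) (hc : FS c) (h : ∀ x, S c x = S a x * S b x) (x : Vec d) :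
    jt c x = S a x • jt b x + S b x • jt0 a x := by
  ext i
  refine Fin.cases ?_ (fun j => ?_) i
  · simp [jt, jt0, JJ_zero, h]
  · have e : S c = fun x => S a x * S b x := funext h
    simp only [jt, jt0, Pi.add_apply, Pi.smul_apply, smul_eq_mul, Fin.cons_succ]
    rw [← pdF_S (hc.jb 1), ← pdF_S (hb.jb 1), ← pdF_S (ha.jb 1), e,
      pdF_mul (ha.smooth.differentiable (by simp) x) (hb.smooth.differentiable (by simp) x)]
    ring
def QQ (g : GY d) (y η ζ : Y d) : ℝ := ipr (fun b => fderiv ℝ (g b) y η) ζ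
lemma QQ_add (g : GY d) (y η η' ζ : Y d) : QQ g y (η + η') ζ = QQ g y η ζ + QQ g y η' ζ := by
  simp only [QQ, ipr, map_add, add_mul, add_re, sum_add_distrib]
lemma QQ_add' (g : GY d) (y η ζ ζ' : Y d) : QQ g y η (ζ + ζ') = QQ g y η ζ + QQ g y η ζ' := by
  simp only [QQ, ipr, Pi.add_apply, map_add, mul_add, add_re, sum_add_distrib]
lemma QQ_smul (g : GY d) (y η ζ : Y d) (r : ℝ) : QQ g y (r • η) ζ = r * QQ g y η ζ := by
  simp only [QQ, ipr, map_smul, mul_sum, Complex.real_smul, mul_assoc, Complex.re_ofReal_mul]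
lemma QQ_smul' (g : GY d) (y η ζ : Y d) (r : ℝ) : QQ g y η (r • ζ) = r * QQ g y η ζ := by
  simp only [QQ, ipr, mul_sum, Pi.smul_apply, Complex.real_smul, map_mul, conj_ofReal]
  refine sum_congr rfl fun b _ => ?_
  rw [← Complex.re_ofReal_mul]; ring_nf
lemma ipr_le (y η : Y d) : |ipr y η| ≤ (d + 1) * ‖y‖ * ‖η‖ := by
  calc |ipr y η| ≤ ∑ b : Fin (d+1), |(y b * cJ (η b)).re| := Finset.abs_sum_le_sum_abs _ _
    _ ≤ ∑ b : Fin (d+1), ‖y‖ * ‖η‖ := sum_le_sum fun b _ => by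
        refine (abs_re_le_norm _).trans ?_
        rw [norm_mul, RCLike.norm_conj]
        exact mul_le_mul (norm_le_pi_norm y b) (norm_le_pi_norm η b) (norm_nonneg _) (norm_nonneg _)
    _ = _ := by simp; ring
lemma QQ_bd (hg : ∀ b, Sm (g b)) (ρ : ℝ) : ∃ C, 0 ≤ C ∧
    (∀ y η ζ, ‖y‖ ≤ ρ → |QQ g y η ζ| ≤ C * ‖η‖ * ‖ζ‖) ∧
    (∀ y y' η, ‖y‖ ≤ ρ → ‖y'‖ ≤ ρ → |QQ g y η η - QQ g y' η η| ≤ C * ‖y - y'‖ * ‖η‖ ^ 2) := by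
  have hc : ∀ b, ContDiff ℝ (⊤:ℕ∞) (fderiv ℝ (g b)) := fun b => (hg b).fderiv_right (m := (⊤:ℕ∞)) (by simp)
  have hK : IsCompact (Metric.closedBall (0 : Y d) ρ) := isCompact_closedBall _ _
  have h1 : ∀ b, ∃ M, ∀ y ∈ Metric.closedBall (0 : Y d) ρ, ‖fderiv ℝ (g b) y‖ ≤ M := fun b =>
    hK.exists_bound_of_continuousOn (hc b).continuous.continuousOn
  have h2 : ∀ b, ∃ M, ∀ y ∈ Metric.closedBall (0 : Y d) ρ, ‖fderiv ℝ (fderiv ℝ (g b)) y‖ ≤ M := fun b =>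
    hK.exists_bound_of_continuousOn ((hc b).continuous_fderiv (by simp)).continuousOn
  choose M1 hM1 using h1
  choose M2 hM2 using h2
  set M : ℝ := ∑ b, (|M1 b| + |M2 b|)
  have hb : ∀ b, |M1 b| + |M2 b| ≤ M := fun b => single_le_sum (f := fun b => |M1 b| + |M2 b|) (fun b _ => by positivity) (mem_univ b)
  have hM : 0 ≤ M := sum_nonneg fun b _ => by positivity
  have hd : (0:ℝ) ≤ d + 1 := by positivity
  refine ⟨(d+1) * M, by positivity, fun y η ζ hy => ?_, fun y y' η hy hy' => ?_⟩
  · refine (ipr_le _ _).trans ?_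
    rw [mul_assoc ((d:ℝ)+1) M]
    gcongr
    refine (pi_norm_le_iff_of_nonneg PO).2 fun b => (ContinuousLinearMap.le_opNorm _ _).trans ?_
    gcongr
    exact (hM1 b y (by simpa using hy)).trans ((le_abs_self _).trans ((le_add_of_nonneg_right (abs_nonneg _)).trans (hb b)))
  · have e : QQ g y η η - QQ g y' η η = ipr (fun b => (fderiv ℝ (g b) y - fderiv ℝ (g b) y') η) η := by
      simp only [QQ, ipr, _root_.sub_apply, sub_mul, Complex.sub_re, sum_sub_distrib]
    rw [e]
    refine (ipr_le _ _).trans ?_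
    rw [pow_two, ← mul_assoc, mul_assoc ((d:ℝ)+1) M]
    refine mR ?_ (norm_nonneg _)
    rw [mul_assoc ((d:ℝ)+1) (M * ‖y - y'‖)]
    refine mL ?_ hd
    refine (pi_norm_le_iff_of_nonneg PO).2 fun b => (ContinuousLinearMap.le_opNorm _ _).trans ?_
    refine mR ?_ (norm_nonneg _)
    refine (convex_closedBall (0 : Y d) ρ).norm_image_sub_le_of_norm_fderiv_le (𝕜 := ℝ) (fun z _ => (hc b).differentiable (by simp) z) (fun z hz => ?_)
      (by simpa using hy') (by simpa using hy)
    exact (hM2 b z hz).trans ((le_abs_self _).trans ((le_add_of_nonneg_left (abs_nonneg _)).trans (hb b)))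
def ej (j : Fin d) : Zd d := Pi.single j 1
lemma ee_lip (n : Zd d) (x ξ : Vec d) : ‖ee n x - ee n ξ‖ ≤ ∑ j, |(n j : ℝ)| * ‖ee (ej j) x - ee (ej j) ξ‖ := by
  set N : Zd d → ℝ := fun n => ‖ee n x - ee n ξ‖ with hN
  have h0 : N 0 = 0 := by simp [hN, ee_zero]
  have hadd : ∀ n m, N (n + m) ≤ N n + N m := by
    intro n m
    have e : ee (n + m) x - ee (n + m) ξ = (ee n x - ee n ξ) * ee m x + ee n ξ * (ee m x - ee m ξ) := by
      rw [ee_add, ee_add]; ring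
    simp only [hN, e]
    refine (norm_add_le _ _).trans ?_
    simp [norm_ee]
  have hneg : ∀ n, N (-n) = N n := by
    intro n; simp only [hN, ee_neg, ← map_sub, RCLike.norm_conj]
  have hnat : ∀ (k : ℕ) v, N (k • v) ≤ k * N v := by
    intro k v
    induction k with
    | zero => simp [h0]
    | succ k ih => rw [succ_nsmul]; refine (hadd _ _).trans ?_; push_cast; linarith
  have hint : ∀ (k : ℤ) v, N (k • v) ≤ |(k:ℝ)| * N v := by
    intro k v
    obtain ⟨m, rfl | rfl⟩ := k.eq_nat_or_neg
    · have := hnat m v; simpa using this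
    · have := hnat m v; rw [neg_smul, hneg]; simpa using this
  have e : n = ∑ j, (n j) • ej j := by
    ext i; simp [ej, Finset.sum_apply, Pi.single_apply]
  calc N n = N (∑ j, (n j) • ej j) := by rw [← e]
    _ ≤ ∑ j, N ((n j) • ej j) := Finset.le_sum_of_subadditive N h0.le hadd _ _
    _ ≤ _ := sum_le_sum fun j _ => hint _ _
lemma jt_lip (hu : FS u) {R : ℝ} (hR : HB (d+2) R u) (x ξ : Vec d) :
    ‖jt u x - jt u ξ‖ ≤ kap d * (Zc d * R) * ∑ j, ‖ee (ej j) x - ee (ej j) ξ‖ := by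
  obtain ⟨B, hB⟩ := hu
  have hk := kap_pos (d := d)
  have hz := Zc_pos (d := d)
  have hr := hR.1
  refine (pi_norm_le_iff_of_nonneg PO).2 fun a => ?_
  simp only [Pi.sub_apply, jt]
  rw [S_fin (hB.JJ a), S_fin (hB.JJ a), ← sum_sub_distrib]
  have h1 : ∑ n ∈ B, jb n ^ (2:ℝ) * ‖u n‖ ≤ Zc d * R := HB.l1 (p := 2) (by rwa [add_comm]) B
  refine (norm_sum_le _ _).trans ?_
  calc ∑ n ∈ B, ‖(kap d : ℂ) * JJ a u n * ee n x - kap d * JJ a u n * ee n ξ‖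
      ≤ ∑ n ∈ B, (kap d * ∑ j, ‖ee (ej j) x - ee (ej j) ξ‖) * (jb n ^ (2:ℝ) * ‖u n‖) := by
        refine sum_le_sum fun n _ => ?_
        rw [← mul_sub, norm_mul, norm_mul, JJ, norm_mul, norm_real, Real.norm_of_nonneg hk.le]
        have l1 := norm_mu_le a n
        have l2 : ‖ee n x - ee n ξ‖ ≤ jb n * ∑ j, ‖ee (ej j) x - ee (ej j) ξ‖ := by
          refine (ee_lip n x ξ).trans ?_
          rw [mul_sum]
          exact sum_le_sum fun j _ => mR (abs_le_jb n j) (norm_nonneg _)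
        calc kap d * (‖mu a n‖ * ‖u n‖) * ‖ee n x - ee n ξ‖ ≤ kap d * (jb n * ‖u n‖) * (jb n * ∑ j, ‖ee (ej j) x - ee (ej j) ξ‖) := by
              gcongr
              have := jb_pos n; positivity
          _ = _ := by rw [show (2:ℝ) = ((2:ℕ):ℝ) by norm_num, rpow_natCast]; ring
    _ = (kap d * ∑ j, ‖ee (ej j) x - ee (ej j) ξ‖) * ∑ n ∈ B, (jb n ^ (2:ℝ) * ‖u n‖) := (mul_sum _ _ _).symm
    _ ≤ (kap d * ∑ j, ‖ee (ej j) x - ee (ej j) ξ‖) * (Zc d * R) := by gcongr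
    _ = _ := by ring
def dsh (j : Fin d) (a : Seq d) : Seq d := fun n => a (n - ej j) - a n
lemma window (d : ℕ) {ε : ℝ} (hε : 0 < ε) : ∃ (B : FZ d) (a : Seq d), Supp B a ∧ starSeq a = a ∧ 0 < ∑ n ∈ B, ‖a n‖ ^ 2 ∧
    ∀ j, Supp B (dsh j a) ∧ ∑ n ∈ B, ‖dsh j a n‖ ^ 2 ≤ ε * ∑ n ∈ B, ‖a n‖ ^ 2 := by
  classical
  obtain ⟨m, hm⟩ := exists_nat_gt (2 / ε)
  set A : FZ d := Fintype.piFinset fun _ => Finset.Icc (-(m:ℤ)) m with hA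
  set B : FZ d := Fintype.piFinset fun _ => Finset.Icc (-(m:ℤ)) (m+1) with hBd
  set a : Seq d := fun n => if n ∈ A then 1 else 0 with ha
  have hAB : A ⊆ B := Fintype.piFinset_subset _ _ fun _ => Finset.Icc_subset_Icc le_rfl LA
  have hsum : ∑ n ∈ B, ‖a n‖ ^ 2 = (2 * m + 1 : ℝ) ^ d := by
    have : ∀ n, ‖a n‖ ^ 2 = if n ∈ A then (1:ℝ) else 0 := fun n => by simp only [ha]; split_ifs <;> simp
    simp only [this, Finset.sum_ite_mem]
    rw [Finset.inter_eq_right.2 hAB, Finset.sum_const, hA, Fintype.card_piFinset]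
    simp only [Int.card_Icc, Finset.prod_const, Finset.card_univ, Fintype.card_fin, nsmul_eq_mul, mul_one]
    rw [show ((m:ℤ) + 1 - -(m:ℤ)).toNat = 2 * m + 1 by omega]; push_cast; ring
  refine ⟨B, a, fun n hn => by simp only [ha]; rw [if_neg fun h => hn (hAB h)], ?_, by rw [hsum]; positivity, fun j => ⟨fun n hn => ?_, ?_⟩⟩
  · ext n
    have : -n ∈ A ↔ n ∈ A := by
      simp only [hA, Fintype.mem_piFinset, Finset.mem_Icc, Pi.neg_apply]
      exact forall_congr' fun i => by constructor <;> intro h <;> constructor <;> linarith [h.1, h.2]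
    simp only [starSeq, ha, this]; split_ifs <;> simp
  · have h1 : n ∉ A := fun h => hn (hAB h)
    have h2 : n - ej j ∉ A := by
      intro h; apply hn
      simp only [hA, hBd, Fintype.mem_piFinset, Finset.mem_Icc] at h ⊢
      intro i
      have := h i
      simp only [ej, Pi.sub_apply, Pi.single_apply] at this
      split_ifs at this <;> constructor <;> linarith [this.1, this.2]
    simp [dsh, ha, h1, h2]
  · set N : FZ d := Fintype.piFinset fun i => if i = j then {-(m:ℤ), (m:ℤ)+1} else Finset.Icc (-(m:ℤ)) m with hNd
    have hle : ∀ n, ‖dsh j a n‖ ^ 2 ≤ if n ∈ N then (1:ℝ) else 0 := by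
      intro n
      split_ifs with h
      · simp only [dsh, ha]; split_ifs <;> simp
      · have : n - ej j ∈ A ↔ n ∈ A := by
          simp only [hNd, hA, Fintype.mem_piFinset] at h ⊢
          constructor
          · intro h1 i
            by_contra h2
            apply h; intro i'
            have h1' := h1 i'
            have h1i := h1 i
            have hij : i = j := by
              by_contra hij
              simp [ej, hij] at h1i h2
              omega
            subst hij
            split_ifs with hi
            · subst hi
              simp [ej] at h1i h2 ⊢
              omega
            · simpa [ej, hi] using h1'
          · intro h1 i
            by_contra h2
            apply h; intro i'
            have h1' := h1 i'
            have h1i := h1 i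
            have hij : i = j := by
              by_contra hij
              simp [ej, hij] at h1i h2
              omega
            subst hij
            split_ifs with hi
            · subst hi
              simp [ej] at h1i h2 ⊢
              omega
            · simpa [ej, hi] using h1'
        simp [dsh, ha, this]
    have hcard : (2 * m + 1 : ℝ) * N.card = 2 * (2 * m + 1) ^ d := by
      have e1 : ((2 * m + 1 : ℝ)) ^ d = ∏ _i : Fin d, (2 * m + 1 : ℝ) := by simp
      rw [e1, hNd, Fintype.card_piFinset, Nat.cast_prod, ← Finset.mul_prod_erase _ _ (mem_univ j),
        ← Finset.mul_prod_erase univ (fun _ : Fin d => (2 * m + 1 : ℝ)) (mem_univ j)]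
      have e2 : ∏ i ∈ univ.erase j, (((if i = j then {-(m:ℤ), (m:ℤ)+1} else Finset.Icc (-(m:ℤ)) m).card : ℕ) : ℝ) = ∏ i ∈ univ.erase j, (2 * m + 1 : ℝ) := by
        refine Finset.prod_congr rfl fun i hi => ?_
        rw [if_neg (Finset.ne_of_mem_erase hi), Int.card_Icc, show ((m:ℤ) + 1 - -(m:ℤ)).toNat = 2 * m + 1 by omega]; push_cast; ring
      rw [e2, if_pos rfl, Finset.card_pair (by omega)]
      push_cast; ring
    calc ∑ n ∈ B, ‖dsh j a n‖ ^ 2 ≤ ∑ n ∈ B, if n ∈ N then (1:ℝ) else 0 := sum_le_sum fun n _ => hle n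
      _ ≤ N.card := by
        rw [Finset.sum_ite_mem, Finset.sum_const, nsmul_eq_mul, mul_one]
        exact_mod_cast Finset.card_le_card Finset.inter_subset_right
      _ ≤ ε * ∑ n ∈ B, ‖a n‖ ^ 2 := by
        rw [hsum]
        rw [div_lt_iff₀ hε] at hm
        have : (0:ℝ) ≤ N.card := Nat.cast_nonneg _
        have h3 : (0:ℝ) ≤ m := Nat.cast_nonneg _
        nlinarith
lemma kk_dsh (h : Supp B a) (j : Fin d) (h' : Supp B (dsh j a)) (ξ x : Vec d) :
    S (kk (dsh j a) ξ) x = S (kk a ξ) x * (ee (ej j) x * cJ (ee (ej j) ξ) - 1) := by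
  have hs : Summable fun n => (kap d : ℂ) * kk a ξ n * ee n x := S_summ (h.kk ξ).summ1 x
  have hs2 := hs.mul_right (ee (ej j) x * cJ (ee (ej j) ξ))
  have e := (Equiv.subRight (ej j)).tsum_eq (fun n => (kap d : ℂ) * kk a ξ n * ee n x * (ee (ej j) x * cJ (ee (ej j) ξ)))
  have hs3 := (Equiv.subRight (ej j)).summable_iff.2 hs2
  rw [mul_sub, mul_one, S, S, ← tsum_mul_right, ← e]
  refine Eq.trans ?_ (hs3.tsum_sub hs)
  congr 1; ext n
  simp only [Function.comp]
  have e1 : ee n x = ee (n - ej j) x * ee (ej j) x := by rw [← ee_add]; simp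
  have e2 : ee n ξ = ee (n - ej j) ξ * ee (ej j) ξ := by rw [← ee_add]; simp
  simp only [kk, dsh, Equiv.subRight_apply, e1, e2, map_mul]
  ring
lemma kk_real (h : starSeq a = a) (ξ x : Vec d) : S (kk a ξ) x = ((S (kk a ξ) x).re : ℂ) := by
  refine (Complex.conj_eq_iff_re.1 ?_).symm
  rw [← S_star]; congr 1; ext n
  have := congrFun h n
  simp only [starSeq] at this
  simp only [starSeq, kk, ee_neg, map_mul, Complex.conj_conj, this]
lemma I_add {f h : Vec d → ℝ} (hf : Continuous f) (hh : Continuous h) : ∫ x in box d, (f x + h x) = (∫ x in box d, f x) + ∫ x in box d, h x :=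
  integral_add (intB hf) (intB hh)
lemma I_sub {f h : Vec d → ℝ} (hf : Continuous f) (hh : Continuous h) : ∫ x in box d, (f x - h x) = (∫ x in box d, f x) - ∫ x in box d, h x :=
  integral_sub (intB hf) (intB hh)
lemma I_sum {ι : Type*} (s : Finset ι) {f : ι → Vec d → ℝ} (hf : ∀ i ∈ s, Continuous (f i)) : ∫ x in box d, (∑ i ∈ s, f i x) = ∑ i ∈ s, ∫ x in box d, f i x :=
  integral_finsetSum _ fun i hi => intB (hf i hi)
lemma I_mono {f h : Vec d → ℝ} (hf : Continuous f) (hh : Continuous h) (H : ∀ x, f x ≤ h x) : ∫ x in box d, f x ≤ ∫ x in box d, h x :=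
  integral_mono (intB hf) (intB hh) H
lemma cont_ipr {f h : Vec d → Y d} (hf : Continuous f) (hh : Continuous h) : Continuous fun x => ipr (f x) (h x) := by
  unfold ipr
  exact continuous_finsetSum _ fun b _ => Complex.continuous_re.comp (((continuous_apply b).comp hf).mul (Complex.continuous_conj.comp ((continuous_apply b).comp hh)))
lemma cont_QQ (hg : ∀ b, Sm (g b)) {u z z' : Seq d} (hu : FS u) (hz : FS z) (hz' : FS z') :
    Continuous fun x => QQ g (jt u x) (jt z x) (jt z' x) :=
  cont_ipr (continuous_pi fun b => cont_lin (hg b) hu hz) (cont_jt hz')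
lemma cont_QQ0 (g : GY d) (y : Y d) {z z' : Seq d} (hz : FS z) (hz' : FS z') :
    Continuous fun x => QQ g y (jt z x) (jt z' x) :=
  cont_ipr (continuous_pi fun b => (fderiv ℝ (g b) y).continuous.comp (cont_jt hz)) (cont_jt hz')
lemma young {a b e : ℝ} (he : 0 < e) : a * b ≤ e * a ^ 2 + b ^ 2 / e := by
  have h : 0 ≤ (e * a - b) ^ 2 + (e * a) ^ 2 + b ^ 2 := by positivity
  have : e * (a * b) ≤ e * (e * a ^ 2 + b ^ 2 / e) := by
    rw [mul_add, mul_div_cancel₀ _ he.ne']; nlinarith [sq_nonneg (e * a - b), sq_nonneg (e*a), sq_nonneg b]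
  exact le_of_mul_le_mul_left this he
lemma garding_pt {C Lp c K r t : ℝ} (hC : 0 ≤ C) (hL : 0 ≤ Lp) (hc : 0 < c) (hK : 0 ≤ K) {y y' η δ : Y d} {w : ℂ} {D : Fin d → ℝ}
    (h1 : ∀ η ζ, |QQ g y' η ζ| ≤ C * ‖η‖ * ‖ζ‖) (h2 : |QQ g y η η - QQ g y' η η| ≤ C * ‖y - y'‖ * ‖η‖ ^ 2)
    (hD : ‖y - y'‖ ≤ Lp * ∑ j, D j) (ht : ‖δ‖ ^ 2 ≤ t) :
    QQ g y' (r • η + w • δ) (r • η + w • δ) - c * ‖r • η + w • δ‖ ^ 2 + K * (r ^ 2 * ‖w‖ ^ 2) ≤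
      r ^ 2 * (QQ g y η η - c / 4 * ‖η‖ ^ 2 + K * ‖w‖ ^ 2) + (8 * (d+1) * (C * Lp) ^ 2 / c) * ‖η‖ ^ 2 * ∑ j, r ^ 2 * (D j) ^ 2
        + (8 * (2 * C) ^ 2 / c + C + c) * ‖w‖ ^ 2 * t := by
  set ω := w • δ with hω
  have hω2 : ‖ω‖ ^ 2 ≤ ‖w‖ ^ 2 * t := by
    rw [hω, norm_smul, mul_pow]; gcongr
  have e1 : QQ g y' (r • η + ω) (r • η + ω) = r ^ 2 * QQ g y' η η + r * (QQ g y' η ω + QQ g y' ω η) + QQ g y' ω ω := by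
    simp only [QQ_add, QQ_add', QQ_smul, QQ_smul']; ring
  have a1 := abs_le.1 (h1 η ω)
  have a2 := abs_le.1 (h1 ω η)
  have a3 := (abs_le.1 (h1 ω ω)).2
  have b1 : r * (QQ g y' η ω + QQ g y' ω η) ≤ (|r| * ‖η‖) * (2 * C * ‖ω‖) := by
    refine (le_abs_self _).trans ?_
    rw [abs_mul, mul_assoc]
    refine mL (abs_le.2 ⟨?_, ?_⟩) (abs_nonneg r) <;> nlinarith [a1.1, a1.2, a2.1, a2.2]
  have b2 := young (a := |r| * ‖η‖) (b := 2 * C * ‖ω‖) (e := c / 8) PO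
  rw [mul_pow, sq_abs] at b2
  have b3 : r ^ 2 * ‖η‖ ^ 2 ≤ 2 * ‖r • η + ω‖ ^ 2 + 2 * ‖ω‖ ^ 2 := by
    have : ‖r • η‖ ≤ ‖r • η + ω‖ + ‖ω‖ := by
      have := norm_sub_le (r • η + ω) ω; simpa using this
    rw [norm_smul] at this
    have h3 : (‖r‖ * ‖η‖) ^ 2 ≤ (‖r • η + ω‖ + ‖ω‖) ^ 2 := pow_le_pow_left₀ PO this 2
    rw [mul_pow, Real.norm_eq_abs, sq_abs] at h3
    nlinarith [sq_nonneg (‖r • η + ω‖ - ‖ω‖)]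
  have b4 : C * ‖y - y'‖ ≤ c / 8 + (8 * (d+1) * (C * Lp) ^ 2 / c) * ∑ j, (D j) ^ 2 := by
    calc C * ‖y - y'‖ ≤ C * (Lp * ∑ j, D j) := by gcongr
      _ = ∑ j, 1 * (C * Lp * D j) := by rw [← mul_assoc, mul_sum]; simp
      _ ≤ ∑ j : Fin d, (c / (8 * (d+1)) + (8 * (d+1) * (C * Lp) ^ 2 / c) * (D j) ^ 2) := sum_le_sum fun j _ => by
          have := young (a := 1) (b := C * Lp * D j) (e := c / (8 * (d+1))) PO
          refine this.trans (le_of_eq ?_)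
          field_simp
      _ = d * (c / (8 * (d+1))) + (8 * (d+1) * (C * Lp) ^ 2 / c) * ∑ j, (D j) ^ 2 := by
          rw [sum_add_distrib, mul_sum]; simp
      _ ≤ _ := by
          gcongr
          rw [mul_div_assoc', div_le_div_iff₀ PO PO]; nlinarith
  have b5 : QQ g y' η η ≤ QQ g y η η + (c / 8 + (8 * (d+1) * (C * Lp) ^ 2 / c) * ∑ j, (D j) ^ 2) * ‖η‖ ^ 2 := by
    have := mR b4 (sq_nonneg ‖η‖)
    linarith [(abs_le.1 h2).1]
  have b6 := mL b5 (sq_nonneg r)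
  have b7 : (2 * C * ‖ω‖) ^ 2 / (c / 8) = (8 * (2 * C) ^ 2 / c) * ‖ω‖ ^ 2 := by field_simp
  have b8 : (8 * (2 * C) ^ 2 / c + C + c) * ‖ω‖ ^ 2 ≤ (8 * (2 * C) ^ 2 / c + C + c) * (‖w‖ ^ 2 * t) := by gcongr
  rw [← mul_sum]
  set P := 8 * (d+1) * (C * Lp) ^ 2 / c
  set W := 8 * (2 * C) ^ 2 / c
  rw [b7] at b2
  rw [e1]
  clear_value P W
  have b9 := mL b3 (by positivity : 0 ≤ c / 2)
  linarith
set_option maxHeartbeats 1000000 in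
lemma garding_gen (hg : ∀ b, Sm (g b))
    (hE : ∀ ρ : ℝ, ∃ c, 0 < c ∧ ∃ K, 0 ≤ K ∧ ∀ y : Y d, ‖y‖ ≤ ρ → ∀ z, FS z →
      c * (∫ x in box d, ‖jt z x‖ ^ 2) - K * (∫ x in box d, ‖S z x‖ ^ 2) ≤ ∫ x in box d, QQ g y (jt z x) (jt z x)) (R : ℝ) :
    ∃ c, 0 < c ∧ ∃ K, 0 ≤ K ∧ ∀ u z, FS u → FS z → HB (d+2) R u →
      c * (∫ x in box d, ‖jt z x‖ ^ 2) - K * (∫ x in box d, ‖S z x‖ ^ 2) ≤ ∫ x in box d, QQ g (jt u x) (jt z x) (jt z x) := by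
  have hk := kap_pos (d := d)
  have hz0 := Zc_pos (d := d)
  obtain ⟨c, hc, K, hK, H⟩ := hE (kap d * (Zc d * |R|))
  obtain ⟨C, hC, hC1, hC2⟩ := QQ_bd hg (kap d * (Zc d * |R|))
  set Lp := kap d * (Zc d * |R|) with hLp
  have hL : 0 ≤ Lp := by positivity
  set M1 := 8 * (d+1) * (C * Lp) ^ 2 / c with hM1
  have hM10 : 0 ≤ M1 := by positivity
  set M2 := 8 * (2 * C) ^ 2 / c + C + c with hM2
  have hM20 : 0 ≤ M2 := by positivity
  clear_value M1 M2
  obtain ⟨B, a, hB, hst, hpos, hw⟩ := window d (ε := c / (8 * (M1 + 1) * (d+1))) PO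
  set σ := ∑ n ∈ B, ‖a n‖ ^ 2 with hσ
  set σ' := fun j : Fin d => ∑ n ∈ B, ‖JJ j.succ a n‖ ^ 2 with hσ'
  have hσ'0 : ∀ j, 0 ≤ σ' j := fun j => sum_nonneg fun n _ => by positivity
  refine ⟨c / 8, by positivity, K + M2 * (∑ j, σ' j) / σ, add_nonneg hK (div_nonneg (mul_nonneg hM20 (sum_nonneg fun j _ => hσ'0 j)) hpos.le), fun u z hu hz hR => ?_⟩
  have hR0 := hR.1
  have hR' : HB (d+2) |R| u := by rwa [abs_of_nonneg hR0]
  have hju : ∀ x, ‖jt u x‖ ≤ Lp := jt_bound (hR'.down LA)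
  have cη : Continuous fun x => ‖jt z x‖ ^ 2 := (cont_jt hz).norm.pow 2
  have cw : Continuous fun x => ‖S z x‖ ^ 2 := hz.cont.norm.pow 2
  have cQ := cont_QQ hg hu hz hz
  set A : Vec d → ℝ := fun x => QQ g (jt u x) (jt z x) (jt z x) - c / 4 * ‖jt z x‖ ^ 2 + K * ‖S z x‖ ^ 2 with hA
  have cA : Continuous A := (cQ.sub (continuous_const.mul cη)).add (continuous_const.mul cw)
  have cE : Continuous fun x => M1 * ‖jt z x‖ ^ 2 := continuous_const.mul cη
  have cW : Continuous fun x => M2 * ‖S z x‖ ^ 2 := continuous_const.mul cw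
  have ck : ∀ {b : Seq d} (hb : Supp B b) {h : Vec d → ℝ} (_ : Continuous h) ξ, Continuous fun x => h x * ‖S (kk b ξ) x‖ ^ 2 :=
    fun hb h hh ξ => hh.mul ((cont_S (hb.kk ξ).summ1).norm.pow 2)
  have key : ∀ ξ, 0 ≤ (∫ x in box d, A x * ‖S (kk a ξ) x‖ ^ 2) + ∑ j : Fin d, (∫ x in box d, (M1 * ‖jt z x‖ ^ 2) * ‖S (kk (dsh j a) ξ) x‖ ^ 2)
      + ∑ j : Fin d, ∫ x in box d, (M2 * ‖S z x‖ ^ 2) * ‖S (kk (JJ j.succ a) ξ) x‖ ^ 2 := by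
    intro ξ
    obtain ⟨zx, hzx, hmul⟩ := FS_mul (⟨B, hB.kk ξ⟩ : FS (kk a ξ)) hz
    have hjt := jt_mul ⟨B, hB.kk ξ⟩ hz hzx hmul
    have h0 := H (jt u ξ) (hju ξ) zx hzx
    have cc := cont_QQ0 g (jt u ξ) hzx hzx
    have cη' : Continuous fun x => ‖jt zx x‖ ^ 2 := (cont_jt hzx).norm.pow 2
    have cw' : Continuous fun x => ‖S zx x‖ ^ 2 := hzx.cont.norm.pow 2
    have h3 : 0 ≤ ∫ x in box d, (QQ g (jt u ξ) (jt zx x) (jt zx x) - c * ‖jt zx x‖ ^ 2 + K * ‖S zx x‖ ^ 2) := by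
      rw [I_add, I_sub cc, integral_const_mul, integral_const_mul]
      · linarith
      · exact continuous_const.mul cη'
      · exact cc.sub (continuous_const.mul cη')
      · exact continuous_const.mul cw'
    refine h3.trans ?_
    have c2 : Continuous fun x => ∑ j : Fin d, (M1 * ‖jt z x‖ ^ 2) * ‖S (kk (dsh j a) ξ) x‖ ^ 2 := continuous_finsetSum _ fun j _ => ck (hw j).1 cE ξ
    have c3 : Continuous fun x => ∑ j : Fin d, (M2 * ‖S z x‖ ^ 2) * ‖S (kk (JJ j.succ a) ξ) x‖ ^ 2 := continuous_finsetSum _ fun j _ => ck (hB.JJ j.succ) cW ξ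
    have c12 : Continuous fun x => A x * ‖S (kk a ξ) x‖ ^ 2 + ∑ j : Fin d, (M1 * ‖jt z x‖ ^ 2) * ‖S (kk (dsh j a) ξ) x‖ ^ 2 := (ck hB cA ξ).add c2
    rw [← I_sum _ (fun j _ => ck (hw j).1 cE ξ), ← I_sum _ (fun (j : Fin d) _ => ck (hB.JJ j.succ) cW ξ), ← I_add (ck hB cA ξ) c2, ← I_add c12 c3]
    refine I_mono ((cc.sub (continuous_const.mul cη')).add (continuous_const.mul cw')) (c12.add c3) fun x => ?_
    set r := (S (kk a ξ) x).re with hr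
    have hre : S (kk a ξ) x = (r : ℂ) := kk_real hst ξ x
    have ej1 : jt zx x = r • jt z x + S z x • jt0 (kk a ξ) x := by
      rw [hjt x, hre]; rfl
    have ew : ‖S zx x‖ ^ 2 = r ^ 2 * ‖S z x‖ ^ 2 := by
      rw [hmul x, hre, norm_mul, mul_pow, norm_real, Real.norm_eq_abs, sq_abs]
    have ea : ‖S (kk a ξ) x‖ ^ 2 = r ^ 2 := by rw [hre, norm_real, Real.norm_eq_abs, sq_abs]
    have ed : ∀ j, ‖S (kk (dsh j a) ξ) x‖ ^ 2 = r ^ 2 * ‖ee (ej j) x - ee (ej j) ξ‖ ^ 2 := fun j => by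
      rw [kk_dsh hB j (hw j).1, hre, norm_mul, mul_pow, norm_real, Real.norm_eq_abs, sq_abs]
      congr 2
      have : ee (ej j) x - ee (ej j) ξ = (ee (ej j) x * cJ (ee (ej j) ξ) - 1) * ee (ej j) ξ := by
        rw [sub_mul, mul_assoc, mul_comm (cJ _), ee_mul_conj]; ring
      rw [this, norm_mul, norm_ee, mul_one]
    have et : ‖jt0 (kk a ξ) x‖ ^ 2 ≤ ∑ j : Fin d, ‖S (kk (JJ j.succ a) ξ) x‖ ^ 2 := by
      have e0 : ∀ j : Fin d, JJ j.succ (kk a ξ) = kk (JJ j.succ a) ξ := fun j => by ext n; simp [JJ, kk, mul_assoc]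
      have s0 : 0 ≤ ∑ j : Fin d, ‖S (kk (JJ j.succ a) ξ) x‖ ^ 2 := sum_nonneg fun j _ => by positivity
      have : ‖jt0 (kk a ξ) x‖ ≤ √(∑ j : Fin d, ‖S (kk (JJ j.succ a) ξ) x‖ ^ 2) := by
        refine (pi_norm_le_iff_of_nonneg (sqrt_nonneg _)).2 fun i => ?_
        refine Fin.cases ?_ (fun j => ?_) i
        · simp [jt0]
        · simp only [jt0, Fin.cons_succ, e0]
          exact le_sqrt_of_sq_le (single_le_sum (f := fun j : Fin d => ‖S (kk (JJ j.succ a) ξ) x‖ ^ 2) (fun j _ => by positivity) (mem_univ j))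
      calc _ ≤ (√(∑ j : Fin d, ‖S (kk (JJ j.succ a) ξ) x‖ ^ 2)) ^ 2 := pow_le_pow_left₀ (norm_nonneg _) this 2
        _ = _ := sq_sqrt s0
    have := garding_pt (g := g) (r := r) (w := S z x) (η := jt z x) (δ := jt0 (kk a ξ) x) hC hL hc hK (hC1 (jt u ξ) · · (hju ξ)) (hC2 (jt u x) (jt u ξ) (jt z x) (hju x) (hju ξ)) (jt_lip hu hR' x ξ) et
    rw [← hM1, ← hM2] at this
    simp only [ej1, ew, ea, ed, ← mul_sum, hA]
    simp only [← mul_sum] at this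
    linarith
  have i1 := kk_swap hB cA
  have i2 := fun j => kk_swap (hw j).1 cE
  have i3 := fun j : Fin d => kk_swap (hB.JJ j.succ) cW
  have j2 := integrable_finsetSum (univ : Finset (Fin d)) fun j _ => (i2 j).1
  have j3 := integrable_finsetSum (univ : Finset (Fin d)) fun j _ => (i3 j).1
  have tot : 0 ≤ ∫ ξ in box d, ((∫ x in box d, A x * ‖S (kk a ξ) x‖ ^ 2) + ∑ j : Fin d, (∫ x in box d, (M1 * ‖jt z x‖ ^ 2) * ‖S (kk (dsh j a) ξ) x‖ ^ 2)
      + ∑ j : Fin d, ∫ x in box d, (M2 * ‖S z x‖ ^ 2) * ‖S (kk (JJ j.succ a) ξ) x‖ ^ 2) := integral_nonneg fun ξ => key ξ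
  rw [integral_add, integral_add i1.1 j2, integral_finsetSum _ fun j _ => (i2 j).1, integral_finsetSum _ fun j _ => (i3 j).1, i1.2] at tot
  rotate_left
  · exact i1.1.add j2
  · exact j3
  simp only [(i2 _).2, (i3 _).2, integral_const_mul, ← sum_mul] at tot
  have eA : ∫ x in box d, A x = (∫ x in box d, QQ g (jt u x) (jt z x) (jt z x)) - c / 4 * (∫ x in box d, ‖jt z x‖ ^ 2) + K * ∫ x in box d, ‖S z x‖ ^ 2 := by
    simp only [hA]
    rw [I_add, I_sub cQ, integral_const_mul, integral_const_mul]
    · exact continuous_const.mul cη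
    · exact cQ.sub (continuous_const.mul cη)
    · exact continuous_const.mul cw
  have p1 : 0 ≤ ∫ x in box d, ‖jt z x‖ ^ 2 := integral_nonneg fun x => by positivity
  have s2 : ∑ j : Fin d, ∑ n ∈ B, ‖dsh j a n‖ ^ 2 ≤ d * (c / (8 * (M1 + 1) * (d+1)) * σ) := by
    refine (sum_le_sum fun j _ => (hw j).2).trans ?_
    simp
  have s3 : (∑ j : Fin d, ∑ n ∈ B, ‖dsh j a n‖ ^ 2) * M1 ≤ σ * (c / 8) := by
    refine (mR s2 hM10).trans ?_
    rw [show (d:ℝ) * (c / (8 * (M1 + 1) * (d+1)) * σ) * M1 = σ * (c / 8) * ((d / (d+1)) * (M1 / (M1 + 1))) by field_simp]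
    refine mul_le_of_le_one_right PO (mul_le_one₀ ?_ PO ?_)
    · rw [div_le_one PO]; linarith
    · rw [div_le_one PO]; linarith
  have s4 := mR s3 p1
  rw [eA] at tot
  simp only [← hσ] at tot
  clear_value σ
  set X := ∫ x in box d, ‖jt z x‖ ^ 2
  set Wz := ∫ x in box d, ‖S z x‖ ^ 2
  set Qx := ∫ x in box d, QQ g (jt u x) (jt z x) (jt z x)
  clear_value X Wz Qx
  have fin : 0 ≤ σ * (Qx - c / 8 * X + K * Wz + M2 * (∑ j, σ' j) / σ * Wz) := by
    have : σ * (Qx - c / 8 * X + K * Wz + M2 * (∑ j, σ' j) / σ * Wz) = σ * (Qx - c / 4 * X + K * Wz) + σ * (c / 8) * X + (∑ j, σ' j) * (M2 * Wz) := by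
      field_simp; ring
    rw [this]; linarith
  have := nonneg_of_mul_nonneg_right fin hpos
  linarith
def gF (F : Y d → ℂ) (b : Fin (d+1)) (y : Y d) : ℂ := wdM b F y + (if b = 0 then 0 else y b)
lemma Sm.wdM (hG : Sm G) (b : Fin (d+1)) : Sm (wdM b G) :=
  ((hG.fd _).add (contDiff_const.mul (hG.fd _))).div_const 2
lemma Sm.wdP (hG : Sm G) (b : Fin (d+1)) : Sm (wdP b G) :=
  ((hG.fd _).sub (contDiff_const.mul (hG.fd _))).div_const 2
lemma Sm_gF {F : Y d → ℂ} (hF : Sm F) (b : Fin (d+1)) : Sm (gF F b) := by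
  refine (hF.wdM b).add ?_
  split_ifs
  · exact contDiff_const
  · exact contDiff_apply ℝ ℂ b
lemma fderiv_wd (G : Y d → ℂ) (y η : Y d) : fderiv ℝ G y η = ∑ a, (wdP a G y * η a + wdM a G y * cJ (η a)) := by
  rw [fderiv_expand, Fintype.sum_prod_type]
  refine sum_congr rfl fun a _ => ?_
  simp only [Fintype.sum_bool, dv, eb, rc, wdP, wdM, if_true, Bool.false_eq_true, if_false]
  apply Complex.ext <;> simp <;> ring
lemma fd_gF {F : Y d → ℂ} (hF : Sm F) (b : Fin (d+1)) (y η : Y d) :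
    fderiv ℝ (gF F b) y η = fderiv ℝ (wdM b F) y η + (if b = 0 then 0 else η b) := by
  unfold gF
  split_ifs with h
  · simp
  · rw [fderiv_fun_add ((hF.wdM b).diff y) (differentiable_apply b).differentiableAt]
    have : fderiv ℝ (fun y : Y d => y b) y = ContinuousLinearMap.proj (R := ℝ) (φ := fun _ : Fin (d+1) => ℂ) b :=
      (ContinuousLinearMap.proj (R := ℝ) (φ := fun _ : Fin (d+1) => ℂ) b).fderiv
    rw [this]; rfl
lemma ell_num {A b c₂ M s : ℝ} (hs : 0 < s) (hA : 0 < A) (hAM : A ≤ M * s) (hb : 0 ≤ b) (hc : 0 < c₂) (h : c₂ ≤ (A / s) ^ 2 - b ^ 2 / s ^ 2) :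
    c₂ / (2 * M) * s ≤ A - b := by
  have hM : 0 < M := by by_contra h'; nlinarith
  rw [div_pow, ← sub_div, le_div_iff₀ PO] at h
  have h1 : b < A := by
    by_contra h'; push Not at h'
    have : A ^ 2 ≤ b ^ 2 := by gcongr
    have : 0 < c₂ * s ^ 2 := by positivity
    linarith
  rw [div_mul_eq_mul_div, div_le_iff₀ PO]
  have h2 : (A - b) * (A + b) ≤ (A - b) * (2 * (M * s)) := mL LA LA
  have h3 : (c₂ * s) * s ≤ ((A - b) * (2 * M)) * s := by nlinarith
  exact le_of_mul_le_mul_right h3 hs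
lemma jt_eq (z : Seq d) (x : Vec d) : jt z x = jt0 z x + Pi.single 0 (S z x) := by
  ext a; refine Fin.cases ?_ (fun j => ?_) a
  · simp [jt, jt0, JJ_zero]
  · simp [jt, jt0]
lemma cont_jt0 (h : FS z) : Continuous (jt0 z) := continuous_pi fun a => by
  refine Fin.cases ?_ (fun j => ?_) a
  · simp only [jt0, Fin.cons_zero]; exact continuous_const
  · exact (h.JJ j.succ).cont
lemma symb {F : Y d → ℂ} (hF : Sm F) (hE : Elliptic d F) (ρ : ℝ) : ∃ c, 0 < c ∧ ∀ y : Y d, ‖y‖ ≤ ρ → ∀ n : Zd d,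
    c * ∑ i, (n i : ℝ) ^ 2 ≤ (∑ i, (n i : ℝ) ^ 2) + (∑ j, ∑ k, (((n j : ℝ) * (n k : ℝ) : ℝ) : ℂ) * wdP (Fin.succ j) (wdM (Fin.succ k) F) y).re
      - ‖∑ j, ∑ k, (((n j : ℝ) * (n k : ℝ) : ℝ) : ℂ) * wdM (Fin.succ j) (wdM (Fin.succ k) F) y‖ := by
  obtain ⟨c₁, h1, c₂, h2, H⟩ := hE
  choose M hM0 hM using fun p : Fin d × Fin d => sm_bound ((hF.wdM p.2.succ).wdP p.1.succ).continuous ρ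
  set MM := ∑ p, M p with hMM
  have hMM0 : 0 ≤ MM := sum_nonneg fun p _ => hM0 p
  have hMle : ∀ p, M p ≤ MM := fun p => single_le_sum (fun p _ => hM0 p) (mem_univ p)
  refine ⟨c₂ / (2 * (1 + d * MM)), by positivity, fun y hy n => ?_⟩
  by_cases hn : n = 0
  · simp [hn]
  obtain ⟨A1, A2⟩ := H (fun i => (n i : ℝ)) y
  have hne : (fun i => (n i : ℝ)) ≠ (0 : Vec d) := fun h => hn (by ext i; simpa using congrFun h i)
  have A2 := A2 hne
  set s := ∑ i, (n i : ℝ) ^ 2 with hs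
  have hs0 : 0 < s := by
    obtain ⟨i, hi⟩ := Function.ne_iff.1 hne
    have : 0 < (n i : ℝ) ^ 2 := (sq_nonneg _).lt_of_ne' (pow_ne_zero 2 hi)
    exact this.trans_le (single_le_sum (f := fun i => (n i : ℝ) ^ 2) (fun i _ => by positivity) (mem_univ i))
  set a := (∑ j, ∑ k, (((n j : ℝ) * (n k : ℝ) : ℝ) : ℂ) * wdP (Fin.succ j) (wdM (Fin.succ k) F) y).re with ha
  have e1 : (∑ j, ∑ k, (((n j : ℝ) * (n k : ℝ) : ℝ) : ℂ) * ((if j = k then 1 else 0) + wdP (Fin.succ j) (wdM (Fin.succ k) F) y)).re = s + a := by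
    simp only [mul_add, sum_add_distrib, add_re, ← ha]
    congr 1
    simp only [mul_ite, mul_one, mul_zero, Finset.sum_ite_eq, mem_univ, if_true, Complex.re_sum, ofReal_re, hs, sq]
  rw [e1] at A1
  have hA : 0 < s + a := lt_of_lt_of_le PO A1
  have haM : a ≤ d * MM * s := by
    calc a ≤ ∑ j, ∑ k, ((n j : ℝ) ^ 2 + (n k : ℝ) ^ 2) / 2 * MM := by
          rw [ha]; refine (Complex.re_le_norm _).trans ((norm_sum_le _ _).trans (sum_le_sum fun j _ => (norm_sum_le _ _).trans (sum_le_sum fun k _ => ?_)))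
          rw [norm_mul, norm_real, Real.norm_eq_abs, abs_mul]
          refine mul_le_mul ?_ ((hM (j, k) y hy).trans (hMle _)) (norm_nonneg _) PO
          nlinarith [sq_nonneg (|(n j : ℝ)| - |(n k : ℝ)|), sq_abs (n j : ℝ), sq_abs (n k : ℝ)]
      _ = d * MM * s := by
          simp only [← sum_mul, ← Finset.sum_div, sum_add_distrib, Finset.sum_const, Finset.card_univ, Fintype.card_fin, nsmul_eq_mul, ← mul_sum, ← hs]; ring
  refine ell_num hs0 hA LA (norm_nonneg _) h2 ?_
  rwa [add_div, div_self hs0.ne']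
lemma hE_gF {F : Y d → ℂ} (hF : Sm F) (hE : Elliptic d F) (ρ : ℝ) : ∃ c, 0 < c ∧ ∃ K, 0 ≤ K ∧ ∀ y : Y d, ‖y‖ ≤ ρ → ∀ z, FS z →
    c * (∫ x in box d, ‖jt z x‖ ^ 2) - K * (∫ x in box d, ‖S z x‖ ^ 2) ≤ ∫ x in box d, QQ (gF F) y (jt z x) (jt z x) := by
  obtain ⟨c, hc, H⟩ := symb hF hE ρ
  obtain ⟨C, hC, hC1, -⟩ := QQ_bd (fun b => Sm_gF hF b) ρ
  refine ⟨c / 2, by positivity, (2 * C) ^ 2 / (c / 2) + C + c / 2, by positivity, fun y hy z hz => ?_⟩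
  obtain ⟨B0, hB0⟩ := hz
  classical
  set B := B0 ∪ B0.image (fun n => -n) with hBd
  have hB : Supp B z := fun n hn => hB0 n fun h => hn (Finset.mem_union_left _ h)
  have hBn : ∀ n, n ∈ B → -n ∈ B := fun n hn => by
    rcases Finset.mem_union.1 hn with h | h
    · exact Finset.mem_union_right _ (Finset.mem_image_of_mem _ h)
    · obtain ⟨m, hm, rfl⟩ := Finset.mem_image.1 h
      rw [neg_neg]; exact Finset.mem_union_left _ hm
  have hz : FS z := ⟨B, hB⟩
  set p := fun j k : Fin d => wdP (Fin.succ j) (wdM (Fin.succ k) F) y with hp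
  set m := fun j k : Fin d => wdM (Fin.succ j) (wdM (Fin.succ k) F) y with hm
  set h : Fin (d+1) → VC d := Fin.cons (fun _ => 0) (fun k x => ∑ j, (p j k * S (JJ j.succ z) x + m j k * S (starSeq (JJ j.succ z)) x) + S (JJ k.succ z) x) with hh
  have c1 : ∀ j k, Continuous fun x => p j k * S (JJ j.succ z) x := fun j k => continuous_const.mul (hz.JJ j.succ).cont
  have c2 : ∀ j k, Continuous fun x => m j k * S (starSeq (JJ j.succ z)) x := fun j k => continuous_const.mul (hz.JJ j.succ).star.cont
  have c3 : ∀ j k, Continuous fun x => p j k * S (JJ j.succ z) x + m j k * S (starSeq (JJ j.succ z)) x := fun j k => (c1 j k).add (c2 j k)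
  have c12 : ∀ k, Continuous fun x => ∑ j, (p j k * S (JJ j.succ z) x + m j k * S (starSeq (JJ j.succ z)) x) := fun k => continuous_finsetSum _ fun j _ => c3 j k
  have hhc : ∀ a, Continuous (h a) := fun a => by
    refine Fin.cases ?_ (fun k => ?_) a
    · exact continuous_const
    · exact (c12 k).add (hz.JJ k.succ).cont
  have epr : ∀ x, ipr (fun b => h b x) (jt z x) = QQ (gF F) y (jt0 z x) (jt0 z x) := fun x => by
    simp only [QQ, ipr, Fin.sum_univ_succ]
    congr 1
    · simp [hh, jt0]
    · refine sum_congr rfl fun k _ => ?_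
      congr 2
      rw [fd_gF hF, fderiv_wd, Fin.sum_univ_succ]
      simp [hh, jt0, S_star, hp, hm]
  have hf : ∀ k n, fCoeff (h k.succ) n = ∑ j, (p j k * (I * n j * z n) + m j k * (I * n j * cJ (z (-n)))) + I * n k * z n := fun k n => by
    simp only [hh, Fin.cons_succ]
    rw [fCoeff_add (c12 k) (hz.JJ k.succ).cont, fCoeff_sum _ _ fun j _ => c3 j k]
    simp only [Pi.add_apply]
    congr 1
    · refine sum_congr rfl fun j _ => ?_
      rw [fCoeff_add (c1 j k) (c2 j k), fCoeff_smul, fCoeff_smul, fCoeff_S (hz.JJ j.succ).summ, fCoeff_S (hz.JJ j.succ).star.summ]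
      simp [JJ, starSeq, mu_succ]
    · rw [fCoeff_S (hz.JJ k.succ).summ]; rfl
  have key := Dv_pair hB hhc
  simp only [epr] at key
  have low : c * ∑ n ∈ B, (∑ i, (n i : ℝ) ^ 2) * ‖z n‖ ^ 2 ≤ ∑ n ∈ B, (Dv h n * cJ (z n)).re := by
    set β := fun n : Zd d => ∑ j, ∑ k, (((n j : ℝ) * (n k : ℝ) : ℝ) : ℂ) * m j k with hβ
    set α := fun n : Zd d => ∑ j, ∑ k, (((n j : ℝ) * (n k : ℝ) : ℝ) : ℂ) * p j k with hα
    have e : ∀ n, Dv h n * cJ (z n) = (((∑ i, (n i : ℝ) ^ 2 : ℝ) : ℂ) + α n) * (‖z n‖ ^ 2 : ℝ) + β n * (cJ (z n) * cJ (z (-n))) := fun n => by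
      have e0 : ((‖z n‖ ^ 2 : ℝ) : ℂ) = z n * cJ (z n) := by rw [mul_conj, normSq_eq_norm_sq]
      have e00 : fCoeff (h 0) n = 0 := by simp [hh, fCoeff_eq]
      rw [e0, Dv, Fin.sum_univ_succ, e00]
      simp only [hf, mu_succ, hα, hβ]
      rw [sum_comm (f := fun j k => (((n j : ℝ) * (n k : ℝ) : ℝ) : ℂ) * p j k), sum_comm (f := fun j k => (((n j : ℝ) * (n k : ℝ) : ℝ) : ℂ) * m j k)]
      rw [Complex.ofReal_sum, mul_zero, zero_add, ← sum_add_distrib, sum_mul, sum_mul, sum_mul, ← sum_add_distrib]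
      refine sum_congr rfl fun k _ => ?_
      simp only [map_mul, Complex.conj_I, map_intCast, mul_add, add_mul, sum_mul, mul_sum, sum_add_distrib]
      have hI : ∀ q : ℂ, I * (I * q) = -q := fun q => by rw [← mul_assoc, I_mul_I]; ring
      rw [show ∀ A B D A' B' D' : ℂ, A = A' → B = B' → D = D' → A + B + D = D' + A' + B' from fun A B D A' B' D' h h' h'' => by rw [h, h', h'']; ring]
      · refine sum_congr rfl fun j _ => ?_
        push_cast; linear_combination (-(n k : ℂ) * p j k * n j * z n * cJ (z n)) * I_mul_I
      · refine sum_congr rfl fun j _ => ?_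
        push_cast; linear_combination (-(n k : ℂ) * m j k * n j * cJ (z (-n)) * cJ (z n)) * I_mul_I
      · push_cast; linear_combination (-(n k : ℂ) * n k * z n * cJ (z n)) * I_mul_I
    have hβn : ∀ n, β (-n) = β n := fun n => by simp [hβ]
    have lb : ∀ n ∈ B, ((∑ i, (n i : ℝ) ^ 2) + (α n).re) * ‖z n‖ ^ 2 - ‖β n‖ * (‖z n‖ ^ 2 / 2) - ‖β n‖ * (‖z (-n)‖ ^ 2 / 2) ≤ (Dv h n * cJ (z n)).re := fun n _ => by
      rw [e n, add_re, Complex.re_mul_ofReal, add_re, ofReal_re]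
      have h1 := (abs_le.1 (abs_re_le_norm (β n * (cJ (z n) * cJ (z (-n)))))).1
      rw [norm_mul, norm_mul, RCLike.norm_conj, RCLike.norm_conj] at h1
      have h2 : ‖β n‖ * (‖z n‖ * ‖z (-n)‖) ≤ ‖β n‖ * (‖z n‖ ^ 2 / 2 + ‖z (-n)‖ ^ 2 / 2) := mL (by nlinarith [sq_nonneg (‖z n‖ - ‖z (-n)‖)]) (norm_nonneg _)
      linarith
    refine le_trans ?_ (sum_le_sum lb)
    rw [sum_sub_distrib, sum_sub_distrib]
    have sw : ∑ n ∈ B, ‖β n‖ * (‖z (-n)‖ ^ 2 / 2) = ∑ n ∈ B, ‖β n‖ * (‖z n‖ ^ 2 / 2) :=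
      Finset.sum_bij' (fun n _ => -n) (fun n _ => -n) (fun n hn => hBn n hn) (fun n hn => hBn n hn) (fun n _ => neg_neg n) (fun n _ => neg_neg n) (fun n _ => by rw [hβn])
    rw [sw, ← sum_sub_distrib, ← sum_sub_distrib, mul_sum]
    refine sum_le_sum fun n _ => ?_
    have := mR (H y hy n) (sq_nonneg ‖z n‖)
    calc _ = _ := (mul_assoc _ _ _).symm
      _ ≤ _ := this
      _ = _ := by ring
  rw [key] at low
  have pv : ∑ n ∈ B, (∑ i, (n i : ℝ) ^ 2) * ‖z n‖ ^ 2 = ∫ x in box d, ∑ j : Fin d, ‖S (JJ j.succ z) x‖ ^ 2 := by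
    rw [I_sum _ fun j _ => (hz.JJ j.succ).cont.norm.pow 2]
    simp only [parseval (hB.JJ _)]
    rw [sum_comm]
    refine sum_congr rfl fun n _ => ?_
    rw [sum_mul]
    refine sum_congr rfl fun j _ => ?_
    simp [JJ, mu_succ, mul_pow]
  rw [pv] at low
  have cw : Continuous fun x => ‖S z x‖ ^ 2 := hz.cont.norm.pow 2
  have cs : Continuous fun x => ∑ j : Fin d, ‖S (JJ j.succ z) x‖ ^ 2 := continuous_finsetSum _ fun j _ => (hz.JJ j.succ).cont.norm.pow 2
  have cQ0 : Continuous fun x => QQ (gF F) y (jt0 z x) (jt0 z x) := by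
    have : Continuous fun x => ipr (fun b => h b x) (jt z x) := cont_ipr (continuous_pi hhc) (cont_jt hz)
    rwa [funext epr] at this
  have fin : (∫ x in box d, (c / 2 * ‖jt z x‖ ^ 2 - ((2 * C) ^ 2 / (c / 2) + C + c / 2) * ‖S z x‖ ^ 2 + QQ (gF F) y (jt0 z x) (jt0 z x))) ≤ ∫ x in box d, (QQ (gF F) y (jt z x) (jt z x) + c * ∑ j : Fin d, ‖S (JJ j.succ z) x‖ ^ 2) := by
    refine I_mono (((continuous_const.mul ((cont_jt hz).norm.pow 2)).sub (continuous_const.mul cw)).add cQ0) ((cont_QQ0 _ y hz hz).add (continuous_const.mul cs)) fun x => ?_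
    set t := ‖jt0 z x‖
    set w := ‖S z x‖
    have n1 : ‖(Pi.single 0 (S z x) : Y d)‖ = w := by rw [Pi.norm_single]
    have ht : t ^ 2 ≤ ∑ j : Fin d, ‖S (JJ j.succ z) x‖ ^ 2 := by
      have s0 : 0 ≤ ∑ j : Fin d, ‖S (JJ j.succ z) x‖ ^ 2 := sum_nonneg fun j _ => by positivity
      refine (Real.le_sqrt (norm_nonneg _) s0).1 ((pi_norm_le_iff_of_nonneg (sqrt_nonneg _)).2 fun i => ?_)
      refine Fin.cases ?_ (fun j => ?_) i
      · simp [jt0]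
      · exact le_sqrt_of_sq_le (single_le_sum (f := fun j : Fin d => ‖S (JJ j.succ z) x‖ ^ 2) (fun j _ => by positivity) (mem_univ j))
    have hj : ‖jt z x‖ ^ 2 ≤ t ^ 2 + w ^ 2 := by
      refine (Real.le_sqrt (norm_nonneg _) PO).1 ((pi_norm_le_iff_of_nonneg (sqrt_nonneg _)).2 fun i => ?_)
      refine Fin.cases ?_ (fun j => ?_) i
      · exact le_sqrt_of_sq_le (by simp [jt, JJ_zero, w]; positivity)
      · refine le_sqrt_of_sq_le ((pow_le_pow_left₀ (norm_nonneg _) (norm_le_pi_norm (jt0 z x) j.succ) 2).trans ?_)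
        have := sq_nonneg w; linarith
    rw [jt_eq z x, QQ_add, QQ_add', QQ_add', ← jt_eq]
    have q1 := hC1 y (jt0 z x) (Pi.single 0 (S z x)) hy
    have q2 := hC1 y (Pi.single 0 (S z x)) (jt0 z x) hy
    have q3 := hC1 y (Pi.single 0 (S z x)) (Pi.single 0 (S z x)) hy
    rw [n1] at q1 q2 q3
    have yg := young (a := t) (b := 2 * C * w) (e := c / 2) PO
    have a1 := (abs_le.1 q1).1
    have a2 := (abs_le.1 q2).1
    have a3 := (abs_le.1 q3).1
    have h1 := mL hj (by positivity : 0 ≤ c / 2)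
    have h2 := mL ht hc.le
    have e3 : (2 * C * w) ^ 2 / (c / 2) = (2 * C) ^ 2 / (c / 2) * w ^ 2 := by ring
    rw [e3] at yg
    linarith
  rw [I_add, I_sub, I_add (h := fun x => c * _) (cont_QQ0 _ y hz hz) (continuous_const.mul cs), integral_const_mul, integral_const_mul, integral_const_mul] at fin
  · linarith
  · exact continuous_const.mul ((cont_jt hz).norm.pow 2)
  · exact continuous_const.mul cw
  · exact (continuous_const.mul ((cont_jt hz).norm.pow 2)).sub (continuous_const.mul cw)
  · exact cQ0
lemma garding {F : Y d → ℂ} (hF : Sm F) (hE : Elliptic d F) (R : ℝ) : ∃ c, 0 < c ∧ ∃ K, 0 ≤ K ∧ ∀ u z, FS u → FS z → HB (d+2) R u →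
    c * (∫ x in box d, ‖jt z x‖ ^ 2) - K * (∫ x in box d, ‖S z x‖ ^ 2) ≤ ∫ x in box d, QQ (gF F) (jt u x) (jt z x) (jt z x) :=
  garding_gen (fun b => Sm_gF hF b) (hE_gF hF hE) R
def CD (u : ℝ → Seq d) (u' : Seq d) (t : ℝ) : Prop := ∀ n, HasDerivAt (fun s => u s n) (u' n) t
lemma CD.supp {u : ℝ → Seq d} {u' : Seq d} {t : ℝ} (h : CD u u' t) (hB : ∀ s, Supp B (u s)) : Supp B u' := fun n hn => by
  have := h n
  simp only [fun s => hB s n hn] at this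
  exact this.unique (hasDerivAt_const t 0)
lemma FS.neg (h : FS c) : FS (-c) := let ⟨B, h⟩ := h; ⟨B, fun n hn => by simp [h n hn]⟩
lemma FS.sub {c e : Seq d} (h : FS c) (h' : FS e) : FS (c - e) := by rw [sub_eq_add_neg]; exact h.add h'.neg
lemma FS_PB (B : FZ d) (c : Seq d) : FS (PB B c) := ⟨B, Supp_PB B c⟩
lemma jt_sub {a b : Seq d} (ha : FS a) (hb : FS b) (x : Vec d) : jt (a - b) x = jt a x - jt b x := by
  ext i
  have e : JJ i (a - b) = JJ i a - JJ i b := by ext n; simp [JJ, mul_sub]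
  simp only [jt, Pi.sub_apply, e]
  exact S_sub (ha.JJ i).summ (hb.JJ i).summ x
lemma jt_fin (h : Supp B z) (x : Vec d) : ‖jt z x‖ ≤ ∑ k ∈ B, kap d * jb k * ‖z k‖ := by
  have kp := (kap_pos (d := d)).le
  refine (pi_norm_le_iff_of_nonneg (sum_nonneg fun k _ => mul_nonneg (mul_nonneg kp (jb_pos k).le) (norm_nonneg _))).2 fun a => ?_
  rw [jt, S_fin (h.JJ a)]
  refine (norm_sum_le _ _).trans (sum_le_sum fun k _ => ?_)
  rw [norm_mul, norm_mul, norm_ee, mul_one, JJ, norm_mul, norm_real, Real.norm_of_nonneg kp, ← mul_assoc]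
  exact mR (mL (norm_mu_le a k) kp) (norm_nonneg _)
lemma lipH {H : Y d → ℂ} (hH : Sm H) (ρ : ℝ) : ∃ C, 0 ≤ C ∧ ∀ y y', ‖y‖ ≤ ρ → ‖y'‖ ≤ ρ → ‖H y - H y'‖ ≤ C * ‖y - y'‖ := by
  obtain ⟨M, hM⟩ := (isCompact_closedBall (0 : Y d) ρ).exists_bound_of_continuousOn (hH.continuous_fderiv (by simp)).continuousOn
  refine ⟨max M 0, le_max_right _ _, fun y y' hy hy' => ?_⟩
  exact (convex_closedBall (0 : Y d) ρ).norm_image_sub_le_of_norm_fderiv_le (𝕜 := ℝ) (fun z _ => hH.diff z)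
    (fun z hz => (hM z hz).trans (le_max_left _ _)) (by simpa using hy') (by simpa using hy)
lemma dt_jt {u : ℝ → Seq d} {u' : Seq d} {t : ℝ} (hB : ∀ s, Supp B (u s)) (h : CD u u' t) (x : Vec d) :
    HasDerivAt (fun s => jt (u s) x) (jt u' x) t := by
  refine hasDerivAt_pi.2 fun a => ?_
  simp only [jt, S_fin ((hB _).JJ a), S_fin ((h.supp hB).JJ a), JJ]
  refine HasDerivAt.fun_sum fun n _ => (((h n).const_mul _).const_mul _).mul_const _
lemma dt_comp {H : Y d → ℂ} (hH : Sm H) {u : ℝ → Seq d} {u' : Seq d} {t : ℝ} (hB : ∀ s, Supp B (u s)) (h : CD u u' t) :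
    CD (fun s => fCoeff fun x => H (jt (u s) x)) (fCoeff fun x => fderiv ℝ H (jt (u t) x) (jt u' x)) t := by
  intro n
  simp only [fCoeff_eq]
  refine HasDerivAt.const_mul _ ?_
  have hb := h.supp hB
  have c1 : ∀ s, Continuous fun x => H (jt (u s) x) * ee (-n) x := fun s => (cont_cp hH ⟨B, hB s⟩).mul (cont_ee _)
  have c2 : Continuous fun x => fderiv ℝ H (jt (u t) x) (jt u' x) * ee (-n) x := (cont_lin hH ⟨B, hB t⟩ ⟨B, hb⟩).mul (cont_ee _)
  have kp := (kap_pos (d := d)).le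
  obtain ⟨K, hK⟩ : ∃ K : ℝ, ∀ᶠ s in nhds t, ∑ k ∈ B, kap d * jb k * ‖(u s - u t) k‖ ≤ K * ‖s - t‖ := by
    have : (fun s => ∑ k ∈ B, kap d * jb k * ‖(u s - u t) k‖) =O[nhds t] fun s => s - t := by
      refine Asymptotics.IsBigO.fun_sum fun k _ => ?_
      exact ((h k).isBigO_sub.norm_left).const_mul_left _
    obtain ⟨K, hK⟩ := this.bound
    refine ⟨K, hK.mono fun s hs => (le_abs_self _).trans hs⟩
  obtain ⟨ε, he, hε⟩ := Metric.eventually_nhds_iff.1 hK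
  set ρ := (∑ k ∈ B, kap d * jb k * ‖u t k‖) + |K| * ε
  obtain ⟨C, hC, hL⟩ := lipH hH ρ
  have s0 : 0 ≤ |K| * ε := by positivity
  have j0 : ∀ x, ‖jt (u t) x‖ ≤ ρ := fun x => (jt_fin (hB t) x).trans (le_add_of_nonneg_right s0)
  have jd : ∀ s ∈ Metric.ball t ε, ∀ x, ‖jt (u s) x - jt (u t) x‖ ≤ |K| * ‖s - t‖ := fun s hs x => by
    rw [← jt_sub ⟨B, hB s⟩ ⟨B, hB t⟩]
    refine (jt_fin (B := B) (fun n hn => by simp [hB s n hn, hB t n hn]) x).trans ((hε hs).trans ?_)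
    exact mR (le_abs_self K) (norm_nonneg _)
  have js : ∀ s ∈ Metric.ball t ε, ∀ x, ‖jt (u s) x‖ ≤ ρ := fun s hs x => by
    have a1 := jd s hs x
    have a2 : ‖s - t‖ ≤ ε := by rw [← dist_eq_norm]; exact (Metric.mem_ball.1 hs).le
    have a3 := norm_le_norm_add_norm_sub' (jt (u s) x) (jt (u t) x)
    have a4 := jt_fin (hB t) x
    have a5 := mL a2 (abs_nonneg K)
    simp only [ρ]; linarith
  have key := hasFDerivAt_integral_of_dominated_loc_of_lip' (μ := volume.restrict (box d)) (𝕜 := ℝ) (F := fun s x => H (jt (u s) x) * ee (-n) x)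
    (F' := fun x => ContinuousLinearMap.toSpanSingleton ℝ (fderiv ℝ H (jt (u t) x) (jt u' x) * ee (-n) x)) (bound := fun _ => C * |K|)
    (Metric.ball_mem_nhds t he) (fun s _ => (c1 s).aestronglyMeasurable) (intB (c1 t))
    ((ContinuousLinearMap.toSpanSingletonCLE (𝕜 := ℝ) (E := ℂ)).continuous.comp c2).aestronglyMeasurable
    (Eventually.of_forall fun x s hs => ?_) (intB continuous_const) (Eventually.of_forall fun x => ?_)
  · have k2 := key.2.hasDerivAt
    rw [ContinuousLinearMap.integral_apply key.1] at k2
    simpa using k2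
  · rw [← sub_mul, norm_mul, norm_ee, mul_one, mul_assoc]
    exact (hL _ _ (js s hs x) (j0 x)).trans (mL (jd s hs x) hC)
  · have := ((hH.diff (jt (u t) x)).hasFDerivAt.comp_hasDerivAt t (dt_jt hB h x)).mul_const (ee (-n) x)
    exact this.hasFDerivAt
lemma dt_lin {H : Y d → ℂ} (hH : Sm H) {u z : ℝ → Seq d} {u' z' : Seq d} {t : ℝ} (hB : ∀ s, Supp B (u s)) (h : CD u u' t)
    (hz : ∀ s, Supp B (z s)) (h' : CD z z' t) :
    CD (fun s => fCoeff fun x => fderiv ℝ H (jt (u s) x) (jt (z s) x)) (fCoeff (fun x => d2 H (jt (u t) x) (jt u' x) (jt (z t) x)) +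
      fCoeff (fun x => fderiv ℝ H (jt (u t) x) (jt z' x))) t := by
  intro n
  have hb := h.supp hB
  have hzb := h'.supp hz
  classical
  have hS : ∀ (z : Seq d), Supp B z → ∀ α, Supp (B ∪ B.image (fun n => -n)) (JC α z) := fun z hz α n hn => by
    simp only [Finset.mem_union, not_or] at hn
    have : z (-n) = 0 := hz _ fun h => hn.2 (Finset.mem_image.2 ⟨-n, h, by simp⟩)
    simp [JC, JJ, starSeq, hz n hn.1, this]
  have fs : ∀ s, FS (u s) := fun s => ⟨B, hB s⟩
  have fz : ∀ s, FS (z s) := fun s => ⟨B, hz s⟩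
  have e1 : ∀ s, fCoeff (fun x => fderiv ℝ H (jt (u s) x) (jt (z s) x)) n = ∑ α, kap d * ∑ k ∈ B ∪ B.image (fun n => -n),
      fCoeff (fun x => dv α H (jt (u s) x)) (n - k) * JC α (z s) k := fun s => by
    rw [fC_lin hH (fs s) (fz s)]
    exact sum_congr rfl fun α _ => fCoeff_mul_S (hS _ (hz s) α) (cont_cp (hH.dv α) (fs s)) n
  simp only [e1]
  have e2 : fCoeff (fun x => d2 H (jt (u t) x) (jt u' x) (jt (z t) x)) n = ∑ α, kap d * ∑ k ∈ B ∪ B.image (fun n => -n),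
      fCoeff (fun x => fderiv ℝ (dv α H) (jt (u t) x) (jt u' x)) (n - k) * JC α (z t) k := by
    have : ∀ x, d2 H (jt (u t) x) (jt u' x) (jt (z t) x) = ∑ α, fderiv ℝ (dv α H) (jt (u t) x) (jt u' x) * S (JC α (z t)) x := fun x => by
      rw [d2_expand hH]; refine sum_congr rfl fun α _ => ?_
      rw [fderiv_expand, sum_mul, S_JC (fz t)]
    simp only [this]
    rw [fCoeff_sum univ (fun (α : Ix d) x => fderiv ℝ (dv α H) (jt (u t) x) (jt u' x) * S (JC α (z t)) x) fun α _ => (cont_lin (hH.dv α) (fs t) ⟨B, hb⟩).mul (cont_S' (fz t) α)]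
    exact sum_congr rfl fun α _ => fCoeff_mul_S (hS _ (hz t) α) (cont_lin (hH.dv α) (fs t) ⟨B, hb⟩) n
  have e3 : fCoeff (fun x => fderiv ℝ H (jt (u t) x) (jt z' x)) n = ∑ α, kap d * ∑ k ∈ B ∪ B.image (fun n => -n),
      fCoeff (fun x => dv α H (jt (u t) x)) (n - k) * JC α z' k := by
    rw [fC_lin hH (fs t) ⟨B, hzb⟩]
    exact sum_congr rfl fun α _ => fCoeff_mul_S (hS _ hzb α) (cont_cp (hH.dv α) (fs t)) n
  rw [Pi.add_apply, e2, e3, ← sum_add_distrib]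
  refine HasDerivAt.fun_sum fun α _ => ?_
  rw [← mul_add, ← sum_add_distrib]
  refine HasDerivAt.const_mul _ (HasDerivAt.fun_sum fun k _ => ?_)
  refine (dt_comp (hH.dv α) hB h (n - k)).mul ?_
  exact ((h' k).const_mul _ |>.const_mul _).add ((conjCLE.hasFDerivAt.comp_hasDerivAt t ((h' (-k)).const_mul _)).const_mul _)
def GG (g : GY d) (u : Seq d) : Seq d := Dv fun b x => g b (jt u x)
def AA (g : GY d) (u z : Seq d) : Seq d := Dv fun b x => fderiv ℝ (g b) (jt u x) (jt z x)
def DA (g : GY d) (u v z : Seq d) : Seq d := Dv fun b x => d2 (g b) (jt u x) (jt v x) (jt z x)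
def ip (B : FZ d) (a b : Seq d) : ℝ := ∑ n ∈ B, (a n * cJ (b n)).re
lemma GG_est (hg : ∀ b, Sm (g b)) (hm : -1 ≤ m) (h1 : m + 2 ≤ L) (h2 : 2 * d + 2 ≤ L) (R : ℝ) :
    ∃ C, 0 ≤ C ∧ ∀ u, FS u → HB L R u → HB m C (GG g u) := by
  choose C hC H using fun b => comp_est h2 (m := m + 1) LA LA (hg b) R
  exact ⟨∑ b, C b, sum_nonneg fun b _ => hC b, fun u hu hR => HB.Dv fun b => H b u hu hR⟩
lemma AA_est (hg : ∀ b, Sm (g b)) (hm : -1 ≤ m) (h1 : m + 2 ≤ L) (h2 : 2 * d + 2 ≤ L) (R : ℝ) :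
    ∃ C, 0 ≤ C ∧ ∀ u z y, FS u → FS z → HB L R u → HB (m+2) y z → HB m (C * y) (AA g u z) := by
  choose C hC H using fun b => lin_est (m := m + 1) LA LA h2 (hg b) R
  refine ⟨∑ b, C b, sum_nonneg fun b _ => hC b, fun u z y hu hz hR hy => ?_⟩
  rw [sum_mul]
  exact HB.Dv fun b => H b u z y hu hz hR (by convert hy using 1; ring)
lemma DA_est (hg : ∀ b, Sm (g b)) (hm : -1 ≤ m) (h1 : m + 2 ≤ L) (h2 : 2 * d + 2 ≤ L) (R : ℝ) :
    ∃ C, 0 ≤ C ∧ ∀ u v z y, FS u → FS v → FS z → HB L R u → HB L R v → HB (m+2) y z → HB m (C * y) (DA g u v z) := by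
  choose C hC H using fun b => bil_est (m := m + 1) LA LA h2 (hg b) R
  refine ⟨∑ b, C b, sum_nonneg fun b _ => hC b, fun u v z y hu hv hz hR hv' hy => ?_⟩
  rw [sum_mul]
  exact HB.Dv fun b => H b u v z y hu hv hz hR hv' (by convert hy using 1; ring)
lemma DA_tame (hg : ∀ b, Sm (g b)) (hm : -1 ≤ m) (h1 : m + 2 ≤ L) (h2 : 2 * d + 2 ≤ L) (R : ℝ) :
    ∃ C, 0 ≤ C ∧ ∀ u v z y, FS u → FS v → FS z → HB L R u → HB (d+1) R v → HB (d+1) R z → HB (m+2) y v → HB (m+2) y z →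
      HB m (C * y) (DA g u v z) := by
  choose C hC H using fun b => bil_tame (m := m + 1) LA LA h2 (hg b) R
  refine ⟨∑ b, C b * 2, sum_nonneg fun b _ => mul_nonneg (hC b) zero_le_two, fun u v z y hu hv hz hR hv' hz' hy hy' => ?_⟩
  rw [sum_mul]
  exact HB.Dv fun b => (H b u v z y y hu hv hz hR hv' hz' (by convert hy using 1; ring) (by convert hy' using 1; ring)).mono (le_of_eq (by ring))
lemma dt_GG (hg : ∀ b, Sm (g b)) {u : ℝ → Seq d} {u' : Seq d} {t : ℝ} (hB : ∀ s, Supp B (u s)) (h : CD u u' t) :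
    CD (fun s => GG g (u s)) (AA g (u t) u') t :=
  fun n => by unfold GG AA Dv; exact HasDerivAt.fun_sum fun b _ => (dt_comp (hg b) hB h n).const_mul _
lemma dt_AA (hg : ∀ b, Sm (g b)) {u z : ℝ → Seq d} {u' z' : Seq d} {t : ℝ} (hB : ∀ s, Supp B (u s)) (h : CD u u' t)
    (hz : ∀ s, Supp B (z s)) (h' : CD z z' t) :
    CD (fun s => AA g (u s) (z s)) (DA g (u t) u' (z t) + AA g (u t) z') t := fun n => by
  have : (DA g (u t) u' (z t) + AA g (u t) z') n = ∑ b, cJ (mu b n) * (fCoeff (fun x => d2 (g b) (jt (u t) x) (jt u' x) (jt (z t) x)) +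
      fCoeff (fun x => fderiv ℝ (g b) (jt (u t) x) (jt z' x))) n := by
    simp only [Pi.add_apply, mul_add, sum_add_distrib]; rfl
  rw [this]
  unfold AA Dv
  exact HasDerivAt.fun_sum fun b _ => (dt_lin (hg b) hB h hz h' n).const_mul _
lemma CD.PB {u : ℝ → Seq d} {u' : Seq d} {t : ℝ} (h : CD u u' t) (B : FZ d) : CD (fun s => PB B (u s)) (PB B u') t := fun n => by
  by_cases hn : n ∈ B
  · simp only [PB_mem hn]; exact h n
  · simp only [fun c => Supp_PB B c n hn]; exact hasDerivAt_const _ _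
lemma CD.smul {u : ℝ → Seq d} {u' : Seq d} {t : ℝ} (h : CD u u' t) (a : ℂ) : CD (fun s n => a * u s n) (fun n => a * u' n) t :=
  fun n => (h n).const_mul a
lemma CD.sub {u v : ℝ → Seq d} {u' v' : Seq d} {t : ℝ} (h : CD u u' t) (h' : CD v v' t) : CD (fun s => u s - v s) (u' - v') t :=
  fun n => (h n).sub (h' n)
lemma dt_ip {u v : ℝ → Seq d} {u' v' : Seq d} {t : ℝ} (h : CD u u' t) (h' : CD v v' t) (B : FZ d) :
    HasDerivAt (fun s => ip B (u s) (v s)) (ip B u' (v t) + ip B (u t) v') t := by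
  simp only [ip, ← sum_add_distrib]
  refine HasDerivAt.fun_sum fun n _ => ?_
  have := (h n).mul (conjCLE.hasFDerivAt.comp_hasDerivAt t (h' n))
  have := reCLM.hasFDerivAt.comp_hasDerivAt t this
  convert this using 1
  · ext s; simp
  · simp
lemma ip_comm (a b : Seq d) : ip B a b = ip B b a := sum_congr rfl fun n _ => by simp; ring
lemma ip_add (a b c : Seq d) : ip B (a + b) c = ip B a c + ip B b c := by
  simp only [ip, ← sum_add_distrib]; exact sum_congr rfl fun n _ => by simp; ring
lemma ip_sub (a b c : Seq d) : ip B (a - b) c = ip B a c - ip B b c := by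
  simp only [ip, ← sum_sub_distrib]; exact sum_congr rfl fun n _ => by simp; ring
lemma ip_I (a : Seq d) : ip B (fun n => I * a n) a = 0 := sum_eq_zero fun n _ => by simp; ring
lemma ip_PB (a b : Seq d) : ip B (PB B a) b = ip B a b := sum_congr rfl fun n hn => by rw [PB_mem hn]
lemma ip_le {x y : ℝ} {a b : Seq d} (m : ℝ) (ha : HB (-m) x a) (hb : HB m y b) (B : FZ d) : |ip B a b| ≤ x * y := by
  have h1 : |ip B a b| ≤ ∑ n ∈ B, (jb n ^ (-m) * ‖a n‖) * (jb n ^ m * ‖b n‖) := by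
    refine (Finset.abs_sum_le_sum_abs _ _).trans (sum_le_sum fun n _ => ?_)
    refine (abs_re_le_norm _).trans (le_of_eq ?_)
    rw [norm_mul, RCLike.norm_conj, rpow_neg (jb_pos n).le]
    field_simp [(QLNLS.jw m n).ne']
  refine h1.trans (le_of_sq' ?_ (mul_nonneg ha.1 hb.1))
  refine (sum_mul_sq_le_sq_mul_sq _ _ _).trans ?_
  rw [mul_pow]
  exact mul_le_mul (ha.2 B) (hb.2 B) (sum_nonneg fun _ _ => sq_nonneg _) (sq_nonneg _)
lemma ip_self (a : Seq d) (m : ℝ) : ip B (Lam m a) (Lam m a) = ∑ n ∈ B, (jb n ^ m * ‖a n‖) ^ 2 :=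
  sum_congr rfl fun n _ => by
    rw [mul_conj, ofReal_re, normSq_eq_norm_sq, Lam, norm_mul, norm_real, Real.norm_of_nonneg (jw m n).le]
lemma HB_mvt {γ γ' : ℝ → Seq d} {b s t : ℝ} (hst : s ≤ t) (hb : 0 ≤ b) (hc : ∀ n, ContinuousOn (fun θ => γ θ n) (Icc s t))
    (hd : ∀ θ ∈ Ioo s t, CD γ (γ' θ) θ) (hH : ∀ θ ∈ Ioo s t, HB m b (γ' θ)) : HB m (b * (t - s)) (γ t - γ s) := by
  refine ⟨mul_nonneg hb LA, fun T => ?_⟩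
  rcases hst.eq_or_lt with rfl | hlt
  · simp
  set D := γ t - γ s
  set q := ∑ n ∈ T, (jb n ^ m * ‖D n‖) ^ 2
  have q0 : 0 ≤ q := sum_nonneg fun _ _ => sq_nonneg _
  have hD : HB m (√q) (PB T D) := ⟨sqrt_nonneg _, fun T' => by
    classical
    rw [sq_sqrt q0]
    calc _ ≤ ∑ n ∈ T' ∪ T, (jb n ^ m * ‖PB T D n‖) ^ 2 := sum_le_sum_of_subset_of_nonneg Finset.subset_union_left fun _ _ _ => sq_nonneg _
      _ = ∑ n ∈ T, (jb n ^ m * ‖PB T D n‖) ^ 2 := (Finset.sum_subset Finset.subset_union_right fun n _ hn => by simp [Supp_PB T D n hn]).symm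
      _ ≤ _ := le_of_eq (sum_congr rfl fun n hn => by rw [PB_mem hn])⟩
  have hf : ∀ θ ∈ Ioo s t, HasDerivAt (fun θ => ip T (Lam m (γ θ)) (Lam m (PB T D))) (ip T (Lam m (γ' θ)) (Lam m (PB T D))) θ := fun θ hθ => by
    have h1 : CD (fun θ => Lam m (γ θ)) (Lam m (γ' θ)) θ := fun n => (hd θ hθ n).const_mul _
    have := dt_ip h1 (fun n => hasDerivAt_const θ (Lam m (PB T D) n)) T
    convert this using 1
    simp [ip]
  have hc' : ContinuousOn (fun θ => ip T (Lam m (γ θ)) (Lam m (PB T D))) (Icc s t) := by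
    refine continuousOn_finsetSum _ fun n _ => Complex.continuous_re.comp_continuousOn ?_
    exact (continuousOn_const.mul (hc n)).mul continuousOn_const
  obtain ⟨θ, hθ, he⟩ := exists_hasDerivAt_eq_slope _ _ hlt hc' hf
  rw [eq_div_iff (sub_pos.2 hlt).ne', ← ip_sub] at he
  have e2 : ip T (Lam m (γ t) - Lam m (γ s)) (Lam m (PB T D)) = q := by
    have : ip T (Lam m (γ t) - Lam m (γ s)) (Lam m (PB T D)) = ip T (Lam m D) (Lam m D) := sum_congr rfl fun n hn => by
      simp only [Lam, PB_mem hn, Pi.sub_apply, D, ← mul_sub]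
    rw [this, ip_self]
  rw [e2] at he
  have h3 : |ip T (Lam m (γ' θ)) (Lam m (PB T D))| ≤ b * √q :=
    ip_le 0 (HB.jw (by simpa using hH θ hθ)) (HB.jw (by simpa using hD)) T
  have h4 : √q * √q ≤ b * (t - s) * √q := by
    rw [Real.mul_self_sqrt q0]
    refine he.symm.le.trans ?_
    calc _ ≤ b * √q * (t - s) := mR ((le_abs_self _).trans h3) (sub_pos.2 hlt).le
      _ = _ := by ring
  rw [← sq_sqrt q0]
  refine pow_le_pow_left₀ (sqrt_nonneg _) ?_ 2
  rcases (sqrt_nonneg q).eq_or_lt with h | h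
  · rw [← h]; exact mul_nonneg hb (sub_pos.2 hlt).le
  · exact le_of_mul_le_mul_right h4 h
lemma HB_lim {ι : Type*} {l : Filter ι} [l.NeBot] {γ : ι → Seq d} {b : ℝ} (h : ∀ n, Tendsto (fun i => γ i n) l (nhds (c n)))
    (hH : ∀ᶠ i in l, HB m b (γ i)) : HB m b c :=
  ⟨hH.exists.choose_spec.1, fun T => le_of_tendsto (tendsto_finsetSum T fun n _ => (((h n).norm.const_mul _).pow 2)) (hH.mono fun _ hi => hi.2 T)⟩
lemma HB.conv {R θ : ℝ} {a b : Seq d} (ha : HB m R a) (hb : HB m R b) (h0 : 0 ≤ θ) (h1 : θ ≤ 1) : HB m R (fun n => b n + (θ:ℂ) * (a n - b n)) := by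
  have := (hb.smul ((1 - θ : ℝ) : ℂ)).add (ha.smul (θ : ℂ))
  rw [norm_real, norm_real, Real.norm_of_nonneg h0, Real.norm_of_nonneg LA] at this
  refine HB.mono (b := (1 - θ) * R + θ * R) ?_ (le_of_eq (by ring))
  convert this using 1; ext n; simp; ring
lemma CD_line (a b : Seq d) (θ : ℝ) : CD (fun θ : ℝ => fun n => b n + (θ:ℂ) * (a n - b n)) (a - b) θ := fun n => by
  simpa using ((Complex.ofRealCLM.hasDerivAt (x := θ)).mul_const (a n - b n)).const_add (b n)
lemma FS.common {a b : Seq d} (ha : FS a) (hb : FS b) : ∃ B, Supp B a ∧ Supp B b := by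
  classical
  obtain ⟨B, h⟩ := ha; obtain ⟨B', h'⟩ := hb
  exact ⟨B ∪ B', fun n hn => h n fun h => hn (by simp [h]), fun n hn => h' n fun h => hn (by simp [h])⟩
lemma Lip (hg : ∀ b, Sm (g b)) (hm : -1 ≤ m) (h1 : m + 2 ≤ L) (h2 : 2 * d + 2 ≤ L) (R : ℝ) :
    ∃ C, 0 ≤ C ∧ ∀ a b y, FS a → FS b → HB L R a → HB L R b → HB (m+2) y (a - b) → HB m (C * y) (GG g a - GG g b) := by
  obtain ⟨C, hC, H⟩ := AA_est hg hm h1 h2 R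
  refine ⟨C, hC, fun a b y ha hb hR hR' hy => ?_⟩
  obtain ⟨B, hB, hB'⟩ := ha.common hb
  set γ : ℝ → Seq d := fun θ n => b n + (θ:ℂ) * (a n - b n)
  have hs : ∀ θ, Supp B (γ θ) := fun θ n hn => by simp [γ, hB n hn, hB' n hn]
  have hd := fun θ : ℝ => dt_GG hg hs (CD_line a b θ)
  have := HB_mvt (m := m) (b := C * y) zero_le_one (mul_nonneg hC hy.1) (fun n => fun θ _ => (hd θ n).continuousAt.continuousWithinAt)
    (fun θ _ => hd θ) fun θ hθ => H _ _ y ⟨B, hs θ⟩ (ha.sub hb) (hR.conv hR' hθ.1.le hθ.2.le) hy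
  have e1 : γ 1 = a := by ext n; simp [γ]
  have e0 : γ 0 = b := by ext n; simp [γ]
  simpa [e1, e0] using this
lemma jt_int (hz : Supp B z) :
    (∫ x in box d, ‖jt z x‖ ^ 2) ≤ hsNorm 1 z ^ 2 ∧ hsNorm 1 z ^ 2 ≤ (d + 1) * ∫ x in box d, ‖jt z x‖ ^ 2 := by
  have fz : FS z := ⟨B, hz⟩
  have cj : ∀ a, Continuous fun x => ‖S (JJ a z) x‖ ^ 2 := fun a => ((fz.JJ a).cont.norm).pow 2
  have e : hsNorm 1 z ^ 2 = ∫ x in box d, ∑ a, ‖S (JJ a z) x‖ ^ 2 := by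
    rw [I_sum _ fun a _ => cj a, hz.normSq]
    simp only [fun a => parseval (hz.JJ a)]
    rw [sum_comm]
    refine sum_congr rfl fun n _ => ?_
    simp only [JJ, norm_mul, mul_pow, ← sum_mul, Real.rpow_one, jb_sq, Fin.sum_univ_succ, mu_zero, mu_succ]
    simp
  have c1 : Continuous fun x => ‖jt z x‖ ^ 2 := ((cont_jt fz).norm).pow 2
  have c2 : Continuous fun x => ∑ a, ‖S (JJ a z) x‖ ^ 2 := continuous_finsetSum _ fun a _ => cj a
  constructor
  · rw [e]
    refine I_mono c1 c2 fun x => ?_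
    have h0 : 0 ≤ ∑ a, ‖S (JJ a z) x‖ ^ 2 := sum_nonneg fun _ _ => sq_nonneg _
    have : ‖jt z x‖ ≤ √(∑ a, ‖S (JJ a z) x‖ ^ 2) := (pi_norm_le_iff_of_nonneg (sqrt_nonneg _)).2 fun a =>
      le_sqrt_of_sq_le (single_le_sum (f := fun a => ‖S (JJ a z) x‖ ^ 2) (fun _ _ => sq_nonneg _) (mem_univ a))
    calc _ ≤ _ := pow_le_pow_left₀ (norm_nonneg _) this 2
      _ = _ := sq_sqrt h0
  · rw [e, ← integral_const_mul]
    refine I_mono c2 (continuous_const.mul c1) fun x => ?_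
    calc _ ≤ ∑ _a : Fin (d+1), ‖jt z x‖ ^ 2 := sum_le_sum fun a _ => pow_le_pow_left₀ (norm_nonneg _) (norm_le_pi_norm (jt z x) a) 2
      _ = _ := by simp
structure Gd (g : GY d) : Prop where
  sm : ∀ b, Sm (g b)
  sym : ∀ y η ζ, QQ g y η ζ = QQ g y ζ η
  zero : ∀ b, g b 0 = 0
  gd : ∀ R : ℝ, ∃ c, 0 < c ∧ ∃ K, 0 ≤ K ∧ ∀ u z, FS u → FS z → HB (d+2) R u →
    c * (∫ x in box d, ‖jt z x‖ ^ 2) - K * (∫ x in box d, ‖S z x‖ ^ 2) ≤ ∫ x in box d, QQ g (jt u x) (jt z x) (jt z x)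
lemma Gd_gF {F : Y d → ℂ} (hF : GoodF d F) (hE : Elliptic d F) : Gd (gF F) := by
  obtain ⟨hS, him, h0⟩ := hF
  have hS : Sm F := hS
  have h1 : fderiv ℝ F 0 = 0 := by
    ext v; have := congrArg (fun T => T (fun _ => v)) (h0 1 (by norm_num)); simpa [iteratedFDeriv_one_apply] using this
  refine ⟨Sm_gF hS, fun y η ζ => ?_, fun b => by simp [gF, QLNLS.wdM, h1], garding hS hE⟩
  have hr : ∀ y v, (fderiv ℝ F y v).im = 0 := fun y v => by
    have e : (fun y => Complex.imCLM (F y)) = fun _ => 0 := funext fun y => him y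
    have := Complex.imCLM.hasFDerivAt.comp y (hS.diff y).hasFDerivAt
    have h2 : HasFDerivAt (fun y => Complex.imCLM (F y)) _ y := this
    rw [e] at h2
    have := h2.unique (hasFDerivAt_const 0 y)
    have := congrArg (fun T => T v) this
    simpa using this
  have h2 : ∀ ζ y, ∑ b, (QLNLS.wdM b F y * cJ (ζ b)).re = (fderiv ℝ F y ζ).re / 2 := fun ζ y => by
    rw [fderiv_wd, Complex.re_sum, Finset.sum_div]
    refine sum_congr rfl fun b _ => ?_
    have : QLNLS.wdP b F y = cJ (QLNLS.wdM b F y) := by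
      rw [QLNLS.wdP, QLNLS.wdM, map_div₀, map_add, map_mul, conj_I, Complex.conj_eq_iff_im.2 (hr _ _), Complex.conj_eq_iff_im.2 (hr _ _), map_ofNat]; ring
    rw [this]; simp
  have h3 : ∀ η ζ, ∑ b, (fderiv ℝ (QLNLS.wdM b F) y η * cJ (ζ b)).re = (fderiv ℝ (fun y => fderiv ℝ F y ζ) y η).re / 2 := fun η ζ => by
    have a1 : HasFDerivAt (fun y => ∑ b, Complex.reCLM (QLNLS.wdM b F y * cJ (ζ b))) _ y :=
      HasFDerivAt.fun_sum fun b _ => Complex.reCLM.hasFDerivAt.comp y (((hS.wdM b).diff y).hasFDerivAt.mul_const (cJ (ζ b)))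
    have a2 : HasFDerivAt (fun y => (1 / 2 : ℝ) * Complex.reCLM (fderiv ℝ F y ζ)) _ y := (Complex.reCLM.hasFDerivAt.comp y ((hS.fd ζ).diff y).hasFDerivAt).const_mul (1 / 2)
    have e : (fun y => ∑ b, Complex.reCLM (QLNLS.wdM b F y * cJ (ζ b))) = fun y => (1 / 2 : ℝ) * Complex.reCLM (fderiv ℝ F y ζ) :=
      funext fun y => by have := h2 ζ y; simp only [Complex.reCLM_apply]; rw [this]; ring
    rw [e] at a1
    have := congrArg (fun T => T η) (a1.unique a2)
    simp only [_root_.sum_apply, ContinuousLinearMap.comp_apply, Complex.reCLM_apply, _root_.smul_apply, smul_eq_mul] at this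
    rw [div_eq_inv_mul, ← one_div, ← this]
    exact sum_congr rfl fun b _ => by rw [mul_comm]
  have h4 : fderiv ℝ (fun y => fderiv ℝ F y ζ) y η = fderiv ℝ (fun y => fderiv ℝ F y η) y ζ := by
    have hsy := (hS.contDiffAt (x := y)).isSymmSndFDerivAt (by simp; exact WithTop.coe_le_coe.2 le_top)
    have hd : DifferentiableAt ℝ (fderiv ℝ F) y := (hS.fderiv_right (m := (⊤:ℕ∞)) (by simp)).differentiable (by simp) y
    have e : ∀ a b, fderiv ℝ (fun y => fderiv ℝ F y a) y b = fderiv ℝ (fderiv ℝ F) y b a := fun a b => by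
      have := (hd.hasFDerivAt.clm_apply (hasFDerivAt_const a y)).fderiv
      rw [this]; simp
    rw [e, e]; exact hsy η ζ
  simp only [QQ, ipr, fd_gF hS, add_mul, add_re, sum_add_distrib, h3, h4]
  congr 1
  refine sum_congr rfl fun b _ => ?_
  split_ifs <;> simp; ring
lemma ip_AA (hg : Gd g) {u z φ : Seq d} (hu : FS u) (hz : FS z) (hφ : Supp B φ) :
    ip B (AA g u z) φ = ∫ x in box d, QQ g (jt u x) (jt z x) (jt φ x) :=
  Dv_pair hφ fun a => cont_lin (hg.sm a) hu hz
lemma ip_AA_symm (hg : Gd g) {u z φ : Seq d} (hu : FS u) (hz : Supp B z) (hφ : Supp B φ) : ip B (AA g u z) φ = ip B (AA g u φ) z := by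
  rw [ip_AA hg hu ⟨B, hz⟩ hφ, ip_AA hg hu ⟨B, hφ⟩ hz]; congr 1; ext x; exact hg.sym _ _ _
lemma gard (hg : Gd g) (R : ℝ) : ∃ c, 0 < c ∧ ∃ K, 0 ≤ K ∧ ∀ (B : FZ d) u z, FS u → Supp B z → HB (d+2) R u →
    c * hsNorm 1 z ^ 2 ≤ ip B (AA g u z) z + K * hsNorm 0 z ^ 2 := by
  obtain ⟨c, hc, K, hK, H⟩ := hg.gd R
  refine ⟨c / (d + 1), by positivity, K, hK, fun B u z hu hz hR => ?_⟩
  have h1 := H u z hu ⟨B, hz⟩ hR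
  have h2 := (jt_int hz).2
  have h3 : ∫ x in box d, ‖S z x‖ ^ 2 = hsNorm 0 z ^ 2 := by rw [parseval hz, hz.normSq]; simp
  rw [ip_AA hg hu ⟨B, hz⟩ hz]
  rw [h3] at h1
  have : c / (d + 1) * hsNorm 1 z ^ 2 ≤ c * ∫ x in box d, ‖jt z x‖ ^ 2 := by
    rw [div_mul_eq_mul_div, div_le_iff₀ PO]
    calc _ ≤ _ := mL h2 hc.le
      _ = _ := by ring
  linarith
lemma interp (l : ℝ) {m' m ε : ℝ} (hl : l ≤ m') (hm : m' < m) (hε : 0 < ε) : ∃ C, 0 ≤ C ∧ ∀ z : Seq d, FS z →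
    hsNorm m' z ≤ ε * hsNorm m z + C * hsNorm l z := by
  set K := max 1 ((1 / ε) ^ (1 / (m - m')))
  have hm0 : 0 < m - m' := by linarith
  have K1 : 1 ≤ K := le_max_left _ _
  refine ⟨K ^ (m' - l), by positivity, fun z hz => ?_⟩
  have h1 : HB 0 (ε * hsNorm m z) (fun n => (ε : ℂ) * (((jb n ^ m : ℝ) : ℂ) * z n)) := by
    have := (HB.jw (m := 0) (p := m) (by simpa using hz.HB m)).smul (ε : ℂ)
    rwa [norm_real, Real.norm_of_nonneg hε.le] at this
  have h2 : HB 0 (K ^ (m' - l) * hsNorm l z) (fun n => ((K ^ (m' - l) : ℝ) : ℂ) * (((jb n ^ l : ℝ) : ℂ) * z n)) := by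
    have := (HB.jw (m := 0) (p := l) (by simpa using hz.HB l)).smul ((K ^ (m' - l) : ℝ) : ℂ)
    rwa [norm_real, Real.norm_of_nonneg PO] at this
  refine ((h1.add h2).of_le1 fun n => ?_).norm
  have j1 := one_le_jb n; have j0 := jb_pos n
  have e : ((fun n => (ε : ℂ) * (((jb n ^ m : ℝ) : ℂ) * z n)) + fun n => ((K ^ (m' - l) : ℝ) : ℂ) * (((jb n ^ l : ℝ) : ℂ) * z n)) n
      = ((ε * jb n ^ m + K ^ (m' - l) * jb n ^ l : ℝ) : ℂ) * z n := by simp; ring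
  have p1 := jw m n; have p2 := jw l n
  rw [e, norm_mul, norm_real, Real.norm_of_nonneg PO, Real.rpow_zero, one_mul]
  refine mR ?_ (norm_nonneg _)
  rcases le_total (jb n) K with h | h
  · have : jb n ^ m' ≤ K ^ (m' - l) * jb n ^ l := by
      calc _ = jb n ^ (m' - l) * jb n ^ l := by rw [← rpow_add j0]; congr 1; ring
        _ ≤ _ := mR (rpow_le_rpow j0.le h LA) p2.le
    nlinarith [mul_pos hε p1]
  · have h3 : 1 / ε ≤ jb n ^ (m - m') := by
      have := rpow_le_rpow PO ((le_max_right _ _).trans h) hm0.le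
      rwa [← rpow_mul PO, one_div_mul_cancel hm0.ne', Real.rpow_one] at this
    have : jb n ^ m' ≤ ε * jb n ^ m := by
      calc _ = ε * (1 / ε * jb n ^ m') := by field_simp
        _ ≤ ε * (jb n ^ (m - m') * jb n ^ m') := by
          exact mL (mR h3 (jw m' n).le) hε.le
        _ = _ := by rw [← rpow_add j0]; congr 2; ring
    have : 0 ≤ K ^ (m' - l) * jb n ^ l := by positivity
    linarith
lemma JC_Lam (p : ℝ) (α : Ix d) (z : Seq d) : JC α (Lam p z) = Lam p (JC α z) := by
  ext n; simp only [JC, JJ, starSeq, Lam, map_mul, conj_ofReal, jb_neg]; ring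
lemma Lam_norm (p m : ℝ) (hz : FS z) : hsNorm m (Lam p z) = hsNorm (m + p) z := by
  simp only [hsNorm, hsNormSq, hs_term]
  congr 2; ext n
  rw [Lam, norm_mul, norm_real, Real.norm_of_nonneg (jw p n).le, rpow_add (jb_pos n), mul_assoc]
lemma AA_comm (hg : Gd g) (p : ℕ) {L : ℝ} (h1 : (p:ℝ) + 2 ≤ L) (h2 : 2 * d + 2 ≤ L) (R : ℝ) :
    ∃ C, 0 ≤ C ∧ ∀ u z y, FS u → FS z → HB L R u → HB (p+1) y z → HB (-1) (C * y) (Lam (p+1) (AA g u z) - AA g u (Lam (p+1) z)) := by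
  choose C hC H using fun q : Fin (d+1) × Ix d => comp_est h2 (m := L - 1) (by linarith [(Nat.cast_nonneg p : (0:ℝ) ≤ p)]) LA ((hg.sm q.1).dv q.2) R
  obtain ⟨K, hK, HK⟩ := comm_est d p (L := L - 1) LA LA
  refine ⟨∑ b, ∑ α, K * C (b, α), sum_nonneg fun b _ => sum_nonneg fun α _ => mul_nonneg hK (hC _), fun u z y hu hz hR hy => ?_⟩
  have fl : FS (Lam (p+1) z) := let ⟨B, hB⟩ := hz; ⟨B, hB.Lam _⟩
  have e : Lam (p+1) (AA g u z) - AA g u (Lam (p+1) z) = fun n => ∑ b, cJ (mu b n) * ∑ α,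
      (Lam (p+1) (fCoeff fun x => dv α (g b) (jt u x) * S (JC α z) x) - fCoeff fun x => dv α (g b) (jt u x) * S (Lam (p+1) (JC α z)) x) n := by
    ext n
    simp only [Pi.sub_apply, Lam, AA, Dv, fC_lin (hg.sm _) hu hz, fC_lin (hg.sm _) hu fl, mul_sum, ← sum_sub_distrib, JC_Lam]
    refine sum_congr rfl fun b _ => sum_congr rfl fun α _ => ?_
    ring
  rw [e]
  simp only [sum_mul]
  refine HB.sum _ fun b _ => ?_
  have hs : HB 0 (∑ α, K * C (b, α) * y) (fun n => ∑ α,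
      (Lam (p+1) (fCoeff fun x => dv α (g b) (jt u x) * S (JC α z) x) - fCoeff fun x => dv α (g b) (jt u x) * S (Lam (p+1) (JC α z)) x) n) := by
    refine HB.sum _ fun α _ => ?_
    obtain ⟨B', hB'⟩ := hz.JC α
    exact (HK B' _ _ _ _ hB' (cont_cp ((hg.sm b).dv α) hu) (H (b, α) u hu hR) (hy.JC α)).mono (le_of_eq (by ring))
  refine hs.of_le1 fun n => ?_
  rw [norm_mul, RCLike.norm_conj, Real.rpow_zero, one_mul, Real.rpow_neg_one, ← mul_assoc]
  refine mul_le_of_le_one_left (norm_nonneg _) ?_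
  rw [inv_mul_le_iff₀ (jb_pos n), mul_one]; exact norm_mu_le b n
lemma quad_abs {c b C K X Z : ℝ} (hc : 0 < c) (hb : 0 ≤ b) (hC : 0 ≤ C) (hK : 0 ≤ K) (hX : 0 ≤ X) (hZ : 0 ≤ Z)
    (h : c * X ^ 2 ≤ (b + C * Z) * X + K * Z ^ 2) : X ≤ (1 / c) * b + ((C + K) / c + 1) * Z := by
  by_contra hn
  push Not at hn
  have h1 : 0 ≤ (1 / c) * b + ((C + K) / c) * Z := by positivity
  have hZX : Z < X := by linarith
  have h2 : c * ((1 / c) * b + ((C + K) / c + 1) * Z) = b + C * Z + K * Z + c * Z := by field_simp; ring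
  have h3 := mul_lt_mul_of_pos_left hn hc
  rw [h2] at h3
  have h4 := mul_lt_mul_of_pos_right h3 (lt_of_le_of_lt hZ hZX)
  have h5 : K * Z * Z ≤ K * Z * X := mL hZX.le PO
  have h6 : 0 ≤ c * Z * X := by positivity
  nlinarith
lemma ellip (hg : Gd g) (p : ℕ) {L : ℝ} (h1 : (p:ℝ) + 2 ≤ L) (h2 : 2 * d + 2 ≤ L) (R : ℝ) :
    ∃ C, 0 ≤ C ∧ ∀ (B : FZ d) u z b, FS u → Supp B z → HB L R u → HB p b (PB B (AA g u z)) →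
      hsNorm (p + 2) z ≤ C * (b + hsNorm 0 z) := by
  obtain ⟨c, hc, K, hK, HG⟩ := gard hg R
  obtain ⟨C, hC, HC⟩ := AA_comm hg p h1 h2 R
  have hp : (0:ℝ) ≤ p := Nat.cast_nonneg p
  have hd := dn d
  set M := (C + K) / c + 1
  have hM : 0 < M := by positivity
  obtain ⟨C1, hC1, HI⟩ := interp (d := d) 0 (m' := p + 1) (m := p + 2) (ε := 1 / (2 * M)) LA LA PO
  refine ⟨2 * (1 / c + M * C1), by positivity, fun B u z b hu hz hR hb => ?_⟩
  have fz : FS z := ⟨B, hz⟩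
  have hl := hz.Lam (p + 1)
  have key := HG B u (Lam (p+1) z) hu hl (hR.down LA)
  rw [Lam_norm _ _ fz, Lam_norm _ _ fz] at key
  have e1 : (1:ℝ) + (p + 1) = p + 2 := by ring
  rw [e1, zero_add] at key
  have b1 := ip_le 1 (HC u z _ hu fz hR (fz.HB _)) (by simpa using hl.HB 1) B
  have b2 : |ip B (Lam (p+1) (PB B (AA g u z))) (Lam (p+1) z)| ≤ b * hsNorm (p+2) z := by
    have := ip_le 1 (a := Lam (p+1) (PB B (AA g u z))) (HB.jw (by convert hb using 1; ring)) (hl.HB 1) B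
    rwa [Lam_norm _ _ fz, e1] at this
  rw [Lam_norm _ _ fz, e1] at b1
  have e2 : ip B (Lam (p+1) (PB B (AA g u z))) (Lam (p+1) z) = ip B (Lam (p+1) (AA g u z)) (Lam (p+1) z) :=
    sum_congr rfl fun n hn => by simp only [Lam, PB_mem hn]
  rw [ip_sub] at b1
  rw [e2] at b2
  have X0 := hsNorm_nonneg (p+2) z
  have Z0 := hsNorm_nonneg (p+1) z
  have := quad_abs (X := hsNorm (p+2) z) (Z := hsNorm (p+1) z) hc hb.1 hC hK X0 Z0 (by
    have := (abs_le.1 b1).1; have := (abs_le.1 b2).2; linarith)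
  have h4 := mL (HI z fz) hM.le
  have e3 : M * (1 / (2 * M) * hsNorm (p+2) z + C1 * hsNorm 0 z) = hsNorm (p+2) z / 2 + M * C1 * hsNorm 0 z := by field_simp
  rw [e3] at h4
  have h5 : 0 ≤ 1 / c * hsNorm 0 z := mul_nonneg PO (hsNorm_nonneg _ _)
  have h6 : 0 ≤ M * C1 * b := mul_nonneg PO hb.1
  have h7 : M * hsNorm (p+1) z = ((C + K) / c + 1) * hsNorm (p+1) z := rfl
  linarith
lemma cdj (hu : FS u) : ContDiff ℝ (⊤ : ℕ∞) (jt u) := contDiff_pi.2 fun a => (hu.JJ a).smooth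
lemma pdj (hu : FS u) (j : Fin d) (x : Vec d) : fderiv ℝ (jt u) x (Pi.single j 1) = jt (JJ j.succ u) x := by
  have h : HasFDerivAt (jt u) _ x := hasFDerivAt_pi.2 fun a => ((hu.JJ a).smooth.differentiable (by simp) x).hasFDerivAt
  ext a
  have e := congrFun (pdF_S ((hu.JJ a).jb 1) j) x
  rw [h.fderiv]
  have e2 : JJ j.succ (JJ a u) = JJ a (JJ j.succ u) := by ext n; simp only [JJ]; ring
  rw [e2] at e
  exact e
lemma perj (hu : FS u) {f : Y d → Y d → ℂ} (hz : FS z) : Periodic2pi fun x => f (jt u x) (jt z x) := fun x k => by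
  have : ∀ u : Seq d, FS u → jt u (fun i => x i + 2 * Real.pi * (k i : ℝ)) = jt u x := fun u _ => funext fun a => per_S _ x k
  beta_reduce; rw [this u hu, this z hz]
lemma JJ_Dv {h h' : Fin (d+1) → VC d} (hh : ∀ b, ContDiff ℝ (⊤ : ℕ∞) (h b)) (hp : ∀ b, Periodic2pi (h b)) (j : Fin d) (e : ∀ b, pdF j (h b) = h' b) :
    JJ j.succ (Dv h) = Dv h' := by
  ext n
  simp only [JJ, Dv, mul_sum]
  refine sum_congr rfl fun b _ => ?_
  rw [← e, fCoeff_pdF ((hh b).of_le (by simp)) (hp b), mu_succ]; ring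
lemma JJ_GG (hg : Gd g) (hu : FS u) (j : Fin d) : JJ j.succ (GG g u) = AA g u (JJ j.succ u) := by
  refine JJ_Dv (fun b => (hg.sm b).comp (cdj hu)) (fun b => perj hu (f := fun y _ => g b y) hu) j fun b => ?_
  ext x
  have := (((hg.sm b).diff (jt u x)).hasFDerivAt.comp x ((cdj hu).differentiable (by simp) x).hasFDerivAt).fderiv
  rw [pdF, ← pdj hu]
  exact congrArg (fun T => T (Pi.single j 1)) this
lemma JJ_AA (hg : Gd g) {u z : Seq d} (hu : FS u) (hz : FS z) (j : Fin d) :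
    JJ j.succ (AA g u z) = DA g u (JJ j.succ u) z + AA g u (JJ j.succ z) := by
  have hf := fun b => (hg.sm b).fderiv_right (m := (⊤:ℕ∞)) (by simp)
  have e : DA g u (JJ j.succ u) z + AA g u (JJ j.succ z) = Dv fun b x => d2 (g b) (jt u x) (jt (JJ j.succ u) x) (jt z x) +
      fderiv ℝ (g b) (jt u x) (jt (JJ j.succ z) x) := by
    rw [Dv_add (fun b => cont_bil (hg.sm b) hu (hu.JJ _) hz) (fun b => cont_lin (hg.sm b) hu (hz.JJ _))]; rfl
  rw [e]
  refine JJ_Dv (fun b => ((hf b).comp (cdj hu)).clm_apply (cdj hz)) (fun b => perj hu (f := fun y η => fderiv ℝ (g b) y η) hz) j fun b => ?_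
  ext x
  have hd : DifferentiableAt ℝ (fderiv ℝ (g b)) (jt u x) := (hf b).differentiable (by simp) _
  have := ((hd.hasFDerivAt.comp x ((cdj hu).differentiable (by simp) x).hasFDerivAt).clm_apply ((cdj hz).differentiable (by simp) x).hasFDerivAt).fderiv
  have e2 : ∀ y a v, DifferentiableAt ℝ (fderiv ℝ (g b)) y → d2 (g b) y v a = fderiv ℝ (fderiv ℝ (g b)) y v a := fun y a v hd => by
    have := (hd.hasFDerivAt.clm_apply (hasFDerivAt_const a y)).fderiv
    rw [d2, this]; simp
  rw [pdF, ← pdj hu, ← pdj hz, e2 _ _ _ hd]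
  have := congrArg (fun T => T (Pi.single j 1)) this
  refine Eq.trans this ?_
  simp [add_comm]
lemma HB_2 {a b : ℝ} (h : HB m a z) (h' : ∀ j : Fin d, HB m b (JJ j.succ (JJ j.succ z))) : HB (m+2) (a + d * b) z := by
  have := h.sub (HB.sum univ fun j _ => h' j)
  refine HB.of_le1 (m := m) (e := z - fun n => ∑ j : Fin d, JJ j.succ (JJ j.succ z) n) (by simpa using this) fun n => ?_
  have e : (z - fun n => ∑ j : Fin d, JJ j.succ (JJ j.succ z) n) n = ((jb n ^ 2 : ℝ) : ℂ) * z n := by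
    rw [jb_sq]; push_cast
    simp only [Pi.sub_apply, JJ, mu_succ]
    have : ∀ j : Fin d, I * (n j : ℂ) * (I * (n j : ℂ) * z n) = -((n j : ℂ) ^ 2 * z n) := fun j => by
      linear_combination (n j : ℂ) ^ 2 * z n * Complex.I_sq
    simp only [this, sum_neg_distrib, ← sum_mul]; ring
  rw [e, norm_mul, norm_real, Real.norm_of_nonneg PO, rpow_add (jb_pos n), mul_assoc]
  norm_num
def Jm (B : FZ d) (c : Seq d) : Seq d := fun n => I * PB B c n
lemma HB.Jm {b : ℝ} (h : HB m b c) (B : FZ d) : HB m b (Jm B c) := by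
  have := (h.PB B).smul I
  rw [Complex.norm_I, one_mul] at this; exact this
lemma Supp_Jm (B : FZ d) (c : Seq d) : Supp B (Jm B c) := fun n hn => by simp [Jm, Supp_PB B c n hn]
lemma FS_Jm (B : FZ d) (c : Seq d) : FS (Jm B c) := ⟨B, Supp_Jm B c⟩
lemma PB_Jm {b : ℝ} (h : HB m b (Jm B c)) : HB m b (PB B c) := h.of_le1 fun n => by simp [Jm]
lemma nv (hg : Gd g) (p : ℕ) (h2 : 2 * (d:ℝ) + 2 ≤ p + 2) (R : ℝ) :
    ∃ C, 0 ≤ C ∧ ∀ (B : FZ d) u, Supp B u → HB (p+2) R u →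
      hsNorm (p+4) u ≤ C * (1 + hsNorm (p+2) (Jm B (GG g u))) ∧ HB (p+2) (C * (1 + hsNorm (p+4) u)) (GG g u) := by
  have p0 : (0:ℝ) ≤ p := Nat.cast_nonneg p
  obtain ⟨C1, hC1, H1⟩ := ellip hg p le_rfl h2 R
  obtain ⟨C2, hC2, H2⟩ := DA_tame hg.sm (m := p) LA le_rfl h2 R
  obtain ⟨C3, hC3, H3⟩ := AA_est hg.sm (m := p) LA le_rfl h2 R
  obtain ⟨C4, hC4, H4⟩ := GG_est hg.sm (m := p) LA le_rfl h2 R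
  obtain ⟨C5, hC5, H5⟩ := interp (d := d) (p+2) (m' := p+3) (m := p+4) (ε := 1 / (2 * (d * C1 * C2 + 1))) LA LA PO
  refine ⟨2 * (|R| + d * (C1 * (1 + (C2 * (C5 * |R|)) + |R|))) + (C4 + d * (C2 + C3)), by positivity, fun B u hB hR => ?_⟩
  have fu : FS u := ⟨B, hB⟩
  have r : R ≤ |R| := le_abs_self R
  have r0 := abs_nonneg R
  have id : ∀ j : Fin d, JJ j.succ (JJ j.succ (GG g u)) = DA g u (JJ j.succ u) (JJ j.succ u) + AA g u (JJ j.succ (JJ j.succ u)) := fun j => by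
    rw [JJ_GG hg fu, JJ_AA hg fu (fu.JJ _)]
  have da : ∀ (j : Fin d) y, HB (p+3) y u → HB p (C2 * y) (DA g u (JJ j.succ u) (JJ j.succ u)) := fun j y hy => by
    have h1 : HB (d+1) R (JJ j.succ u) := (hR.down (m' := d + 1 + 1) LA).JJ _
    have h2 : HB (p+2) y (JJ j.succ u) := (hy.down (m' := p + 2 + 1) LA).JJ _
    exact H2 _ _ _ _ fu (fu.JJ _) (fu.JJ _) hR h1 h1 h2 h2
  set W := hsNorm (p+4) u
  have W0 : 0 ≤ W := hsNorm_nonneg _ _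
  set V := hsNorm (p+2) (Jm B (GG g u))
  have V0 : 0 ≤ V := hsNorm_nonneg _ _
  set U := hsNorm (p+3) u
  have hv : HB (p+2) V (Jm B (GG g u)) := (Supp_Jm B _).HB _
  have hW : HB (p+4) W u := fu.HB _
  have hU : HB (p+3) U u := fu.HB _
  have hI : U ≤ 1 / (2 * (d * C1 * C2 + 1)) * W + C5 * |R| := (H5 u fu).trans (by have := hR.norm; gcongr; linarith)
  constructor
  · have k1 : ∀ j : Fin d, HB (p+2) (C1 * (V + C2 * U + R)) (JJ j.succ (JJ j.succ u)) := fun j => by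
      have e : PB B (AA g u (JJ j.succ (JJ j.succ u))) = PB B (JJ j.succ (JJ j.succ (GG g u))) - PB B (DA g u (JJ j.succ u) (JJ j.succ u)) := by
        rw [id]; ext n; by_cases hn : n ∈ B
        · simp [PB_mem hn]
        · simp [fun c => Supp_PB B c n hn]
      have a1 : HB p V (PB B (JJ j.succ (JJ j.succ (GG g u)))) := by
        have : PB B (JJ j.succ (JJ j.succ (GG g u))) = JJ j.succ (JJ j.succ (PB B (GG g u))) := by
          ext n; by_cases hn : n ∈ B
          · simp [PB_mem hn, JJ]
          · simp [fun c => Supp_PB B c n hn, JJ]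
        rw [this]
        exact HB.JJ (HB.JJ ((PB_Jm hv).down LA) _) _
      have a2 := a1.sub ((da j U hU).PB B)
      rw [← e] at a2
      have a3 := H1 B u _ _ fu ((hB.JJ _).JJ _) hR a2
      have a4 : hsNorm 0 (JJ j.succ (JJ j.succ u)) ≤ R := (HB.JJ (HB.JJ (hR.down LA) _) _).norm
      exact (((fu.JJ _).JJ _).HB _).mono (a3.trans (mL LA hC1))
    have k2 := (HB_2 hR k1).norm
    rw [show (p:ℝ) + 2 + 2 = p + 4 by ring] at k2
    have k3 : W ≤ |R| + d * (C1 * (V + C2 * (1 / (2 * (d * C1 * C2 + 1)) * W + C5 * |R|) + |R|)) := k2.trans (by gcongr)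
    have k4 : d * C1 * C2 * (1 / (2 * (d * C1 * C2 + 1)) * W) ≤ W / 2 := by
      rw [show (d:ℝ) * C1 * C2 * (1 / (2 * (d * C1 * C2 + 1)) * W) = (d * C1 * C2 / (d * C1 * C2 + 1)) * (W / 2) by field_simp]
      refine mul_le_of_le_one_left LA ((div_le_one PO).2 LA)
    have k5 : W ≤ 2 * (|R| + d * (C1 * (V + C2 * (C5 * |R|) + |R|))) := by nlinarith [k3, k4]
    refine k5.trans ?_
    have q1 : 0 ≤ (C4 + d * (C2 + C3)) * (1 + V) := by positivity
    have q2 : 0 ≤ |R| * V := by positivity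
    have q3 : 0 ≤ d * (C1 * (1 + C2 * (C5 * |R|) + |R|)) * V - d * C1 * V := by
      rw [show d * (C1 * (1 + C2 * (C5 * |R|) + |R|)) * V - d * C1 * V = d * (C1 * (C2 * (C5 * |R|) + |R|)) * V by ring]; positivity
    have q4 : 0 ≤ d * C1 * (1:ℝ) := by positivity
    nlinarith [q1, q2, q3, q4]
  · have a1 : ∀ j : Fin d, HB p (C2 * W + C3 * W) (JJ j.succ (JJ j.succ (GG g u))) := fun j => by
      rw [id]
      refine (da j W (hW.down LA)).add (H3 _ _ _ fu ((fu.JJ _).JJ _) hR ?_)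
      exact HB.JJ (HB.JJ (hW.down LA) _) _
    refine (HB_2 (H4 u fu hR) a1).mono ?_
    have q1 : 0 ≤ 2 * (|R| + d * (C1 * (1 + C2 * (C5 * |R|) + |R|))) * (1 + W) := by positivity
    have q2 : 0 ≤ C4 * W := by positivity
    have q3 : 0 ≤ d * (C2 + C3) := by positivity
    nlinarith [q1, q2, q3]
lemma jt_add {a b : Seq d} (ha : FS a) (hb : FS b) (x : Vec d) : jt (a + b) x = jt a x + jt b x := by
  have := jt_sub (ha.add hb) hb x
  rw [add_sub_cancel_right] at this; rw [this]; abel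
lemma AA_add (hg : Gd g) {u a b : Seq d} (hu : FS u) (ha : FS a) (hb : FS b) : AA g u (a + b) = AA g u a + AA g u b := by
  unfold AA
  rw [← Dv_add (fun b => cont_lin (hg.sm b) hu ha) (fun b => cont_lin (hg.sm b) hu hb)]
  simp only [jt_add ha hb, map_add]
def yy (g : GY d) (B : FZ d) (u : Seq d) : ℕ → Seq d
  | 0 => Jm B (GG g u)
  | j+1 => Jm B (AA g u (yy g B u j))
def gg (g : GY d) (B : FZ d) (u : Seq d) : ℕ → Seq d
  | 0 => 0
  | j+1 => Jm B (DA g u (yy g B u 0) (yy g B u j) + AA g u (gg g B u j))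
lemma Supp_yy (u : Seq d) (j : ℕ) : Supp B (yy g B u j) := by cases j <;> exact Supp_Jm _ _
lemma Supp_gg (u : Seq d) (j : ℕ) : Supp B (gg g B u j) := by
  cases j
  · exact fun n _ => rfl
  · exact Supp_Jm _ _
lemma Jm_add (a b : Seq d) : Jm B (a + b) = Jm B a + Jm B b := by
  ext n; by_cases hn : n ∈ B
  · simp [Jm, PB_mem hn, mul_add]
  · simp [Jm, fun c => Supp_PB B c n hn]
lemma CD_yy (hg : Gd g) {u : ℝ → Seq d} {t : ℝ} (hB : ∀ s, Supp B (u s)) (h : CD u (yy g B (u t) 0) t) (j : ℕ) :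
    CD (fun s => yy g B (u s) j) (yy g B (u t) (j+1) + gg g B (u t) j) t := by
  induction j with
  | zero =>
    have : CD (fun s => yy g B (u s) 0) (yy g B (u t) 1) t := ((dt_GG hg.sm hB h).PB B).smul I
    simpa [gg] using this
  | succ j ih =>
    have : CD (fun s => yy g B (u s) (j+1)) _ t := ((dt_AA hg.sm hB h (fun s => Supp_yy (u s) j) ih).PB B).smul I
    convert this using 1
    have e : Jm B (AA g (u t) (yy g B (u t) (j+1))) + Jm B (DA g (u t) (yy g B (u t) 0) (yy g B (u t) j) + AA g (u t) (gg g B (u t) j)) =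
      Jm B (DA g (u t) (yy g B (u t) 0) (yy g B (u t) j) + AA g (u t) (yy g B (u t) (j+1) + gg g B (u t) j)) := by
      rw [AA_add hg ⟨B, hB t⟩ ⟨B, Supp_yy _ _⟩ ⟨B, Supp_gg _ _⟩, ← Jm_add]; congr 1; abel
    exact e
lemma yy_est (hg : Gd g) (k : ℕ) (hk : HKK d k) (R : ℝ) (j : ℕ) : j ≤ k → ∃ C, 0 ≤ C ∧ ∀ (B : FZ d) u, Supp B u → HB (2*k+1) R u →
    HB (2*k-1-2*j) C (yy g B u j) ∧ HB (2*k+1-2*j) (C * hsNorm (2*k+1) (yy g B u 0)) (yy g B u j) ∧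
    HB (2*k+1-2*j) (C * hsNorm (2*k+1) (yy g B u 0)) (gg g B u j) ∧ hsNorm (2*k+1) (yy g B u 0) ≤ C * (hsNorm (2*k+1-2*j) (yy g B u j) + 1) := by
  have d0 := dn d
  obtain ⟨C0, hC0, H0⟩ := GG_est hg.sm (m := 2*k-1) (L := 2*k+1) LA LA LA R
  have hv : ∀ (B : FZ d) u, Supp B u → HB (2*k+1) R u → HB (2*k-1) C0 (yy g B u 0) := fun B u hB hR => (H0 u ⟨B, hB⟩ hR).Jm B
  induction j with
  | zero =>
    intro _
    refine ⟨C0 + 1, by positivity, fun B u hB hR => ?_⟩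
    have V0 := hsNorm_nonneg (2*k+1) (yy g B u 0)
    refine ⟨((hv B u hB hR).down (by simp)).mono LA, (((Supp_yy u 0).HB (2*k+1)).down (by simp)).mono (by nlinarith), HB.zero _ PO, ?_⟩
    simp only [Nat.cast_zero, mul_zero, sub_zero]; nlinarith
  | succ j ih =>
    intro hj
    obtain ⟨C, hC, H⟩ := ih (by omega)
    obtain ⟨q, hq⟩ : ∃ q, k = j + 1 + q := ⟨k - (j+1), by omega⟩
    have hq' : (k:ℝ) = j + 1 + q := by rw [hq]; push_cast; ring
    have q0 : (0:ℝ) ≤ q := Nat.cast_nonneg q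
    have j0 : (0:ℝ) ≤ j := Nat.cast_nonneg j
    obtain ⟨C1, hC1, H1⟩ := AA_est hg.sm (m := 2*k-1-2*j) (L := 2*k+1) LA LA LA R
    obtain ⟨C2, hC2, H2⟩ := AA_est hg.sm (m := 2*k-3-2*j) (L := 2*k+1) LA LA LA R
    obtain ⟨C3, hC3, H3⟩ : ∃ C3, 0 ≤ C3 ∧ ∀ (B : FZ d) u, Supp B u → HB (2*k+1) R u →
        HB (2*k-1-2*j) (C3 * hsNorm (2*k+1) (yy g B u 0)) (DA g u (yy g B u 0) (yy g B u j)) := by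
      rcases Nat.eq_zero_or_pos j with rfl | hj0
      · obtain ⟨C3, hC3, H3⟩ := DA_tame hg.sm (m := 2*k-1) (L := 2*k+1) LA LA LA (|R| + C0)
        refine ⟨C3, hC3, fun B u hB hR => ?_⟩
        have fs : FS (yy g B u 0) := ⟨B, Supp_yy _ _⟩
        have h1 : HB (d+1) (|R| + C0) (yy g B u 0) := ((hv B u hB hR).down LA).mono (by linarith [abs_nonneg R])
        have h2 : HB (2*k-1+2) (hsNorm (2*k+1) (yy g B u 0)) (yy g B u 0) := (fs.HB (2*k+1)).down LA
        exact (H3 u _ _ _ ⟨B, hB⟩ fs fs (hR.mono (by linarith [le_abs_self R])) h1 h1 h2 h2).down (by simp)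
      · have j1 : (1:ℝ) ≤ j := by exact_mod_cast hj0
        obtain ⟨C3, hC3, H3⟩ := DA_est hg.sm (m := 2*k-1-2*j) (L := 2*k-1) LA LA LA (|R| + C0)
        refine ⟨C3 * C, mul_nonneg hC3 hC, fun B u hB hR => ?_⟩
        rw [mul_assoc]
        exact H3 u _ _ _ ⟨B, hB⟩ ⟨B, Supp_yy _ _⟩ ⟨B, Supp_yy _ _⟩ ((hR.down LA).mono (by linarith [le_abs_self R]))
          ((hv B u hB hR).mono (by linarith [abs_nonneg R])) ((H B u hB hR).2.1.down LA)
    obtain ⟨C5, hC5, H5⟩ := ellip hg (2*q+1) (L := 2*k+1) (by push_cast; linarith) LA R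
    refine ⟨C2 * C + C1 * C + C3 + C * (C5 * (1 + C) + 1), by positivity, fun B u hB hR => ?_⟩
    have fu : FS u := ⟨B, hB⟩
    have fy : FS (yy g B u j) := ⟨B, Supp_yy _ _⟩
    obtain ⟨a1, a2, a3, a4⟩ := H B u hB hR
    set V := hsNorm (2*k+1) (yy g B u 0)
    have V0 : 0 ≤ V := hsNorm_nonneg _ _
    have p1 : 0 ≤ C * (C5 * (1 + C) + 1) := by positivity
    have p2 : 0 ≤ C1 * C := by positivity
    have p3 : 0 ≤ C2 * C := by positivity
    have b1 := H1 u _ _ fu fy hR (a2.down LA)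
    refine ⟨((H2 u _ _ fu fy hR (a1.down LA)).Jm B |>.down (by push_cast; linarith)).mono LA,
      (b1.Jm B |>.down (by push_cast; linarith)).mono (by linarith [mul_nonneg p1 V0, mul_nonneg p3 V0, mul_nonneg hC3 V0]), ?_, ?_⟩
    · have := ((H3 B u hB hR).add (H1 u _ _ fu ⟨B, Supp_gg _ _⟩ hR (a3.down LA))).Jm B
      exact (this.down (by push_cast; linarith)).mono (by linarith [mul_nonneg p1 V0, mul_nonneg p3 V0])
    · have e : ((2*q+1 : ℕ) : ℝ) = 2*k+1-2*((j+1:ℕ):ℝ) := by push_cast; linarith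
      have := H5 B u _ _ fu (Supp_yy u j) hR (PB_Jm ((Supp_yy u (j+1)).HB _))
      rw [e] at this
      set Z := hsNorm (2*k+1-2*((j+1:ℕ):ℝ)) (yy g B u (j+1))
      have Z0 : 0 ≤ Z := hsNorm_nonneg _ _
      rw [show (2*k+1-2*((j+1:ℕ):ℝ) + 2) = 2*k+1-2*(j:ℝ) by push_cast; ring] at this
      have a5 : hsNorm 0 (yy g B u j) ≤ C := (a1.down LA).norm
      calc V ≤ C * (C5 * (Z + C) + 1) := a4.trans (by gcongr; exact this.trans (by gcongr))
        _ ≤ C * (C5 * (1 + C) + 1) * (Z + 1) := by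
          rw [mul_assoc]; gcongr
          have : 0 ≤ C5 * C * Z := by positivity
          linarith [mul_nonneg hC5 hC]
        _ ≤ _ := by gcongr; linarith
lemma en (hg : Gd g) (k : ℕ) (hk : HKK d k) (R : ℝ) : ∃ C K, 0 ≤ C ∧ ∀ (B : FZ d) u, Supp B u → HB (2*k+1) R u →
    0 ≤ ip B (AA g u (yy g B u k)) (yy g B u k) + K ∧ hsNorm (2*k+3) u ^ 2 ≤ C * (ip B (AA g u (yy g B u k)) (yy g B u k) + K) ∧
    ip B (DA g u (yy g B u 0) (yy g B u k)) (yy g B u k) + 2 * ip B (AA g u (yy g B u k)) (gg g B u k) ≤ C * (ip B (AA g u (yy g B u k)) (yy g B u k) + K) ∧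
    ip B (AA g u (yy g B u k)) (yy g B u k) + K ≤ C * (1 + hsNorm (2*k+3) u) ^ 2 := by
  have d0 := dn d
  have k1 : 1 ≤ k := by by_contra h; have : k = 0 := by omega
                        rw [this] at hk; norm_num at hk; linarith
  obtain ⟨C0, hC0, H0⟩ := GG_est hg.sm (m := 2*k-1) (L := 2*k+1) LA LA LA R
  obtain ⟨C, hC, H⟩ := yy_est hg k hk R k le_rfl
  obtain ⟨C7, hC7, H7⟩ := nv hg (2*k-1) (by rw [Nat.cast_sub (by omega)]; push_cast; linarith) R
  rw [Nat.cast_sub (by omega)] at H7; push_cast at H7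
  rw [show (2*k-1+4:ℝ) = 2*k+3 by ring, show (2*k-1+2:ℝ) = 2*k+1 by ring] at H7
  obtain ⟨c, hc, K, hK, HG⟩ := gard hg R
  obtain ⟨C1, hC1, H1⟩ := AA_est hg.sm (m := -1) (L := 2*k+1) LA LA LA R
  obtain ⟨C2, hC2, H2⟩ := DA_est hg.sm (m := -1) (L := 2*k-1) LA LA LA (|R| + C0)
  have hε : 0 < √(c / (4 * (K+1))) := Real.sqrt_pos.2 PO
  obtain ⟨C6, hC6, H6⟩ := interp (d := d) (-1) (m' := 0) (m := 1) (by norm_num) (by norm_num) hε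
  set K1 := 2 * K * (C6 * C) ^ 2
  have hK1 : 0 ≤ K1 := by positivity
  set c8 := 2 * C7 ^ 2 * (1 + C) ^ 2 + 2 * C7 ^ 2 * C ^ 2
  set c9 := C2 + 4 * C1 * C ^ 2 + 4 * C1 * C ^ 2
  set c11 := C1 * (C * (C7 * 2)) ^ 2
  have c80 : 0 ≤ c8 := by positivity
  have c90 : 0 ≤ c9 := by positivity
  have c110 : 0 ≤ c11 := by positivity
  refine ⟨(c8 + c9) * (2 / c) + (c11 + K1 + c / 2), K1 + c / 2, by positivity, fun B u hB hR => ?_⟩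
  have fu : FS u := ⟨B, hB⟩
  have sy := Supp_yy (g := g) (B := B) u k
  obtain ⟨a1, a2, a3, a4⟩ := H B u hB hR
  obtain ⟨b1, b2⟩ := H7 B u hB hR
  have ev : Jm B (GG g u) = yy g B u 0 := rfl
  rw [ev] at b1
  rw [show (2*k+1-2*k:ℝ) = 1 by ring] at a2 a3 a4
  rw [show (2*k-1-2*k:ℝ) = -1 by ring] at a1
  have b3 := (b2.Jm B).norm
  rw [ev] at b3
  set y := yy g B u k
  set X := hsNorm 1 y
  set V := hsNorm (2*k+1) (yy g B u 0)
  set W := hsNorm (2*k+3) u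
  have X0 : 0 ≤ X := hsNorm_nonneg _ _
  have V0 : 0 ≤ V := hsNorm_nonneg _ _
  have W0 : 0 ≤ W := hsNorm_nonneg _ _
  have hX : HB 1 X y := sy.HB 1
  have hX' : HB (-1+2) X y := hX.down (by norm_num)
  set E := ip B (AA g u y) y
  have g1 := HG B u y fu sy (hR.down LA)
  have g2 : hsNorm 0 y ≤ √(c / (4 * (K+1))) * X + C6 * C := (H6 y ⟨B, sy⟩).trans (by have := a1.norm; gcongr)
  have g3 : hsNorm 0 y ^ 2 ≤ 2 * (c / (4 * (K+1)) * X ^ 2) + 2 * (C6 * C) ^ 2 := by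
    have := pow_le_pow_left₀ (hsNorm_nonneg 0 y) g2 2
    have e := sq_sqrt (show 0 ≤ c / (4 * (K+1)) by positivity)
    have e2 : (√(c / (4 * (K+1))) * X) ^ 2 = c / (4 * (K+1)) * X ^ 2 := by rw [mul_pow, e]
    linarith [add_sq_le (a := √(c / (4 * (K+1))) * X) (b := C6 * C)]
  have g4 : K * (2 * (c / (4 * (K+1)) * X ^ 2)) ≤ c / 2 * X ^ 2 := by
    rw [show K * (2 * (c / (4 * (K+1)) * X ^ 2)) = (K / (K+1)) * (c / 2 * X ^ 2) by field_simp; ring]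
    exact mul_le_of_le_one_left PO ((div_le_one PO).2 LA)
  have g5 : c / 2 * (1 + X ^ 2) ≤ E + (K1 + c / 2) := by
    have := mL g3 hK
    simp only [K1]; linarith
  have g6 : 1 + X ^ 2 ≤ 2 / c * (E + (K1 + c / 2)) := by
    rw [div_mul_eq_mul_div, le_div_iff₀ hc]; linarith
  set Q := E + (K1 + c / 2)
  have Q0 : 0 ≤ Q := le_trans PO g5
  have hEX : E ≤ C1 * X * X := (le_abs_self _).trans (ip_le 1 (H1 u y X fu ⟨B, sy⟩ hR hX') hX B)
  have lift : ∀ {z c' : ℝ}, 0 ≤ c' → z ≤ c' * (1 + X ^ 2) → c' ≤ c8 + c9 → z ≤ ((c8 + c9) * (2 / c) + (c11 + K1 + c / 2)) * Q := by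
    intro z c' h0 h1 h2
    calc z ≤ c' * (2 / c * Q) := h1.trans (by gcongr)
      _ ≤ (c8 + c9) * (2 / c * Q) := by gcongr
      _ ≤ _ := by
        have : 0 ≤ (c11 + K1 + c / 2) * Q := by positivity
        linarith
  refine ⟨Q0, lift c80 ?_ LA, lift c90 ?_ LA, ?_⟩
  · have : W ≤ C7 * (1 + C) + C7 * C * X := b1.trans (by linarith [mL a4 hC7])
    have := pow_le_pow_left₀ W0 this 2
    have := add_sq_le (a := C7 * (1 + C)) (b := C7 * C * X)
    have p1 : 0 ≤ C7 ^ 2 * (1 + C) ^ 2 * X ^ 2 := by positivity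
    have p2 : 0 ≤ C7 ^ 2 * C ^ 2 := by positivity
    simp only [c8]; linarith
  · have v1 : HB (2*k-1) (|R| + C0) (yy g B u 0) := ((H0 u fu hR).Jm B).mono (by linarith [abs_nonneg R])
    have e1 := (le_abs_self _).trans (ip_le 1 (H2 u _ y X fu ⟨B, Supp_yy _ _⟩ ⟨B, sy⟩ ((hR.down LA).mono (by linarith [le_abs_self R])) v1 hX') hX B)
    have e2 := (le_abs_self _).trans (ip_le 1 (H1 u y X fu ⟨B, sy⟩ hR hX') a3 B)
    have e3 : C * V ≤ C * (C * (X + 1)) := by gcongr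
    have e4 : C1 * X * (C * V) ≤ C1 * X * (C * (C * (X + 1))) := by gcongr
    have p1 : 0 ≤ C1 * C ^ 2 := by positivity
    have p2 : C1 * C ^ 2 * (X * (X + 1)) ≤ C1 * C ^ 2 * (2 * (1 + X ^ 2)) := mL (by linarith [sq_nonneg (X - 1), sq_nonneg X]) p1
    have p3 : 0 ≤ C1 * C ^ 2 * (1 + X ^ 2) := by positivity
    simp only [c9]; linarith
  · have e1 : X ≤ C * (C7 * 2) * (1 + W) := a2.norm.trans (by
      have : 0 ≤ C * C7 * (1 + W) := by positivity
      linarith [mL b3 hC])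
    have e2 : C1 * X * X ≤ c11 * (1 + W) ^ 2 := by
      have := mL (pow_le_pow_left₀ X0 e1 2) hC1
      simp only [c11]; linarith
    have e3 : 1 ≤ (1 + W) ^ 2 := one_le_pow₀ LA
    have e4 : K1 + c / 2 ≤ (K1 + c / 2) * (1 + W) ^ 2 := le_mul_of_one_le_right PO e3
    have e5 : 0 ≤ (c8 + c9) * (2 / c) * (1 + W) ^ 2 := by positivity
    rw [show ((c8 + c9) * (2 / c) + (c11 + K1 + c / 2)) * (1 + W) ^ 2 = (c8 + c9) * (2 / c) * (1 + W) ^ 2 + c11 * (1 + W) ^ 2 + (K1 + c / 2) * (1 + W) ^ 2 by ring]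
    simp only [Q]; linarith
lemma gron {φ φ' : ℝ → ℝ} {C a b : ℝ} (hc : ContinuousOn φ (Icc a b)) (hd : ∀ t ∈ Ioo a b, HasDerivAt φ (φ' t) t) (hle : ∀ t ∈ Ioo a b, φ' t ≤ C * φ t) :
    ∀ t ∈ Icc a b, φ t ≤ φ a * Real.exp (C * (t - a)) := by
  intro t ht
  have h1 : ∀ t, HasDerivAt (fun s => Real.exp (-(C * (s - a)))) (Real.exp (-(C * (t - a))) * -(C * 1)) t := fun t =>
    ((((hasDerivAt_id t).sub_const a).const_mul C).neg).exp
  have h2 : AntitoneOn (fun s => φ s * Real.exp (-(C * (s - a)))) (Icc a b) := by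
    refine antitoneOn_of_deriv_nonpos (convex_Icc a b) (hc.mul (by fun_prop)) ?_ ?_
    · rw [interior_Icc]; exact fun t ht => ((hd t ht).mul (h1 t)).differentiableAt.differentiableWithinAt
    · rw [interior_Icc]; intro t ht
      have e : deriv (fun s => φ s * Real.exp (-(C * (s - a)))) t = _ := ((hd t ht).mul (h1 t)).deriv
      rw [e, show φ' t * Real.exp (-(C * (t - a))) + φ t * (Real.exp (-(C * (t - a))) * -(C * 1)) = (φ' t - C * φ t) * Real.exp (-(C * (t - a))) by ring]
      exact mul_nonpos_of_nonpos_of_nonneg (by linarith [hle t ht]) (Real.exp_pos _).le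
  have := h2 (Set.left_mem_Icc.2 (ht.1.trans ht.2)) ht ht.1
  simp only [sub_self, mul_zero, neg_zero, Real.exp_zero, mul_one] at this
  rw [Real.exp_neg, ← div_eq_mul_inv, div_le_iff₀ (Real.exp_pos _)] at this
  exact this
def Gal (g : GY d) (B : FZ d) (T : ℝ) (u : ℝ → Seq d) : Prop :=
  (∀ s, Supp B (u s)) ∧ ∀ t ∈ Icc 0 T, CD u (yy g B (u t) 0) t
lemma ip_Jm (a : Seq d) : ip B (Jm B a) a = 0 := sum_eq_zero fun n hn => by rw [Jm, PB_mem hn]; simp; ring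
lemma AP (hg : Gd g) (k : ℕ) (hk : HKK d k) (R : ℝ) : ∃ C, 0 ≤ C ∧ ∀ (B : FZ d) T u, T ≤ 1 → Gal g B T u →
    (∀ t ∈ Icc 0 T, HB (2*k+1) R (u t)) → ∀ t ∈ Icc 0 T, hsNorm (2*k+3) (u t) ≤ C * (1 + hsNorm (2*k+3) (u 0)) := by
  obtain ⟨C, K, hC, H⟩ := en hg k hk R
  refine ⟨C * Real.exp C, by positivity, fun B T u hT hu hR t ht => ?_⟩
  have h0 : (0:ℝ) ∈ Icc 0 T := ⟨le_rfl, ht.1.trans ht.2⟩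
  have hd : ∀ t ∈ Icc 0 T, HasDerivAt (fun s => ip B (AA g (u s) (yy g B (u s) k)) (yy g B (u s) k) + K)
      (ip B (DA g (u t) (yy g B (u t) 0) (yy g B (u t) k)) (yy g B (u t) k) + 2 * ip B (AA g (u t) (yy g B (u t) k)) (gg g B (u t) k)) t := fun t ht => by
    have a1 := CD_yy hg hu.1 (hu.2 t ht) k
    have a2 := dt_AA hg.sm hu.1 (hu.2 t ht) (fun s => Supp_yy (u s) k) a1
    have a3 := (dt_ip a2 a1 B).add_const K
    refine a3.congr_deriv ?_
    have sy := Supp_yy (g := g) (B := B) (u t) k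
    have sz : Supp B (yy g B (u t) (k+1) + gg g B (u t) k) := fun n hn => by simp [Supp_yy (g := g) (B := B) (u t) (k+1) n hn, Supp_gg (g := g) (B := B) (u t) k n hn]
    have e : ip B (yy g B (u t) (k+1)) (AA g (u t) (yy g B (u t) k)) = 0 := ip_Jm _
    rw [ip_add, ip_AA_symm hg ⟨B, hu.1 t⟩ sz sy, ip_comm _ (yy g B (u t) (k+1) + gg g B (u t) k), ip_add, e, ip_comm (gg g B (u t) k)]; ring
  have h1 := gron (fun s hs => (hd s hs).continuousAt.continuousWithinAt) (fun s hs => hd s ⟨hs.1.le, hs.2.le⟩)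
    (fun s hs => (H B (u s) (hu.1 s) (hR s ⟨hs.1.le, hs.2.le⟩)).2.2.1) t ht
  obtain ⟨-, b1, -, -⟩ := H B (u t) (hu.1 t) (hR t ht)
  obtain ⟨c0, -, -, c1⟩ := H B (u 0) (hu.1 0) (hR 0 h0)
  refine le_of_sq' ?_ (mul_nonneg PO (by have := hsNorm_nonneg (2*k+3) (u 0); linarith))
  have e1 : Real.exp (C * (t - 0)) ≤ Real.exp C := Real.exp_le_exp.2 (by have := ht.2; nlinarith)
  have e2 : 1 ≤ Real.exp C := Real.one_le_exp hC
  calc hsNorm (2*k+3) (u t) ^ 2 ≤ C * (C * (1 + hsNorm (2*k+3) (u 0)) ^ 2 * Real.exp C) :=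
        b1.trans (mL (h1.trans (mul_le_mul c1 e1 (Real.exp_pos _).le (c0.trans c1))) hC)
    _ = C ^ 2 * (1 + hsNorm (2*k+3) (u 0)) ^ 2 * (Real.exp C * 1) := by ring
    _ ≤ C ^ 2 * (1 + hsNorm (2*k+3) (u 0)) ^ 2 * (Real.exp C * Real.exp C) := by gcongr
    _ = _ := by ring
lemma HB.coef {b : ℝ} (h : HB m b c) (hm : 0 ≤ m) (n : Zd d) : ‖c n‖ ≤ b := by
  have := h.2 {n}
  rw [Finset.sum_singleton] at this
  refine le_trans ?_ (le_of_sq' this h.1)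
  exact le_mul_of_one_le_left (norm_nonneg _) (one_le_rpow (one_le_jb n) hm)
lemma HB_fin (h : Supp B c) {x : ℝ} (hx : ∀ n, ‖c n‖ ≤ x) (hx0 : 0 ≤ x) (m : ℝ) : HB m ((∑ n ∈ B, jb n ^ m) * x) c := by
  have e0 : 0 ≤ ∑ n ∈ B, jb n ^ m := sum_nonneg fun n _ => (jw m n).le
  refine (h.HB m).mono (le_of_sq' ?_ (mul_nonneg e0 hx0))
  rw [h.normSq, sum_mul]
  refine (sum_sq_le_sq_sum_of_nonneg fun n _ => mul_nonneg (jw m n).le (norm_nonneg _)).trans ?_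
  refine pow_le_pow_left₀ (sum_nonneg fun n _ => mul_nonneg (jw m n).le (norm_nonneg _)) (sum_le_sum fun n _ => ?_) 2
  exact mL (hx n) (jw m n).le
def cl (M x : ℝ) : ℝ := max (-M) (min x M)
lemma cl_lip (M x y : ℝ) : |cl M x - cl M y| ≤ |x - y| := by
  unfold cl
  refine (abs_max_sub_max_le_max _ _ _ _).trans ?_
  simp only [sub_self, abs_zero]
  refine max_le (abs_nonneg _) ((abs_min_sub_min_le_max _ _ _ _).trans ?_)
  simp
lemma cl_le {M : ℝ} (hM : 0 ≤ M) (x : ℝ) : |cl M x| ≤ M := abs_le.2 ⟨le_max_left _ _, max_le LA (min_le_right _ _)⟩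
lemma cl_eq {M x : ℝ} (h : |x| ≤ M) : cl M x = x := by
  obtain ⟨h1, h2⟩ := abs_le.1 h
  rw [cl, min_eq_left h2, max_eq_right h1]
def clc (M : ℝ) (z : ℂ) : ℂ := ⟨cl M z.re, cl M z.im⟩
lemma clc_lip (M : ℝ) (z w : ℂ) : ‖clc M z - clc M w‖ ≤ 2 * ‖z - w‖ := by
  refine (Complex.norm_le_abs_re_add_abs_im _).trans ?_
  have h1 := (cl_lip M z.re w.re).trans (abs_re_le_norm (z - w))
  have h2 := (cl_lip M z.im w.im).trans (Complex.abs_im_le_norm (z - w))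
  simp only [clc, Complex.sub_re, Complex.sub_im]; linarith
lemma clc_le {M : ℝ} (hM : 0 ≤ M) (z : ℂ) : ‖clc M z‖ ≤ 2 * M := by
  refine (Complex.norm_le_abs_re_add_abs_im _).trans ?_
  have := cl_le hM z.re; have := cl_le hM z.im
  simp only [clc]; linarith
lemma clc_eq {M : ℝ} {z : ℂ} (h : ‖z‖ ≤ M) : clc M z = z :=
  Complex.ext (cl_eq ((abs_re_le_norm z).trans h)) (cl_eq ((Complex.abs_im_le_norm z).trans h))
open Classical in
def ex (B : FZ d) (y : B → ℂ) : Seq d := fun n => if h : n ∈ B then y ⟨n, h⟩ else 0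
lemma ex_mem (y : B → ℂ) {n : Zd d} (h : n ∈ B) : ex B y n = y ⟨n, h⟩ := by simp [ex, h]
lemma Supp_ex (y : B → ℂ) : Supp B (ex B y) := fun n h => by simp [ex, h]
lemma ode (hg : Gd g) {c0 : Seq d} (h0 : Supp B c0) {M : ℝ} (hM : 0 ≤ M) : ∃ u : ℝ → Seq d, (∀ s, Supp B (u s)) ∧ u 0 = c0 ∧
    (∀ n, ContinuousOn (fun s => u s n) (Icc 0 1)) ∧ ∀ t ∈ Icc (0:ℝ) 1, (∀ n, ‖u t n‖ ≤ M) → CD u (yy g B (u t) 0) t := by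
  set q : (B → ℂ) → Seq d := fun y => ex B fun n => clc M (y n)
  set f : (B → ℂ) → (B → ℂ) := fun y n => I * GG g (q y) n
  have sq : ∀ y, Supp B (q y) := fun y => Supp_ex _
  have fq : ∀ y, FS (q y) := fun y => ⟨B, sq y⟩
  have bq : ∀ y n, ‖q y n‖ ≤ 2 * M := fun y n => by
    by_cases hn : n ∈ B
    · simp only [q, ex_mem _ hn]; exact clc_le hM _
    · rw [sq y n hn, norm_zero]; positivity
  have lq : ∀ y y' n, ‖(q y - q y') n‖ ≤ 2 * ‖y - y'‖ := fun y y' n => by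
    rw [Pi.sub_apply]
    by_cases hn : n ∈ B
    · simp only [q, ex_mem _ hn]
      exact (clc_lip M _ _).trans (mL (norm_le_pi_norm (y - y') ⟨n, hn⟩) zero_le_two)
    · rw [sq y n hn, sq y' n hn, sub_zero, norm_zero]; positivity
  set R := (∑ n ∈ B, jb n ^ (2 * (d:ℝ) + 2)) * (2 * M)
  have d0 := dn d
  have hR : ∀ y, HB (2 * d + 2) R (q y) := fun y => HB_fin (sq y) (bq y) PO _
  obtain ⟨C, hC, H⟩ := GG_est hg.sm (m := 0) (L := 2 * d + 2) (by norm_num) LA le_rfl R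
  obtain ⟨C', hC', H'⟩ := Lip hg.sm (m := 0) (L := 2 * d + 2) (by norm_num) LA le_rfl R
  set K := C' * ((∑ n ∈ B, jb n ^ ((0:ℝ) + 2)) * 2)
  have K0 : 0 ≤ K := mul_nonneg hC' (mul_nonneg (sum_nonneg fun n _ => (jw _ n).le) zero_le_two)
  have hb : ∀ y, ‖f y‖ ≤ C := fun y => (pi_norm_le_iff_of_nonneg hC).2 fun n => by
    simp only [f, norm_mul, Complex.norm_I, one_mul]; exact (H _ (fq y) (hR y)).coef le_rfl _
  have hl : LipschitzWith (Real.toNNReal K) f := LipschitzWith.of_dist_le_mul fun y y' => by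
    rw [dist_eq_norm, dist_eq_norm, Real.coe_toNNReal _ K0]
    refine (pi_norm_le_iff_of_nonneg PO).2 fun n => ?_
    have := (H' _ _ _ (fq y) (fq y') (hR y) (hR y') (HB_fin (B := B) (x := 2 * ‖y - y'‖) (fun n hn => by simp [sq y n hn, sq y' n hn]) (lq y y') PO (0+2))).coef le_rfl n
    simp only [f, Pi.sub_apply, ← mul_sub, norm_mul, Complex.norm_I, one_mul]
    refine this.trans (le_of_eq ?_)
    simp only [K]; ring
  have PL : IsPicardLindelof (fun _ => f) (tmin := -1) (tmax := 2) ⟨0, by norm_num⟩ (fun n : B => c0 n) (Real.toNNReal (C * 2)) 0 (Real.toNNReal C) (Real.toNNReal K) :=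
    IsPicardLindelof.of_time_independent (fun y _ => by rw [Real.coe_toNNReal _ hC]; exact hb y) (hl.lipschitzOnWith) (by
      rw [Real.coe_toNNReal _ hC, Real.coe_toNNReal _ PO]; norm_num)
  obtain ⟨α, ha0, ha⟩ := PL.exists_eq_forall_mem_Icc_hasDerivWithinAt₀
  have hd : ∀ t ∈ Icc (0:ℝ) 1, HasDerivAt α (f (α t)) t := fun t ht =>
    (ha t ⟨by linarith [ht.1], by linarith [ht.2]⟩).hasDerivAt (Icc_mem_nhds (by linarith [ht.1]) (by linarith [ht.2]))
  refine ⟨fun s => ex B (α s), fun s => Supp_ex _, ?_, fun n => ?_, fun t ht hn n => ?_⟩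
  · ext n; by_cases hn : n ∈ B
    · show ex B (α 0) n = c0 n
      rw [ex_mem _ hn]; exact congrFun ha0 ⟨n, hn⟩
    · show ex B (α 0) n = c0 n
      rw [Supp_ex _ n hn, h0 n hn]
  · by_cases hn : n ∈ B
    · simp only [ex_mem _ hn]
      exact fun s hs => ((hasDerivAt_pi.1 (hd s hs)) ⟨n, hn⟩).continuousAt.continuousWithinAt
    · simp only [fun y => Supp_ex (B := B) y n hn]; exact continuousOn_const
  · by_cases h : n ∈ B
    · simp only [ex_mem _ h]
      have := (hasDerivAt_pi.1 (hd t ht)) ⟨n, h⟩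
      refine this.congr_deriv ?_
      have e : q (α t) = ex B (α t) := by
        ext k; by_cases hk : k ∈ B
        · have : ‖ex B (α t) k‖ ≤ M := hn k
          simp only [q]; rw [ex_mem _ hk] at this ⊢; rw [ex_mem _ hk]; exact clc_eq this
        · rw [Supp_ex _ k hk, sq _ k hk]
      simp only [f, e, yy, Jm]; rw [PB_mem h]
    · rw [Supp_yy _ 0 n h]; simp only [fun y => Supp_ex (B := B) y n h]; exact hasDerivAt_const _ _
lemma boot {h : ℝ → ℝ} {T b : ℝ} (hc : ContinuousOn h (Icc 0 T)) (h0 : h 0 < b)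
    (hs : ∀ t ∈ Icc 0 T, (∀ τ ∈ Icc 0 t, h τ ≤ b) → h t < b) : ∀ t ∈ Icc 0 T, h t ≤ b := by
  intro t ht
  by_contra hn
  push Not at hn
  have iv : ∀ τ ∈ Icc 0 T, b < h τ → ∃ σ ∈ Icc 0 τ, h σ = b := fun τ hτ hb =>
    intermediate_value_Icc hτ.1 (hc.mono (Set.Icc_subset_Icc_right hτ.2)) ⟨h0.le, hb.le⟩
  obtain ⟨σ, hσ, hσb⟩ := iv t ht hn
  have hcp : IsCompact (Icc 0 T ∩ h ⁻¹' {b}) := isCompact_Icc.of_isClosed_subset (hc.preimage_isClosed_of_isClosed isClosed_Icc isClosed_singleton) Set.inter_subset_left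
  obtain ⟨t1, ⟨m1, m2⟩, l1⟩ := hcp.exists_isLeast ⟨σ, ⟨hσ.1, hσ.2.trans ht.2⟩, hσb⟩
  have m2 : h t1 = b := m2
  refine absurd (hs t1 m1 fun τ hτ => ?_) (by rw [m2]; exact lt_irrefl b)
  by_contra hb
  push Not at hb
  obtain ⟨ρ, hρ, hρb⟩ := iv τ ⟨hτ.1, hτ.2.trans m1.2⟩ hb
  have := l1 ⟨⟨hρ.1, hρ.2.trans (hτ.2.trans m1.2)⟩, hρb⟩
  have e : τ = t1 := le_antisymm hτ.2 (this.trans hρ.2)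
  rw [e, m2] at hb; exact lt_irrefl b hb
lemma galerkin (hg : Gd g) (k : ℕ) (hk : HKK d k) {M0 : ℝ} (hM0 : 0 ≤ M0) : ∃ T, 0 < T ∧ T ≤ 1 ∧ ∃ R2, 0 ≤ R2 ∧
    ∀ (B : FZ d) c0, Supp B c0 → HB (2*k+3) M0 c0 → ∃ u, Gal g B T u ∧ u 0 = c0 ∧ ∀ t ∈ Icc 0 T, HB (2*k+3) R2 (u t) := by
  have d0 := dn d
  obtain ⟨C, hC, H⟩ := AP hg k hk (M0 + 1)
  set R2 := C * (1 + M0)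
  have hR2 : 0 ≤ R2 := by positivity
  obtain ⟨C3, hC3, H3⟩ := GG_est hg.sm (m := 2*k+1) (L := 2*k+3) LA LA LA R2
  set T := min 1 (1 / (2 * (C3 + 1)))
  have hT0 : 0 < T := lt_min one_pos PO
  have hT1 : T ≤ 1 := min_le_left _ _
  have hT3 : C3 * T < 1 := by
    have : T ≤ 1 / (2 * (C3 + 1)) := min_le_right _ _
    rw [le_div_iff₀ PO] at this; nlinarith
  refine ⟨T, hT0, hT1, R2, hR2, fun B c0 hB h0 => ?_⟩
  obtain ⟨u, hu, hu0, huc, hud⟩ := ode hg hB (M := M0 + 1) LA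
  have toG : ∀ t ∈ Icc 0 T, (∀ τ ∈ Icc 0 t, hsNorm (2*k+1) (u τ) ^ 2 ≤ (M0 + 1) ^ 2) → Gal g B t u ∧ (∀ τ ∈ Icc 0 t, HB (2*k+1) (M0 + 1) (u τ)) ∧
      ∀ τ ∈ Icc 0 t, HB (2*k+3) R2 (u τ) := fun t ht hb => by
    have a1 : ∀ τ ∈ Icc 0 t, HB (2*k+1) (M0 + 1) (u τ) := fun τ hτ => ((hu τ).HB _).mono (le_of_sq' (hb τ hτ) LA)
    have a2 : Gal g B t u := ⟨hu, fun τ hτ => hud τ ⟨hτ.1, hτ.2.trans (ht.2.trans hT1)⟩ fun n => (a1 τ hτ).coef LA n⟩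
    refine ⟨a2, a1, fun τ hτ => ((hu τ).HB _).mono ((H B t u (ht.2.trans hT1) a2 a1 τ hτ).trans ?_)⟩
    rw [hu0]; have := h0.norm; simp only [R2]; gcongr
  have bb := boot (h := fun t => hsNorm (2*k+1) (u t) ^ 2) (T := T) (b := (M0 + 1) ^ 2) ?_ ?_ ?_
  · obtain ⟨a, -, b⟩ := toG T ⟨hT0.le, le_rfl⟩ bb
    exact ⟨u, a, hu0, b⟩
  · simp only [(hu _).normSq]
    exact continuousOn_finsetSum _ fun n _ => (continuousOn_const.mul ((huc n).mono (Set.Icc_subset_Icc_right hT1)).norm).pow 2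
  · simp only [hu0]
    have := (h0.down (m' := 2*k+1) LA).norm
    have := hsNorm_nonneg (2*k+1) c0
    exact pow_lt_pow_left₀ LA this two_ne_zero
  · intro t ht hb
    obtain ⟨a1, -, a3⟩ := toG t ht hb
    have a4 := HB_mvt (m := 2*k+1) (γ := u) (γ' := fun τ => yy g B (u τ) 0) ht.1 hC3 (fun n => (huc n).mono (Set.Icc_subset_Icc_right (ht.2.trans hT1)))
      (fun τ hτ => a1.2 τ ⟨hτ.1.le, hτ.2.le⟩) (fun τ hτ => (H3 _ ⟨B, hu τ⟩ (a3 τ ⟨hτ.1.le, hτ.2.le⟩)).Jm B)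
    have a5 := (a4.add (h0.down (m' := 2*k+1) LA)).norm
    rw [hu0, sub_add_cancel, sub_zero] at a5
    have := hsNorm_nonneg (2*k+1) (u t)
    have := mL ht.2 hC3
    exact pow_lt_pow_left₀ LA LA two_ne_zero
lemma DA_symm (hg : Gd g) (u v z : Seq d) : DA g u v z = DA g u z v := by
  unfold DA; congr 1; funext b x
  have hG := hg.sm b
  have hf : ContDiff ℝ 1 (fderiv ℝ (g b)) := hG.fderiv_right (m := 1) (WithTop.coe_le_coe.2 le_top)
  have e : ∀ p q : Y d, d2 (g b) (jt u x) p q = fderiv ℝ (fderiv ℝ (g b)) (jt u x) p q := fun p q => by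
    rw [d2, fderiv_clm_apply (hf.differentiable (by simp) _) (by fun_prop)]; simp
  rw [e, e]
  exact (hG.contDiffAt (x := jt u x)).isSymmSndFDerivAt (by simp; exact WithTop.coe_le_coe.2 le_top) _ _
lemma AA_zero (hg : Gd g) (hu : FS u) : AA g u 0 = 0 := by
  have := AA_add hg hu (a := 0) (b := 0) ⟨∅, fun _ _ => rfl⟩ ⟨∅, fun _ _ => rfl⟩
  simpa using this
lemma AAl (hg : Gd g) (h2 : 2 * d + 2 ≤ L) (R : ℝ) : ∃ C, 0 ≤ C ∧ ∀ a b z y, FS a → FS b → FS z → HB L R a → HB L R b → HB L R z → HB 1 y (a - b) →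
    HB (-1) (C * y) (AA g a z - AA g b z) := by
  have d0 := dn d
  obtain ⟨C, hC, H⟩ := DA_est hg.sm (m := -1) le_rfl LA h2 R
  refine ⟨C, hC, fun a b z y ha hb hz hR hR' hz' hy => ?_⟩
  obtain ⟨B, hB, hB'⟩ := ha.common hb
  obtain ⟨B1, hB1⟩ := hz
  classical
  set γ : ℝ → Seq d := fun θ n => b n + (θ:ℂ) * (a n - b n)
  set D := B ∪ B1
  have hs : ∀ θ, Supp D (γ θ) := fun θ n hn => by
    have : n ∉ B := fun h => hn (Finset.mem_union_left _ h)
    simp [γ, hB n this, hB' n this]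
  have hz : Supp D z := fun n hn => hB1 n fun h => hn (Finset.mem_union_right _ h)
  have hd : ∀ θ : ℝ, CD (fun s => AA g (γ s) z) (DA g (γ θ) z (a - b)) θ := fun θ => by
    have := dt_AA hg.sm hs (CD_line a b θ) (z := fun _ => z) (z' := 0) (fun _ => hz) (fun n => hasDerivAt_const _ _)
    rwa [AA_zero hg ⟨D, hs θ⟩, add_zero, DA_symm hg] at this
  have := HB_mvt (m := -1) (b := C * y) zero_le_one (mul_nonneg hC hy.1) (fun n => fun θ _ => (hd θ n).continuousAt.continuousWithinAt)
    (fun θ _ => hd θ) fun θ hθ => H _ _ _ y ⟨D, hs θ⟩ ⟨D, hz⟩ (ha.sub hb) (hR.conv hR' hθ.1.le hθ.2.le) hz' (by norm_num; exact hy)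
  have e1 : γ 1 = a := by ext n; simp [γ]
  have e0 : γ 0 = b := by ext n; simp [γ]
  simpa [e1, e0] using this
lemma ip_w {w : Seq d} (h : Supp B w) : ip B w w = hsNorm 0 w ^ 2 := by
  rw [h.normSq]; refine sum_congr rfl fun n _ => ?_
  rw [mul_conj, ofReal_re, normSq_eq_norm_sq]; simp
lemma Supp.sub {a b : Seq d} (h : Supp B a) (h' : Supp B b) : Supp B (a - b) := fun n hn => by simp [h n hn, h' n hn]
lemma mvt1 {f f' : ℝ → ℝ} {b : ℝ} (hd : ∀ θ, HasDerivAt f (f' θ) θ) (h : ∀ θ ∈ Ioo (0:ℝ) 1, b ≤ f' θ) : b ≤ f 1 - f 0 := by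
  obtain ⟨θ, hθ, e⟩ := exists_hasDerivAt_eq_slope f f' one_pos (fun x _ => (hd x).continuousAt.continuousWithinAt) fun x _ => hd x
  have := h θ hθ; rw [e] at this; simpa using this
lemma dif0 (hg : Gd g) (h2 : 2 * d + 2 ≤ L) (R : ℝ) : ∃ c K C, 0 < c ∧ 0 ≤ C ∧ ∀ (B : FZ d) u u' v v' γ, Supp B u → Supp B u' → Supp B v → Supp B v' →
    HB L R u → HB L R u' → HB L R v → HB L R v' → HB 1 γ ((v - Jm B (GG g u)) - (v' - Jm B (GG g u'))) →
    c * hsNorm 1 (u - u') ^ 2 ≤ ip B (GG g u - GG g u') (u - u') + K * ip B (u - u') (u - u') ∧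
    ip B (GG g u - GG g u') (u - u') + K * ip B (u - u') (u - u') ≤ C * hsNorm 1 (u - u') ^ 2 ∧
    ip B (AA g u v - AA g u' v') (u - u') + ip B (GG g u - GG g u') (v - v') + K * (ip B (v - v') (u - u') + ip B (u - u') (v - v'))
      ≤ C * (hsNorm 1 (u - u') ^ 2 + γ * hsNorm 1 (u - u')) := by
  have d0 := dn d
  obtain ⟨c, hc, K, hK, H1⟩ := gard hg R
  obtain ⟨C1, hC1, H2⟩ := Lip hg.sm (m := -1) le_rfl LA h2 R
  obtain ⟨C2, hC2, H3⟩ := AAl hg h2 R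
  refine ⟨c, K, 2 * C1 + K + 3 * C2 + 2 + 2 * K * C1 + 2 * K, hc, by positivity, fun B u u' v v' γ su su' sv sv' hu hu' hv hv' hγ => ?_⟩
  set w := u - u' with hw
  set y := hsNorm 1 w
  set Δ := GG g u - GG g u'
  have y0 : 0 ≤ y := hsNorm_nonneg _ _
  have sw : Supp B w := su.sub su'
  have hy : HB 1 y w := sw.HB 1
  have hΔ : HB (-1) (C1 * y) Δ := H2 u u' y ⟨B, su⟩ ⟨B, su'⟩ hu hu' (by norm_num; exact hy)
  have g0 := hγ.1
  set ln : ℝ → Seq d := fun θ n => u' n + (θ:ℂ) * (u n - u' n)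
  have sl : ∀ θ, Supp B (ln θ) := fun θ n hn => by simp [ln, su n hn, su' n hn]
  have e1 : ln 1 = u := by ext n; simp [ln]
  have e0 : ln 0 = u' := by ext n; simp [ln]
  have dl : ∀ z : Seq d, ∀ θ : ℝ, HasDerivAt (fun s => ip B (GG g (ln s)) z) (ip B (AA g (ln θ) w) z) θ := fun z θ => by
    have := dt_ip (dt_GG hg.sm sl (CD_line u u' θ)) (v := fun _ => z) (v' := 0) (fun n => hasDerivAt_const _ _) B
    refine this.congr_deriv ?_
    have : ip B (GG g (ln θ)) (0 : Seq d) = 0 := by simp [ip]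
    rw [this, add_zero]
  have w0 : hsNorm 0 w ≤ y := hsNorm_mono (sw.inHs 1) zero_le_one
  have w02 : hsNorm 0 w ^ 2 ≤ y ^ 2 := pow_le_pow_left₀ (hsNorm_nonneg _ _) w0 2
  have co : c * y ^ 2 - K * hsNorm 0 w ^ 2 ≤ ip B Δ w := by
    have := mvt1 (dl w) (b := c * y ^ 2 - K * hsNorm 0 w ^ 2) fun θ hθ => by
      have := H1 B (ln θ) w ⟨B, sl θ⟩ sw ((hu.conv hu' hθ.1.le hθ.2.le).down LA)
      linarith
    rwa [e1, e0, ← ip_sub] at this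
  have bΔ := (abs_le.1 (ip_le 1 hΔ hy B)).2
  have sdv : Supp B (v - v') := sv.sub sv'
  set z := v - v' with hz
  set h := (v - Jm B (GG g u)) - (v' - Jm B (GG g u')) with hh
  have ez : z = Jm B Δ + h := by
    ext n; simp only [hz, hh, Δ, Pi.add_apply, Pi.sub_apply, Jm]
    by_cases hn : n ∈ B
    · simp only [PB_mem hn, Pi.sub_apply]; ring
    · simp only [Supp_PB B _ n hn]; ring
  have b1 : ip B Δ z ≤ C1 * y * γ := by
    rw [ez, ip_comm, ip_add, ip_Jm, zero_add, ip_comm]; exact (abs_le.1 (ip_le 1 hΔ hγ B)).2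
  have b2 : ip B z w ≤ C1 * y * y + γ * y := by
    rw [ez, ip_add]
    have := (abs_le.1 (ip_le 1 (hΔ.Jm B) hy B)).2
    have := (abs_le.1 (ip_le 1 (hγ.down (by norm_num : (-1:ℝ) ≤ 1)) hy B)).2
    linarith
  have dA : ∀ θ ∈ Icc (0:ℝ) 1, ∀ q, Supp B q → HB L R q → |ip B (AA g u q - AA g (ln θ) q) w| ≤ C2 * y * y := fun θ hθ q sq hq => by
    refine ip_le 1 (H3 u (ln θ) q y ⟨B, su⟩ ⟨B, sl θ⟩ ⟨B, sq⟩ hu (hu.conv hu' hθ.1 hθ.2) hq ?_) hy B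
    have := (hy.smul (1 - (θ:ℂ))).mono (b' := y) (mul_le_of_le_one_left y0 (by
      rw [show (1:ℂ) - θ = ((1 - θ : ℝ) : ℂ) by push_cast; rfl, norm_real]
      exact abs_le.2 ⟨by linarith [hθ.2], by linarith [hθ.1]⟩))
    convert this using 1
    ext n; simp only [ln, hw, Pi.sub_apply]; ring
  have AAs : ∀ θ, AA g (ln θ) v = AA g (ln θ) z + AA g (ln θ) v' := fun θ => by
    rw [← AA_add hg ⟨B, sl θ⟩ ⟨B, sdv⟩ ⟨B, sv'⟩, hz, sub_add_cancel]
  have dz : ∀ θ ∈ Icc (0:ℝ) 1, ip B (AA g u z - AA g (ln θ) z) w ≤ 2 * C2 * y ^ 2 := fun θ hθ => by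
    have a1 := (abs_le.1 (dA θ hθ v sv hv)).2
    have a2 := (abs_le.1 (dA θ hθ v' sv' hv')).1
    have a3 := AAs 1
    rw [e1] at a3
    rw [a3, AAs θ, show AA g u z + AA g u v' - (AA g (ln θ) z + AA g (ln θ) v') = (AA g u z - AA g (ln θ) z) + (AA g u v' - AA g (ln θ) v') by abel, ip_add] at a1
    linarith
  have tay : ip B (AA g u z) w - ip B Δ z ≤ 2 * C2 * y ^ 2 := by
    have := mvt1 (f := fun θ => ip B (GG g (ln θ)) z - θ * ip B (AA g u z) w) (f' := fun θ => ip B (AA g (ln θ) w) z - ip B (AA g u z) w) (b := -(2 * C2 * y ^ 2))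
      (fun θ => ((dl z θ).sub ((hasDerivAt_id θ).mul_const _)).congr_deriv (by ring)) fun θ hθ => by
        have := dz θ ⟨hθ.1.le, hθ.2.le⟩
        rw [ip_sub] at this
        rw [ip_AA_symm hg ⟨B, sl θ⟩ sw sdv]; linarith
    simp only [e1, e0] at this
    have e : ip B Δ z = ip B (GG g u) z - ip B (GG g u') z := ip_sub _ _ _
    rw [e]; linarith
  have t3 : ip B (AA g u v - AA g u' v') w ≤ ip B (AA g u z) w + C2 * y ^ 2 := by
    have a2 := (abs_le.1 (dA 0 ⟨le_rfl, zero_le_one⟩ v' sv' hv')).2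
    have a3 := AAs 1
    rw [e1] at a3; rw [e0] at a2
    rw [a3, show AA g u z + AA g u v' - AA g u' v' = AA g u z + (AA g u v' - AA g u' v') by abel, ip_add]; linarith
  rw [ip_w sw, ip_comm w z]
  have k1 := mL w02 hK
  have k2 := mL b2 hK
  have p1 : 0 ≤ y ^ 2 := sq_nonneg y
  have p2 : 0 ≤ γ * y := mul_nonneg g0 y0
  have q1 := mul_nonneg hK p1
  have q2 := mul_nonneg hK p2
  have q3 := mul_nonneg hC1 p1
  have q4 := mul_nonneg hC1 p2
  have q5 := mul_nonneg hC2 p1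
  have q6 := mul_nonneg hC2 p2
  have q7 := mul_nonneg hK q3
  have q8 := mul_nonneg hK q4
  refine ⟨by linarith, ?_, ?_⟩
  · linarith
  · linarith
lemma dif (hg : Gd g) (h2 : 2 * d + 2 ≤ L) (R : ℝ) : ∃ C, 0 ≤ C ∧ ∀ (B : FZ d) (u u' v v' : ℝ → Seq d) (γ a b : ℝ), b ≤ a + 1 →
    (∀ t, Supp B (u t)) → (∀ t, Supp B (u' t)) → (∀ t ∈ Icc a b, CD u (v t) t ∧ CD u' (v' t) t ∧ HB L R (u t) ∧ HB L R (u' t) ∧ HB L R (v t) ∧ HB L R (v' t) ∧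
      HB 1 γ ((v t - Jm B (GG g (u t))) - (v' t - Jm B (GG g (u' t))))) → ∀ t ∈ Icc a b, hsNorm 1 (u t - u' t) ^ 2 ≤ C * (hsNorm 1 (u a - u' a) ^ 2 + γ ^ 2) := by
  obtain ⟨c, K, C, hc, hC, H⟩ := dif0 hg h2 R
  set D := 2 * C * (1 / c + 1)
  have hD : 0 ≤ D := by positivity
  refine ⟨(1 / c) * ((C + 1) * Real.exp D), by positivity, fun B u u' v v' γ a b hab su su' h t ht => ?_⟩
  have HH := fun t (ht : t ∈ Icc a b) => H B (u t) (u' t) (v t) (v' t) γ (su t) (su' t) ((h t ht).1.supp su) ((h t ht).2.1.supp su')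
    (h t ht).2.2.1 (h t ht).2.2.2.1 (h t ht).2.2.2.2.1 (h t ht).2.2.2.2.2.1 (h t ht).2.2.2.2.2.2
  have hd := fun t (ht : t ∈ Icc a b) => (((dt_ip ((dt_GG hg.sm su (h t ht).1).sub (dt_GG hg.sm su' (h t ht).2.1)) ((h t ht).1.sub (h t ht).2.1) B).add
    ((dt_ip ((h t ht).1.sub (h t ht).2.1) ((h t ht).1.sub (h t ht).2.1) B).const_mul K)).add_const (γ ^ 2))
  have h1 := gron (C := D) (fun s hs => (hd s hs).continuousAt.continuousWithinAt) (fun s hs => hd s ⟨hs.1.le, hs.2.le⟩) (fun s hs => by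
    obtain ⟨x1, x2, x3⟩ := HH s ⟨hs.1.le, hs.2.le⟩
    simp only [Pi.add_apply]
    set y := hsNorm 1 (u s - u' s)
    set E := ip B (GG g (u s) - GG g (u' s)) (u s - u' s) + K * ip B (u s - u' s) (u s - u' s)
    refine x3.trans ?_
    have z1 : y ^ 2 + γ * y ≤ 2 * (y ^ 2 + γ ^ 2) := by linarith [sq_nonneg (y - γ), sq_nonneg y, sq_nonneg γ]
    have z2 : y ^ 2 ≤ (1 / c) * E := by rw [one_div, inv_mul_eq_div, le_div_iff₀ hc, mul_comm]; exact x1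
    have z3 : 0 ≤ E := le_trans PO x1
    have z4 : y ^ 2 + γ ^ 2 ≤ (1 / c + 1) * (E + γ ^ 2) := by
      have : 0 ≤ (1 / c) * γ ^ 2 := by positivity
      linarith
    calc C * (y ^ 2 + γ * y) ≤ C * (2 * ((1 / c + 1) * (E + γ ^ 2))) := mL LA hC
      _ = D * (E + γ ^ 2) := by ring) t ht
  obtain ⟨x1, -, -⟩ := HH t ht
  have ha : a ∈ Icc a b := ⟨le_rfl, ht.1.trans ht.2⟩
  obtain ⟨-, x2, -⟩ := HH a ha
  simp only [Pi.add_apply] at h1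
  set y := hsNorm 1 (u t - u' t)
  set E := ip B (GG g (u t) - GG g (u' t)) (u t - u' t) + K * ip B (u t - u' t) (u t - u' t)
  set y0 := hsNorm 1 (u a - u' a)
  have e1 : Real.exp (D * (t - a)) ≤ Real.exp D := Real.exp_le_exp.2 (mul_le_of_le_one_right hD (by linarith [ht.2]))
  have z2 : y ^ 2 ≤ (1 / c) * (E + γ ^ 2) := by
    rw [one_div, inv_mul_eq_div, le_div_iff₀ hc, mul_comm]; linarith [sq_nonneg γ]
  refine z2.trans ?_
  rw [mul_assoc]
  refine mL (h1.trans ?_) PO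
  rw [mul_right_comm (C+1)]
  refine mul_le_mul ?_ e1 (Real.exp_pos _).le PO
  have := mul_nonneg hC (sq_nonneg γ)
  linarith [sq_nonneg y0]
lemma Q_fin (d : ℕ) (r : ℝ) : {n : Zd d | jb n ≤ r}.Finite := by
  refine (Set.finite_Icc (fun _ : Fin d => -⌈r⌉) (fun _ => ⌈r⌉)).subset fun n hn => ?_
  have h : ∀ i, |n i| ≤ ⌈r⌉ := fun i => by
    have := (abs_le_jb n i).trans ((show jb n ≤ r from hn).trans (Int.le_ceil r))
    exact_mod_cast this
  exact ⟨fun i => (abs_le.1 (h i)).1, fun i => (abs_le.1 (h i)).2⟩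
def Q (d : ℕ) (r : ℝ) : FZ d := (Q_fin d r).toFinset
lemma mem_Q {r : ℝ} {n : Zd d} : n ∈ Q d r ↔ jb n ≤ r := by simp [Q]
lemma PB_not {n : Zd d} (h : n ∉ B) (c : Seq d) : PB B c n = 0 := Supp_PB B c n h
def pp (δ : ℝ) (h : ℕ) (n : Zd d) : ℝ := jb n ^ δ / (2 ^ δ) ^ h
def W (δ : ℝ) (h : ℕ) (n : Zd d) : ℝ := min (pp δ h n) (pp δ h n)⁻¹
lemma pp_pos (δ : ℝ) (h : ℕ) (n : Zd d) : 0 < pp δ h n := div_pos (jw δ n) (pow_pos PO h)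
lemma W_pos (δ : ℝ) (h : ℕ) (n : Zd d) : 0 < W δ h n := lt_min (pp_pos δ h n) (inv_pos.2 (pp_pos δ h n))
lemma W_le (δ : ℝ) (h : ℕ) (n : Zd d) : W δ h n ≤ 1 := by
  rcases le_total (pp δ h n) 1 with h1 | h1
  · exact (min_le_left _ _).trans h1
  · exact (min_le_right _ _).trans (inv_le_one_of_one_le₀ h1)
lemma pp_eq (δ : ℝ) (h : ℕ) (n : Zd d) : pp δ h n = (jb n / 2 ^ h) ^ δ := by
  rw [pp, Real.div_rpow (jb_pos n).le PO, ← rpow_natCast, ← rpow_natCast, ← rpow_mul two_pos.le, ← rpow_mul two_pos.le, mul_comm]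
lemma tele {κ p : ℝ} (hκ : 1 < κ) (hp : 0 < p) : min p p⁻¹ ≤ 2 * (κ + 1) / (κ - 1) * (p / (1 + p) - (p / κ) / (1 + p / κ)) := by
  have k0 : 0 < κ := by linarith
  have e : 2 * (κ + 1) / (κ - 1) * (p / (1 + p) - (p / κ) / (1 + p / κ)) = 2 * (κ + 1) * p / ((1 + p) * (κ + p)) := by
    have : κ - 1 ≠ 0 := by linarith
    have : 1 + p ≠ 0 := by positivity
    have : κ + p ≠ 0 := by positivity
    field_simp; ring
  rw [e, le_div_iff₀ PO]
  rcases le_total p 1 with h | h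
  · refine (mR (min_le_left _ _) PO).trans ?_
    have : (1 + p) * (κ + p) ≤ 2 * (κ + 1) := mul_le_mul LA LA PO (by norm_num)
    have := mL this hp.le
    linarith
  · refine (mR (min_le_right _ _) PO).trans ?_
    rw [inv_mul_eq_div, div_le_iff₀ hp]
    have : (1 + p) * (κ + p) ≤ (2 * p) * ((κ + 1) * p) := mul_le_mul LA (by have := mL h k0.le; linarith) PO PO
    linarith
lemma W_sum (hδ : 0 < δ) : ∃ C, 0 ≤ C ∧ ∀ (a b : ℕ) (n : Zd d), ∑ h ∈ Finset.Ico a b, W δ h n ≤ C := by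
  have hκ : (1:ℝ) < 2 ^ δ := Real.one_lt_rpow one_lt_two hδ
  refine ⟨2 * (2 ^ δ + 1) / (2 ^ δ - 1), div_nonneg PO LA, fun a b n => ?_⟩
  have h1 : ∑ h ∈ Finset.Ico a b, W δ h n ≤ ∑ h ∈ Finset.range b, W δ h n :=
    sum_le_sum_of_subset_of_nonneg (fun h hh => Finset.mem_range.2 (Finset.mem_Ico.1 hh).2) fun h _ _ => (W_pos δ h n).le
  refine h1.trans ?_
  have h2 : ∀ h ∈ Finset.range b, W δ h n ≤ 2 * (2 ^ δ + 1) / (2 ^ δ - 1) * (pp δ h n / (1 + pp δ h n) - pp δ (h+1) n / (1 + pp δ (h+1) n)) := fun h _ => by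
    have := tele hκ (pp_pos δ h n)
    rwa [show pp δ h n / 2 ^ δ = pp δ (h+1) n by rw [pp, pp, pow_succ, div_div]] at this
  refine (sum_le_sum h2).trans ?_
  rw [← mul_sum, Finset.sum_range_sub']
  refine mul_le_of_le_one_right (div_nonneg PO LA) ?_
  have := pp_pos δ 0 n
  have x1 : pp δ 0 n / (1 + pp δ 0 n) ≤ 1 := (div_le_one PO).2 LA
  have := pp_pos δ b n
  have x2 : 0 ≤ pp δ b n / (1 + pp δ b n) := by positivity
  linarith
def Wc (δ : ℝ) (h : ℕ) (c : Seq d) : Seq d := fun n => (W δ h n : ℂ) * c n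
lemma Wc_norm (h : ℕ) (c : Seq d) (n : Zd d) : ‖Wc δ h c n‖ = W δ h n * ‖c n‖ := by
  rw [Wc, norm_mul, norm_real, Real.norm_of_nonneg (W_pos δ h n).le]
lemma HB.Wc {b : ℝ} (hc : HB m b c) (h : ℕ) : HB m b (Wc δ h c) := hc.of_le1 fun n => by
  rw [Wc_norm]; exact mL (mul_le_of_le_one_left (norm_nonneg _) (W_le δ h n)) (QLNLS.jw m n).le
lemma Wc_sum (hδ : 0 < δ) (s : ℝ) : ∃ C, 0 ≤ C ∧ ∀ (c : Seq d) b, HB s b c → ∀ p q : ℕ, ∑ h ∈ Finset.Ico p q, hsNorm s (Wc δ h c) ^ 2 ≤ C * b ^ 2 := by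
  obtain ⟨C, hC, H⟩ := W_sum (d := d) hδ
  refine ⟨C, hC, fun c b hc p q => ?_⟩
  simp only [hsNorm_sq, hsNormSq]
  rw [← Summable.tsum_finsetSum fun h _ => (hc.Wc h).inHs]
  refine tsum_le_of_sum_le' (mul_nonneg hC (sq_nonneg b)) fun T => ?_
  refine le_trans ?_ (mL (hc.2 T) hC)
  rw [mul_sum]
  refine sum_le_sum fun n _ => ?_
  simp only [hs_term]; simp only [Wc_norm]
  calc _ ≤ ∑ h ∈ Finset.Ico p q, W δ h n * (jb n ^ s * ‖c n‖) ^ 2 := sum_le_sum fun h _ => by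
        have := W_pos δ h n
        have : W δ h n ^ 2 ≤ W δ h n := by rw [sq]; exact mul_le_of_le_one_left this.le (W_le δ h n)
        calc _ = W δ h n ^ 2 * (jb n ^ s * ‖c n‖) ^ 2 := by ring
          _ ≤ _ := mR this (sq_nonneg _)
    _ ≤ _ := by rw [← sum_mul]; exact mR (H p q n) (sq_nonneg _)
lemma W_key (hδ : 0 < δ) (hs : δ ≤ s - 1) (h : ℕ) (n : Zd d) :
    jb n ^ s ≤ W δ h n * ((2 ^ h) ^ (s - 1) * jb n ^ (1:ℝ)) ∨ jb n ^ s = W δ h n * (jb n ^ (s + δ) / (2 ^ δ) ^ h) := by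
  have j0 := jb_pos n
  have p2 : (0:ℝ) < 2 ^ h := by positivity
  rcases le_total (jb n / 2 ^ h) 1 with h1 | h1
  · left
    have p1 : pp δ h n ≤ 1 := by rw [pp_eq]; exact Real.rpow_le_one PO h1 hδ.le
    rw [W, min_eq_left (p1.trans (one_le_inv₀ (pp_pos δ h n) |>.2 p1)), pp_eq]
    have e : jb n ^ s = (jb n / 2 ^ h) ^ (s - 1) * ((2 ^ h) ^ (s - 1) * jb n ^ (1:ℝ)) := by
      rw [← mul_assoc, ← mul_rpow PO p2.le, div_mul_cancel₀ _ p2.ne', ← rpow_add j0]; ring_nf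
    rw [e]
    exact mR (Real.rpow_le_rpow_of_exponent_ge PO h1 hs) PO
  · right
    have p1 : 1 ≤ pp δ h n := by rw [pp_eq]; exact one_le_rpow h1 hδ.le
    rw [W, min_eq_right ((inv_le_one_of_one_le₀ p1).trans p1), pp, rpow_add j0]
    have := (jw δ n).ne'
    field_simp
lemma lemJ (hδ : 0 < δ) (hs : δ ≤ s - 1) : ∃ C, 0 ≤ C ∧ ∀ (v : ℕ → Seq d) (x : ℕ → ℝ) (a b : ℕ) (D : ℝ), 0 ≤ D →
    (∀ h ∈ Finset.Ico a b, HB 1 (x h / (2 ^ h) ^ (s - 1)) (v h) ∧ HB (s + δ) (x h * (2 ^ δ) ^ h) (v h)) → ∑ h ∈ Finset.Ico a b, x h ^ 2 ≤ D ^ 2 →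
    HB s (C * D) (fun n => ∑ h ∈ Finset.Ico a b, v h n) := by
  obtain ⟨C, hC, H⟩ := W_sum (d := d) hδ
  refine ⟨√C * 2, by positivity, fun v x a b D hD hv hx => ⟨by positivity, fun T => ?_⟩⟩
  have k0 : (0:ℝ) < 2 ^ δ := by positivity
  have hz : ∀ h ∈ Finset.Ico a b, ∑ n ∈ T, (jb n ^ s * ‖v h n‖ / W δ h n) ^ 2 ≤ (2 * x h) ^ 2 := fun h hh => by
    obtain ⟨h1, h2⟩ := hv h hh
    have p2 : (0:ℝ) < (2 ^ h) ^ (s - 1) := by positivity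
    have x0 : 0 ≤ x h := by
      have := h2.1
      exact le_of_mul_le_mul_right (by simpa using this) (pow_pos k0 h)
    have h1' := (h1.smul (((2 ^ h) ^ (s - 1) : ℝ) : ℂ)).2 T
    have h2' := (h2.smul (((((2 ^ δ) ^ h)⁻¹ : ℝ)) : ℂ)).2 T
    rw [norm_real, Real.norm_of_nonneg p2.le, mul_div_cancel₀ _ p2.ne'] at h1'
    rw [norm_real, Real.norm_of_nonneg PO, mul_comm (x h), inv_mul_cancel_left₀ (pow_pos k0 h).ne'] at h2'
    rw [two_mul]
    refine le_trans (sum_le_sum fun n _ => ?_) (l2_add T _ _ x0 x0 h1' h2')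
    have w0 := W_pos δ h n
    have := jw s n
    refine pow_le_pow_left₀ PO ?_ 2
    rw [div_le_iff₀ w0, norm_mul, norm_mul, norm_real, norm_real, Real.norm_of_nonneg p2.le, Real.norm_of_nonneg PO]
    have y1 : 0 ≤ W δ h n * (jb n ^ (1:ℝ) * ((2 ^ h) ^ (s - 1) * ‖v h n‖)) := by have := jw 1 n; positivity
    have y2 : 0 ≤ W δ h n * (jb n ^ (s+δ) * (((2 ^ δ) ^ h)⁻¹ * ‖v h n‖)) := by have := jw (s+δ) n; positivity
    rcases W_key hδ hs h n with e | e
    · have := mR e (norm_nonneg (v h n)); linarith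
    · rw [div_eq_mul_inv] at e; rw [e]; linarith
  calc ∑ n ∈ T, (jb n ^ s * ‖∑ h ∈ Finset.Ico a b, v h n‖) ^ 2
      ≤ ∑ n ∈ T, C * ∑ h ∈ Finset.Ico a b, (jb n ^ s * ‖v h n‖ / W δ h n) ^ 2 := sum_le_sum fun n _ => by
        have j0 := (jw s n).le
        have e1 : jb n ^ s * ‖∑ h ∈ Finset.Ico a b, v h n‖ ≤ ∑ h ∈ Finset.Ico a b, W δ h n * (jb n ^ s * ‖v h n‖ / W δ h n) := by
          refine (mL (norm_sum_le _ _) j0).trans (le_of_eq ?_)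
          rw [mul_sum]
          exact sum_congr rfl fun h _ => by rw [mul_div_cancel₀ _ (W_pos δ h n).ne']
        refine (pow_le_pow_left₀ (mul_nonneg j0 (norm_nonneg _)) e1 2).trans ((sum_mul_sq_le_sq_mul_sq _ _ _).trans ?_)
        refine mR (le_trans (sum_le_sum fun h _ => ?_) (H a b n)) (sum_nonneg fun h _ => sq_nonneg _)
        rw [sq]; exact mul_le_of_le_one_left (W_pos δ h n).le (W_le δ h n)
    _ = C * ∑ h ∈ Finset.Ico a b, ∑ n ∈ T, (jb n ^ s * ‖v h n‖ / W δ h n) ^ 2 := by rw [← mul_sum, sum_comm]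
    _ ≤ C * ∑ h ∈ Finset.Ico a b, 4 * x h ^ 2 := mL (sum_le_sum fun h hh => (hz h hh).trans (le_of_eq (by ring))) hC
    _ ≤ C * (4 * D ^ 2) := by rw [← mul_sum]; exact mL LA hC
    _ = (√C * 2 * D) ^ 2 := by rw [mul_pow, mul_pow, sq_sqrt hC]; ring
lemma sh1 (hδ : 0 < δ) (hs : 1 ≤ s) {b : ℝ} (h : ℕ) (hc : HB s b (Wc δ h c)) :
    HB 1 (2 ^ δ / (2 ^ h) ^ (s - 1) * b) (PB (Q d (2 ^ (h+1))) c - PB (Q d (2 ^ h)) c) := by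
  refine hc.of_le PO fun n => ?_
  have j0 := jb_pos n
  have p2 : (0:ℝ) < 2 ^ h := by positivity
  have R0 : 0 ≤ 2 ^ δ / (2 ^ h) ^ (s - 1) * (jb n ^ s * ‖Wc δ h c n‖) := by have := jw s n; positivity
  rw [Pi.sub_apply]
  by_cases h2 : jb n ≤ 2 ^ (h+1)
  swap
  · rw [PB_not (mt mem_Q.1 h2), PB_not (mt mem_Q.1 fun h1 => h2 (h1.trans (pow_le_pow_right₀ one_le_two (by omega))))]; simpa using R0
  by_cases h1 : jb n ≤ 2 ^ h
  · rw [PB_mem (mem_Q.2 h2), PB_mem (mem_Q.2 h1)]; simpa using R0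
  rw [PB_mem (mem_Q.2 h2), PB_not (mt mem_Q.1 h1), sub_zero, Wc_norm]
  push Not at h1
  have x1 : 1 ≤ jb n / 2 ^ h := (one_le_div p2).2 h1.le
  have x2 : jb n / 2 ^ h ≤ 2 := by rw [div_le_iff₀ p2]; rw [pow_succ] at h2; linarith
  have p1 : 1 ≤ pp δ h n := by rw [pp_eq]; exact one_le_rpow x1 hδ.le
  have p3 : pp δ h n ≤ 2 ^ δ := by rw [pp_eq]; exact rpow_le_rpow PO x2 hδ.le
  have w : 1 ≤ 2 ^ δ * W δ h n := by
    rw [W, min_eq_right ((inv_le_one_of_one_le₀ p1).trans p1), ← div_eq_mul_inv, one_le_div (pp_pos δ h n)]; exact p3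
  have e : jb n ^ (1:ℝ) ≤ jb n ^ s / (2 ^ h) ^ (s - 1) := by
    rw [le_div_iff₀ PO, show s = 1 + (s - 1) by ring, rpow_add j0, show 1 + (s - 1) - 1 = s - 1 by ring]
    exact mL (rpow_le_rpow p2.le h1.le LA) (jw 1 n).le
  calc jb n ^ (1:ℝ) * ‖c n‖ ≤ (jb n ^ s / (2 ^ h) ^ (s - 1)) * ‖c n‖ * (2 ^ δ * W δ h n) := by
        have y := mR e (norm_nonneg (c n))
        exact y.trans (le_mul_of_one_le_right ((mul_nonneg (jw 1 n).le (norm_nonneg _)).trans y) w)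
    _ = _ := by ring
lemma sh2 (hδ : 0 < δ) {b : ℝ} (h : ℕ) (hc : HB s b (Wc δ h c)) :
    HB (s + δ) ((2 ^ δ) ^ 2 * (2 ^ δ) ^ h * b) (PB (Q d (2 ^ (h+1))) c) := by
  refine hc.of_le PO fun n => ?_
  have j0 := jb_pos n
  have p2 : (0:ℝ) < 2 ^ h := by positivity
  have k0 : (1:ℝ) ≤ 2 ^ δ := one_le_rpow one_le_two hδ.le
  have R0 : 0 ≤ (2 ^ δ) ^ 2 * (2 ^ δ) ^ h * (jb n ^ s * ‖Wc δ h c n‖) := by have := jw s n; positivity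
  by_cases h2 : jb n ≤ 2 ^ (h+1)
  swap
  · rw [PB_not (mt mem_Q.1 h2)]; simpa using R0
  rw [PB_mem (mem_Q.2 h2), Wc_norm]
  have x2 : jb n / 2 ^ h ≤ 2 := by rw [div_le_iff₀ p2]; rw [pow_succ] at h2; linarith
  have p3 : pp δ h n ≤ 2 ^ δ := by rw [pp_eq]; exact rpow_le_rpow PO x2 hδ.le
  have p0 := pp_pos δ h n
  have w : pp δ h n ≤ (2 ^ δ) ^ 2 * W δ h n := by
    rcases le_total (pp δ h n) 1 with p1 | p1
    · rw [W, min_eq_left (p1.trans (one_le_inv₀ p0 |>.2 p1))]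
      exact le_mul_of_one_le_left p0.le (one_le_pow₀ k0)
    · rw [W, min_eq_right ((inv_le_one_of_one_le₀ p1).trans p1), ← div_eq_mul_inv, le_div_iff₀ p0, ← sq]
      exact pow_le_pow_left₀ p0.le p3 2
  have e : jb n ^ (s + δ) = jb n ^ s * (pp δ h n * (2 ^ δ) ^ h) := by
    rw [pp, div_mul_cancel₀ _ PO, rpow_add j0]
  rw [e]
  have := mR (mL (mR w (by positivity : (0:ℝ) ≤ (2 ^ δ) ^ h)) (jw s n).le) (norm_nonneg (c n))
  linarith
def Tow (g : GY d) (T m R : ℝ) (c0 : Seq d) (u : ℕ → ℝ → Seq d) : Prop :=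
  ∀ h, Gal g (Q d (4 ^ h)) T (u h) ∧ u h 0 = PB (Q d (2 ^ h)) c0 ∧ ∀ t ∈ Icc 0 T, HB m R (u h t)
lemma Supp.mono {B' : FZ d} (h : Supp B c) (hB : ∀ n ∈ B, n ∈ B') : Supp B' c := fun n hn => h n fun h => hn (hB n h)
lemma Qsub {a b : ℝ} (h : a ≤ b) : ∀ n ∈ Q d a, n ∈ Q d b := fun _ hn => mem_Q.2 ((mem_Q.1 hn).trans h)
lemma tow_ex (hg : Gd g) (k : ℕ) (hk : HKK d k) {M0 : ℝ} (hM0 : 0 ≤ M0) : ∃ T, 0 < T ∧ T ≤ 1 ∧ ∃ R2, 0 ≤ R2 ∧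
    ∀ c0, HB (2*k+3) M0 c0 → ∃ u, Tow g T (2*k+3) R2 c0 u := by
  obtain ⟨T, h1, h2, R2, h3, H⟩ := galerkin hg k hk hM0
  refine ⟨T, h1, h2, R2, h3, fun c0 hc => ?_⟩
  choose u hu using fun h : ℕ => H (Q d (4 ^ h)) (PB (Q d (2 ^ h)) c0)
    ((Supp_PB _ c0).mono (Qsub (pow_le_pow_left₀ (by norm_num) (by norm_num) h))) (hc.PB _)
  exact ⟨u, hu⟩
lemma hsNorm_sub_comm (m : ℝ) (a b : Seq d) : hsNorm m (a - b) = hsNorm m (b - a) := by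
  unfold hsNorm hsNormSq; congr 1; refine tsum_congr fun n => ?_
  rw [Pi.sub_apply, Pi.sub_apply, norm_sub_rev]
lemma tow1 (hg : Gd g) (k : ℕ) (hk : HKK d k) (hδ : 0 < δ) (h5 : 5 ≤ s) (hsd : s + δ = 2 * k + 5) (M0 R2 : ℝ) : ∃ C, 0 ≤ C ∧
    ∀ T c0 u, T ≤ 1 → HB s M0 c0 → Tow g T (2*k+3) R2 c0 u → ∀ t ∈ Icc 0 T, ∀ h : ℕ,
      HB 1 (C * (hsNorm s (Wc δ h c0) + ((2 ^ δ) ^ h)⁻¹) / (2 ^ h) ^ (s - 1)) (u (h+1) t - u h t) ∧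
      HB (s + δ) (C * (hsNorm s (Wc δ h c0) + ((2 ^ δ) ^ h)⁻¹) * (2 ^ δ) ^ h) (u (h+1) t - u h t) := by
  have d0 := dn d
  obtain ⟨C1, hC1, H1⟩ := AP hg (k+1) (by push_cast; linarith) R2
  obtain ⟨C2, hC2, H2⟩ := nv hg (2*k+1) (by push_cast; linarith) R2
  obtain ⟨C4, hC4, H4⟩ := GG_est hg.sm (m := 2*k+1) (L := 2*k+3) LA LA LA R2
  obtain ⟨C3, hC3, H3⟩ := dif hg (L := 2*k+1) LA (max R2 C4)
  rw [show 2 * ((k+1:ℕ):ℝ) + 3 = s + δ by push_cast; linarith, show 2 * ((k+1:ℕ):ℝ) + 1 = 2*k+3 by push_cast; ring] at H1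
  rw [show ((2*k+1:ℕ):ℝ) + 4 = s + δ by push_cast; linarith, show ((2*k+1:ℕ):ℝ) + 2 = s + δ - 2 by push_cast; linarith] at H2
  set κ : ℝ := 2 ^ δ
  have k1 : 1 ≤ κ := one_le_rpow one_le_two hδ.le
  set K := C2 * (1 + C1 * (1 + κ ^ 2 * |M0|))
  have K0 : 0 ≤ K := by positivity
  refine ⟨2 * C1 * κ ^ 2 + √C3 * (κ + K), by positivity, fun T c0 u hT hc hu t ht h => ?_⟩
  set P : ℝ := 2 ^ h with hP
  have P0 : 0 < P := by positivity
  have P1 : 1 ≤ P := one_le_pow₀ one_le_two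
  have kh : κ ^ h = P ^ δ := by
    simp only [κ, P]; rw [← rpow_natCast, ← rpow_natCast, ← rpow_mul two_pos.le, ← rpow_mul two_pos.le, mul_comm]
  have kh1 : 1 ≤ κ ^ h := one_le_pow₀ k1
  set ω := hsNorm s (Wc δ h c0)
  have hω : HB s ω (Wc δ h c0) := (hc.Wc h).inHs.HB
  have w0 := hω.1
  have wM : ω ≤ |M0| := (hc.Wc h).norm.trans (le_abs_self _)
  have s2 := sh2 hδ h hω
  have s1 := sh1 hδ LA h hω
  have s2' : HB (s + δ) (κ ^ 2 * κ ^ h * ω) (PB (Q d (2 ^ h)) c0) := s2.of_le1 fun n => by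
    by_cases hn : n ∈ Q d (2 ^ h)
    · rw [PB_mem hn, PB_mem (Qsub (pow_le_pow_right₀ one_le_two (by omega)) n hn)]
    · rw [PB_not hn, norm_zero, mul_zero]; exact mul_nonneg (jw _ _).le (norm_nonneg _)
  have u1 : ∀ τ ∈ Icc 0 T, hsNorm (s+δ) (u (h+1) τ) ≤ C1 * (1 + κ ^ 2 * κ ^ h * ω) := fun τ hτ => by
    have := H1 _ T _ hT (hu (h+1)).1 (hu (h+1)).2.2 τ hτ
    rw [(hu (h+1)).2.1] at this
    exact this.trans (mL (by linarith [s2.norm]) hC1)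
  have u2 : ∀ τ ∈ Icc 0 T, hsNorm (s+δ) (u h τ) ≤ C1 * (1 + κ ^ 2 * κ ^ h * ω) := fun τ hτ => by
    have := H1 _ T _ hT (hu h).1 (hu h).2.2 τ hτ
    rw [(hu h).2.1] at this
    exact this.trans (mL (by linarith [s2'.norm]) hC1)
  have sB : ∀ t, Supp (Q d (4 ^ (h+1))) (u h t) := fun t => ((hu h).1.1 t).mono (Qsub (pow_le_pow_right₀ (by norm_num) (by omega)))
  have sB' := (hu (h+1)).1.1
  constructor
  · set γ := P ^ (-(s - 1)) * (K * (κ ^ h)⁻¹)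
    have er : ∀ τ ∈ Icc 0 T, HB 1 γ ((Jm (Q d (4 ^ (h+1))) (GG g (u (h+1) τ)) - Jm (Q d (4 ^ (h+1))) (GG g (u (h+1) τ))) -
        (Jm (Q d (4 ^ h)) (GG g (u h τ)) - Jm (Q d (4 ^ (h+1))) (GG g (u h τ)))) := fun τ hτ => by
      have a1 := (H2 _ _ ((hu h).1.1 τ) (by rw [show s + δ - 2 = 2 * k + 3 by linarith]; exact (hu h).2.2 τ hτ)).2
      have a2 : C2 * (1 + hsNorm (s + δ) (u h τ)) ≤ K * κ ^ h := by
        simp only [K]; rw [mul_assoc]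
        refine mL ?_ hC2
        have b1 := u2 τ hτ
        have b2 : C1 * (κ ^ 2 * κ ^ h * ω) ≤ C1 * (κ ^ 2 * κ ^ h * |M0|) := by gcongr
        have b3 := mL kh1 hC1
        linarith
      have a3 := a1.mono a2
      have a4 := a3.of_le (m' := 1) (c := (Jm (Q d (4 ^ (h+1))) (GG g (u (h+1) τ)) - Jm (Q d (4 ^ (h+1))) (GG g (u (h+1) τ))) -
        (Jm (Q d (4 ^ h)) (GG g (u h τ)) - Jm (Q d (4 ^ (h+1))) (GG g (u h τ)))) (K := (P ^ (2:ℝ)) ^ (-(s + δ - 3))) PO fun n => by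
          have j0 := jb_pos n
          have := jw (s + δ - 2) n
          have R0 : 0 ≤ (P ^ (2:ℝ)) ^ (-(s + δ - 3)) * (jb n ^ (s + δ - 2) * ‖GG g (u h τ) n‖) := by positivity
          simp only [sub_self, zero_sub, Pi.neg_apply, norm_neg, Pi.sub_apply, Pi.zero_apply, Jm]
          by_cases h1 : jb n ≤ 4 ^ h
          · rw [PB_mem (mem_Q.2 h1), PB_mem (mem_Q.2 (h1.trans (pow_le_pow_right₀ (by norm_num) (by omega))))]; simpa using R0
          by_cases h2 : jb n ≤ 4 ^ (h+1)
          swap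
          · rw [PB_not (mt mem_Q.1 h1), PB_not (mt mem_Q.1 h2)]; simpa using R0
          rw [PB_not (mt mem_Q.1 h1), PB_mem (mem_Q.2 h2), mul_zero, zero_sub, norm_neg, norm_mul, Complex.norm_I, one_mul, ← mul_assoc]
          refine mR ?_ (norm_nonneg _)
          push Not at h1
          have e4 : P ^ (2:ℝ) = 4 ^ h := by rw [Real.rpow_two, hP, ← pow_mul, mul_comm, pow_mul]; norm_num
          rw [e4, show s + δ - 2 = 1 + (s + δ - 3) by ring, rpow_add j0, mul_left_comm]
          refine le_mul_of_one_le_right (jw 1 n).le ?_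
          rw [rpow_neg PO, inv_mul_eq_div, one_le_div PO]
          exact rpow_le_rpow PO h1.le LA
      refine a4.mono ?_
      simp only [γ]
      rw [mul_left_comm, mul_left_comm (P ^ (-(s-1)))]
      refine mL ?_ K0
      rw [kh, ← rpow_neg P0.le, ← rpow_mul P0.le, ← rpow_add P0, ← rpow_add P0]
      exact Real.rpow_le_rpow_of_exponent_le P1 LA
    have hd := H3 (Q d (4 ^ (h+1))) (u (h+1)) (u h) (fun t => Jm (Q d (4 ^ (h+1))) (GG g (u (h+1) t))) (fun t => Jm (Q d (4 ^ h)) (GG g (u h t))) γ 0 T LA sB' sB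
      (fun τ hτ => ⟨(hu (h+1)).1.2 τ hτ, (hu h).1.2 τ hτ, (((hu (h+1)).2.2 τ hτ).down LA).mono (le_max_left _ _), (((hu h).2.2 τ hτ).down LA).mono (le_max_left _ _),
        ((H4 _ ⟨_, (hu (h+1)).1.1 τ⟩ ((hu (h+1)).2.2 τ hτ)).Jm _).mono (le_max_right _ _), ((H4 _ ⟨_, (hu h).1.1 τ⟩ ((hu h).2.2 τ hτ)).Jm _).mono (le_max_right _ _), er τ hτ⟩) t ht
    rw [(hu (h+1)).2.1, (hu h).2.1] at hd
    refine ((sB' t).sub (sB t)).HB 1 |>.mono ?_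
    have g0 : 0 ≤ γ := by positivity
    have n1 := s1.norm
    have n0 := hsNorm_nonneg 1 (PB (Q d (2 ^ (h+1))) c0 - PB (Q d (2 ^ h)) c0)
    have f1 : hsNorm 1 (u (h+1) t - u h t) ≤ √C3 * (κ / P ^ (s - 1) * ω + γ) := by
      refine le_of_sq' (hd.trans ?_) PO
      rw [mul_pow (√C3), sq_sqrt hC3]
      refine mL ?_ hC3
      have := pow_le_pow_left₀ n0 n1 2
      have : 0 ≤ κ / P ^ (s - 1) * ω * γ := by positivity
      linarith
    refine f1.trans ?_
    have e : √C3 * (κ / P ^ (s - 1) * ω + γ) = √C3 * (κ * ω + K * (κ ^ h)⁻¹) / P ^ (s - 1) := by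
      simp only [γ]; rw [rpow_neg P0.le]; ring
    rw [e]
    refine div_le_div_of_nonneg_right ?_ PO
    have t1 : 0 ≤ (κ ^ h)⁻¹ := by positivity
    have t2 : 0 ≤ 2 * C1 * κ ^ 2 * (ω + (κ ^ h)⁻¹) := by positivity
    have t3 : 0 ≤ √C3 * (κ * (κ ^ h)⁻¹) := by positivity
    have t4 : 0 ≤ √C3 * (K * ω) := by positivity
    linarith
  · refine ((FS.HB ⟨_, sB' t⟩ (s+δ)).sub (FS.HB ⟨_, sB t⟩ (s+δ))).mono ?_
    have b1 := u1 t ht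
    have b2 := u2 t ht
    refine (add_le_add b1 b2).trans ?_
    have e : (2 * C1 * κ ^ 2 + √C3 * (κ + K)) * (ω + (κ ^ h)⁻¹) * κ ^ h = (2 * C1 * κ ^ 2 + √C3 * (κ + K)) * (ω * κ ^ h + 1) := by
      rw [mul_assoc, add_mul ω, inv_mul_cancel₀ (show κ ^ h ≠ 0 by positivity)]
    rw [e]
    have t2 : 0 ≤ √C3 * (κ + K) * (ω * κ ^ h + 1) := by positivity
    have t3 : C1 * 1 ≤ C1 * κ ^ 2 := mL (one_le_pow₀ k1) hC1
    linarith
lemma jt_sub' {x y : ℝ} {a b : Seq d} (ha : HB (d+1) x a) (hb : HB (d+1) y b) (p : Vec d) : jt (a - b) p = jt a p - jt b p := by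
  ext i
  rw [Pi.sub_apply]; unfold jt
  rw [← S_sub (ha.JJ i).summ0 (hb.JJ i).summ0]; congr 1; ext n; simp [JJ, mul_sub]
lemma cont_jt' {x : ℝ} (ha : HB (d+1) x a) : Continuous (jt a) := continuous_pi fun i => cont_S (ha.JJ i).summ0
lemma GG_l0 (hg : ∀ b, Sm (g b)) (R : ℝ) : ∃ C, 0 ≤ C ∧ ∀ a b y, HB (d+1) R a → HB (d+1) R b → HB (d+1) y (a - b) → HB (-1) (C * y) (GG g a - GG g b) := by
  choose C hC H using fun b => lipH (hg b) (kap d * (Zc d * R))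
  have k0 : 0 ≤ kap d * Zc d * √((2 * π) ^ d) := mul_nonneg (mul_nonneg kap_pos.le Zc_pos.le) (sqrt_nonneg _)
  refine ⟨∑ i, C i * (kap d * Zc d * √((2 * π) ^ d)), sum_nonneg fun i _ => mul_nonneg (hC i) k0, fun a b y ha hb hy => ?_⟩
  have ca := cont_jt' ha
  have cb := cont_jt' hb
  unfold GG
  rw [← Dv_sub (h := fun i x => g i (jt a x)) (k := fun i x => g i (jt b x)) (fun i => (hg i).continuous.comp ca) (fun i => (hg i).continuous.comp cb), sum_mul]
  refine HB.Dv fun i => ?_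
  have z : 0 ≤ C i * (kap d * (Zc d * y)) := mul_nonneg (hC i) (mul_nonneg kap_pos.le (mul_nonneg Zc_pos.le hy.1))
  have := HB_sup (f := fun x => g i (jt a x) - g i (jt b x)) (((hg i).continuous.comp ca).sub ((hg i).continuous.comp cb)) z fun x => by
    refine (H i _ _ (jt_bound ha x) (jt_bound hb x)).trans (mL ?_ (hC i))
    rw [← jt_sub' ha hb]; exact jt_bound hy x
  rw [neg_add_cancel]
  exact this.mono (le_of_eq (by ring))
lemma HB.coef' {b : ℝ} (h : HB m b c) (n : Zd d) : jb n ^ m * ‖c n‖ ≤ b := by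
  have := h.2 {n}
  rw [Finset.sum_singleton] at this
  exact le_of_sq' this h.1
lemma HB_z {ι : Type*} {l : Filter ι} {γ : ι → Seq d} {y : ι → ℝ} (h : ∀ᶠ i in l, HB m (y i) (γ i)) (hy : Tendsto y l (nhds 0)) (n : Zd d) :
    Tendsto (fun i => γ i n) l (nhds 0) := by
  refine squeeze_zero_norm' (a := fun i => (jb n ^ m)⁻¹ * y i) (h.mono fun i hi => ?_) (by simpa using hy.const_mul _)
  have := hi.coef' n
  rwa [inv_mul_eq_div, le_div_iff₀' (jw m n)]
lemma GG_lim (hg : ∀ b, Sm (g b)) {ι : Type*} {l : Filter ι} {γ : ι → Seq d} {R : ℝ} {y : ι → ℝ} (h1 : ∀ᶠ i in l, HB (d+1) R (γ i))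
    (h2 : HB (d+1) R c) (h : ∀ᶠ i in l, HB (d+1) (y i) (γ i - c)) (hy : Tendsto y l (nhds 0)) (n : Zd d) :
    Tendsto (fun i => GG g (γ i) n) l (nhds (GG g c n)) := by
  obtain ⟨C, hC, H⟩ := GG_l0 hg R
  have := HB_z (γ := fun i => GG g (γ i) - GG g c) (h1.and h |>.mono fun i hi => H _ _ _ hi.1 h2 hi.2) (by simpa using hy.const_mul C) n
  simpa using this.add_const (GG g c n)
lemma PBt {p b r : ℝ} (h : HB (m+p) b c) (hp : 0 ≤ p) (hr : 0 < r) : HB m (r ^ (-p) * b) (PB (Q d r) c - c) :=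
  h.of_le PO fun n => by
    have j0 := jb_pos n
    by_cases hn : n ∈ Q d r
    · rw [Pi.sub_apply, PB_mem hn, sub_self, norm_zero, mul_zero]; have := jw (m+p) n; positivity
    · rw [Pi.sub_apply, PB_not hn, zero_sub, norm_neg, ← mul_assoc]
      refine mR ?_ (norm_nonneg _)
      rw [rpow_add j0, mul_left_comm]
      refine le_mul_of_one_le_right (jw m n).le ?_
      rw [rpow_neg hr.le, inv_mul_eq_div, one_le_div PO]
      exact rpow_le_rpow hr.le (not_le.1 (mt mem_Q.2 hn)).le hp
lemma PBlim {b : ℝ} (hg : ∀ b, Sm (g b)) (h : HB (d+2) b c) (n : Zd d) :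
    Tendsto (fun r : ℕ => GG g (PB (Q d (r+1)) c) n) atTop (nhds (GG g c n)) := by
  have h1 : HB (d+1) b c := h.down LA
  refine GG_lim hg (R := b) (y := fun r : ℕ => ((r:ℝ)+1) ^ (-1:ℝ) * b) (Eventually.of_forall fun r => h1.PB _) h1
    (Eventually.of_forall fun r => PBt (by convert h using 1; ring) zero_le_one PO) ?_ n
  have := (tendsto_one_div_add_atTop_nhds_zero_nat (𝕜 := ℝ)).mul_const b
  simpa [Real.rpow_neg_one] using this
lemma PBl (c : Seq d) (n : Zd d) : Tendsto (fun r : ℕ => PB (Q d (r+1)) c n) atTop (nhds (c n)) := by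
  obtain ⟨N, hN⟩ := exists_nat_ge (jb n)
  refine tendsto_const_nhds.congr' ((eventually_ge_atTop N).mono fun r hr => ?_)
  have : (N:ℝ) ≤ r := by exact_mod_cast hr
  exact (PB_mem (mem_Q.2 LA) c).symm
lemma PB_sub (a b : Seq d) : PB B (a - b) = PB B a - PB B b := by
  ext n; by_cases h : n ∈ B
  · simp [PB_mem h]
  · simp [PB_not h]
lemma GG_est' (hg : ∀ b, Sm (g b)) (hm : -1 ≤ m) (h1 : m + 2 ≤ L) (h2 : 2 * d + 2 ≤ L) (R : ℝ) :
    ∃ C, 0 ≤ C ∧ ∀ u, HB L R u → HB m C (GG g u) := by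
  obtain ⟨C, hC, H⟩ := GG_est hg hm h1 h2 R
  have d0 := dn d
  exact ⟨C, hC, fun u hu => HB_lim (PBlim hg (hu.down LA)) (Eventually.of_forall fun r => H _ (FS_PB _ _) (hu.PB _))⟩
lemma Lip' (hg : ∀ b, Sm (g b)) (hm : -1 ≤ m) (h1 : m + 2 ≤ L) (h2 : 2 * d + 2 ≤ L) (R : ℝ) :
    ∃ C, 0 ≤ C ∧ ∀ a b y, HB L R a → HB L R b → HB (m+2) y (a - b) → HB m (C * y) (GG g a - GG g b) := by
  obtain ⟨C, hC, H⟩ := Lip hg hm h1 h2 R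
  have d0 := dn d
  refine ⟨C, hC, fun a b y ha hb hy => HB_lim (fun n => (PBlim hg (ha.down LA) n).sub (PBlim hg (hb.down LA) n)) (Eventually.of_forall fun r =>
    H _ _ y (FS_PB _ _) (FS_PB _ _) (ha.PB _) (hb.PB _) ?_)⟩
  rw [← PB_sub]; exact hy.PB _
lemma tail0 {f : ℕ → ℝ} {C : ℝ} (hf : ∀ n, 0 ≤ f n) (h : ∀ N, ∑ n ∈ Finset.Ico 0 N, f n ≤ C) {ε : ℝ} (hε : 0 < ε) :
    ∃ N, ∀ p ≥ N, ∀ q, ∑ n ∈ Finset.Ico p q, f n ≤ ε := by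
  have hs : Summable f := summable_of_sum_range_le hf fun n => by rw [Finset.range_eq_Ico]; exact h n
  obtain ⟨N, hN⟩ := ((tendsto_order.1 (tendsto_sum_nat_add f)).2 ε hε).exists_forall_of_atTop
  refine ⟨N, fun p hp q => ?_⟩
  rw [Finset.sum_Ico_eq_sum_range]
  refine le_trans ?_ (hN p hp).le
  simp_rw [add_comm p]
  exact ((summable_nat_add_iff p).2 hs).sum_le_tsum _ fun i _ => hf _
lemma Wc_le (h : ℕ) {a b : Seq d} {x y : ℝ} (ha : HB s x a) (hb : HB s y b) : hsNorm s (Wc δ h b) ≤ hsNorm s (Wc δ h a) + hsNorm s (Wc δ h (b - a)) := by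
  have := ((ha.Wc (δ := δ) h).inHs.HB.add ((hb.sub ha).Wc (δ := δ) h).inHs.HB).norm
  convert this using 2
  ext n; simp [Wc]; ring
lemma towlim (hg : Gd g) (k : ℕ) (hk : HKK d k) (hδ : 0 < δ) (h5 : 5 ≤ s) (hδ2 : δ ≤ 2) (hsd : s + δ = 2 * k + 5) (M0 R2 : ℝ)
    {c0 : Seq d} (hc : HB s M0 c0) {ε : ℝ} (hε : 0 < ε) : ∃ h0 : ℕ, ∃ η > 0, ∀ T c0' u, T ≤ 1 → HB s M0 c0' → HB s η (c0' - c0) → Tow g T (2*k+3) R2 c0' u →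
      ∀ t ∈ Icc 0 T, ∀ h ≥ h0, ∀ H ≥ h, HB s ε (u H t - u h t) := by
  obtain ⟨C1, hC1, H1⟩ := tow1 hg k hk hδ h5 hsd M0 R2
  obtain ⟨C2, hC2, H2⟩ := lemJ (d := d) hδ (show δ ≤ s - 1 by linarith)
  obtain ⟨C3, hC3, H3⟩ := Wc_sum (d := d) hδ s
  set κ : ℝ := 2 ^ δ
  have k1 : 1 < κ := Real.one_lt_rpow one_lt_two hδ
  have k0 : 0 < κ := by linarith
  have r1 : κ⁻¹ ^ 2 < 1 := pow_lt_one₀ PO (inv_lt_one_of_one_lt₀ k1) (by norm_num)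
  set D := ε / (C2 + 1)
  have D0 : 0 < D := by positivity
  set ζ := D ^ 2 / (3 * (C1 + 1) ^ 2)
  have z0 : 0 < ζ := by positivity
  obtain ⟨N1, T1⟩ := tail0 (fun n => sq_nonneg (hsNorm s (Wc δ n c0))) (fun N => H3 c0 M0 hc 0 N) (show 0 < ζ / 3 by positivity)
  obtain ⟨N2, T2⟩ := tail0 (f := fun h => (κ⁻¹ ^ 2) ^ h) (fun n => by positivity) (fun N => by
    have := (summable_geometric_of_lt_one PO r1).sum_le_tsum (Finset.Ico 0 N) (fun i _ => by positivity)
    exact this) (show 0 < ζ / 3 by positivity)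
  set η := √(ζ / (3 * (C3 + 1)))
  have η2 : η ^ 2 = ζ / (3 * (C3 + 1)) := sq_sqrt PO
  refine ⟨max N1 N2, η, by positivity, fun T c0' u hT hc' hd hu t ht h hh H hH => ?_⟩
  have hh1 : N1 ≤ h := (le_max_left _ _).trans hh
  have hh2 : N2 ≤ h := (le_max_right _ _).trans hh
  have := H2 (fun i => u (i+1) t - u i t) (fun i => C1 * (hsNorm s (Wc δ i c0') + (κ ^ i)⁻¹)) h H D D0.le (fun i _ => H1 T c0' u hT hc' hu t ht i) ?_
  · have e : (fun n => ∑ i ∈ Finset.Ico h H, (u (i+1) t - u i t) n) = u H t - u h t := by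
      ext n
      rw [Pi.sub_apply, ← Finset.sum_Ico_sub (fun i => u i t n) hH]; rfl
    rw [e] at this
    refine this.mono ?_
    simp only [D]; rw [mul_div_assoc', div_le_iff₀ PO]
    linarith
  · have t3 : ∑ i ∈ Finset.Ico h H, hsNorm s (Wc δ i (c0' - c0)) ^ 2 ≤ ζ / 3 := by
      refine (H3 _ η hd h H).trans ?_
      rw [η2, mul_div_assoc', div_le_div_iff₀ PO (by norm_num)]
      linarith [mul_nonneg hC3 z0.le]
    calc ∑ i ∈ Finset.Ico h H, (C1 * (hsNorm s (Wc δ i c0') + (κ ^ i)⁻¹)) ^ 2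
        ≤ ∑ i ∈ Finset.Ico h H, C1 ^ 2 * (3 * (hsNorm s (Wc δ i c0) ^ 2 + (κ⁻¹ ^ 2) ^ i + hsNorm s (Wc δ i (c0' - c0)) ^ 2)) := by
          refine sum_le_sum fun i _ => ?_
          rw [mul_pow]
          refine mL ?_ (sq_nonneg C1)
          have a1 := Wc_le (δ := δ) i hc hc'
          have a2 := hsNorm_nonneg s (Wc δ i c0')
          have a3 : 0 ≤ (κ ^ i)⁻¹ := by positivity
          have a4 : (κ⁻¹ ^ 2) ^ i = (κ ^ i)⁻¹ ^ 2 := by rw [← pow_mul, mul_comm, pow_mul, inv_pow]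
          rw [a4]
          refine (pow_le_pow_left₀ PO (add_le_add_left a1 _) 2).trans ?_
          generalize hsNorm s (Wc δ i c0) = x
          generalize hsNorm s (Wc δ i (c0' - c0)) = y
          generalize (κ ^ i)⁻¹ = z
          nlinarith [sq_nonneg (x - y), sq_nonneg (x - z), sq_nonneg (y - z)]
      _ ≤ C1 ^ 2 * (3 * ζ) := by
          rw [← mul_sum, ← mul_sum, sum_add_distrib, sum_add_distrib]
          have b1 := T1 h hh1 H
          have b2 := T2 h hh2 H
          refine mL ?_ (sq_nonneg C1)
          linarith
      _ ≤ D ^ 2 := by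
          simp only [ζ]; rw [mul_div_assoc', mul_div_assoc', div_le_iff₀ PO]
          have : D ^ 2 * C1 ^ 2 ≤ D ^ 2 * (C1 + 1) ^ 2 := mL (pow_le_pow_left₀ hC1 LA 2) (sq_nonneg D)
          linarith
def SQ (g : GY d) (s T : ℝ) (c : ℝ → Seq d) : Prop := (∀ t ∈ Ico 0 T, InHsSeq s (c t)) ∧
  (∀ t₀ ∈ Ico 0 T, ∀ ε > 0, ∃ η > 0, ∀ t ∈ Ico 0 T, |t - t₀| < η → HB s ε (c t - c t₀)) ∧
  ∀ t₀ ∈ Ico 0 T, ∀ ε > 0, ∃ η > 0, ∀ t ∈ Ico 0 T, t ≠ t₀ → |t - t₀| < η →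
    HB (s-2) ε (fun n => (c t n - c t₀ n) / ((t - t₀ : ℝ) : ℂ) - I * GG g (c t₀) n)
lemma HB_mvt' {γ γ' : ℝ → Seq d} {b t t₀ : ℝ} (hb : 0 ≤ b) (hd : ∀ θ ∈ Set.uIcc t₀ t, CD γ (γ' θ) θ) (hH : ∀ θ ∈ Set.uIcc t₀ t, HB m b (γ' θ)) :
    HB m (b * |t - t₀|) (γ t - γ t₀) := by
  rcases le_total t₀ t with h | h
  · rw [Set.uIcc_of_le h] at hd hH
    rw [abs_of_nonneg LA]
    exact HB_mvt h hb (fun n θ hθ => (hd θ hθ n).continuousAt.continuousWithinAt) (fun θ hθ => hd θ ⟨hθ.1.le, hθ.2.le⟩) fun θ hθ => hH θ ⟨hθ.1.le, hθ.2.le⟩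
  · rw [Set.uIcc_of_ge h] at hd hH
    rw [abs_sub_comm, abs_of_nonneg LA, ← neg_sub (γ t₀)]
    exact (HB_mvt h hb (fun n θ hθ => (hd θ hθ n).continuousAt.continuousWithinAt) (fun θ hθ => hd θ ⟨hθ.1.le, hθ.2.le⟩) fun θ hθ => hH θ ⟨hθ.1.le, hθ.2.le⟩).neg
lemma limt (hg : Gd g) (k : ℕ) (hk : HKK d k) (hs : 2 * k + 3 ≤ s) {T R2 : ℝ} (hT : 0 < T) {c0 : Seq d} {u : ℕ → ℝ → Seq d}
    (hu : Tow g T (2*k+3) R2 c0 u) (hconv : ∀ ε > 0, ∃ h0, ∀ t ∈ Icc 0 T, ∀ h ≥ h0, ∀ H ≥ h, HB s ε (u H t - u h t)) :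
    ∃ c : ℝ → Seq d, (∀ t ∈ Icc 0 T, ∀ n, Tendsto (fun h => u h t n) atTop (nhds (c t n))) ∧ c 0 = c0 ∧ SQ g s T c := by
  have d0 := dn d
  have s0 : 0 ≤ s := by linarith
  have fs : ∀ h t, FS (u h t) := fun h t => ⟨_, (hu h).1.1 t⟩
  set c : ℝ → Seq d := fun t n => limUnder atTop (fun h => u h t n)
  have lim : ∀ t ∈ Icc 0 T, ∀ n, Tendsto (fun h => u h t n) atTop (nhds (c t n)) := fun t ht n => by
    refine tendsto_nhds_limUnder (cauchySeq_tendsto_of_complete (Metric.cauchySeq_iff'.2 fun ε hε => ?_))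
    obtain ⟨h0, H⟩ := hconv (ε / 2) LA
    refine ⟨h0, fun h hh => ?_⟩
    have := (H t ht h0 le_rfl h hh).coef s0 n
    rw [dist_eq_norm]; exact lt_of_le_of_lt this LA
  have conv : ∀ ε > 0, ∃ h0, ∀ t ∈ Icc 0 T, ∀ h ≥ h0, HB s ε (u h t - c t) := fun ε hε => by
    obtain ⟨h0, H⟩ := hconv ε hε
    refine ⟨h0, fun t ht h hh => ?_⟩
    rw [← neg_sub]
    exact (HB_lim (l := atTop) (γ := fun H => u H t - u h t) (fun n => (lim t ht n).sub_const _) ((eventually_ge_atTop h).mono fun H' hH => H t ht h hh H' hH)).neg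
  obtain ⟨C4, hC4, H4⟩ := GG_est hg.sm (m := 2*k+1) (L := 2*k+3) LA LA LA R2
  have lipt : ∀ h, ∃ K, 0 ≤ K ∧ ∀ t ∈ Icc 0 T, ∀ t₀ ∈ Icc 0 T, HB s (K * |t - t₀|) (u h t - u h t₀) := fun h => by
    refine ⟨(∑ n ∈ Q d (4^h), jb n ^ s) * C4, mul_nonneg (sum_nonneg fun n _ => (jw s n).le) hC4, fun t ht t₀ ht₀ => ?_⟩
    have sub := Set.uIcc_subset_Icc ht₀ ht
    refine HB_mvt' (mul_nonneg (sum_nonneg fun n _ => (jw s n).le) hC4) (fun θ hθ => (hu h).1.2 θ (sub hθ)) fun θ hθ => ?_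
    exact HB_fin (Supp_Jm _ _) (fun n => ((H4 _ (fs h θ) ((hu h).2.2 θ (sub hθ))).Jm _).coef PO n) hC4 s
  obtain ⟨h1, H1⟩ := hconv 1 one_pos
  set R := 1 + (∑ n ∈ Q d (4^h1), jb n ^ s) * R2
  have uR : ∀ h ≥ h1, ∀ t ∈ Icc 0 T, HB s R (u h t) := fun h hh t ht => by
    have e : u h t = (u h t - u h1 t) + u h1 t := by abel
    rw [e]
    exact (H1 t ht h1 le_rfl h hh).add (HB_fin ((hu h1).1.1 t) (fun n => ((hu h1).2.2 t ht).coef PO n) ((hu h1).2.2 t ht).1 s)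
  have cR : ∀ t ∈ Icc 0 T, HB s R (c t) := fun t ht => HB_lim (lim t ht) ((eventually_ge_atTop h1).mono fun h hh => uR h hh t ht)
  have E : ∀ ε > 0, ∃ η > 0, ∃ h0, ∀ t₀ ∈ Icc 0 T, ∀ h ≥ h0, ∀ t ∈ Icc 0 T, |t - t₀| < η → HB s ε (u h t - u h t₀) := fun ε hε => by
    obtain ⟨h0, H⟩ := hconv (ε / 3) LA
    obtain ⟨K, hK, HK⟩ := lipt h0
    refine ⟨ε / 3 / (K + 1), by positivity, h0, fun t₀ ht₀ h hh t ht htt => ?_⟩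
    have e : u h t - u h t₀ = (u h t - u h0 t) + (u h0 t - u h0 t₀) - (u h t₀ - u h0 t₀) := by abel
    rw [e]
    refine (((H t ht h0 le_rfl h hh).add (HK t ht t₀ ht₀)).sub (H t₀ ht₀ h0 le_rfl h hh)).mono ?_
    rw [lt_div_iff₀ PO] at htt
    have := abs_nonneg (t - t₀)
    linarith
  refine ⟨c, lim, funext fun n => ?_, fun t ht => (cR t ⟨ht.1, ht.2.le⟩).inHs, fun t₀ ht₀ ε hε => ?_, fun t₀ ht₀ ε hε => ?_⟩
  · refine tendsto_nhds_unique (lim 0 ⟨le_rfl, hT.le⟩ n) (tendsto_const_nhds.congr' ?_)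
    filter_upwards [(tendsto_pow_atTop_atTop_of_one_lt (one_lt_two (α := ℝ))).eventually_ge_atTop (jb n)] with h hh
    rw [(hu h).2.1]; exact (PB_mem (mem_Q.2 hh) c0).symm
  · obtain ⟨η, hη, h0, H⟩ := E ε hε
    refine ⟨η, hη, fun t ht htt => ?_⟩
    have i1 : t ∈ Icc 0 T := ⟨ht.1, ht.2.le⟩
    have i0 : t₀ ∈ Icc 0 T := ⟨ht₀.1, ht₀.2.le⟩
    exact HB_lim (l := atTop) (γ := fun h => u h t - u h t₀) (fun n => (lim t i1 n).sub (lim t₀ i0 n)) ((eventually_ge_atTop h0).mono fun h hh => H t₀ i0 h hh t i1 htt)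
  · obtain ⟨C, hC, HL⟩ := Lip hg.sm (m := s-2) (L := s) LA LA LA R
    obtain ⟨η, hη, h0, H⟩ := E (ε / (C + 1)) PO
    refine ⟨η, hη, fun t ht hne htt => ?_⟩
    have i1 : t ∈ Icc 0 T := ⟨ht.1, ht.2.le⟩
    have i0 : t₀ ∈ Icc 0 T := ⟨ht₀.1, ht₀.2.le⟩
    have tne : ((t - t₀ : ℝ) : ℂ) ≠ 0 := by exact_mod_cast sub_ne_zero.2 hne
    set v : ℕ → Seq d := fun h => Jm (Q d (4^h)) (GG g (u h t₀))
    have sub := Set.uIcc_subset_Icc i0 i1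
    have vl : ∀ n, Tendsto (fun h => v h n) atTop (nhds (I * GG g (c t₀) n)) := fun n => by
      have : Tendsto (fun h => hsNorm s (u h t₀ - c t₀)) atTop (nhds 0) := Metric.tendsto_atTop.2 fun ε hε => by
        obtain ⟨h0, H⟩ := conv (ε/2) LA
        refine ⟨h0, fun h hh => ?_⟩
        rw [Real.dist_eq, sub_zero, abs_of_nonneg (hsNorm_nonneg _ _)]
        exact lt_of_le_of_lt (H t₀ i0 h hh).norm LA
      have := (GG_lim hg.sm (R := R) ((eventually_ge_atTop h1).mono fun h hh => (uR h hh t₀ i0).down LA) ((cR t₀ i0).down LA)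
        ((eventually_ge_atTop h1).mono fun h hh => ((uR h hh t₀ i0).sub (cR t₀ i0)).inHs.HB.down LA) this n).const_mul I
      refine this.congr' ?_
      filter_upwards [(tendsto_pow_atTop_atTop_of_one_lt (show (1:ℝ) < 4 by norm_num)).eventually_ge_atTop (jb n)] with h hh
      simp only [v, Jm]; rw [PB_mem (mem_Q.2 hh)]
    refine HB_lim (l := atTop) (γ := fun h n => (u h t n - u h t₀ n) / ((t - t₀ : ℝ) : ℂ) - v h n) (fun n => (((lim t i1 n).sub (lim t₀ i0 n)).div_const _).sub (vl n))
      ((eventually_ge_atTop (max h0 h1)).mono fun h hh => ?_)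
    have hh0 : h0 ≤ h := (le_max_left _ _).trans hh
    have hh1 : h1 ≤ h := (le_max_right _ _).trans hh
    have := (HB_mvt' (m := s-2) (γ := fun θ n => u h θ n - (θ:ℂ) * v h n) (γ' := fun θ => Jm (Q d (4^h)) (GG g (u h θ)) - v h) (b := C * (ε / (C+1))) (t := t) (t₀ := t₀) PO
      (fun θ hθ n => ?_) (fun θ hθ => ?_)).smul ((t - t₀ : ℝ) : ℂ)⁻¹
    · refine HB.mono (b := ‖((t - t₀ : ℝ) : ℂ)⁻¹‖ * (C * (ε / (C+1)) * |t - t₀|)) ?_ ?_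
      · convert this using 1
        ext n
        simp only [Pi.sub_apply]
        push_cast at tne ⊢
        field_simp; ring
      · rw [norm_inv, norm_real, Real.norm_eq_abs, mul_comm, mul_inv_cancel_right₀ (abs_ne_zero.2 (sub_ne_zero.2 hne)), mul_div_assoc', div_le_iff₀ PO]
        linarith
    · have h1 := (hu h).1.2 θ (sub hθ) n
      have h2 : HasDerivAt (fun θ : ℝ => (θ:ℂ) * v h n) (1 * v h n) θ := (HasDerivAt.ofReal_comp (hasDerivAt_id θ)).mul_const _
      exact (h1.sub h2).congr_deriv (by rw [one_mul]; rfl)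
    · have := (HL _ _ _ (fs h θ) (fs h t₀) (uR h hh1 θ (sub hθ)) (uR h hh1 t₀ i0) (by
        rw [sub_add_cancel]; refine H t₀ i0 h hh0 θ (sub hθ) (lt_of_le_of_lt ?_ htt)
        exact Set.abs_sub_left_of_mem_uIcc hθ)).Jm (Q d (4^h))
      convert this using 1
      ext n; simp only [v, Pi.sub_apply, Jm, PB_sub]; ring
lemma seqc (hg : Gd g) (k : ℕ) (hk : HKK d k) (hδ : 0 < δ) (h5 : 5 ≤ s) (hδ2 : δ ≤ 2) (hsd : s + δ = 2 * k + 5) (M0 R2 : ℝ)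
    {c0 : Seq d} (hc : HB s M0 c0) {ε : ℝ} (hε : 0 < ε) : ∃ η > 0, ∀ T c0' u u' (c c' : ℝ → Seq d), T ≤ 1 → HB s M0 c0' → HB s η (c0' - c0) →
      Tow g T (2*k+3) R2 c0 u → Tow g T (2*k+3) R2 c0' u' → (∀ t ∈ Icc 0 T, ∀ n, Tendsto (fun h => u h t n) atTop (nhds (c t n))) →
      (∀ t ∈ Icc 0 T, ∀ n, Tendsto (fun h => u' h t n) atTop (nhds (c' t n))) → ∀ t ∈ Icc 0 T, HB s ε (c' t - c t) := by
  have d0 := dn d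
  obtain ⟨h0, η1, hη1, H⟩ := towlim hg k hk hδ h5 hδ2 hsd M0 R2 hc (show 0 < ε / 3 by linarith)
  obtain ⟨C4, hC4, H4⟩ := GG_est hg.sm (m := 2*k+1) (L := 2*k+3) LA LA LA R2
  obtain ⟨C3, hC3, H3⟩ := dif hg (L := 2*k+1) LA (max R2 C4)
  set K := (4 ^ h0 : ℝ) ^ (s - 1) * √C3
  have K0 : 0 ≤ K := by positivity
  set η := min η1 (ε / 3 / (K + 1))
  have η0 : 0 < η := lt_min hη1 PO
  refine ⟨η, η0, fun T c0' u u' c c' hT hc' hd hu hu' hl hl' t ht => ?_⟩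
  have L1 : HB s (ε/3) (c t - u h0 t) := HB_lim (l := atTop) (γ := fun h => u h t - u h0 t) (fun n => (hl t ht n).sub_const _)
    ((eventually_ge_atTop h0).mono fun h hh => H T c0 u hT hc (by rw [sub_self]; exact HB.zero s hη1.le) hu t ht h0 le_rfl h hh)
  have L2 : HB s (ε/3) (c' t - u' h0 t) := HB_lim (l := atTop) (γ := fun h => u' h t - u' h0 t) (fun n => (hl' t ht n).sub_const _)
    ((eventually_ge_atTop h0).mono fun h hh => H T c0' u' hT hc' (hd.mono (min_le_left _ _)) hu' t ht h0 le_rfl h hh)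
  have sp := ((hu' h0).1.1 t).sub ((hu h0).1.1 t)
  have hdf := H3 (Q d (4 ^ h0)) (u' h0) (u h0) (fun t => Jm (Q d (4 ^ h0)) (GG g (u' h0 t))) (fun t => Jm (Q d (4 ^ h0)) (GG g (u h0 t))) 0 0 T LA (hu' h0).1.1 (hu h0).1.1
      (fun τ hτ => ⟨(hu' h0).1.2 τ hτ, (hu h0).1.2 τ hτ, (((hu' h0).2.2 τ hτ).down LA).mono (le_max_left _ _), (((hu h0).2.2 τ hτ).down LA).mono (le_max_left _ _),
        ((H4 _ ⟨_, (hu' h0).1.1 τ⟩ ((hu' h0).2.2 τ hτ)).Jm _).mono (le_max_right _ _), ((H4 _ ⟨_, (hu h0).1.1 τ⟩ ((hu h0).2.2 τ hτ)).Jm _).mono (le_max_right _ _),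
        by rw [sub_self, sub_self, sub_self]; exact HB.zero 1 le_rfl⟩) t ht
  rw [(hu' h0).2.1, (hu h0).2.1, ← PB_sub] at hdf
  have n1 : hsNorm 1 (PB (Q d (2 ^ h0)) (c0' - c0)) ≤ η := ((hd.down LA).PB _).norm
  have f1 : hsNorm 1 (u' h0 t - u h0 t) ≤ √C3 * η := by
    refine le_of_sq' (hdf.trans ?_) PO
    rw [mul_pow (√C3), sq_sqrt hC3, zero_pow two_ne_zero, add_zero]
    exact mL (pow_le_pow_left₀ (hsNorm_nonneg _ _) n1 2) hC3
  have L3 : HB s ((4 ^ h0 : ℝ) ^ (s - 1) * (√C3 * η)) (u' h0 t - u h0 t) := ((sp.HB 1).mono f1).of_le PO fun n => by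
    by_cases hn : n ∈ Q d (4 ^ h0)
    · rw [← mul_assoc]
      refine mR ?_ (norm_nonneg _)
      rw [show s = (s - 1) + 1 by ring, rpow_add (jb_pos n), add_sub_cancel_right]
      exact mR (rpow_le_rpow (jb_pos n).le (mem_Q.1 hn) LA) (jw 1 n).le
    · rw [sp n hn]; simp
  have e : c' t - c t = (c' t - u' h0 t) + (u' h0 t - u h0 t) - (c t - u h0 t) := by abel
  rw [e]
  refine ((L2.add L3).sub L1).mono ?_
  have : η * (K + 1) ≤ ε / 3 := (le_div_iff₀ PO).1 (min_le_right _ _)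
  simp only [K] at this ⊢
  linarith
lemma SQ.bdd {T t : ℝ} {c : ℝ → Seq d} (h : SQ g s T c) (ht : t < T) : ∃ R, ∀ τ ∈ Icc 0 t, HB s R (c τ) := by
  have hi : ∀ τ ∈ Icc 0 t, τ ∈ Ico 0 T := fun τ hτ => ⟨hτ.1, lt_of_le_of_lt hτ.2 ht⟩
  have hco : ContinuousOn (fun τ => hsNorm s (c τ)) (Icc 0 t) := Metric.continuousOn_iff.2 fun τ hτ ε hε => by
    obtain ⟨η, hη, H⟩ := h.2.1 τ (hi τ hτ) (ε/2) LA
    refine ⟨η, hη, fun a ha hd => ?_⟩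
    have h1 := H a (hi a ha) hd
    have n1 := ((h.1 τ (hi τ hτ)).HB.add h1).norm
    have n2 := ((h.1 a (hi a ha)).HB.sub h1).norm
    rw [add_sub_cancel] at n1
    rw [sub_sub_cancel] at n2
    rw [Real.dist_eq, abs_lt]; constructor <;> linarith
  obtain ⟨R, hR⟩ := isCompact_Icc.exists_bound_of_continuousOn hco
  exact ⟨R, fun τ hτ => (h.1 τ (hi τ hτ)).HB.mono ((le_abs_self _).trans (hR τ hτ))⟩
lemma SQ.cd {T t : ℝ} {c : ℝ → Seq d} (h : SQ g s T c) (hs : 2 ≤ s) (ht : t ∈ Ioo 0 T) : CD c (fun n => I * GG g (c t) n) t := fun n => by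
  refine hasDerivAt_iff_tendsto_slope.2 (Metric.tendsto_nhdsWithin_nhds.2 fun ε hε => ?_)
  obtain ⟨η, hη, H⟩ := h.2.2 t ⟨ht.1.le, ht.2⟩ (ε/2) LA
  refine ⟨min η (min t (T - t)), lt_min hη (lt_min ht.1 (by linarith [ht.2])), fun {a} ha hd => ?_⟩
  rw [Real.dist_eq, lt_min_iff, lt_min_iff, abs_lt, abs_lt, abs_lt] at hd
  have := (H a ⟨by linarith [hd.2.1.1], by linarith [hd.2.2.2]⟩ ha (abs_lt.2 hd.1)).coef LA n
  rw [dist_eq_norm]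
  refine lt_of_le_of_lt (le_of_eq ?_) (lt_of_le_of_lt this LA)
  congr 2
  rw [slope_def_module, div_eq_inv_mul, ← Complex.ofReal_inv, Complex.real_smul]
lemma uniq (hg : Gd g) (hs : 2 * d + 4 ≤ s) (hs4 : 4 ≤ s) {T T' t : ℝ} {c c' : ℝ → Seq d} (h : SQ g s T c) (h' : SQ g s T' c') (h0 : c 0 = c' 0)
    (ht0 : 0 ≤ t) (ht : t < T) (ht' : t < T') (t1 : t ≤ 1) : c t = c' t := by
  have d0 := dn d
  rcases ht0.eq_or_lt with rfl | ht0
  · exact h0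
  obtain ⟨R1, hR1⟩ := h.bdd ht
  obtain ⟨R1', hR1'⟩ := h'.bdd ht'
  set R := max R1 R1'
  replace hR1 := fun τ hτ => (hR1 τ hτ).mono (le_max_left R1 R1')
  replace hR1' := fun τ hτ => (hR1' τ hτ).mono (le_max_right R1 R1')
  obtain ⟨C4, hC4, H4⟩ := GG_est' hg.sm (m := s-2) (L := s) LA LA LA R
  obtain ⟨C5, hC5, H5⟩ := Lip' hg.sm (m := 1) (L := s) LA LA LA R
  obtain ⟨C3, hC3, H3⟩ := dif hg (L := s-2) LA (max R C4)
  have R0 : 0 ≤ R := (hR1 t ⟨ht0.le, le_rfl⟩).1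
  set K := √C3 * (2 + 2 * (C5 * R))
  have main : ∀ r : ℕ, HB 1 (K * ((r:ℝ)+1) ^ (-1:ℝ)) (PB (Q d (r+1)) (c t) - PB (Q d (r+1)) (c' t)) := fun r => by
    set η := ((r:ℝ)+1) ^ (-1:ℝ)
    have η0 : 0 < η := by positivity
    obtain ⟨a1, ha1, A1⟩ := h.2.1 0 ⟨le_rfl, ht0.trans ht⟩ η η0
    obtain ⟨a2, ha2, A2⟩ := h'.2.1 0 ⟨le_rfl, ht0.trans ht'⟩ η η0
    set τ := min (min (a1/2) (a2/2)) t
    have τ0 : 0 < τ := by positivity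
    have τ1 : τ ≤ a1 / 2 := (min_le_left _ _).trans (min_le_left _ _)
    have τ2 : τ ≤ a2 / 2 := (min_le_left _ _).trans (min_le_right _ _)
    have τt : τ ≤ t := min_le_right _ _
    replace A1 := A1 τ ⟨τ0.le, by linarith⟩ (by rw [sub_zero, abs_of_pos τ0]; linarith)
    replace A2 := A2 τ ⟨τ0.le, by linarith⟩ (by rw [sub_zero, abs_of_pos τ0]; linarith)
    have A3 := A1.sub A2
    rw [h0, sub_sub_sub_cancel_right] at A3
    set B := Q d (r+1)
    have er : ∀ a, HB s R a → HB 1 (C5 * (η * R)) (Jm B (GG g a) - Jm B (GG g (PB B a))) := fun a ha => by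
      have p := PBt (m := 3) (p := 1) (ha.down LA) zero_le_one (show 0 < (r:ℝ)+1 by positivity)
      have p1 := p.neg
      rw [neg_sub] at p1
      have := (H5 a (PB B a) _ ha (ha.PB B) (by rw [show (1:ℝ)+2 = 3 by norm_num]; exact p1)).Jm B
      convert this using 1
      ext n; simp only [Pi.sub_apply, Jm, PB_sub]; ring
    have cdP : ∀ {c : ℝ → Seq d} {σ}, CD c (fun n => I * GG g (c σ) n) σ → CD (fun τ => PB B (c τ)) (Jm B (GG g (c σ))) σ := fun {c σ} hh n => by
      by_cases hn : n ∈ B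
      · simp only [PB_mem hn, Jm]; exact hh n
      · simp only [PB_not hn, Jm, mul_zero]; exact hasDerivAt_const _ _
    have hdf := H3 B (fun τ => PB B (c τ)) (fun τ => PB B (c' τ)) (fun τ => Jm B (GG g (c τ))) (fun τ => Jm B (GG g (c' τ))) (C5 * (η * R) + C5 * (η * R)) τ t LA
      (fun _ => Supp_PB _ _) (fun _ => Supp_PB _ _) (fun σ hσ => by
        have i : σ ∈ Icc 0 t := ⟨τ0.le.trans hσ.1, hσ.2⟩
        have b := hR1 σ i
        have b' := hR1' σ i
        exact ⟨cdP (h.cd LA ⟨lt_of_lt_of_le τ0 hσ.1, lt_of_le_of_lt hσ.2 ht⟩), cdP (h'.cd LA ⟨lt_of_lt_of_le τ0 hσ.1, lt_of_le_of_lt hσ.2 ht'⟩),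
          ((b.down LA).PB _).mono (le_max_left _ _), ((b'.down LA).PB _).mono (le_max_left _ _),
          ((H4 _ b).Jm _).mono (le_max_right _ _), ((H4 _ b').Jm _).mono (le_max_right _ _), (er _ b).sub (er _ b')⟩) t ⟨τt, le_rfl⟩
    refine (((Supp_PB B _).sub (Supp_PB B _)).HB 1).mono (le_of_sq' (hdf.trans ?_) PO)
    have n1 : hsNorm 1 (PB B (c τ) - PB B (c' τ)) ≤ η + η := by rw [← PB_sub]; exact ((A3.down LA).PB B).norm
    have n2 := pow_le_pow_left₀ (hsNorm_nonneg _ _) n1 2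
    simp only [K]
    rw [mul_assoc, mul_pow (√C3), sq_sqrt hC3]
    refine mL ?_ hC3
    have : 0 ≤ η * η * (C5 * R) := by positivity
    linarith
  have z : Tendsto (fun r : ℕ => K * ((r:ℝ)+1) ^ (-1:ℝ)) atTop (nhds 0) := by
    have := (tendsto_one_div_add_atTop_nhds_zero_nat (𝕜 := ℝ)).const_mul K
    simpa [Real.rpow_neg_one] using this
  ext n
  have := tendsto_nhds_unique (HB_z (Eventually.of_forall main) z n) ((PBl (c t) n).sub (PBl (c' t) n))
  exact (sub_eq_zero.1 this.symm)
lemma InHs_S {R : ℝ} (h : HB s R c) (hs : d ≤ s) : InHs s (S c) := by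
  have h0 := (h.down hs).summ0
  refine ⟨per_S c, by rw [fCoeff_S h0]; exact h.inHs, fun x => ?_⟩
  rw [fCoeff_S h0]
  exact (S_summ h0 x).hasSum
lemma InHs.eq {u : VC d} (h : InHs s u) : u = S (fCoeff u) := by
  funext x
  exact (h.2.2 x).tsum_eq.symm
lemma pdF_add {f h : VC d} {x : Vec d} (hf : DifferentiableAt ℝ f x) (hh : DifferentiableAt ℝ h x) (j : Fin d) :
    pdF j (fun y => f y + h y) x = pdF j f x + pdF j h x := by
  unfold pdF
  rw [fderiv_fun_add hf hh]; rfl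
lemma cont_pdF (hf : ContDiff ℝ 1 f) (j : Fin d) : Continuous (pdF j f) := by
  unfold pdF
  exact (hf.continuous_fderiv (by norm_num)).clm_apply continuous_const
lemma per_pdF (hp : Periodic2pi f) (j : Fin d) : Periodic2pi (pdF j f) := by
  intro x i
  unfold pdF
  have := fderiv_comp_add_right (𝕜 := ℝ) (f := f) (x := x) fun k => 2 * π * (i k : ℝ)
  rw [show (fun y => f (y + fun k => 2 * π * (i k : ℝ))) = f from funext fun y => hp y i] at this
  rw [this]; rfl
lemma eqn {F : Y d → ℂ} (hF : Sm F) {R : ℝ} (h : HB s R c) (hs : 2 * d + 4 ≤ s) (x : Vec d) :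
    -(∑ j, pdF j (pdF j (S c)) x) + Pop F (S c) x = S (GG (gF F) c) x := by
  have hd0 := dn d
  have h2 : Summable fun n => jb n ^ 2 * ‖c n‖ := (h.down (m' := ((2:ℕ):ℝ) + d) (by push_cast; linarith)).summN
  have h1 : Summable fun n => jb n ^ 1 * ‖c n‖ := (h.down (m' := ((1:ℕ):ℝ) + d) (by push_cast; linarith)).summN
  have hjet : jet (S c) = jt c := by
    funext y a; exact jet_S h1 y a
  have hjc : ContDiff ℝ 1 (jt c) := contDiff_pi.2 fun a => contDiff_S 1 (summ_JJ h2 a)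
  have hw : ∀ b, ContDiff ℝ 1 fun y => wdM b F (jt c y) := fun b => ((hF.wdM b).of_le (by exact_mod_cast le_top)).comp hjc
  have hg : ∀ b, ContDiff ℝ 1 fun y => gF F b (jt c y) := fun b => ((Sm_gF hF b).of_le (by exact_mod_cast le_top)).comp hjc
  have hp : ∀ b, Periodic2pi fun y => gF F b (jt c y) := fun b y i => by
    show gF F b (jt c _) = _
    rw [per_jt]
  have hcont : Continuous fun y => gF F 0 (jt c y) - ∑ j : Fin d, pdF j (fun z => gF F j.succ (jt c z)) y :=
    (hg 0).continuous.sub (continuous_finsetSum _ fun j _ => cont_pdF (hg j.succ) j)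
  have hco : fCoeff (fun y => gF F 0 (jt c y) - ∑ j : Fin d, pdF j (fun z => gF F j.succ (jt c z)) y) = GG (gF F) c := by
    rw [fCoeff_sub (hg 0).continuous (continuous_finsetSum _ fun j _ => cont_pdF (hg j.succ) j),
      fCoeff_sum univ (fun j => pdF j (fun z => gF F j.succ (jt c z))) (fun j _ => cont_pdF (hg j.succ) j)]
    funext n
    simp only [GG, Dv, Fin.sum_univ_succ, mu_zero, mu_succ, Pi.sub_apply, Finset.sum_apply, map_one, one_mul, sub_eq_add_neg, ← sum_neg_distrib]
    congr 1
    refine sum_congr rfl fun j _ => ?_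
    rw [fCoeff_pdF (hg j.succ) (hp j.succ)]
    simp
  obtain ⟨C, _, hC⟩ := GG_est' (g := gF F) (Sm_gF hF) (m := d) (L := s) LA LA LA R
  have := eq_S_of_summ hcont (fun y i => by
    show _ - _ = _ - _
    congr 1
    · exact hp 0 y i
    · exact sum_congr rfl fun j _ => per_pdF (hp j.succ) j y i) (by rw [hco]; exact (hC c h).summ0) x
  rw [hco] at this
  rw [← this]
  unfold Pop
  rw [hjet]
  have e : ∀ j : Fin d, pdF j (fun z => gF F j.succ (jt c z)) x = pdF j (fun z => wdM j.succ F (jt c z)) x + pdF j (pdF j (S c)) x := fun j => by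
    have : (fun z => gF F j.succ (jt c z)) = fun z => wdM j.succ F (jt c z) + pdF j (S c) z := by
      funext z; rw [pdF_S h1]; simp [gF, jt]
    rw [this, pdF_add ((hw j.succ).differentiable (by norm_num) x)]
    rw [pdF_S h1]
    exact (contDiff_S 1 (summ_JJ h2 j.succ)).differentiable (by norm_num) x
  simp only [e, sum_add_distrib]
  simp only [gF]
  simp
  ring
lemma fq {a b e : Seq d} (ha : SM a) (hb : SM b) (he : Summable fun n => ‖e n‖) (D : ℂ) :
    fCoeff (fun x => (S a x - S b x) / D - S e x) = fun n => (a n - b n) / D - e n := by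
  have := fCoeff_sub (f := fun x => D⁻¹ * (S a x - S b x)) (continuous_const.mul ((cont_S ha).sub (cont_S hb))) (cont_S he)
  rw [fCoeff_smul, fCoeff_sub (cont_S ha) (cont_S hb), fCoeff_S ha, fCoeff_S hb, fCoeff_S he] at this
  simp only [div_eq_inv_mul]
  exact this
lemma fsb {a b : Seq d} (ha : SM a) (hb : SM b) : fCoeff (S a - S b) = a - b := by
  have := fCoeff_sub (cont_S ha) (cont_S hb)
  rw [fCoeff_S ha, fCoeff_S hb] at this
  exact this
lemma HB.quo {m x y z : ℝ} {a b e : Seq d} (ha : HB m x a) (hb : HB m y b) (he : HB m z e) (D : ℂ) :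
    InHsSeq m (fun n => (a n - b n) / D - e n) := by
  have := ((ha.sub hb).smul D⁻¹).sub he
  simp only [div_eq_inv_mul]
  exact this.inHs
lemma IsSol.SQ {F : Y d → ℂ} (hF : Sm F) (hs : 2 * d + 4 ≤ s) {T : ℝ} {u₀ : VC d} {u : ℝ → VC d} (h : IsSol F s T u₀ u) :
    SQ (gF F) s T fun t => fCoeff (u t) := by
  obtain ⟨h1, -, h3, w, h4, h5, -, h7⟩ := h
  have hd0 := dn d
  have hu : ∀ t ∈ Ico 0 T, u t = S (fCoeff (u t)) := fun t ht => (h1 t ht).eq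
  have hb : ∀ t ∈ Ico 0 T, HB s _ (fCoeff (u t)) := fun t ht => (h1 t ht).2.1.HB
  have hsm : ∀ t ∈ Ico 0 T, Summable fun n => ‖fCoeff (u t) n‖ := fun t ht => ((hb t ht).down LA).summ0
  have hG : ∀ t ∈ Ico 0 T, ∃ C, HB (s-2) C (fun n => I * GG (gF F) (fCoeff (u t)) n) := fun t ht => by
    obtain ⟨C, _, hC⟩ := GG_est' (g := gF F) (Sm_gF hF) (m := s-2) (L := s) LA LA LA (hsNorm s (fCoeff (u t)))
    exact ⟨_, (hC _ (hb t ht)).smul I⟩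
  have hw : ∀ t ∈ Ico 0 T, w t = S (fun n => I * GG (gF F) (fCoeff (u t)) n) := fun t ht => by
    funext x
    have e1 := eqn hF (hb t ht) hs x
    have e2 := h7 t ht x
    rw [← hu t ht] at e1
    rw [S_smul, ← e1]
    linear_combination (-I) * e2 + (w t x) * I_sq
  refine ⟨fun t ht => (h1 t ht).2.1, fun t₀ h0 ε hε => ?_, fun t₀ h0 ε hε => ?_⟩
  · obtain ⟨η, hη, H⟩ := h3 t₀ h0 ε hε
    refine ⟨η, hη, fun t ht hh => ?_⟩
    have := H t ht hh
    rw [sobNorm, hu t ht, hu t₀ h0, fsb (hsm t ht) (hsm t₀ h0)] at this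
    exact (((hb t ht).sub (hb t₀ h0)).inHs).HB.mono this.le
  · obtain ⟨η, hη, H⟩ := h5 t₀ h0 ε hε
    refine ⟨η, hη, fun t ht hn hh => ?_⟩
    have := H t ht hn hh
    obtain ⟨C, hC⟩ := hG t₀ h0
    rw [sobNorm, hw t₀ h0] at this
    have e := fq (hsm t ht) (hsm t₀ h0) (hC.down (by linarith : (d:ℝ) ≤ s - 2)).summ0 ((t - t₀ : ℝ) : ℂ)
    rw [← hu t ht, ← hu t₀ h0] at e
    rw [e] at this
    exact (((hb t ht).down LA).quo ((hb t₀ h0).down LA) hC _).HB.mono this.le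
lemma SQ.IsSol {F : Y d → ℂ} (hF : Sm F) (hs : 2 * d + 4 ≤ s) {T : ℝ} {u₀ : VC d} (h0 : InHs s u₀) {c : ℝ → Seq d}
    (h : SQ (gF F) s T c) (hc0 : c 0 = fCoeff u₀) : IsSol F s T u₀ fun t => S (c t) := by
  obtain ⟨h1, h2, h3⟩ := h
  have hd0 := dn d
  have hb : ∀ t ∈ Ico 0 T, HB s _ (c t) := fun t ht => (h1 t ht).HB
  have hsm : ∀ t ∈ Ico 0 T, Summable fun n => ‖c t n‖ := fun t ht => ((hb t ht).down LA).summ0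
  have hG : ∀ t ∈ Ico 0 T, ∃ C, HB (s-2) C (fun n => I * GG (gF F) (c t) n) := fun t ht => by
    obtain ⟨C, _, hC⟩ := GG_est' (g := gF F) (Sm_gF hF) (m := s-2) (L := s) LA LA LA (hsNorm s (c t))
    exact ⟨_, (hC _ (hb t ht)).smul I⟩
  have hgs : ∀ t ∈ Ico 0 T, Summable fun n => ‖I * GG (gF F) (c t) n‖ := fun t ht => by
    obtain ⟨C, hC⟩ := hG t ht
    exact (hC.down (by linarith : (d:ℝ) ≤ s - 2)).summ0
  refine ⟨fun t ht => InHs_S (hb t ht) LA, fun x => by beta_reduce; rw [hc0, ← h0.eq], fun t₀ ht₀ ε hε => ?_,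
    fun t => S (fun n => I * GG (gF F) (c t) n), fun t ht => ?_, fun t₀ ht₀ ε hε => ?_, fun t₀ ht₀ ε hε => ?_, fun t ht x => ?_⟩
  · obtain ⟨η, hη, H⟩ := h2 t₀ ht₀ (ε/2) LA
    refine ⟨η, hη, fun t ht hh => ?_⟩
    rw [sobNorm, fsb (hsm t ht) (hsm t₀ ht₀)]
    linarith [(H t ht hh).norm]
  · obtain ⟨C, hC⟩ := hG t ht
    exact InHs_S hC LA
  · obtain ⟨η, hη, H⟩ := h3 t₀ ht₀ (ε/2) LA
    refine ⟨η, hη, fun t ht hn hh => ?_⟩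
    rw [sobNorm, fq (hsm t ht) (hsm t₀ ht₀) (hgs t₀ ht₀)]
    linarith [(H t ht hn hh).norm]
  · obtain ⟨C, hC0, hC⟩ := Lip' (g := gF F) (Sm_gF hF) (m := s-2) (L := s) LA LA LA (hsNorm s (c t₀) + 1)
    obtain ⟨η, hη, H⟩ := h2 t₀ ht₀ (min 1 (ε / (2 * (C + 1)))) (lt_min one_pos PO)
    refine ⟨η, hη, fun t ht hh => ?_⟩
    have hh := H t ht hh
    have hbt : HB s (hsNorm s (c t₀) + 1) (c t) := by
      have := ((hb t₀ ht₀).add hh).mono (add_le_add_right (min_le_left _ _) _)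
      rwa [add_sub_cancel] at this
    have := (hC (c t) (c t₀) _ hbt ((hb t₀ ht₀).mono LA) (by rw [sub_add_cancel]; exact hh.mono (min_le_right _ _))).smul I
    rw [sobNorm, fsb (hgs t ht) (hgs t₀ ht₀)]
    have e : ((fun n => I * GG (gF F) (c t) n) - fun n => I * GG (gF F) (c t₀) n) = fun n => I * (GG (gF F) (c t) - GG (gF F) (c t₀)) n := by
      funext n; simp [mul_sub]
    rw [e]
    refine this.norm.trans_lt ?_
    rw [norm_I, one_mul, ← mul_div_assoc, div_lt_iff₀ PO]
    nlinarith
  · have e1 := eqn hF (hb t ht) hs x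
    beta_reduce
    rw [S_smul, ← e1]
    linear_combination (-(∑ j, pdF j (pdF j (S (c t))) x) + Pop F (S (c t)) x) * I_sq
lemma IsSol.ini {F : Y d → ℂ} {T : ℝ} {u₀ : VC d} {u : ℝ → VC d} (h : IsSol F s T u₀ u) : fCoeff (u 0) = fCoeff u₀ :=
  congrArg fCoeff (funext h.2.1)
lemma InHs.smm {u : VC d} (h : InHs s u) (hs : d ≤ s) : Summable fun n => ‖fCoeff u n‖ := (h.2.1.HB.down hs).summ0
lemma InHs.sb {u v : VC d} (h : InHs s u) (h' : InHs s v) (hs : d ≤ s) : fCoeff (u - v) = fCoeff u - fCoeff v := by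
  have := fsb (h.smm hs) (h'.smm hs)
  rwa [← h.eq, ← h'.eq] at this
end
theorem statement_0 (d : ℕ) (hd : 1 ≤ d) (F : (Fin (d + 1) → ℂ) → ℂ)
    (hF : GoodF d F) (hE : Elliptic d F) (s : ℝ) (hs : 2 * (d : ℝ) + 11 < s) :
    ∃ Tf : ℝ → ℝ, (∀ x : ℝ, 0 < Tf x) ∧
      ∀ u₀ : Fn d, InHs s u₀ →
        -- existence
        (∃ u : ℝ → Fn d, IsSol F s (Tf (sobNorm s u₀)) u₀ u) ∧
        -- uniqueness
        (∀ u u' : ℝ → Fn d,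
          IsSol F s (Tf (sobNorm s u₀)) u₀ u → IsSol F s (Tf (sobNorm s u₀)) u₀ u' →
          ∀ t ∈ Set.Ico (0 : ℝ) (Tf (sobNorm s u₀)), ∀ x : Vec d, u t x = u' t x) ∧
        -- continuity of the solution map `u₀ ↦ u(t)` in the `H^s` topology
        (∀ u : ℝ → Fn d, IsSol F s (Tf (sobNorm s u₀)) u₀ u →
          ∀ t ∈ Set.Ico (0 : ℝ) (Tf (sobNorm s u₀)), ∀ δ > (0 : ℝ), ∃ η > (0 : ℝ),
            ∀ u₀' : Fn d, InHs s u₀' → sobNorm s (u₀' - u₀) < η →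
              ∀ (T' : ℝ) (u' : ℝ → Fn d), t < T' → IsSol F s T' u₀' u' →
                sobNorm s (u' t - u t) < δ) := by
  have hg := Gd_gF hF hE
  have hS : Sm F := hF.1
  have d0 : (0:ℝ) ≤ d := Nat.cast_nonneg d
  obtain ⟨k, hk1, hk2⟩ : ∃ k : ℕ, 2 * (k:ℝ) + 3 ≤ s ∧ s < 2 * k + 5 := by
    refine ⟨⌊(s - 3) / 2⌋₊, ?_, ?_⟩
    · have := Nat.floor_le (show 0 ≤ (s - 3) / 2 by linarith)
      linarith
    · have := Nat.lt_floor_add_one ((s - 3) / 2)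
      linarith
  have hk : 2 * (d:ℝ) + 2 ≤ 2 * k - 1 := by linarith
  have hs4 : 2 * (d:ℝ) + 4 ≤ s := by linarith
  have hds : (d:ℝ) ≤ s := by linarith
  choose Tf hT0 hT1 R2 hR2 hu using fun x : ℝ => tow_ex hg k hk (show 0 ≤ |x| + 1 by positivity)
  have key : ∀ x : ℝ, ∀ c0 : Seq d, HB s (|x| + 1) c0 → ∃ u c, Tow (gF F) (Tf x) (2*k+3) (R2 x) c0 u ∧
      (∀ t ∈ Set.Icc 0 (Tf x), ∀ n, Tendsto (fun h => u h t n) atTop (nhds (c t n))) ∧ c 0 = c0 ∧ SQ (gF F) s (Tf x) c := by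
    intro x c0 hc
    obtain ⟨u, hu⟩ := hu x c0 (hc.down hk1)
    obtain ⟨c, hc⟩ := limt hg k hk hk1 (hT0 x) hu fun ε hε => by
      obtain ⟨h0, η, hη, H⟩ := towlim hg k hk (δ := 2 * k + 5 - s) (s := s) (by linarith) (by linarith) (by linarith) (by ring) (|x| + 1) (R2 x) hc hε
      exact ⟨h0, H (Tf x) c0 u (hT1 x) hc (by rw [sub_self]; exact HB.zero _ hη.le) hu⟩
    exact ⟨u, c, hu, hc⟩
  have hini : ∀ u₀ : Vec d → ℂ, InHs s u₀ → HB s (|sobNorm s u₀| + 1) (fCoeff u₀) := fun u₀ h =>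
    h.2.1.HB.mono (by have := le_abs_self (sobNorm s u₀); unfold sobNorm at this ⊢; linarith)
  refine ⟨Tf, hT0, fun u₀ h0 => ⟨?_, fun u u' h h' t ht x => ?_, fun u h t ht δ hδ => ?_⟩⟩
  · obtain ⟨-, c, -, -, h1, h2⟩ := key (sobNorm s u₀) (fCoeff u₀) (hini u₀ h0)
    exact ⟨_, h2.IsSol hS hs4 h0 h1⟩
  · have e := uniq hg hs4 (by linarith) (h.SQ hS hs4) (h'.SQ hS hs4) (h.ini.trans h'.ini.symm) ht.1 ht.2 ht.2 (ht.2.le.trans (hT1 _))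
    rw [(h.1 t ht).eq, (h'.1 t ht).eq]
    exact congrArg (fun c => S c x) e
  · obtain ⟨η, hη, H⟩ := seqc hg k hk (δ := 2 * k + 5 - s) (s := s) (by linarith) (by linarith) (by linarith) (by ring)
      (|sobNorm s u₀| + 1) (R2 (sobNorm s u₀)) (hini u₀ h0) (half_pos hδ)
    refine ⟨min η 1, lt_min hη one_pos, fun u₀' h0' hn T' u' htT h' => ?_⟩
    have hn' : HB s (min η 1) (fCoeff u₀' - fCoeff u₀) := by
      rw [sobNorm, h0'.sb h0 hds] at hn
      exact (h0'.2.1.HB.sub h0.2.1.HB).inHs.HB.mono hn.le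
    have hb' : HB s (|sobNorm s u₀| + 1) (fCoeff u₀') := by
      have := (h0.2.1.HB.add hn').mono (add_le_add (le_abs_self _) (min_le_right _ _))
      rwa [add_sub_cancel] at this
    obtain ⟨v, c, hv, hl, hc, hq⟩ := key (sobNorm s u₀) (fCoeff u₀) (hini u₀ h0)
    obtain ⟨v', c', hv', hl', hc', hq'⟩ := key (sobNorm s u₀) (fCoeff u₀') hb'
    have e := uniq hg hs4 (by linarith) (h.SQ hS hs4) hq (h.ini.trans hc.symm) ht.1 ht.2 ht.2 (ht.2.le.trans (hT1 _))
    have e' := uniq hg hs4 (by linarith) (h'.SQ hS hs4) hq' (h'.ini.trans hc'.symm) ht.1 htT ht.2 (ht.2.le.trans (hT1 _))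
    have := H _ _ v v' c c' (hT1 _) hb' (hn'.mono (min_le_left _ _)) hv hv' hl hl' t ⟨ht.1, ht.2.le⟩
    rw [sobNorm, (h'.1 t ⟨ht.1, htT⟩).sb (h.1 t ht) hds]
    beta_reduce at e e'
    rw [e, e']
    linarith [this.norm]

end QLNLS
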